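/- Let a ∈ (0,1), let 0 < a₀ < a/4, and let f_I satisfy conditions (i)–(iii). Then there exists a pair (f,p) solving problem (P) on (0,∞) with f bounded on (−1,1)×(0,∞), such that f(·,t) converges uniformly on [−1,1] to f_I as t → 0⁺, and for every T > 0 there exists r = r(T) > 0 such that for all 0 < t ≤ T: f is C^∞ on the set {(x,s) : |x − p(s)| ≤ r, 0 < s ≤ T}, the flux λ(t) = −∂_x f(p(t),t) satisfies λ(t) > r, and p(t) ∈ (−1+r, 1−r). Moreover this solution is unique: any two bounded solutions of (P) on (0,∞) with these properties and the same initial datum f_I coincide. -/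

import Mathlib

open MeasureTheory

/-- The 1D heat kernel `K(x,t) = (4πt)^{-1/2} exp(-x²/(4t))`. -/
noncomputable def heatK (x t : ℝ) : ℝ :=
  (Real.sqrt (4 * Real.pi * t))⁻¹ * Real.exp (-(x ^ 2) / (4 * t))

/-- The Neumann heat kernel on `[-1,1]`:
`Γ(x,x';t) = Σ_{k∈ℤ} K(x − (2k + (−1)^{|k|} x'), t)`. -/
noncomputable def heatGamma (x x' t : ℝ) : ℝ :=
  ∑' k : ℤ, heatK (x - (2 * (k : ℝ) + (-1 : ℝ) ^ k.natAbs * x')) t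

/-- The flux `λ(s) = −∂ₓ f(p(s), s)` at the free boundary. -/
noncomputable def flux (f : ℝ → ℝ → ℝ) (p : ℝ → ℝ) (s : ℝ) : ℝ :=
  -deriv (fun x => f x s) (p s)

/-- `ā(s) = min {a, 1 − p(s), 1 + p(s)}`. -/
noncomputable def abar (a : ℝ) (p : ℝ → ℝ) (s : ℝ) : ℝ :=
  min a (min (1 - p s) (1 + p s))

/-- The sup norm `‖h‖_{L^∞(−1,1)}` (for continuous `h`). -/
noncomputable def supNorm (h : ℝ → ℝ) : ℝ := ⨆ x : Set.Icc (-1:ℝ) 1, |h x.1|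

/-- Conditions (i)–(iii) on the initial datum `f_I ∈ C²([−1,1])`:
(i) unique zero `p_I ∈ (−1,1)`, positive to the left, negative to the right;
(ii) Neumann conditions `∂ₓf_I(±1) = 0`;
(iii) `λ_I = −∂ₓ f_I(p_I) > 0` and `−∂ₓ f_I > λ_I/2` on `(p_I − a₀, p_I + a₀)`. -/
structure IsInitialDatum (fI : ℝ → ℝ) (pI a₀ lamI : ℝ) : Prop where
  smooth : ContDiffOn ℝ 2 fI (Set.Icc (-1) 1)
  pI_mem : pI ∈ Set.Ioo (-1 : ℝ) 1
  zero_at : fI pI = 0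
  pos_left : ∀ x ∈ Set.Ico (-1 : ℝ) pI, 0 < fI x
  neg_right : ∀ x ∈ Set.Ioc pI 1, fI x < 0
  neumann_left : derivWithin fI (Set.Icc (-1) 1) (-1) = 0
  neumann_right : derivWithin fI (Set.Icc (-1) 1) 1 = 0
  lamI_eq : lamI = -deriv fI pI
  lamI_pos : 0 < lamI
  slope : ∀ x ∈ Set.Ioo (pI - a₀) (pI + a₀), lamI / 2 < -deriv fI x

/-- A solution `(f, p)` of problem (P) on the time set `J` with parameter `a` and
initial datum `f_I`: `p` is a continuous curve in `(−1,1)`, `p(t)` is the unique zero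
of `f(·,t)` (positive to the left, negative to the right), `f(·,t)` is differentiable
at `p(t)`, the flux is locally integrable on `J`, and the Duhamel identity holds. -/
structure IsSolutionP (a : ℝ) (fI : ℝ → ℝ) (J : Set ℝ) (f : ℝ → ℝ → ℝ) (p : ℝ → ℝ) : Prop where
  p_cont : ContinuousOn p J
  p_mem : ∀ t ∈ J, p t ∈ Set.Ioo (-1 : ℝ) 1
  zero_at : ∀ t ∈ J, f (p t) t = 0
  pos_left : ∀ t ∈ J, ∀ x ∈ Set.Ico (-1 : ℝ) (p t), 0 < f x t
  neg_right : ∀ t ∈ J, ∀ x ∈ Set.Ioc (p t) 1, f x t < 0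
  diff_at : ∀ t ∈ J, DifferentiableAt ℝ (fun x => f x t) (p t)
  flux_loc_int : LocallyIntegrableOn (flux f p) J
  duhamel : ∀ t ∈ J, ∀ x ∈ Set.Icc (-1 : ℝ) 1,
      f x t = (∫ x' in (-1 : ℝ)..1, heatGamma x x' t * fI x')
        + ∫ s in (0 : ℝ)..t,
            (heatGamma x (p s - abar a p s) (t - s)
              - heatGamma x (p s + abar a p s) (t - s)) * flux f p s

/-- The Duhamel iterate with data `(p_n, λ_n)` and initial datum `f_I`. -/
noncomputable def duhamelIterate (a : ℝ) (fI pn lamn : ℝ → ℝ) (x t : ℝ) : ℝ :=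
  (∫ x' in (-1 : ℝ)..1, heatGamma x x' t * fI x')
    + ∫ s in (0 : ℝ)..t,
        (heatGamma x (pn s - a) (t - s) - heatGamma x (pn s + a) (t - s)) * lamn s

/-- A "good solution" of (P) on `(0,∞)`: bounded, attains the initial datum uniformly,
and for each horizon `T` there is `r > 0` giving smoothness near the free boundary,
non-degeneracy `λ(t) > r` of the flux, and `p(t) ∈ (−1+r, 1−r)`. -/
def GoodSolution (a : ℝ) (fI : ℝ → ℝ) (f : ℝ → ℝ → ℝ) (p : ℝ → ℝ) : Prop :=
  IsSolutionP a fI (Set.Ioi 0) f p ∧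
  (∃ B : ℝ, ∀ x ∈ Set.Ioo (-1:ℝ) 1, ∀ t > (0:ℝ), |f x t| ≤ B) ∧
  TendstoUniformlyOn (fun t x => f x t) fI (nhdsWithin 0 (Set.Ioi 0)) (Set.Icc (-1) 1) ∧
  ∀ T > (0:ℝ), ∃ r > (0:ℝ),
    ContDiffOn ℝ (⊤ : ℕ∞) (fun q : ℝ × ℝ => f q.1 q.2)
      {q : ℝ × ℝ | |q.1 - p q.2| ≤ r ∧ 0 < q.2 ∧ q.2 ≤ T} ∧
    (∀ t, 0 < t → t ≤ T → r < flux f p t) ∧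
    (∀ t, 0 < t → t ≤ T → p t ∈ Set.Ioo (-1 + r) (1 - r))

section Development
open Set Filter Topology
open scoped Real

/-- The space-time plane. -/
local notation "ℝ²" => ℝ × ℝ

/-- The closed spatial interval. -/
local notation "𝕁" => Icc (-1:ℝ) 1

set_option linter.unusedSectionVars false

section PL
variable {E P F S : Type} [NormedAddCommGroup E] [NormedSpace ℝ E] 
  [NormedAddCommGroup P] [NormedSpace ℝ P]
  [NormedAddCommGroup F] [NormedSpace ℝ F]

/-- partial derivative in the first variable -/
noncomputable def pd1 (Ψ : E × P → F) (z : E × P) : E →L[ℝ] F :=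
  (fderiv ℝ Ψ z).comp (ContinuousLinearMap.inl ℝ E P)

lemma pd1_contDiffOn {Ψ : E × P → F} {Ω : Set (E × P)} (hΩ : IsOpen Ω)
    (h : ∀ n : ℕ, ContDiffOn ℝ n Ψ Ω) (n : ℕ) : ContDiffOn ℝ n (pd1 Ψ) Ω := by
  have h1 : ContDiffOn ℝ n (fderiv ℝ Ψ) Ω := by
    have := h (n+1)
    exact this.fderiv_of_isOpen hΩ (by norm_cast)
  exact h1.clm_comp contDiffOn_const

lemma pl_isOpen {Ω : Set (E × P)} (hΩ : IsOpen Ω) {C : Set P} (hC : IsCompact C) :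
    IsOpen {q : E | ∀ y ∈ C, (q, y) ∈ Ω} := by
  rw [isOpen_iff_mem_nhds]
  intro q hq
  obtain ⟨u, v, hu, hv, hqu, hCv, huv⟩ := generalized_tube_lemma (s := {q}) isCompact_singleton hC hΩ
    (by rintro ⟨a, b⟩ ⟨ha, hb⟩; simp at ha; subst ha; exact hq b hb)
  refine mem_of_superset (hu.mem_nhds (hqu rfl)) ?_
  intro q' hq' y hy
  exact huv ⟨hq', hCv hy⟩

variable [MeasurableSpace S] [MeasurableSpace P] [BorelSpace P] [SecondCountableTopology P]

lemma pl_meas {μ : Measure S} {g : P → F} {C : Set P}  {c : S → P}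
    (hc : Measurable c) (hcC : ∀ s, c s ∈ C) (hg : ContinuousOn g C) :
    AEStronglyMeasurable (fun s => g (c s)) μ := by
  have h1 : Continuous (C.domRestrict g) := hg.domRestrict
  have h2 : StronglyMeasurable (C.domRestrict g) := h1.stronglyMeasurable
  have h3 : Measurable (fun s => (⟨c s, hcC s⟩ : C)) := hc.subtype_mk
  exact (h2.comp_measurable h3).aestronglyMeasurable

lemma pl_hasFDerivAt [FiniteDimensional ℝ E] {μ : Measure S} {Ψ : E × P → F} {Ω : Set (E × P)} (hΩ : IsOpen Ω)
    (hΨ : ∀ n : ℕ, ContDiffOn ℝ n Ψ Ω) {C : Set P} (hC : IsCompact C) {c : S → P}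
    (hc : Measurable c) (hcC : ∀ s, c s ∈ C) {lam : S → ℝ} (hl : Integrable lam μ) {q : E}
    (hq : ∀ y ∈ C, (q, y) ∈ Ω) :
    HasFDerivAt (fun q => ∫ s, lam s • Ψ (q, c s) ∂μ) (∫ s, lam s • pd1 Ψ (q, c s) ∂μ) q ∧
    Integrable (fun s => lam s • Ψ (q, c s)) μ ∧ Integrable (fun s => lam s • pd1 Ψ (q, c s)) μ := by
  have hU := pl_isOpen hΩ hC
  obtain ⟨ε, hε, hball⟩ := Metric.isOpen_iff.1 hU q hq
  have hpd := pd1_contDiffOn hΩ hΨ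
  -- compact set
  have hK : IsCompact (Metric.closedBall q (ε/2) ×ˢ C) :=
    (isCompact_closedBall q (ε/2)).prod hC
  have hKΩ : Metric.closedBall q (ε/2) ×ˢ C ⊆ Ω := by
    rintro ⟨a, b⟩ ⟨ha, hb⟩
    exact hball (Metric.closedBall_subset_ball (by linarith) ha) b hb
  have hcont : ContinuousOn (pd1 Ψ) Ω := (hpd 0).continuousOn
  have hcontΨ : ContinuousOn Ψ Ω := (hΨ 0).continuousOn
  obtain ⟨B, hB⟩ := hK.exists_bound_of_continuousOn (hcont.mono hKΩ)
  obtain ⟨B', hB'⟩ := hK.exists_bound_of_continuousOn (hcontΨ.mono hKΩ)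
  have slice : ∀ {G : Type} [NormedAddCommGroup G] {g : E × P → G} , ContinuousOn g Ω → ∀ q' ∈ Metric.ball q (ε/2),
      ContinuousOn (fun y => g (q', y)) C := by
    intro G _ g hg q' hq'
    refine hg.comp (by fun_prop) ?_
    intro y hy
    exact hKΩ ⟨Metric.ball_subset_closedBall hq', hy⟩
  have hqm : q ∈ Metric.ball q (ε/2) := Metric.mem_ball_self (by linarith)
  have i1 : Integrable (fun s => lam s • Ψ (q, c s)) μ := by
    refine (hl.norm.mul_const B').mono' (hl.1.smul (pl_meas (g := fun y => Ψ (q, y)) hc hcC (slice hcontΨ q hqm))) ?_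
    refine Eventually.of_forall fun s => ?_
    rw [norm_smul]
    exact mul_le_mul_of_nonneg_left (hB' _ ⟨Metric.ball_subset_closedBall hqm, hcC s⟩) (norm_nonneg _)
  have i2 : Integrable (fun s => lam s • pd1 Ψ (q, c s)) μ := by
    refine (hl.norm.mul_const B).mono' (hl.1.smul (pl_meas (g := fun y => pd1 Ψ (q, y)) hc hcC (slice hcont q hqm))) ?_
    refine Eventually.of_forall fun s => ?_
    rw [norm_smul]
    exact mul_le_mul_of_nonneg_left (hB _ ⟨Metric.ball_subset_closedBall hqm, hcC s⟩) (norm_nonneg _)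
  refine ⟨?_, i1, i2⟩
  refine hasFDerivAt_integral_of_dominated_of_fderiv_le (𝕜 := ℝ) (s := Metric.ball q (ε/2)) (bound := fun s => ‖lam s‖ * B)
    (F := fun q s => lam s • Ψ (q, c s)) (F' := fun q s => lam s • pd1 Ψ (q, c s))
    (Metric.ball_mem_nhds q (by linarith)) ?_ i1 i2.1 ?_ (hl.norm.mul_const B) ?_
  · filter_upwards [Metric.ball_mem_nhds q (show 0 < ε/2 by linarith)] with q' hq'
    exact hl.1.smul (pl_meas (g := fun y => Ψ (q', y)) hc hcC (slice hcontΨ q' hq'))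
  · refine Eventually.of_forall fun s q' hq' => ?_
    rw [norm_smul]
    exact mul_le_mul_of_nonneg_left (hB _ ⟨Metric.ball_subset_closedBall hq', hcC s⟩) (norm_nonneg _)
  · refine Eventually.of_forall fun s q' hq' => ?_
    have hm : (q', c s) ∈ Ω := hKΩ ⟨Metric.ball_subset_closedBall hq', hcC s⟩
    have h1 : HasFDerivAt Ψ (fderiv ℝ Ψ (q', c s)) (q', c s) :=
      (((hΨ 1).differentiableOn (by norm_num)).differentiableAt (hΩ.mem_nhds hm)).hasFDerivAt
    have h2 : HasFDerivAt (fun q : E => (q, c s)) (ContinuousLinearMap.inl ℝ E P) q' :=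
      hasFDerivAt_prodMk_left q' (c s)
    exact (HasFDerivAt.comp q' h1 h2).const_smul (lam s)

lemma pl_contDiffOn [FiniteDimensional ℝ E] {μ : Measure S} {Ω : Set (E × P)} (hΩ : IsOpen Ω)
    {C : Set P} (hC : IsCompact C) {c : S → P}
    (hc : Measurable c) (hcC : ∀ s, c s ∈ C) {lam : S → ℝ} (hl : Integrable lam μ) (n : ℕ) :
    ∀ {F : Type} [NormedAddCommGroup F] [NormedSpace ℝ F] (Ψ : E × P → F)
    (_hΨ : ∀ n : ℕ, ContDiffOn ℝ n Ψ Ω),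
    ContDiffOn ℝ n (fun q => ∫ s, lam s • Ψ (q, c s) ∂μ) {q : E | ∀ y ∈ C, (q, y) ∈ Ω} := by
  induction n with
  | zero =>
    intro F _ _ Ψ hΨ
    refine contDiffOn_zero.2 fun q hq => ?_
    exact (pl_hasFDerivAt hΩ hΨ hC hc hcC hl hq).1.continuousAt.continuousWithinAt
  | succ n ih =>
    intro F _ _ Ψ hΨ
    push_cast
    rw [contDiffOn_succ_iff_fderiv_of_isOpen (pl_isOpen hΩ hC)]
    refine ⟨fun q hq => (pl_hasFDerivAt hΩ hΨ hC hc hcC hl hq).1.differentiableAt.differentiableWithinAt, by simp, ?_⟩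
    refine (ih (pd1 Ψ) (pd1_contDiffOn hΩ hΨ)).congr ?_
    intro q hq
    exact (pl_hasFDerivAt hΩ hΨ hC hc hcC hl hq).1.fderiv

end PL

section glue
noncomputable def gl (α θ : ℝ) : ℝ := if 0 < θ then θ ^ α * Real.exp (-(1/(4*θ))) else 0

lemma gl_zero (α : ℝ) {θ : ℝ} (h : θ ≤ 0) : gl α θ = 0 := by simp [gl, not_lt.2 h]

lemma gl_tendsto (α : ℝ) : Tendsto (gl α) (𝓝 0) (𝓝 0) := by
  have h1 : Tendsto (fun y : ℝ => y ^ (-α) * Real.exp (-(1/4) * y)) atTop (𝓝 0) := by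
    have := tendsto_rpow_mul_exp_neg_mul_atTop_nhds_zero (-α) (1/4) (by norm_num)
    exact this
  have h2 : Tendsto (gl α) (𝓝[>] 0) (𝓝 0) := by
    refine (h1.comp tendsto_inv_nhdsGT_zero).congr' ?_
    filter_upwards [self_mem_nhdsWithin] with θ hθ
    have hθ : 0 < θ := hθ
    simp only [Function.comp, gl, if_pos hθ]
    rw [Real.inv_rpow hθ.le, Real.rpow_neg hθ.le, inv_inv]
    congr 2
    field_simp
  have h3 : Tendsto (gl α) (𝓝[≤] 0) (𝓝 0) := by
    refine tendsto_const_nhds.congr' ?_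
    filter_upwards [self_mem_nhdsWithin] with θ hθ
    rw [gl_zero α hθ]
  have h4 := h3.sup h2
  rwa [nhdsLE_sup_nhdsGT] at h4

lemma gl_mul (α : ℝ) (θ : ℝ) : gl α θ = θ * gl (α - 1) θ := by
  unfold gl
  split_ifs with h
  · rw [Real.rpow_sub_one h.ne']; field_simp
  · simp

lemma gl_hasDerivAt (α θ : ℝ) : HasDerivAt (gl α) (α * gl (α-1) θ + (1/4) * gl (α - 2) θ) θ := by
  rcases lt_trichotomy θ 0 with h | h | h
  · rw [gl_zero _ h.le, gl_zero _ h.le]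
    have : HasDerivAt (fun _ : ℝ => (0:ℝ)) 0 θ := hasDerivAt_const _ _
    simp only [mul_zero, add_zero]
    refine this.congr_of_eventuallyEq ?_
    filter_upwards [Iio_mem_nhds h] with y hy
    exact gl_zero _ (le_of_lt hy)
  · subst h
    rw [gl_zero _ le_rfl, gl_zero _ le_rfl, hasDerivAt_iff_tendsto_slope]
    simp only [mul_zero, add_zero]
    refine ((gl_tendsto (α - 1)).mono_left nhdsWithin_le_nhds).congr' ?_
    filter_upwards [self_mem_nhdsWithin] with y hy
    have hy : y ≠ 0 := hy
    rw [slope_def_field, gl_zero α le_rfl, gl_mul α y]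
    field_simp
    simp
  · have h1 : HasDerivAt (fun y : ℝ => y ^ α * Real.exp (-(1/(4*y)))) 
      (α * θ ^ (α - 1) * Real.exp (-(1/(4*θ))) + θ ^ α * (Real.exp (-(1/(4*θ))) * (1/(4*θ^2)))) θ := by
      have h2 := Real.hasDerivAt_rpow_const (x := θ) (p := α) (Or.inl h.ne')
      have h3 : HasDerivAt (fun y : ℝ => -(1/(4*y))) (1/(4*θ^2)) θ := by
        have := ((hasDerivAt_id θ).const_mul 4).inv (by simpa using h.ne')
        refine ((this.neg).congr_of_eventuallyEq (Eventually.of_forall fun y => by simp)).congr_deriv ?_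
        simp; field_simp
      exact h2.mul h3.exp
    have e : α * gl (α-1) θ + (1/4) * gl (α - 2) θ = (α * θ ^ (α - 1) * Real.exp (-(1/(4*θ))) + θ ^ α * (Real.exp (-(1/(4*θ))) * (1/(4*θ^2)))) := by
      simp only [gl, if_pos h]
      rw [Real.rpow_sub h α 2, Real.rpow_two]; field_simp
    rw [e]
    refine h1.congr_of_eventuallyEq ?_
    filter_upwards [Ioi_mem_nhds h] with y hy
    simp only [gl, if_pos (show 0 < y from hy)]

lemma gl_contDiff (n : ℕ) : ∀ α, ContDiff ℝ n (gl α) := by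
  induction n with
  | zero => 
    intro α
    exact contDiff_zero.2 (continuous_iff_continuousAt.2 fun θ => (gl_hasDerivAt α θ).continuousAt)
  | succ n ih =>
    intro α
    push_cast
    rw [contDiff_succ_iff_deriv]
    refine ⟨fun θ => (gl_hasDerivAt α θ).differentiableAt, by simp, ?_⟩
    have : deriv (gl α) = fun θ => α * gl (α-1) θ + (1/4) * gl (α - 2) θ := by
      ext θ; exact (gl_hasDerivAt α θ).deriv
    rw [this]
    exact (contDiff_const.mul (ih _)).add (contDiff_const.mul (ih _))

end glue

section caloric
/-- smooth (all finite orders) -/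
def SmoothOn {E : Type} [NormedAddCommGroup E] [NormedSpace ℝ E] (f : E → ℝ) (U : Set E) : Prop :=
  ∀ n : ℕ, ContDiffOn ℝ n f U

noncomputable def dX (f : ℝ² → ℝ) (z : ℝ²) : ℝ := fderiv ℝ f z (1, 0)
noncomputable def dT (f : ℝ² → ℝ) (z : ℝ²) : ℝ := fderiv ℝ f z (0, 1)

lemma SmoothOn.fderivApply {E : Type} [NormedAddCommGroup E] [NormedSpace ℝ E] {f : E → ℝ} {U : Set E} (h : SmoothOn f U) (hU : IsOpen U) (v : E) :
    SmoothOn (fun z => fderiv ℝ f z v) U := by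
  intro n
  have h1 : ContDiffOn ℝ n (fderiv ℝ f) U := (h (n+1)).fderiv_of_isOpen hU (by norm_cast)
  exact h1.clm_apply contDiffOn_const

lemma SmoothOn.dX {f : ℝ² → ℝ} {U} (h : SmoothOn f U) (hU : IsOpen U) : SmoothOn (dX f) U :=
  h.fderivApply hU _
lemma SmoothOn.dT {f : ℝ² → ℝ} {U} (h : SmoothOn f U) (hU : IsOpen U) : SmoothOn (dT f) U :=
  h.fderivApply hU _
lemma SmoothOn.continuousOn {E : Type} [NormedAddCommGroup E] [NormedSpace ℝ E] {f : E → ℝ} {U : Set E} (h : SmoothOn f U) : ContinuousOn f U := (h 0).continuousOn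
lemma SmoothOn.hasFDerivAt {E : Type} [NormedAddCommGroup E] [NormedSpace ℝ E] {f : E → ℝ} {U : Set E} (h : SmoothOn f U) (hU : IsOpen U) {z} (hz : z ∈ U) :
    HasFDerivAt f (fderiv ℝ f z) z :=
  (((h 1).differentiableOn (by norm_num)).differentiableAt (hU.mem_nhds hz)).hasFDerivAt

lemma SmoothOn.hasDerivX {f : ℝ² → ℝ} {U} (h : SmoothOn f U) (hU : IsOpen U) {x t : ℝ} (hz : (x, t) ∈ U) :
    HasDerivAt (fun y => f (y, t)) (_root_.dX f (x, t)) x := by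
  have h1 := h.hasFDerivAt hU hz
  have h2 : HasDerivAt (fun y : ℝ => (y, t)) ((1:ℝ), (0:ℝ)) x := (hasDerivAt_id x).prodMk (hasDerivAt_const x t)
  exact h1.comp_hasDerivAt x h2

lemma SmoothOn.hasDerivT {f : ℝ² → ℝ} {U} (h : SmoothOn f U) (hU : IsOpen U) {x t : ℝ} (hz : (x, t) ∈ U) :
    HasDerivAt (fun s => f (x, s)) (_root_.dT f (x, t)) t := by
  have h1 := h.hasFDerivAt hU hz
  have h2 : HasDerivAt (fun y : ℝ => (x, y)) ((0:ℝ), (1:ℝ)) t := (hasDerivAt_const t x).prodMk (hasDerivAt_id t)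
  exact h1.comp_hasDerivAt t h2

structure Caloric (f : ℝ² → ℝ) (U : Set ℝ²) : Prop where
  smooth : SmoothOn f U
  heat : ∀ z ∈ U, dT f z = dX (dX f) z

/-- the heat equation via explicit derivatives -/
lemma heat_of {f : ℝ² → ℝ} {U : Set ℝ²} (hU : IsOpen U) (h : SmoothOn f U) {x t A B : ℝ} (hz : (x, t) ∈ U)
    (D : ℝ → ℝ) (hA : HasDerivAt (fun s => f (x, s)) A t)
    (hD : ∀ᶠ y in 𝓝 x, HasDerivAt (fun y => f (y, t)) (D y) y) (hB : HasDerivAt D B x) (hAB : A = B) :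
    dT f (x, t) = dX (dX f) (x, t) := by
  rw [(h.hasDerivT hU hz).unique hA, hAB]
  refine hB.unique ?_
  refine ((h.dX hU).hasDerivX hU hz).congr_of_eventuallyEq ?_
  have h3 : ∀ᶠ y in 𝓝 x, (y, t) ∈ U := by
    have : Continuous (fun y : ℝ => (y, t)) := by fun_prop
    exact this.continuousAt.eventually (hU.mem_nhds hz)
  filter_upwards [hD, h3] with y hy hy3
  exact hy.unique (h.hasDerivX hU hy3)

lemma Caloric.of_dense {f : ℝ² → ℝ} {U : Set ℝ²} (hU : IsOpen U) (h : SmoothOn f U)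
    (hd : ∀ z ∈ U, z.2 ≠ 0 → dT f z = dX (dX f) z) : Caloric f U := by
  refine ⟨h, fun z hz => ?_⟩
  by_cases h0 : z.2 ≠ 0
  · exact hd z hz h0
  obtain ⟨x, t⟩ := z
  have c1 : ContinuousAt (fun s : ℝ => dT f (x, s) - dX (dX f) (x, s)) t := by
    have e1 := ((h.dT hU).continuousOn.continuousAt (hU.mem_nhds hz))
    have e2 := (((h.dX hU).dX hU).continuousOn.continuousAt (hU.mem_nhds hz))
    have e3 : ContinuousAt (fun s : ℝ => (x, s)) t := by fun_prop
    exact (e1.sub e2).comp_of_eq e3 rfl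
  have c2 : Tendsto (fun s : ℝ => dT f (x, s) - dX (dX f) (x, s)) (𝓝[≠] t) (𝓝 0) := by
    refine tendsto_const_nhds.congr' ?_
    have e3 : ContinuousAt (fun s : ℝ => (x, s)) t := by fun_prop
    filter_upwards [self_mem_nhdsWithin, (e3.eventually (hU.mem_nhds hz)).filter_mono nhdsWithin_le_nhds] with s hs hs2
    have : s ≠ 0 := by
      simp only [not_not] at h0
      intro h; subst h; exact hs (by simpa using h0.symm)
    rw [hd _ hs2 this, sub_self]
  have := tendsto_nhds_unique (c1.tendsto.mono_left nhdsWithin_le_nhds) c2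
  linarith

end caloric

section heatK

lemma heatK_nonpos_time {x t : ℝ} (h : t ≤ 0) : heatK x t = 0 := by
  unfold heatK
  rw [Real.sqrt_eq_zero_of_nonpos]; · simp
  · have := Real.pi_pos; nlinarith

lemma heatK_gl {w t : ℝ} (hw : w ≠ 0) : heatK w t = (√(4 * π))⁻¹ * (|w|⁻¹ * gl (-(1/2)) (t / w^2)) := by
  have hw2 : 0 < w^2 := by positivity
  by_cases h : 0 < t
  · have hθ : 0 < t / w^2 := by positivity
    unfold heatK gl
    rw [if_pos hθ, Real.sqrt_mul (by positivity), Real.rpow_neg hθ.le, ← Real.sqrt_eq_rpow, Real.sqrt_div h.le, Real.sqrt_sq_eq_abs]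
    have e : -(1 / (4 * (t / w^2))) = -w^2/(4*t) := by field_simp
    rw [e]
    have : |w| ≠ 0 := by positivity
    have : √t ≠ 0 := by positivity
    field_simp
  · push Not at h
    rw [heatK_nonpos_time h, gl_zero]
    · simp
    · exact div_nonpos_of_nonpos_of_nonneg h hw2.le

lemma SmoothOn.of_cover {E : Type} [NormedAddCommGroup E] [NormedSpace ℝ E] {f : E → ℝ} {U : Set E}
    (h : ∀ z ∈ U, ∃ V, IsOpen V ∧ z ∈ V ∧ SmoothOn f V) : SmoothOn f U := by
  intro n z hz
  obtain ⟨V, hV, hzV, hf⟩ := h z hz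
  exact ((hf n).contDiffAt (hV.mem_nhds hzV)).contDiffWithinAt

lemma heatK_smooth : SmoothOn (fun z : ℝ² => heatK z.1 z.2) {z | z ≠ 0} := by
  refine SmoothOn.of_cover fun z hz => ?_
  by_cases h1 : z.1 ≠ 0
  · refine ⟨{z | z.1 ≠ 0}, isOpen_ne_fun (by fun_prop) (by fun_prop), h1, fun n => ?_⟩
    have : ContDiffOn ℝ n (fun z : ℝ² => (√(4 * π))⁻¹ * (|z.1|⁻¹ * gl (-(1/2)) (z.2 / z.1^2))) {z | z.1 ≠ 0} := by
      refine contDiffOn_const.mul (ContDiffOn.mul ?_ ?_)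
      · refine ContDiffOn.inv ?_ (fun z hz => by simpa using hz)
        intro z hz
        exact (ContDiffAt.abs (f := fun z : ℝ² => z.1) contDiffAt_fst hz).contDiffWithinAt
      · refine (gl_contDiff n _).comp_contDiffOn ?_
        exact ContDiffOn.div (by fun_prop) (by fun_prop) (fun z hz => by simpa using hz)
    exact this.congr fun z hz => heatK_gl hz
  · push Not at h1
    have h2 : z.2 ≠ 0 := fun h => hz (Prod.ext h1 h)
    rcases lt_or_gt_of_ne h2 with h | h
    · refine ⟨{z | z.2 < 0}, isOpen_lt (by fun_prop) (by fun_prop), h, fun n => ?_⟩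
      exact (contDiffOn_const (c := (0:ℝ))).congr fun z hz => heatK_nonpos_time (le_of_lt hz)
    · refine ⟨{z | 0 < z.2}, isOpen_lt (by fun_prop) (by fun_prop), h, fun n => ?_⟩
      unfold heatK
      have hp := Real.pi_pos
      refine ContDiffOn.mul (ContDiffOn.inv (ContDiffOn.sqrt (by fun_prop) ?_) ?_) (ContDiffOn.exp (ContDiffOn.div (by fun_prop) (by fun_prop) ?_))
      · intro z hz; have : 0 < z.2 := hz; positivity
      · intro z hz; have : 0 < z.2 := hz; positivity
      · intro z hz; have : 0 < z.2 := hz; positivity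

lemma isOpen_ne_zero : IsOpen {z : ℝ² | z ≠ 0} := isOpen_ne

lemma heatK_hasDerivX (x : ℝ) {t : ℝ} (ht : 0 < t) : HasDerivAt (fun x => heatK x t) (-(x/(2*t)) * heatK x t) x := by
  unfold heatK
  have h1 : HasDerivAt (fun x : ℝ => -(x^2)/(4*t)) (-(x/(2*t))) x := by
    have := ((hasDerivAt_pow 2 x).neg).div_const (4*t)
    refine this.congr_deriv ?_
    simp; field_simp; ring
  refine ((h1.exp).const_mul ((√(4 * π * t))⁻¹)).congr_deriv ?_
  ring

lemma heatK_hasDerivT (x : ℝ) {t : ℝ} (ht : 0 < t) :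
    HasDerivAt (fun t => heatK x t) ((x^2/(4*t^2) - 1/(2*t)) * heatK x t) t := by
  unfold heatK
  have hp := Real.pi_pos
  have h1 : HasDerivAt (fun t : ℝ => -(x^2)/(4*t)) (x^2/(4*t^2)) t := by
    have := (((hasDerivAt_id t).const_mul 4).inv (by simpa using ht.ne')).const_mul (-(x^2))
    refine (this.congr_of_eventuallyEq (Eventually.of_forall fun y => ?_)).congr_deriv ?_
    · simp [div_eq_mul_inv]
    simp; field_simp
  have hpos : 4 * π * t ≠ 0 := by positivity
  have h2 : HasDerivAt (fun t : ℝ => (√(4 * π * t))⁻¹) (-(1/(2*t)) * (√(4 * π * t))⁻¹) t := by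
    have := (((hasDerivAt_id t).const_mul (4*π)).sqrt hpos).inv (by simp; positivity)
    refine this.congr_deriv ?_
    have e : (√(4 * π * t))^2 = 4 * π * t := Real.sq_sqrt (by positivity)
    have : √(4 * π * t) ≠ 0 := by positivity
    simp only [id]
    rw [e]; field_simp
  refine (h2.mul (h1.exp)).congr_deriv ?_
  ring

lemma heatK_caloric : Caloric (fun z : ℝ² => heatK z.1 z.2) {z | z ≠ 0} := by
  refine Caloric.of_dense isOpen_ne_zero heatK_smooth ?_
  rintro ⟨x, t⟩ hz ht
  rcases lt_or_gt_of_ne ht with h | h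
  · have h : t < 0 := h
    refine heat_of isOpen_ne_zero heatK_smooth hz (fun _ => 0) (A := 0) (B := 0) ?_ ?_ (hasDerivAt_const _ _) rfl
    · refine (hasDerivAt_const t (0:ℝ)).congr_of_eventuallyEq ?_
      filter_upwards [Iio_mem_nhds h] with s hs
      exact heatK_nonpos_time (le_of_lt hs)
    · refine Eventually.of_forall fun y => ?_
      refine (hasDerivAt_const y (0:ℝ)).congr_of_eventuallyEq ?_
      refine Eventually.of_forall fun y => heatK_nonpos_time h.le
  · have h : 0 < t := h
    refine heat_of isOpen_ne_zero heatK_smooth hz _ (heatK_hasDerivT x h) (Eventually.of_forall fun y => heatK_hasDerivX y h) 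
      (((((hasDerivAt_id x).div_const (2*t)).neg).mul (heatK_hasDerivX x h))) ?_
    simp only [id, Pi.neg_apply]
    field_simp
    ring

lemma heatK_nonneg (x t : ℝ) : 0 ≤ heatK x t := by unfold heatK; positivity
lemma heatK_pos (x : ℝ) {t : ℝ} (h : 0 < t) : 0 < heatK x t := by
  unfold heatK; have := Real.pi_pos; positivity
lemma heatK_neg (x t : ℝ) : heatK (-x) t = heatK x t := by simp [heatK]
lemma heatK_anti {x y t : ℝ} (h : |x| ≤ |y|) : heatK y t ≤ heatK x t := by
  rcases le_or_gt t 0 with ht | ht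
  · rw [heatK_nonpos_time ht, heatK_nonpos_time ht]
  unfold heatK
  have : x^2 ≤ y^2 := sq_le_sq.2 h
  gcongr
end heatK

section caloric_algebra
variable {f g : ℝ² → ℝ} {U V : Set ℝ²}

lemma SmoothOn.mono {E : Type} [NormedAddCommGroup E] [NormedSpace ℝ E] {f : E → ℝ} {U V : Set E}
    (h : SmoothOn f U) (hV : V ⊆ U) : SmoothOn f V := fun n => (h n).mono hV
lemma SmoothOn.congr {E : Type} [NormedAddCommGroup E] [NormedSpace ℝ E] {f g : E → ℝ} {U : Set E}
    (h : SmoothOn f U) (hg : ∀ x ∈ U, g x = f x) : SmoothOn g U := fun n => (h n).congr hg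
lemma SmoothOn.add {E : Type} [NormedAddCommGroup E] [NormedSpace ℝ E] {f g : E → ℝ} {U : Set E}
    (h : SmoothOn f U) (hg : SmoothOn g U) : SmoothOn (fun z => f z + g z) U := fun n => (h n).add (hg n)
lemma SmoothOn.mul {E : Type} [NormedAddCommGroup E] [NormedSpace ℝ E] {f g : E → ℝ} {U : Set E}
    (h : SmoothOn f U) (hg : SmoothOn g U) : SmoothOn (fun z => f z * g z) U := fun n => (h n).mul (hg n)
lemma SmoothOn.comp {E E' : Type} [NormedAddCommGroup E] [NormedSpace ℝ E] [NormedAddCommGroup E'] [NormedSpace ℝ E']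
    {f : E → ℝ} {U : Set E} {g : E' → E} {V : Set E'}
    (h : SmoothOn f U) (hg : ∀ n : ℕ, ContDiffOn ℝ n g V) (hm : MapsTo g V U) : SmoothOn (fun z => f (g z)) V :=
  fun n => (h n).comp (hg n) hm

/-- dX computed from any derivative -/
lemma dX_eq (hU : IsOpen U) (h : SmoothOn f U) {x t D : ℝ} (hz : (x, t) ∈ U) (hD : HasDerivAt (fun y => f (y, t)) D x) :
    dX f (x, t) = D := (h.hasDerivX hU hz).unique hD

lemma ev_slice (hU : IsOpen U) {x t : ℝ} (hz : (x, t) ∈ U) : ∀ᶠ y in 𝓝 x, (y, t) ∈ U := by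
  have : Continuous (fun y : ℝ => (y, t)) := by fun_prop
  exact this.continuousAt.eventually (hU.mem_nhds hz)
lemma ev_sliceT (hU : IsOpen U) {x t : ℝ} (hz : (x, t) ∈ U) : ∀ᶠ y in 𝓝 t, (x, y) ∈ U := by
  have : Continuous (fun y : ℝ => (x, y)) := by fun_prop
  exact this.continuousAt.eventually (hU.mem_nhds hz)

lemma Caloric.mono (h : Caloric f U) (hV : V ⊆ U) : Caloric f V :=
  ⟨h.smooth.mono hV, fun z hz => h.heat z (hV hz)⟩

lemma Caloric.congr (hU : IsOpen U) (h : Caloric f U) (hg : ∀ z ∈ U, g z = f z) : Caloric g U := by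
  refine ⟨h.smooth.congr hg, ?_⟩
  rintro ⟨x, t⟩ hz
  refine heat_of hU (h.smooth.congr hg) hz (fun y => dX f (y, t)) (((h.smooth.hasDerivT hU hz)).congr_of_eventuallyEq ?_) ?_
    ((h.smooth.dX hU).hasDerivX hU hz) (h.heat _ hz)
  · filter_upwards [ev_sliceT hU hz] with s hs using hg _ hs
  · filter_upwards [(ev_slice hU hz)] with y hy
    refine (h.smooth.hasDerivX hU hy).congr_of_eventuallyEq ?_
    filter_upwards [ev_slice hU hy] with s hs using hg _ hs

lemma Caloric.add (hU : IsOpen U) (h : Caloric f U) (hg : Caloric g U) : Caloric (fun z => f z + g z) U := by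
  have hs : SmoothOn (fun z => f z + g z) U := fun n => (h.smooth n).add (hg.smooth n)
  refine ⟨hs, ?_⟩
  rintro ⟨x, t⟩ hz
  refine heat_of hU hs hz (fun y => dX f (y, t) + dX g (y, t)) ((h.smooth.hasDerivT hU hz).add (hg.smooth.hasDerivT hU hz)) ?_
    (((h.smooth.dX hU).hasDerivX hU hz).add ((hg.smooth.dX hU).hasDerivX hU hz)) ?_
  · filter_upwards [ev_slice hU hz] with y hy
    exact (h.smooth.hasDerivX hU hy).add (hg.smooth.hasDerivX hU hy)
  · rw [h.heat _ hz, hg.heat _ hz]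

lemma Caloric.const_mul (hU : IsOpen U) (h : Caloric f U) (c : ℝ) : Caloric (fun z => c * f z) U := by
  have hs : SmoothOn (fun z => c * f z) U := fun n => contDiffOn_const.mul (h.smooth n)
  refine ⟨hs, ?_⟩
  rintro ⟨x, t⟩ hz
  refine heat_of hU hs hz (fun y => c * dX f (y, t)) ((h.smooth.hasDerivT hU hz).const_mul c) ?_
    (((h.smooth.dX hU).hasDerivX hU hz).const_mul c) ?_
  · filter_upwards [ev_slice hU hz] with y hy
    exact (h.smooth.hasDerivX hU hy).const_mul c
  · rw [h.heat _ hz]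

lemma Caloric.sub (hU : IsOpen U) (h : Caloric f U) (hg : Caloric g U) : Caloric (fun z => f z - g z) U := by
  have := h.add hU (hg.const_mul hU (-1))
  exact this.congr hU fun z _ => by ring

/-- reflection and translation -/
lemma Caloric.affine (hU : IsOpen U) (h : Caloric f U) (σ b τ : ℝ) (hσ : σ ^ 2 = 1) :
    Caloric (fun z => f (σ * z.1 + b, z.2 + τ)) {z | (σ * z.1 + b, z.2 + τ) ∈ U} := by
  have hcont : Continuous (fun z : ℝ² => (σ * z.1 + b, z.2 + τ)) := by fun_prop
  have hV : IsOpen {z : ℝ² | (σ * z.1 + b, z.2 + τ) ∈ U} := hU.preimage hcont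
  have hs : SmoothOn (fun z : ℝ² => f (σ * z.1 + b, z.2 + τ)) {z | (σ * z.1 + b, z.2 + τ) ∈ U} :=
    h.smooth.comp (fun n => by fun_prop) (fun z hz => hz)
  refine ⟨hs, ?_⟩
  rintro ⟨x, t⟩ hz
  have d1 : ∀ x, HasDerivAt (fun y : ℝ => σ * y + b) σ x := fun x => by
    simpa using ((hasDerivAt_id x).const_mul σ).add_const b
  have d2 : HasDerivAt (fun y : ℝ => y + τ) 1 t := by
    simpa using (hasDerivAt_id t).add_const τ
  have hz' : (σ * x + b, t + τ) ∈ U := hz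
  have k1 := HasDerivAt.comp t (h.smooth.hasDerivT hU hz') d2
  have k2 := (HasDerivAt.comp x ((h.smooth.dX hU).hasDerivX hU hz') (d1 x)).mul_const σ
  refine heat_of hV hs hz (fun y => dX f (σ * y + b, t + τ) * σ) k1 ?_ k2 ?_
  · filter_upwards [ev_slice hV hz] with y hy
    have hy' : (σ * y + b, t + τ) ∈ U := hy
    exact HasDerivAt.comp y (h.smooth.hasDerivX hU hy') (d1 y)
  · rw [h.heat _ hz]; linear_combination (- dX (dX f) (σ * x + b, t + τ)) * hσ

lemma pd1_slice {P : Type} [NormedAddCommGroup P] [NormedSpace ℝ P] {Ψ : ℝ² × P → ℝ} {Ω : Set (ℝ² × P)}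
    (hΩ : IsOpen Ω) (h : SmoothOn Ψ Ω) {q : ℝ²} {y : P} (hz : (q, y) ∈ Ω) (v : ℝ²) :
    pd1 Ψ (q, y) v = fderiv ℝ (fun q => Ψ (q, y)) q v := by
  have h1 := h.hasFDerivAt hΩ hz
  have h2 := HasFDerivAt.comp q h1 (hasFDerivAt_prodMk_left (𝕜 := ℝ) q y)
  have h3 := h2.fderiv
  unfold pd1
  rw [← h3]; rfl

lemma pl_dir {P S : Type} [NormedAddCommGroup P] [NormedSpace ℝ P] [MeasurableSpace S] [MeasurableSpace P] [BorelSpace P] [SecondCountableTopology P]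
    {μ : Measure S} {Ψ : ℝ² × P → ℝ} {Ω : Set (ℝ² × P)} (hΩ : IsOpen Ω)
    (hΨ : SmoothOn Ψ Ω) {C : Set P} (hC : IsCompact C) {c : S → P}
    (hc : Measurable c) (hcC : ∀ s, c s ∈ C) {lam : S → ℝ} (hl : Integrable lam μ) {q : ℝ²}
    (hq : ∀ y ∈ C, (q, y) ∈ Ω) (v : ℝ²) :
    fderiv ℝ (fun q => ∫ s, lam s * Ψ (q, c s) ∂μ) q v = ∫ s, lam s * pd1 Ψ (q, c s) v ∂μ := by
  obtain ⟨h1, -, h3⟩ := pl_hasFDerivAt hΩ hΨ hC hc hcC hl hq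
  have := h1.fderiv
  simp only [smul_eq_mul] at this
  rw [this, ContinuousLinearMap.integral_apply h3]
  rfl

lemma pl_caloric {P S : Type} [NormedAddCommGroup P] [NormedSpace ℝ P] [MeasurableSpace S] [MeasurableSpace P] [BorelSpace P] [SecondCountableTopology P]
    {μ : Measure S} {Ψ : ℝ² × P → ℝ} {Ω : Set (ℝ² × P)} (hΩ : IsOpen Ω)
    (hΨ : SmoothOn Ψ Ω) (hcal : ∀ y, Caloric (fun q => Ψ (q, y)) {q | (q, y) ∈ Ω}) {C : Set P} (hC : IsCompact C) {c : S → P}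
    (hc : Measurable c) (hcC : ∀ s, c s ∈ C) {lam : S → ℝ} (hl : Integrable lam μ) :
    Caloric (fun q => ∫ s, lam s * Ψ (q, c s) ∂μ) {q | ∀ y ∈ C, (q, y) ∈ Ω} := by
  have hU : IsOpen {q | ∀ y ∈ C, (q, y) ∈ Ω} := pl_isOpen hΩ hC
  have hs : SmoothOn (fun q => ∫ s, lam s * Ψ (q, c s) ∂μ) {q | ∀ y ∈ C, (q, y) ∈ Ω} := fun n =>
    pl_contDiffOn hΩ hC hc hcC hl n Ψ hΨ
  refine ⟨hs, fun q hq => ?_⟩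
  have hΨ1 : SmoothOn (fun z => pd1 Ψ z (1, 0)) Ω := fun n => (pd1_contDiffOn hΩ hΨ n).clm_apply contDiffOn_const
  have e1 : dX (fun q => ∫ s, lam s * Ψ (q, c s) ∂μ) =ᶠ[𝓝 q] fun q => ∫ s, lam s * pd1 Ψ (q, c s) (1, 0) ∂μ := by
    filter_upwards [hU.mem_nhds hq] with q' hq'
    exact pl_dir hΩ hΨ hC hc hcC hl hq' (1, 0)
  have e2 : dX (dX (fun q => ∫ s, lam s * Ψ (q, c s) ∂μ)) q = ∫ s, lam s * pd1 (fun z => pd1 Ψ z (1, 0)) (q, c s) (1, 0) ∂μ := by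
    unfold dX at e1 ⊢
    rw [e1.fderiv_eq]
    exact pl_dir hΩ hΨ1 hC hc hcC hl hq (1, 0)
  rw [e2]
  unfold dT
  rw [pl_dir hΩ hΨ hC hc hcC hl hq]
  refine integral_congr_ae (Eventually.of_forall fun s => ?_)
  have hm := hq _ (hcC s)
  have ho : IsOpen {q | (q, c s) ∈ Ω} := hΩ.preimage (by fun_prop)
  simp only
  rw [pd1_slice hΩ hΨ hm, pd1_slice hΩ hΨ1 hm]
  have e3 := (hcal (c s)).heat q hm
  unfold dT dX at e3
  rw [e3]
  congr 1
  have e4 : (fun z => fderiv ℝ (fun q => Ψ (q, c s)) z (1, 0)) =ᶠ[𝓝 q] fun q => pd1 Ψ (q, c s) (1, 0) := by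
    filter_upwards [ho.mem_nhds hm] with q' hq'
    exact (pd1_slice hΩ hΨ hq' _).symm
  rw [e4.fderiv_eq]

end caloric_algebra

section MP

lemma second_deriv_nonneg {f D : ℝ → ℝ} {x B : ℝ} (hD : ∀ᶠ y in 𝓝 x, HasDerivAt f (D y) y)
    (hB : HasDerivAt D B x) (hmin : IsLocalMin f x) : 0 ≤ B := by
  by_contra hneg
  push Not at hneg
  have hDx : D x = 0 := hmin.hasDerivAt_eq_zero hD.self_of_nhds
  have e1 : deriv f =ᶠ[𝓝 x] D := hD.mono fun y hy => hy.deriv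
  have h2 : deriv (deriv f) x = B := by rw [e1.deriv_eq]; exact hB.deriv
  have h3 : deriv f x = 0 := by rw [e1.self_of_nhds, hDx]
  have hmax : IsLocalMax f x := isLocalMax_of_deriv_deriv_neg (by rw [h2]; exact hneg) h3 hD.self_of_nhds.continuousAt
  have hc : f =ᶠ[𝓝 x] fun _ => f x := by
    filter_upwards [hmin, hmax] with y h1 h2 using le_antisymm h2 h1
  have hd : deriv f =ᶠ[𝓝 x] fun _ => 0 := by
    have := hc.eventuallyEq_nhds
    filter_upwards [this] with y hy
    rw [hy.deriv_eq]; simp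
  have : deriv (deriv f) x = 0 := by rw [hd.deriv_eq]; simp
  rw [h2] at this; linarith

/-- `Φ` satisfies `Φ_t ≥ Φ_xx - e` at `(x,t)`, an interior point of `Q`. -/
def IntPt (Q : Set ℝ²) (Φ : ℝ → ℝ → ℝ) (e x t : ℝ) : Prop :=
  (∀ᶠ y in 𝓝 x, (y, t) ∈ Q) ∧ (∀ᶠ s in 𝓝[<] t, (x, s) ∈ Q) ∧
  ∃ A B, ∃ D : ℝ → ℝ, HasDerivAt (Φ x) A t ∧ (∀ᶠ y in 𝓝 x, HasDerivAt (fun y => Φ y t) (D y) y) ∧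
    HasDerivAt D B x ∧ B - e ≤ A

lemma MP0 {Q : Set ℝ²} (hQ : IsCompact Q) {Φ : ℝ → ℝ → ℝ} {e : ℝ} (he : e < 0) (hΦ : ContinuousOn (fun z : ℝ² => Φ z.1 z.2) Q)
    (h : ∀ x t, (x, t) ∈ Q → 0 ≤ Φ x t ∨ IntPt Q Φ e x t) : ∀ x t, (x, t) ∈ Q → 0 ≤ Φ x t := by
  intro x t hxt
  obtain ⟨⟨x0, t0⟩, h0, hmin⟩ := hQ.exists_isMinOn ⟨_, hxt⟩ hΦ
  have hmin' : ∀ y s, (y, s) ∈ Q → Φ x0 t0 ≤ Φ y s := fun y s hy => hmin hy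
  refine le_trans ?_ (hmin' x t hxt)
  rcases h x0 t0 h0 with h1 | ⟨hx, ht, A, B, D, hA, hD, hB, hAB⟩
  · exact h1
  exfalso
  have hB0 : 0 ≤ B := second_deriv_nonneg hD hB (by
    filter_upwards [hx] with y hy using hmin' y t0 hy)
  have hA0 : A ≤ 0 := by
    have := hA.hasDerivWithinAt (s := Iio t0)
    rw [hasDerivWithinAt_iff_tendsto_slope' (by simp)] at this
    refine le_of_tendsto this ?_
    filter_upwards [ht, self_mem_nhdsWithin] with s hs hs2
    have hs2 : s < t0 := hs2
    rw [slope_def_field]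
    exact div_nonpos_of_nonneg_of_nonpos (by linarith [hmin' x0 s hs]) (by linarith)
  linarith

/-- comparison with errors on `Q ⊆ ℝ × [τ, τ+S]`. -/
lemma MP1 {Q : Set ℝ²} (hQ : IsCompact Q) {Φ : ℝ → ℝ → ℝ} {e τ S : ℝ} (he : 0 ≤ e)
    (hΦ : ContinuousOn (fun z : ℝ² => Φ z.1 z.2) Q) (hS : ∀ x t, (x, t) ∈ Q → τ ≤ t ∧ t ≤ τ + S)
    (h : ∀ x t, (x, t) ∈ Q → -e ≤ Φ x t ∨ IntPt Q Φ e x t) : ∀ x t, (x, t) ∈ Q → -(e * (1 + S)) ≤ Φ x t := by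
  intro x t hxt
  have key : ∀ ε > 0, 0 ≤ Φ x t + e + (e + ε) * (t - τ) := by
    intro ε hε
    refine MP0 (Φ := fun x t => Φ x t + e + (e + ε) * (t - τ)) hQ (e := -ε) (by linarith) ?_ ?_ x t hxt
    · exact (hΦ.add continuousOn_const).add (by fun_prop)
    · intro x t hxt
      have := hS x t hxt
      rcases h x t hxt with h1 | ⟨hx, ht, A, B, D, hA, hD, hB, hAB⟩
      · left
        have : 0 ≤ (e + ε) * (t - τ) := mul_nonneg (by linarith) (by linarith)
        linarith
      · right
        refine ⟨hx, ht, A + (e+ε), B, D, ?_, ?_, hB, by linarith⟩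
        · have : HasDerivAt (fun t => (e + ε) * (t - τ)) (e+ε) t := by
            simpa using ((hasDerivAt_id t).sub_const τ).const_mul (e+ε)
          exact (hA.add_const e).add this
        · filter_upwards [hD] with y hy
          exact (hy.add_const _).add_const _
  have h2 := hS x t hxt
  have h3 : 0 ≤ Φ x t + e + e * (t - τ) := by
    have : Tendsto (fun ε : ℝ => Φ x t + e + (e + ε) * (t - τ)) (𝓝[>] 0) (𝓝 (Φ x t + e + (e + 0) * (t - τ))) := by
      apply Tendsto.mono_left _ nhdsWithin_le_nhds
      apply Continuous.tendsto; fun_prop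
    rw [add_zero] at this
    refine ge_of_tendsto this ?_
    filter_upwards [self_mem_nhdsWithin] with ε hε using key ε hε
  nlinarith

/-- `V` is a uniform limit on `Q` of approximate supersolutions. -/
def SuperLim (Q : Set ℝ²) (I : Set ℝ²) (V : ℝ → ℝ → ℝ) : Prop :=
  ∀ ε > 0, ∃ V' : ℝ → ℝ → ℝ, ContinuousOn (fun z : ℝ² => V' z.1 z.2) Q ∧ (∀ x t, (x, t) ∈ Q → |V' x t - V x t| ≤ ε) ∧
    ∀ x t, (x, t) ∈ I → ∃ A B, ∃ D : ℝ → ℝ, HasDerivAt (V' x) A t ∧ (∀ᶠ y in 𝓝 x, HasDerivAt (fun y => V' y t) (D y) y) ∧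
    HasDerivAt D B x ∧ B - ε ≤ A

/-- Comparison: `V` supersolution (in the limit), `β` caloric subsolution. -/
lemma comparison {Q I : Set ℝ²} (hQ : IsCompact Q) {V : ℝ → ℝ → ℝ} (hV : SuperLim Q I V) {β : ℝ → ℝ → ℝ}
    {τ S : ℝ} (hβ : ContinuousOn (fun z : ℝ² => β z.1 z.2) Q) (hS : ∀ x t, (x, t) ∈ Q → τ ≤ t ∧ t ≤ τ + S)
    (h : ∀ x t, (x, t) ∈ Q → β x t ≤ V x t ∨ ((x, t) ∈ I ∧ (∀ᶠ y in 𝓝 x, (y, t) ∈ Q) ∧ (∀ᶠ s in 𝓝[<] t, (x, s) ∈ Q) ∧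
      ∃ A B, ∃ D : ℝ → ℝ, HasDerivAt (β x) A t ∧ (∀ᶠ y in 𝓝 x, HasDerivAt (fun y => β y t) (D y) y) ∧
    HasDerivAt D B x ∧ A ≤ B)) : ∀ x t, (x, t) ∈ Q → β x t ≤ V x t := by
  intro x t hxt
  have hSS := hS x t hxt
  have key : ∀ ε > 0, β x t ≤ V x t + ε * (2 + S) := by
    intro ε hε
    obtain ⟨V', hc, hclose, hsup⟩ := hV ε hε
    have := MP1 hQ (Φ := fun x t => V' x t - β x t) (e := ε) hε.le (hc.sub hβ) hS ?_ x t hxt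
    · have h2 := abs_le.1 (hclose x t hxt)
      linarith
    · intro x t hxt
      rcases h x t hxt with h1 | ⟨hI, hx, ht, A, B, D, hA, hD, hB, hAB⟩
      · left
        have h2 := abs_le.1 (hclose x t hxt)
        linarith
      · right
        obtain ⟨A', B', D', hA', hD', hB', hAB'⟩ := hsup x t hI
        refine ⟨hx, ht, A' - A, B' - B, fun y => D' y - D y, hA'.sub hA, ?_, hB'.sub hB, by linarith⟩
        filter_upwards [hD, hD'] with y h1 h2 using h2.sub h1
  have h3 : Tendsto (fun ε : ℝ => V x t + ε * (2 + S)) (𝓝[>] 0) (𝓝 (V x t + 0 * (2 + S))) := by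
      apply Tendsto.mono_left _ nhdsWithin_le_nhds
      apply Continuous.tendsto; fun_prop
  rw [zero_mul, add_zero] at h3
  refine ge_of_tendsto h3 ?_
  filter_upwards [self_mem_nhdsWithin] with ε hε using key ε hε

end MP

section Gam

noncomputable def sg (k : ℤ) : ℝ := (-1 : ℝ) ^ k.natAbs
lemma sg_cases (k : ℤ) : (Even k ∧ sg k = 1) ∨ (Odd k ∧ sg k = -1) := by
  rcases Int.even_or_odd k with h | h
  · left; refine ⟨h, ?_⟩; unfold sg; rw [Even.neg_one_pow (Int.natAbs_even.2 h)]
  · right; refine ⟨h, ?_⟩; unfold sg; rw [Odd.neg_one_pow (Int.natAbs_odd.2 h)]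
lemma sg_abs (k : ℤ) : |sg k| = 1 := by
  rcases sg_cases k with ⟨_, h⟩ | ⟨_, h⟩ <;> simp [h]

lemma heatGamma_def (x y t : ℝ) : heatGamma x y t = ∑' k : ℤ, heatK (x - (2 * k + sg k * y)) t := rfl

/-- tail integrand; `z = ((x,t),y)`, `w = (κ, ε)` -/
noncomputable def tailΨ (z : (ℝ² × ℝ) × ℝ²) : ℝ :=
  (√(4 * π))⁻¹ * (z.1.1.2 ^ 2 * ((2 - z.2.1 * (z.1.1.1 - z.2.2 * z.1.2))^5)⁻¹ *
    gl (-(5/2)) (z.1.1.2 * z.2.1^2 / (2 - z.2.1 * (z.1.1.1 - z.2.2 * z.1.2))^2))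

def tailΩ : Set ((ℝ² × ℝ) × ℝ²) := {z | 0 < 2 - z.2.1 * (z.1.1.1 - z.2.2 * z.1.2)}
lemma tailΩ_open : IsOpen tailΩ := isOpen_lt (by fun_prop) (by fun_prop)

lemma tailΨ_smooth : SmoothOn tailΨ tailΩ := by
  intro n
  unfold tailΨ
  refine contDiffOn_const.mul (ContDiffOn.mul (ContDiffOn.mul (by fun_prop) (ContDiffOn.inv (by fun_prop) ?_)) ?_)
  · intro z hz; have : 0 < 2 - z.2.1 * (z.1.1.1 - z.2.2 * z.1.2) := hz; positivity
  · refine (gl_contDiff n _).comp_contDiffOn (ContDiffOn.div (by fun_prop) (by fun_prop) ?_)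
    intro z hz; have : 0 < 2 - z.2.1 * (z.1.1.1 - z.2.2 * z.1.2) := hz; positivity

lemma tail_formula {x y t κ ε : ℝ} (hκ : κ ≠ 0) (hm : 0 < 2 - κ * (x - ε * y)) :
    heatK (x - (2 / κ + ε * y)) t = |κ|^5 * tailΨ (((x,t),y),(κ,ε)) := by
  have hw : x - (2/κ + ε*y) = -(2 - κ * (x - ε*y)) / κ := by field_simp; ring
  set m := 2 - κ * (x - ε * y) with hmdef
  have hne : x - (2/κ + ε*y) ≠ 0 := by rw [hw]; exact div_ne_zero (neg_ne_zero.2 hm.ne') hκ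
  rw [heatK_gl hne, hw, gl_mul, gl_mul (-(1/2) - 1)]
  unfold tailΨ
  simp only
  rw [← hmdef]
  have e1 : t / (-m/κ)^2 = t * κ^2 / m^2 := by field_simp
  have e2 : |(-m)/κ| = m / |κ| := by rw [abs_div, abs_neg, abs_of_pos hm]
  rw [e1, e2]
  have e3 : (-(1/2) - 1 - 1 : ℝ) = -(5/2) := by norm_num
  rw [e3]
  have h4 : |κ| ≠ 0 := abs_ne_zero.2 hκ
  have e5 : κ^2 = |κ|^2 := (sq_abs κ).symm
  rw [e5]
  field_simp

noncomputable def tlam (k : ℤ) : ℝ := if 3 ≤ |k| then |(k:ℝ)⁻¹|^5 else 0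
noncomputable def tc (k : ℤ) : ℝ² := (if 3 ≤ |k| then (k:ℝ)⁻¹ else 0, sg k)
def tC : Set ℝ² := Icc (-(1/3)) (1/3) ×ˢ Icc (-1) 1
lemma tC_compact : IsCompact tC := isCompact_Icc.prod isCompact_Icc
lemma tc_mem (k : ℤ) : tc k ∈ tC := by
  refine ⟨?_, ?_⟩
  · rw [mem_Icc, ← abs_le]
    unfold tc
    simp only
    split_ifs with h
    · rw [abs_inv]
      have : (3:ℝ) ≤ |(k:ℝ)| := by exact_mod_cast h
      rw [one_div]
      exact inv_anti₀ (by norm_num) this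
    · simp
  · rw [mem_Icc, ← abs_le]; exact (sg_abs k).le

lemma tlam_summable : Summable tlam := by
  have h : Summable (fun k : ℤ => |(k:ℝ)⁻¹|^5) := by
    have := (Real.summable_one_div_int_pow (p := 5)).2 (by norm_num)
    refine this.abs.congr fun k => ?_
    simp [abs_pow, abs_inv]
  refine Summable.of_nonneg_of_le (fun k => ?_) (fun k => ?_) h
  · unfold tlam; split_ifs <;> positivity
  · unfold tlam; split_ifs
    · rfl
    · positivity

lemma tlam_integrable : Integrable tlam Measure.count := by
  rw [integrable_count_iff]; exact tlam_summable.norm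

noncomputable def Gtail (z : ℝ² × ℝ) : ℝ := ∫ k, tlam k * tailΨ (z, tc k) ∂Measure.count

def box2 : Set (ℝ² × ℝ) := {z | |z.1.1| < 2 ∧ |z.2| < 2}
lemma box2_open : IsOpen box2 := by
  have h1 : IsOpen {z : ℝ² × ℝ | |z.1.1| < 2} := isOpen_lt (by fun_prop) (by fun_prop)
  have h2 : IsOpen {z : ℝ² × ℝ | |z.2| < 2} := isOpen_lt (by fun_prop) (by fun_prop)
  exact h1.inter h2

lemma box2_tail {z : ℝ² × ℝ} (hz : z ∈ box2) : ∀ w ∈ tC, (z, w) ∈ tailΩ := by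
  rintro ⟨κ, ε⟩ ⟨h1, h2⟩
  obtain ⟨⟨x, t⟩, y⟩ := z
  obtain ⟨hx, hy⟩ := hz
  rw [mem_Icc, ← abs_le] at h1 h2
  simp only at h1 h2 hx hy
  show 0 < 2 - κ * (x - ε * y)
  have e1 : |x - ε*y| ≤ |x| + |ε| * |y| := by rw [← abs_mul]; exact abs_sub _ _
  have e2 : |ε| * |y| ≤ 1 * 2 := mul_le_mul h2 hy.le (abs_nonneg _) (by norm_num)
  have e3 : |κ * (x-ε*y)| ≤ (1/3) * 4 := by
    rw [abs_mul]; exact mul_le_mul h1 (by linarith) (abs_nonneg _) (by norm_num)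
  have := le_abs_self (κ * (x-ε*y))
  linarith

lemma Gtail_smooth : SmoothOn Gtail box2 := by
  intro n
  have := pl_contDiffOn (μ := Measure.count) tailΩ_open tC_compact (c := tc) (Measurable.of_discrete) tc_mem tlam_integrable n tailΨ tailΨ_smooth
  exact this.mono fun z hz => box2_tail hz

lemma term_tail {x y t : ℝ} (hx : |x| < 2) (hy : |y| < 2) {k : ℤ} (hk : 3 ≤ |k|) :
    heatK (x - (2 * k + sg k * y)) t = tlam k * tailΨ (((x,t),y), tc k) := by
  have hk0 : (k:ℝ) ≠ 0 := by
    have : k ≠ 0 := by rintro rfl; simp at hk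
    exact_mod_cast this
  have h := box2_tail (z := ((x,t),y)) ⟨hx, hy⟩ (tc k) (tc_mem k)
  unfold tlam
  unfold tc at *
  rw [if_pos hk] at *
  rw [if_pos hk]
  have := tail_formula (x := x) (y := y) (t := t) (κ := (k:ℝ)⁻¹) (ε := sg k) (inv_ne_zero hk0) h
  rw [← this]
  congr 2
  simp

lemma tail_summable {x y : ℝ} (t : ℝ) (hx : |x| < 2) (hy : |y| < 2) : Summable (fun k => tlam k * tailΨ (((x,t),y), tc k)) := by
  have := (pl_hasFDerivAt (μ := Measure.count) tailΩ_open tailΨ_smooth tC_compact (c := tc) (Measurable.of_discrete) tc_mem tlam_integrable (q := ((x,t),y)) (box2_tail ⟨hx, hy⟩)).2.1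
  rw [integrable_count_iff] at this
  exact this.of_norm

lemma heatK_summable {x y : ℝ} (t : ℝ) (hx : |x| < 2) (hy : |y| < 2) : Summable (fun k : ℤ => heatK (x - (2 * k + sg k * y)) t) := by
  refine (tail_summable t hx hy).congr_cofinite ?_
  have : ({k : ℤ | ¬ (3 ≤ |k|)}).Finite := by
    refine (Set.finite_Icc (-3 : ℤ) 3).subset ?_
    intro k hk
    simp only [mem_ofPred_eq, not_le] at hk
    rw [abs_lt] at hk
    exact ⟨by omega, by omega⟩
  refine this.subset ?_
  intro k hk
  intro h
  exact hk (term_tail hx hy h).symm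

lemma heatGamma_eq {x y : ℝ} (t : ℝ) (hx : |x| < 2) (hy : |y| < 2) :
    heatGamma x y t = (∑ k ∈ Finset.Icc (-2 : ℤ) 2, heatK (x - (2 * k + sg k * y)) t) + Gtail ((x,t),y) := by
  have h1 := (heatK_summable t hx hy).sum_add_tsum_compl (s := Finset.Icc (-2:ℤ) 2)
  rw [heatGamma_def, ← h1]
  congr 1
  unfold Gtail
  have hi : Integrable (fun k => tlam k * tailΨ (((x,t),y), tc k)) Measure.count := by
    rw [integrable_count_iff]; exact (tail_summable t hx hy).norm
  rw [integral_countable hi]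
  simp only [Measure.real, Measure.count_singleton, ENNReal.toReal_one, one_smul]
  rw [tsum_subtype (s := ((Finset.Icc (-2:ℤ) 2 : Finset ℤ) : Set ℤ)ᶜ) (f := fun k : ℤ => heatK (x - (2 * k + sg k * y)) t)]
  refine tsum_congr fun k => ?_
  by_cases h : 3 ≤ |k|
  · rw [indicator_of_mem, term_tail hx hy h]
    simp only [mem_compl_iff, Finset.mem_coe, Finset.mem_Icc]
    intro h2
    have : |k| ≤ 2 := abs_le.2 ⟨by omega, by omega⟩
    omega
  · rw [indicator_of_notMem]
    · unfold tlam; rw [if_neg h, zero_mul]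
    · simp only [mem_compl_iff, not_not, Finset.mem_coe, Finset.mem_Icc]
      rw [← abs_le]; omega

/-- domain of joint smoothness of the Neumann kernel -/
def gΩ : Set (ℝ² × ℝ) := {z | z ∈ box2 ∧ ∀ k ∈ Finset.Icc (-2:ℤ) 2, (z.1.1 - (2 * (k:ℝ) + sg k * z.2), z.1.2) ≠ (0 : ℝ²)}

lemma gΩ_open : IsOpen gΩ := by
  have : gΩ = box2 ∩ ⋂ k ∈ Finset.Icc (-2:ℤ) 2, {z : ℝ² × ℝ | (z.1.1 - (2 * (k:ℝ) + sg k * z.2), z.1.2) ≠ (0 : ℝ²)} := by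
    ext z; simp only [gΩ, mem_ofPred_eq, mem_inter_iff, mem_iInter]
  rw [this]
  refine box2_open.inter (isOpen_biInter_finset fun k _ => ?_)
  exact isOpen_ne.preimage (by fun_prop)

lemma heatGamma_smooth : SmoothOn (fun z : ℝ² × ℝ => heatGamma z.1.1 z.2 z.1.2) gΩ := by
  have : SmoothOn (fun z : ℝ² × ℝ => (∑ k ∈ Finset.Icc (-2 : ℤ) 2, heatK (z.1.1 - (2 * k + sg k * z.2)) z.1.2) + Gtail z) gΩ := by
    refine SmoothOn.add ?_ (Gtail_smooth.mono fun z hz => hz.1)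
    intro n
    refine ContDiffOn.sum fun k hk => ?_
    exact (heatK_smooth n).comp (g := fun z : ℝ² => heatK z.1 z.2) (f := fun z : ℝ² × ℝ => (z.1.1 - (2 * k + sg k * z.2), z.1.2)) (by fun_prop) (fun z hz => hz.2 k hk)
  refine this.congr ?_
  rintro ⟨⟨x, t⟩, y⟩ hz
  exact heatGamma_eq t hz.1.1 hz.1.2

lemma gΩ_slice_open (y : ℝ) : IsOpen {q : ℝ² | (q, y) ∈ gΩ} := gΩ_open.preimage (by fun_prop)

lemma heatK_shift_caloric (b : ℝ) : Caloric (fun z : ℝ² => heatK (z.1 - b) z.2) {z | (z.1 - b, z.2) ≠ (0 : ℝ²)} := by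
  have := heatK_caloric.affine isOpen_ne_zero 1 (-b) 0 (by norm_num)
  simp only [one_mul, add_zero, ← sub_eq_add_neg] at this
  exact this

lemma Caloric.zero (U : Set ℝ²) : Caloric (fun _ => 0) U := by
  refine ⟨fun n => contDiffOn_const, fun z _ => ?_⟩
  have : dX (fun _ : ℝ² => (0:ℝ)) = fun _ => 0 := by ext; simp [dX]
  simp [dT, this]

lemma Caloric.sum {ι : Type} (s : Finset ι) {f : ι → ℝ² → ℝ} {U : Set ℝ²} (hU : IsOpen U) (h : ∀ i ∈ s, Caloric (f i) U) :
    Caloric (fun z => ∑ i ∈ s, f i z) U := by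
  classical
  induction s using Finset.induction_on with
  | empty => simpa using Caloric.zero U
  | insert a s ha ih =>
    have := (h a (Finset.mem_insert_self a s)).add hU (ih fun i hi => h i (Finset.mem_insert_of_mem hi))
    exact this.congr hU fun z _ => by rw [Finset.sum_insert ha]

lemma Gtail_caloric {y : ℝ} (hy : |y| < 2) : Caloric (fun q => Gtail (q, y)) {q | |q.1| < 2} := by
  have hO : IsOpen {z : ℝ² × ℝ² | ((z.1, y), z.2) ∈ tailΩ} := tailΩ_open.preimage (by fun_prop)
  have := pl_caloric (μ := Measure.count) (Ψ := fun z : ℝ² × ℝ² => tailΨ ((z.1, y), z.2)) (Ω := {z | ((z.1, y), z.2) ∈ tailΩ})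
    hO (tailΨ_smooth.comp (fun n => by fun_prop) (fun z hz => hz)) ?_ tC_compact (c := tc) (Measurable.of_discrete) tc_mem tlam_integrable
  · refine this.mono ?_
    intro q hq w hw
    exact box2_tail (z := (q, y)) ⟨hq, hy⟩ w hw
  · rintro ⟨κ, ε⟩
    have hO2 : IsOpen {q : ℝ² | (q, (κ, ε)) ∈ {z : ℝ² × ℝ² | ((z.1, y), z.2) ∈ tailΩ}} := hO.preimage (by fun_prop)
    by_cases hκ : κ = 0
    · subst hκ
      refine (Caloric.zero _).congr hO2 ?_
      intro q hq
      simp [tailΨ, gl_zero]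
    · have h1 := ((heatK_shift_caloric (2/κ + ε * y)).mono (V := {q : ℝ² | (q, (κ, ε)) ∈ {z : ℝ² × ℝ² | ((z.1, y), z.2) ∈ tailΩ}}) ?_).const_mul hO2 ((|κ|^5)⁻¹)
      · refine h1.congr hO2 ?_
        rintro ⟨x, t⟩ hq
        have h2 := tail_formula (x := x) (y := y) (t := t) (κ := κ) (ε := ε) hκ hq
        simp only
        rw [h2]
        have : |κ| ≠ 0 := abs_ne_zero.2 hκ
        field_simp
      · rintro ⟨x, t⟩ hq h0
        have hq : 0 < 2 - κ * (x - ε * y) := hq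
        have h0 := congrArg Prod.fst h0
        simp only [Prod.fst_zero] at h0
        have : κ * (x - (2/κ + ε*y)) = 0 := by rw [h0]; ring
        have h3 : κ * (x - (2/κ + ε*y)) = - (2 - κ * (x - ε * y)) := by field_simp; ring
        linarith

lemma heatGamma_caloric (y : ℝ) : Caloric (fun q : ℝ² => heatGamma q.1 y q.2) {q | (q, y) ∈ gΩ} := by
  by_cases hy : |y| < 2
  · have hO := gΩ_slice_open y
    have h1 : Caloric (fun q : ℝ² => ∑ k ∈ Finset.Icc (-2 : ℤ) 2, heatK (q.1 - (2 * k + sg k * y)) q.2) {q | (q, y) ∈ gΩ} := by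
      refine Caloric.sum _ hO fun k hk => ?_
      exact (heatK_shift_caloric _).mono fun q hq => hq.2 k hk
    refine (h1.add hO ((Gtail_caloric hy).mono fun q hq => hq.1.1)).congr hO ?_
    rintro ⟨x, t⟩ hz
    exact heatGamma_eq t hz.1.1 hz.1.2
  · have : {q : ℝ² | (q, y) ∈ gΩ} = ∅ := by
      ext q; simp only [mem_ofPred_eq, mem_empty_iff_false, iff_false]; intro h; exact hy h.1.2
    rw [this]
    exact ⟨fun n => contDiffOn_empty, fun z hz => hz.elim⟩

end Gam

section Gsym

lemma sg_neg (k : ℤ) : sg (-k) = sg k := by simp [sg]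
lemma sg_one_sub (k : ℤ) : sg (1 - k) = - sg k := by
  rcases sg_cases k with ⟨h, e⟩ | ⟨h, e⟩ <;> rcases sg_cases (1 - k) with ⟨h', e'⟩ | ⟨h', e'⟩
  · exfalso; rcases h with ⟨a, rfl⟩; rcases h' with ⟨b, hb⟩; omega
  · rw [e, e']
  · rw [e, e']; norm_num
  · exfalso; rcases h with ⟨a, rfl⟩; rcases h' with ⟨b, hb⟩; omega

lemma heatGamma_neg_neg (x y t : ℝ) : heatGamma (-x) (-y) t = heatGamma x y t := by
  rw [heatGamma_def, heatGamma_def, ← (Equiv.neg ℤ).tsum_eq]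
  refine tsum_congr fun k => ?_
  simp only [Equiv.neg_apply, sg_neg]
  rw [← heatK_neg]
  congr 1; push_cast; ring

lemma heatGamma_refl_right (x y t : ℝ) : heatGamma (2 - x) y t = heatGamma x y t := by
  rw [heatGamma_def, heatGamma_def, ← (Equiv.subLeft (1:ℤ)).tsum_eq]
  refine tsum_congr fun k => ?_
  simp only [Equiv.subLeft_apply, sg_one_sub]
  rw [← heatK_neg]
  congr 1; push_cast; ring

lemma sg_symm_inv : Function.Involutive (fun k : ℤ => if Even k then -k else k) := by
  intro k
  by_cases h : Even k
  · simp [h]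
  · simp [h]

lemma heatGamma_symm (x y t : ℝ) : heatGamma x y t = heatGamma y x t := by
  rw [heatGamma_def, heatGamma_def, ← (sg_symm_inv.toPerm).tsum_eq]
  refine tsum_congr fun k => ?_
  simp only [Function.Involutive.coe_toPerm]
  rcases sg_cases k with ⟨h, e⟩ | ⟨h, e⟩
  · rw [if_pos h, sg_neg, e, ← heatK_neg]
    congr 1; push_cast; ring
  · rw [if_neg (Int.not_even_iff_odd.2 h), e]
    congr 1; ring

lemma heatGamma_refl_left (x y t : ℝ) : heatGamma (-2 - x) y t = heatGamma x y t := by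
  rw [← heatGamma_neg_neg, show -(-2 - x) = 2 - (-x) by ring, heatGamma_refl_right, heatGamma_neg_neg]

lemma heatGamma_nonneg (x y t : ℝ) : 0 ≤ heatGamma x y t := tsum_nonneg fun _ => heatK_nonneg _ _
lemma heatGamma_nonpos_time (x y : ℝ) {t : ℝ} (h : t ≤ 0) : heatGamma x y t = 0 := by
  rw [heatGamma_def]; simp [heatK_nonpos_time h]

lemma Gtail_nonpos_time {z : ℝ² × ℝ} (h : z.1.2 ≤ 0) : Gtail z = 0 := by
  unfold Gtail
  have : ∀ k, tlam k * tailΨ (z, tc k) = 0 := by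
    intro k
    unfold tailΨ
    rw [gl_zero]; · simp
    · exact div_nonpos_of_nonpos_of_nonneg (mul_nonpos_of_nonpos_of_nonneg h (sq_nonneg _)) (sq_nonneg _)
  simp [this]

lemma mem_gΩ_of_time {x y t : ℝ} (hx : |x| < 2) (hy : |y| < 2) (ht : t ≠ 0) : ((x, t), y) ∈ gΩ :=
  ⟨⟨hx, hy⟩, fun _ _ h => ht (congrArg Prod.snd h)⟩

lemma mem_gΩ_of_ne {x y t : ℝ} (hx : |x| ≤ 1) (hy : |y| ≤ 1) (h : x ≠ y) : ((x, t), y) ∈ gΩ := by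
  refine ⟨⟨by show |x| < 2; linarith, by show |y| < 2; linarith⟩, fun k hk h0 => h ?_⟩
  have h0 : x - (2 * (k:ℝ) + sg k * y) = 0 := congrArg Prod.fst h0
  rw [abs_le] at hx hy
  rw [Finset.mem_Icc] at hk
  obtain ⟨k1, k2⟩ := hk
  rcases sg_cases k with ⟨hk, e⟩ | ⟨hk, e⟩ <;> rw [e] at h0
  · have : k = -2 ∨ k = 0 ∨ k = 2 := by
      rcases hk with ⟨b, hb⟩; omega
    rcases this with rfl | rfl | rfl <;> push_cast at h0 <;> linarith
  · have : k = -1 ∨ k = 1 := by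
      rcases hk with ⟨b, hb⟩; omega
    rcases this with rfl | rfl <;> push_cast at h0 <;> linarith

lemma heatK_le (x : ℝ) {t : ℝ} (ht : 0 < t) : heatK x t ≤ (√t)⁻¹ := by
  unfold heatK
  have h1 : Real.exp (-(x^2)/(4*t)) ≤ 1 := by
    rw [Real.exp_le_one_iff]
    exact div_nonpos_of_nonpos_of_nonneg (by nlinarith [sq_nonneg x]) (by linarith)
  have h2 : (√(4 * π * t))⁻¹ ≤ (√t)⁻¹ := by
    apply inv_anti₀ (by positivity)
    apply Real.sqrt_le_sqrt
    nlinarith [Real.pi_gt_three]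
  calc _ ≤ (√t)⁻¹ * 1 := mul_le_mul h2 h1 (by positivity) (by positivity)
    _ = _ := mul_one _

/-- uniform bound `Γ ≤ C t^{-1/2}` on `(0,T]`. -/
lemma heatGamma_bound (T : ℝ) : ∃ C > 0, ∀ x y t, |x| ≤ 1 → |y| ≤ 1 → 0 < t → t ≤ T → heatGamma x y t ≤ C * (√t)⁻¹ := by
  have hK : IsCompact ((𝕁 ×ˢ Icc 0 T) ×ˢ 𝕁) := (isCompact_Icc.prod isCompact_Icc).prod isCompact_Icc
  obtain ⟨B, hB⟩ := hK.exists_bound_of_continuousOn (f := Gtail) (Gtail_smooth.continuousOn.mono (by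
    rintro ⟨⟨x, t⟩, y⟩ ⟨⟨hx, ht⟩, hy⟩
    rw [mem_Icc, ← abs_le] at hx hy
    exact ⟨by show |x| < 2; simp only at hx; linarith, by show |y| < 2; simp only at hy; linarith⟩))
  refine ⟨5 + |B| * √T, by positivity, fun x y t hx hy ht htT => ?_⟩
  rw [heatGamma_eq t (by linarith) (by linarith), add_mul]
  have h1 : ∑ k ∈ Finset.Icc (-2 : ℤ) 2, heatK (x - (2 * k + sg k * y)) t ≤ ∑ k ∈ Finset.Icc (-2 : ℤ) 2, (√t)⁻¹ :=
    Finset.sum_le_sum fun k _ => heatK_le _ ht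
  have h2 : ∑ k ∈ Finset.Icc (-2 : ℤ) 2, (√t)⁻¹ = 5 * (√t)⁻¹ := by
    rw [Finset.sum_const]; simp
  have h3 := hB ((x, t), y) ⟨⟨abs_le.1 hx, ⟨ht.le, htT⟩⟩, abs_le.1 hy⟩
  have h4 : Gtail ((x,t),y) ≤ |B| := le_trans (le_abs_self _) (le_trans h3 (le_abs_self B))
  have h5 : 1 ≤ √T * (√t)⁻¹ := by
    rw [← div_eq_mul_inv, one_le_div (by positivity)]; exact Real.sqrt_le_sqrt htT
  have h6 : |B| ≤ |B| * √T * (√t)⁻¹ := by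
    rw [mul_assoc]; exact le_mul_of_one_le_right (abs_nonneg _) h5
  linarith

end Gsym

section unfold

lemma heatK_continuous {t : ℝ} (ht : 0 < t) : Continuous (fun x => heatK x t) := by unfold heatK; fun_prop

lemma heatK_integrable {t : ℝ} (ht : 0 < t) : Integrable (fun x => heatK x t) := by
  have := (integrable_exp_neg_mul_sq (show 0 < 1/(4*t) by positivity)).const_mul ((√(4*π*t))⁻¹)
  refine this.congr (Eventually.of_forall fun x => ?_)
  simp only [heatK]; congr 2; field_simp

lemma heatK_integral {t : ℝ} (ht : 0 < t) : ∫ x, heatK x t = 1 := by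
  have h1 : (fun x => heatK x t) = fun x => (√(4*π*t))⁻¹ * Real.exp (-(1/(4*t)) * x^2) := by
    ext x; simp only [heatK]; congr 2; field_simp
  rw [h1, integral_const_mul, integral_gaussian]
  have : π / (1/(4*t)) = 4 * π * t := by field_simp
  rw [this]
  have hp := Real.pi_pos
  exact inv_mul_cancel₀ (by positivity)

/-- even about both `1` and `-1` -/
def Ev (g : ℝ → ℝ) : Prop := (∀ y, g (2 - y) = g y) ∧ (∀ y, g (-2 - y) = g y)

lemma Ev.per4 {g : ℝ → ℝ} (h : Ev g) (y : ℝ) : g (y + 4) = g y := by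
  rw [← h.1, show 2 - (y+4) = -2 - y by ring, h.2]

lemma Ev.perZ {g : ℝ → ℝ} (h : Ev g) (y : ℝ) (n : ℤ) : g (y + 4 * n) = g y := by
  have : Function.Periodic g 4 := h.per4
  have := this.int_mul n y
  rw [mul_comm]; exact this

lemma Ev.img {g : ℝ → ℝ} (h : Ev g) (k : ℤ) (y : ℝ) : g (2 * k + sg k * y) = g y := by
  rcases sg_cases k with ⟨⟨b, hb⟩, e⟩ | ⟨⟨b, hb⟩, e⟩ <;> rw [e]
  · rw [hb]
    rw [show (2 * ((b + b : ℤ) : ℝ) + 1 * y) = y + 4 * (b:ℤ) by push_cast; ring, h.perZ]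
  · rw [hb]
    rw [show (2 * ((2 * b + 1 : ℤ) : ℝ) + -1 * y) = (2 - y) + 4 * (b:ℤ) by push_cast; ring, h.perZ, h.1]

lemma hasSum_seg {f : ℝ → ℝ} (hf : Integrable f) : HasSum (fun k : ℤ => ∫ z in (2*(k:ℝ)-1)..(2*k+1), f z) (∫ z, f z) := by
  have h1 : Integrable (fun w => f (2 * w)) := hf.comp_mul_left' (by norm_num)
  have h2 := (h1.hasSum_intervalIntegral (-(1/2))).mul_left 2
  have h3 := Measure.integral_comp_mul_left f 2
  rw [h3] at h2
  have e1 : (fun k : ℤ => ∫ z in (2*(k:ℝ)-1)..(2*k+1), f z) = fun k : ℤ => 2 * ∫ (x : ℝ) in -(1 / 2) + (k:ℝ)..-(1 / 2) + (k:ℝ) + 1, f (2 * x) := by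
    funext k
    rw [intervalIntegral.mul_integral_comp_mul_left]
    congr 1 <;> ring
  have e2 : (∫ z, f z) = 2 * |(2:ℝ)⁻¹| • ∫ (y : ℝ), f y := by
    rw [abs_of_pos (by norm_num)]; simp
  rw [e1, e2]; exact h2

lemma seg_change (f : ℝ → ℝ) (k : ℤ) : ∫ y in (-1:ℝ)..1, f (2 * k + sg k * y) = ∫ z in (2*(k:ℝ)-1)..(2*k+1), f z := by
  rcases sg_cases k with ⟨_, e⟩ | ⟨_, e⟩ <;> rw [e]
  · simp only [one_mul]
    rw [intervalIntegral.integral_comp_add_left (fun z => f z)]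
    congr 1 
  · have : ∀ y : ℝ, (2 * (k:ℝ) + -1 * y) = 2 * k - y := fun y => by ring
    simp only [this]
    rw [intervalIntegral.integral_comp_sub_left (fun z => f z)]
    congr 1; ring

lemma unfold_gamma {g : ℝ → ℝ} (hg : Ev g) (hc : Continuous g) {B : ℝ} (hB : ∀ y, |g y| ≤ B) (x : ℝ) {t : ℝ} (ht : 0 < t) :
    ∫ y in (-1:ℝ)..1, heatGamma x y t * g y = ∫ y, heatK (x - y) t * g y := by
  have hi0 : Integrable (fun y => heatK (x - y) t) := (heatK_integrable ht).comp_sub_left x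
  have hi : Integrable (fun y => heatK (x - y) t * g y) := 
    hi0.mul_bdd hc.aestronglyMeasurable (Eventually.of_forall hB)
  have hcont : Continuous (fun y => heatK (x - y) t * g y) :=
    ((heatK_continuous ht).comp (by fun_prop)).mul hc
  have e1 : ∀ k : ℤ, ∀ y, heatK (x - (2 * k + sg k * y)) t * g y = (fun z => heatK (x - z) t * g z) (2 * k + sg k * y) := by
    intro k y; simp only [hg.img]
  have hs := hasSum_seg hi
  have hsn := (hasSum_seg hi.norm).summable
  have := hasSum_integral_of_summable_integral_norm (μ := volume.restrict (Ioc (-1:ℝ) 1)) (F := fun (k : ℤ) y => heatK (x - (2 * k + sg k * y)) t * g y) ?_ ?_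
  · rw [intervalIntegral.integral_of_le (by norm_num)]
    have e2 : ∫ y in Ioc (-1:ℝ) 1, heatGamma x y t * g y = ∫ y in Ioc (-1:ℝ) 1, ∑' k : ℤ, heatK (x - (2 * k + sg k * y)) t * g y := by
      congr 1; ext y; rw [tsum_mul_right, heatGamma_def]
    rw [e2]
    refine this.unique ?_
    have e3 : (fun k : ℤ => ∫ y in Ioc (-1:ℝ) 1, heatK (x - (2 * k + sg k * y)) t * g y) = fun k : ℤ => ∫ z in (2*(k:ℝ)-1)..(2*k+1), heatK (x - z) t * g z := by
      funext k
      rw [← seg_change, intervalIntegral.integral_of_le (by norm_num)]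
      simp only [e1]
    rw [e3]; exact hs
  · intro k
    simp only [e1]
    have : Continuous (fun y => (fun z => heatK (x - z) t * g z) (2 * k + sg k * y)) := hcont.comp (by fun_prop)
    exact (this.continuousOn.integrableOn_compact isCompact_Icc).mono_set Ioc_subset_Icc_self
  · refine hsn.congr fun k => ?_
    rw [← seg_change, intervalIntegral.integral_of_le (by norm_num)]
    simp only [e1]

lemma heatGamma_mass (x : ℝ) {t : ℝ} (ht : 0 < t) : ∫ y in (-1:ℝ)..1, heatGamma x y t = 1 := by
  have := unfold_gamma (g := fun _ => 1) ⟨fun _ => rfl, fun _ => rfl⟩ continuous_const (B := 1) (by simp) x ht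
  simp only [mul_one] at this
  rw [this, integral_sub_left_eq_self (fun y => heatK y t), heatK_integral ht]

lemma heatK_conv_pt (x y w : ℝ) {h t : ℝ} (hh : 0 < h) (ht : 0 < t) :
    heatK (x - y) h * heatK (y - w) t = heatK (x - w) (t + h) * heatK (y - (t * x + h * w)/(t+h)) (t*h/(t+h)) := by
  have hp := Real.pi_pos
  unfold heatK
  rw [mul_mul_mul_comm, mul_mul_mul_comm (√(4 * π * (t + h)))⁻¹, ← Real.exp_add, ← Real.exp_add, ← mul_inv, ← mul_inv, ← Real.sqrt_mul (by positivity), ← Real.sqrt_mul (by positivity)]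
  congr 2
  · congr 1; field_simp
  · field_simp; ring

lemma heatK_conv (x w : ℝ) {h t : ℝ} (hh : 0 < h) (ht : 0 < t) :
    ∫ y, heatK (x - y) h * heatK (y - w) t = heatK (x - w) (t + h) := by
  simp only [heatK_conv_pt x _ w hh ht]
  rw [integral_const_mul, integral_sub_right_eq_self (fun y => heatK y (t*h/(t+h))), heatK_integral (by positivity), mul_one]

end unfold

section semigroup

lemma Ev.eq_img {g : ℝ → ℝ} (h : Ev g) (k : ℤ) (y : ℝ) : g y = g (sg k * (y - 2 * k)) := by
  conv_lhs => rw [show y = 2 * k + sg k * (sg k * (y - 2*k)) by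
    rcases sg_cases k with ⟨_, e⟩ | ⟨_, e⟩ <;> rw [e] <;> ring]
  rw [h.img]

lemma exists_img (y : ℝ) : ∃ k : ℤ, |sg k * (y - 2 * k)| ≤ 1 := by
  refine ⟨round (y/2), ?_⟩
  rw [abs_mul, sg_abs, one_mul]
  have := abs_sub_round (y/2)
  rw [abs_le] at *
  constructor <;> linarith

lemma Ev.continuous {g : ℝ → ℝ} (h : Ev g) (hc : ∀ y, |y| ≤ 1 → ContinuousAt g y) : Continuous g := by
  rw [continuous_iff_continuousAt]
  intro y
  obtain ⟨k, hk⟩ := exists_img y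
  have e : g = fun y => g (sg k * (y - 2*k)) := funext fun y => h.eq_img k y
  rw [e]
  exact ContinuousAt.comp_of_eq (f := fun y => sg k * (y - 2*k)) (hc _ hk) (by fun_prop) rfl

lemma Ev.bound {g : ℝ → ℝ} (h : Ev g) {B : ℝ} (hB : ∀ y, |y| ≤ 1 → |g y| ≤ B) (y : ℝ) : |g y| ≤ B := by
  obtain ⟨k, hk⟩ := exists_img y
  rw [h.eq_img k]; exact hB _ hk

lemma heatGamma_contAt {x y t : ℝ} (hz : ((x, t), y) ∈ gΩ) : ContinuousAt (fun z : ℝ² × ℝ => heatGamma z.1.1 z.2 z.1.2) ((x, t), y) :=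
  heatGamma_smooth.continuousOn.continuousAt (gΩ_open.mem_nhds hz)

lemma heatGamma_ev (z t : ℝ) : Ev (fun y => heatGamma y z t) := ⟨fun y => heatGamma_refl_right y z t, fun y => heatGamma_refl_left y z t⟩

lemma heatGamma_contX {z t : ℝ} (hz : |z| < 2) (ht : 0 < t) : Continuous (fun y => heatGamma y z t) := by
  refine (heatGamma_ev z t).continuous fun y hy => ?_
  have := heatGamma_contAt (mem_gΩ_of_time (x := y) (y := z) (t := t) (by linarith) hz ht.ne')
  exact ContinuousAt.comp_of_eq (f := fun y : ℝ => ((y, t), z)) this (by fun_prop) rfl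

lemma heatGamma_contY {x t : ℝ} (hx : |x| < 2) (ht : 0 < t) : Continuous (fun y => heatGamma x y t) := by
  simp only [heatGamma_symm x]; exact heatGamma_contX hx ht

lemma semigroup {x z h t : ℝ} (hx : |x| < 2) (hz : |z| < 2) (hh : 0 < h) (ht : 0 < t) :
    ∫ y in (-1:ℝ)..1, heatGamma x y h * heatGamma y z t = heatGamma x z (t + h) := by
  have hc := heatGamma_contX hz ht
  obtain ⟨B, hB⟩ := (isCompact_Icc (a := (-1:ℝ)) (b := 1)).exists_bound_of_continuousOn hc.continuousOn
  have hB' : ∀ y, |heatGamma y z t| ≤ B := (heatGamma_ev z t).bound fun y hy => hB y (abs_le.1 hy)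
  rw [unfold_gamma (heatGamma_ev z t) hc hB' x hh]
  have e1 : ∀ y, heatK (x - y) h * heatGamma y z t = ∑' k : ℤ, heatK (x - y) h * heatK (y - (2 * k + sg k * z)) t := by
    intro y; rw [tsum_mul_left, heatGamma_def]
  simp only [e1]
  have hint : ∀ k : ℤ, Integrable (fun y => heatK (x - y) h * heatK (y - (2 * k + sg k * z)) t) := by
    intro k
    have hi0 : Integrable (fun y => heatK (x - y) h) := (heatK_integrable hh).comp_sub_left x
    refine hi0.mul_bdd (c := (√t)⁻¹) ((heatK_continuous ht).comp (by fun_prop)).aestronglyMeasurable (Eventually.of_forall fun y => ?_)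
    rw [Real.norm_eq_abs, abs_of_nonneg (heatK_nonneg _ _)]; exact heatK_le _ ht
  have hsum : HasSum (fun k : ℤ => ∫ y, heatK (x - y) h * heatK (y - (2 * k + sg k * z)) t) (heatGamma x z (t + h)) := by
    simp only [heatK_conv _ _ hh ht]
    exact (heatK_summable (t+h) hx hz).hasSum
  have := hasSum_integral_of_summable_integral_norm hint ?_
  · exact this.unique hsum
  · refine hsum.summable.congr fun k => ?_
    refine integral_congr_ae (Eventually.of_forall fun y => ?_)
    simp only [Real.norm_eq_abs]
    rw [abs_of_nonneg (mul_nonneg (heatK_nonneg _ _) (heatK_nonneg _ _))]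

lemma heatK_fourier (c : ℝ) {t : ℝ} (ht : 0 < t) :
    ∫ u : ℝ, (heatK u t : ℂ) * Complex.exp (Complex.I * c * u) = Complex.exp (-(c^2*t : ℝ)) := by
  have h := fourierIntegral_gaussian (b := (1/(4*t) : ℝ)) (by rw [Complex.ofReal_re]; positivity) (c : ℂ)
  have hp := Real.pi_pos
  have e : ∀ u : ℝ, (heatK u t : ℂ) * Complex.exp (Complex.I * c * u) = ((√(4*π*t))⁻¹ : ℝ) * (Complex.exp (Complex.I * c * u) * Complex.exp (-((1/(4*t) : ℝ) : ℂ) * u^2)) := by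
    intro u
    have : heatK u t = (√(4*π*t))⁻¹ * Real.exp (-(1/(4*t)) * u^2) := by
      simp only [heatK]; congr 2; field_simp
    rw [this]; push_cast; ring
  simp only [e]
  rw [integral_const_mul, h]
  have e2 : ((π : ℂ) / ((1/(4*t) : ℝ) : ℂ)) ^ (1/2 : ℂ) = ((√(4*π*t) : ℝ) : ℂ) := by
    have : ((π : ℂ) / ((1/(4*t) : ℝ) : ℂ)) = ((4*π*t : ℝ) : ℂ) := by
      push_cast; field_simp
    rw [this, Real.sqrt_eq_rpow, Complex.ofReal_cpow (by positivity)]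
    norm_num
  rw [e2, ← mul_assoc, ← Complex.ofReal_mul, inv_mul_cancel₀ (by positivity)]
  simp only [Complex.ofReal_one, one_mul]
  congr 1
  push_cast
  have : (t:ℂ) ≠ 0 := by exact_mod_cast ht.ne'
  field_simp

lemma heatK_sin (c x : ℝ) {t : ℝ} (ht : 0 < t) : ∫ z, heatK (x - z) t * Real.sin (c * z) = Real.exp (-(c^2*t)) * Real.sin (c * x) := by
  have h0 : ∫ z, heatK (x - z) t * Real.sin (c * z) = ∫ u, heatK u t * Real.sin (c * (x - u)) := by
    rw [← integral_sub_left_eq_self (fun u => heatK u t * Real.sin (c * (x - u))) volume x]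
    simp
  rw [h0]
  have h1 := heatK_fourier (-c) ht
  have h2 : ∫ u : ℝ, Complex.exp (Complex.I * c * x) * ((heatK u t : ℂ) * Complex.exp (Complex.I * (-c : ℝ) * u)) = Complex.exp (Complex.I * c * x) * Complex.exp (-((-c)^2*t : ℝ)) := by
    rw [integral_const_mul, h1]
  have h3 : ∀ u : ℝ, Complex.exp (Complex.I * c * x) * ((heatK u t : ℂ) * Complex.exp (Complex.I * (-c : ℝ) * u)) = (heatK u t : ℂ) * Complex.exp ((c * (x - u) : ℝ) * Complex.I) := by
    intro u
    rw [mul_left_comm, ← Complex.exp_add]; congr 2; push_cast; ring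
  simp only [h3] at h2
  have h4 : Integrable (fun u : ℝ => (heatK u t : ℂ) * Complex.exp ((c * (x - u) : ℝ) * Complex.I)) := by
    refine (heatK_integrable ht).ofReal.mul_bdd (c := 1) (by fun_prop) (Eventually.of_forall fun u => ?_)
    rw [Complex.norm_exp_ofReal_mul_I]
  have h5 := congrArg Complex.im h2
  have h6 := integral_im h4
  simp only [RCLike.im_eq_complex_im] at h6
  rw [← h6] at h5
  have h7 : ∀ u : ℝ, ((heatK u t : ℂ) * Complex.exp ((c * (x - u) : ℝ) * Complex.I)).im = heatK u t * Real.sin (c * (x - u)) := by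
    intro u
    rw [Complex.im_ofReal_mul, Complex.exp_ofReal_mul_I_im]
  simp only [h7] at h5
  rw [h5, show Complex.I * c * x = ((c * x : ℝ) : ℂ) * Complex.I by push_cast; ring, ← Complex.ofReal_neg, ← Complex.ofReal_exp, mul_comm (Complex.exp _),
    Complex.im_ofReal_mul, Complex.exp_ofReal_mul_I_im]
  simp

noncomputable def kap : ℝ := (π/2)^2

lemma heatGamma_sin (x : ℝ) {t : ℝ} (ht : 0 < t) :
    ∫ y in (-1:ℝ)..1, heatGamma x y t * Real.sin (π/2 * y) = Real.exp (-(kap*t)) * Real.sin (π/2 * x) := by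
  rw [unfold_gamma (B := 1) _ (by fun_prop) (fun y => Real.abs_sin_le_one _) x ht, heatK_sin _ _ ht]; · rfl
  constructor
  · intro y; show Real.sin (π/2*(2-y)) = Real.sin (π/2*y); rw [show π/2 * (2 - y) = π - π/2*y by ring, Real.sin_pi_sub]
  · intro y; show Real.sin (π/2*(-2-y)) = Real.sin (π/2*y)
    rw [show π/2 * (-2 - y) = -(π/2*y + π) by ring, Real.sin_neg, Real.sin_add_pi, neg_neg]

end semigroup

section util

noncomputable def util (φ : ℝ → ℝ) (x t : ℝ) : ℝ := ∫ ζ, heatK ζ 1 * φ (x - √t * ζ)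

lemma util_nonpos (φ : ℝ → ℝ) (x : ℝ) {t : ℝ} (ht : t ≤ 0) : util φ x t = φ x := by
  unfold util
  rw [Real.sqrt_eq_zero_of_nonpos ht]
  simp only [zero_mul, sub_zero]
  rw [integral_mul_const, heatK_integral one_pos, one_mul]

variable {φ : ℝ → ℝ} {B : ℝ}

lemma util_integrable (hc : Continuous φ) (hB : ∀ y, |φ y| ≤ B) (x t : ℝ) : Integrable (fun ζ => heatK ζ 1 * φ (x - √t * ζ)) :=
  (heatK_integrable one_pos).mul_bdd (hc.comp (by fun_prop)).aestronglyMeasurable (Eventually.of_forall fun _ => hB _)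

lemma util_eq_K (x : ℝ) {t : ℝ} (ht : 0 < t) : util φ x t = ∫ y, heatK (x - y) t * φ y := by
  have hs : 0 < √t := Real.sqrt_pos.2 ht
  have h1 : ∫ y, heatK (x - y) t * φ y = ∫ u, heatK u t * φ (x - u) := by
    rw [← integral_sub_left_eq_self (fun u => heatK u t * φ (x - u)) volume x]
    simp
  have h2 := Measure.integral_comp_mul_left (fun u => heatK u t * φ (x - u)) (√t)
  rw [h1]
  have h3 : ∫ u, heatK u t * φ (x - u) = √t * ∫ ζ, heatK (√t * ζ) t * φ (x - √t * ζ) := by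
    rw [h2, abs_of_pos (inv_pos.2 hs), smul_eq_mul, ← mul_assoc, mul_inv_cancel₀ hs.ne', one_mul]
  rw [h3, ← integral_const_mul]
  unfold util
  refine integral_congr_ae (Eventually.of_forall fun ζ => ?_)
  simp only [heatK]
  rw [Real.sqrt_mul (by have := Real.pi_pos; positivity : (0:ℝ) ≤ 4*π) t, mul_one, mul_pow, Real.sq_sqrt ht.le]
  have : -(t * ζ^2)/(4*t) = -ζ^2/(4*1) := by field_simp
  rw [this]
  have hp : √(4 * π) ≠ 0 := by have := Real.pi_pos; positivity
  field_simp

lemma util_eq_gamma (hE : Ev φ) (hc : Continuous φ) (hB : ∀ y, |φ y| ≤ B) (x : ℝ) {t : ℝ} (ht : 0 < t) :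
    util φ x t = ∫ y in (-1:ℝ)..1, heatGamma x y t * φ y := by
  rw [util_eq_K x ht, unfold_gamma hE hc hB x ht]

lemma util_continuous (hc : Continuous φ) (hB : ∀ y, |φ y| ≤ B) : Continuous (fun z : ℝ² => util φ z.1 z.2) := by
  unfold util
  refine continuous_of_dominated (bound := fun ζ => heatK ζ 1 * B) (fun z => (util_integrable hc hB z.1 z.2).1) ?_ ((heatK_integrable one_pos).mul_const B) ?_
  · intro z
    refine Eventually.of_forall fun ζ => ?_
    rw [norm_mul, Real.norm_eq_abs, abs_of_nonneg (heatK_nonneg _ _)]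
    exact mul_le_mul_of_nonneg_left (hB _) (heatK_nonneg _ _)
  · exact Eventually.of_forall fun ζ => continuous_const.mul (hc.comp (by fun_prop))

lemma util_bound (hB : ∀ y, |φ y| ≤ B) (x t : ℝ) : |util φ x t| ≤ B := by
  unfold util
  have h := norm_integral_le_of_norm_le (μ := volume) (f := fun ζ => heatK ζ 1 * φ (x - √t * ζ)) ((heatK_integrable one_pos).mul_const B) (Eventually.of_forall fun ζ => by
    rw [norm_mul, Real.norm_eq_abs, abs_of_nonneg (heatK_nonneg _ _)]
    exact mul_le_mul_of_nonneg_left (hB _) (heatK_nonneg _ _))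
  rwa [integral_mul_const, heatK_integral one_pos, one_mul] at h

lemma util_hasDerivAt {φ' : ℝ → ℝ} {B' : ℝ} (hd : ∀ x, HasDerivAt φ (φ' x) x) (hc' : Continuous φ') (hB : ∀ y, |φ y| ≤ B) (hB' : ∀ y, |φ' y| ≤ B') (x t : ℝ) :
    HasDerivAt (fun x => util φ x t) (util φ' x t) x := by
  have hc : Continuous φ := continuous_iff_continuousAt.2 fun x => (hd x).continuousAt
  unfold util
  refine (hasDerivAt_integral_of_dominated_loc_of_deriv_le (s := univ) (bound := fun ζ => heatK ζ 1 * B') (F := fun x ζ => heatK ζ 1 * φ (x - √t * ζ)) (F' := fun x ζ => heatK ζ 1 * φ' (x - √t * ζ)) (x₀ := x) (μ := volume) univ_mem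
    (Eventually.of_forall fun x => (util_integrable hc hB x t).1) (util_integrable hc hB x t) (util_integrable hc' hB' x t).1 ?_ ((heatK_integrable one_pos).mul_const B') ?_).2
  · refine Eventually.of_forall fun ζ x _ => ?_
    rw [norm_mul, Real.norm_eq_abs, abs_of_nonneg (heatK_nonneg _ _)]
    exact mul_le_mul_of_nonneg_left (hB' _) (heatK_nonneg _ _)
  · refine Eventually.of_forall fun ζ x _ => ?_
    have := (hd (x - √t * ζ)).comp x ((hasDerivAt_id x).sub_const (√t * ζ))
    rw [mul_one] at this
    exact this.const_mul _

lemma util_lip {L : ℝ} (hc : Continuous φ) (hB : ∀ y, |φ y| ≤ B) (hL : ∀ x y, |φ x - φ y| ≤ L * |x - y|) (x y t : ℝ) :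
    |util φ x t - util φ y t| ≤ L * |x - y| := by
  unfold util
  rw [← integral_sub (util_integrable hc hB x t) (util_integrable hc hB y t)]
  have h := norm_integral_le_of_norm_le (μ := volume) (f := fun ζ => heatK ζ 1 * φ (x - √t * ζ) - heatK ζ 1 * φ (y - √t * ζ)) ((heatK_integrable one_pos).mul_const (L * |x - y|)) (Eventually.of_forall fun ζ => by
    rw [← mul_sub, norm_mul, Real.norm_eq_abs, abs_of_nonneg (heatK_nonneg _ _)]
    refine mul_le_mul_of_nonneg_left ?_ (heatK_nonneg _ _)
    have := hL (x - √t * ζ) (y - √t * ζ)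
    rwa [sub_sub_sub_cancel_right] at this)
  rwa [integral_mul_const, heatK_integral one_pos, one_mul] at h

lemma util_ev (hE : Ev φ) (t : ℝ) : Ev (fun x => util φ x t) := by
  have key : ∀ x, ∫ ζ, heatK ζ 1 * φ (x + √t * ζ) = util φ x t := by
    intro x
    unfold util
    rw [← integral_neg_eq_self (fun ζ => heatK ζ 1 * φ (x - √t * ζ))]
    simp [heatK_neg]
  constructor
  · intro x
    show util φ (2 - x) t = util φ x t
    rw [← key x]; unfold util
    refine integral_congr_ae (Eventually.of_forall fun ζ => ?_)
    simp only; rw [← hE.1]; congr 2; ring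
  · intro x
    show util φ (-2 - x) t = util φ x t
    rw [← key x]; unfold util
    refine integral_congr_ae (Eventually.of_forall fun ζ => ?_)
    simp only; rw [← hE.2]; congr 2; ring

def clamp (y : ℝ) : ℝ := max (-1) (min 1 y)
lemma clamp_mem (y : ℝ) : clamp y ∈ 𝕁 := by unfold clamp; constructor <;> simp
lemma clamp_eq {y : ℝ} (h : y ∈ 𝕁) : clamp y = y := by
  unfold clamp; rw [min_eq_right h.2, max_eq_right h.1]
lemma clamp_cont : Continuous clamp := by unfold clamp; fun_prop

lemma util_caloric (hE : Ev φ) (hc : Continuous φ) (hB : ∀ y, |φ y| ≤ B) :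
    Caloric (fun z : ℝ² => util φ z.1 z.2) {z | |z.1| < 2 ∧ 0 < z.2} := by
  have hO : IsOpen {z : ℝ² | |z.1| < 2 ∧ 0 < z.2} := by
    have h1 : IsOpen {z : ℝ² | |z.1| < 2} := isOpen_lt (by fun_prop) (by fun_prop)
    have h2 : IsOpen {z : ℝ² | 0 < z.2} := isOpen_lt (by fun_prop) (by fun_prop)
    exact h1.inter h2
  have hl : Integrable φ (volume.restrict (Ioc (-1:ℝ) 1)) :=
    (hc.continuousOn.integrableOn_compact isCompact_Icc).mono_set Ioc_subset_Icc_self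
  have := pl_caloric (Ψ := fun z : ℝ² × ℝ => heatGamma z.1.1 z.2 z.1.2) gΩ_open heatGamma_smooth heatGamma_caloric
    (isCompact_Icc (a := (-1:ℝ)) (b := 1)) (c := clamp) clamp_cont.measurable clamp_mem hl
  refine (this.mono (V := {z : ℝ² | |z.1| < 2 ∧ 0 < z.2}) ?_).congr hO ?_
  · rintro ⟨x, t⟩ ⟨hx, ht⟩ y hy
    exact mem_gΩ_of_time hx (by have := abs_le.2 hy; linarith) (ne_of_gt ht)
  · rintro ⟨x, t⟩ ⟨hx, ht⟩
    rw [util_eq_gamma hE hc hB x ht, intervalIntegral.integral_of_le (by norm_num)]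
    refine setIntegral_congr_fun measurableSet_Ioc fun y hy => ?_
    simp only
    rw [clamp_eq ⟨hy.1.le, hy.2⟩, mul_comm]

end util

section P7

/-- `ā` as a function of the position. -/
noncomputable def al (a q : ℝ) : ℝ := min a (min (1 - q) (1 + q))

lemma al_cont (a : ℝ) : Continuous (al a) := by unfold al; fun_prop
lemma al_neg (a q : ℝ) : al a (-q) = al a q := by
  unfold al; rw [min_comm (1 - -q)]; ring_nf
lemma al_pos {a q : ℝ} (ha : 0 < a) (hq : q ∈ Ioo (-1:ℝ) 1) : 0 < al a q := by
  unfold al; refine lt_min ha (lt_min ?_ ?_) <;> linarith [hq.1, hq.2]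
lemma al_nonneg {a q : ℝ} (ha : 0 < a) (hq : q ∈ 𝕁) : 0 ≤ al a q := by
  unfold al; refine le_min ha.le (le_min ?_ ?_) <;> linarith [hq.1, hq.2]
lemma al_le_l (a q : ℝ) : al a q ≤ 1 + q := (min_le_right _ _).trans (min_le_right _ _)
lemma al_le_r (a q : ℝ) : al a q ≤ 1 - q := (min_le_right _ _).trans (min_le_left _ _)
lemma ym_abs {a q : ℝ} (ha : 0 < a) (hq : q ∈ 𝕁) : |q - al a q| ≤ 1 := by
  have := al_nonneg ha hq; have := al_le_l a q
  rw [abs_le]; constructor <;> linarith [hq.1, hq.2]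
lemma yp_abs {a q : ℝ} (ha : 0 < a) (hq : q ∈ 𝕁) : |q + al a q| ≤ 1 := by
  have := al_nonneg ha hq; have := al_le_r a q
  rw [abs_le]; constructor <;> linarith [hq.1, hq.2]

noncomputable def Gk (a x q t : ℝ) : ℝ := heatGamma x (q - al a q) t - heatGamma x (q + al a q) t

lemma Gk_nonpos_time (a x q : ℝ) {t : ℝ} (h : t ≤ 0) : Gk a x q t = 0 := by
  unfold Gk; rw [heatGamma_nonpos_time _ _ h, heatGamma_nonpos_time _ _ h, sub_zero]

lemma Gk_neg (a x q t : ℝ) : Gk a (-x) (-q) t = - Gk a x q t := by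
  unfold Gk
  rw [al_neg, show -q - al a q = -(q + al a q) by ring, show -q + al a q = -(q - al a q) by ring,
    heatGamma_neg_neg, heatGamma_neg_neg]; ring

lemma Gk_bound (a : ℝ) (ha : 0 < a) (T : ℝ) : ∃ C > 0, ∀ x q t, |x| ≤ 1 → q ∈ 𝕁 → 0 < t → t ≤ T →
    |Gk a x q t| ≤ C * (√t)⁻¹ := by
  obtain ⟨C, hC, h⟩ := heatGamma_bound T
  refine ⟨C, hC, fun x q t hx hq ht hT => ?_⟩
  have h1 := h x _ t hx (ym_abs ha hq) ht hT
  have h2 := h x _ t hx (yp_abs ha hq) ht hT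
  have h3 := heatGamma_nonneg x (q - al a q) t
  have h4 := heatGamma_nonneg x (q + al a q) t
  unfold Gk
  rw [abs_le]; constructor <;> linarith

lemma Gk_contAt {a x q t : ℝ} (h1 : ((x, t), q - al a q) ∈ gΩ) (h2 : ((x, t), q + al a q) ∈ gΩ) :
    ContinuousAt (fun z : ℝ × ℝ × ℝ => Gk a z.1 z.2.1 z.2.2) (x, q, t) := by
  have hal := al_cont a
  have e1 : ContinuousAt (fun z : ℝ × ℝ × ℝ => ((z.1, z.2.2), z.2.1 - al a z.2.1)) (x, q, t) := by
    apply Continuous.continuousAt; fun_prop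
  have e2 : ContinuousAt (fun z : ℝ × ℝ × ℝ => ((z.1, z.2.2), z.2.1 + al a z.2.1)) (x, q, t) := by
    apply Continuous.continuousAt; fun_prop
  unfold Gk
  exact (ContinuousAt.comp (f := fun z : ℝ × ℝ × ℝ => ((z.1, z.2.2), z.2.1 - al a z.2.1)) (heatGamma_contAt h1) e1).sub
    (ContinuousAt.comp (f := fun z : ℝ × ℝ × ℝ => ((z.1, z.2.2), z.2.1 + al a z.2.1)) (heatGamma_contAt h2) e2)

lemma Gk_contAt_time {a x q t : ℝ} (ha : 0 < a) (hx : |x| < 2) (hq : q ∈ 𝕁) (ht : t ≠ 0) :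
    ContinuousAt (fun z : ℝ × ℝ × ℝ => Gk a z.1 z.2.1 z.2.2) (x, q, t) :=
  Gk_contAt (mem_gΩ_of_time hx (by linarith [ym_abs ha hq]) ht) (mem_gΩ_of_time hx (by linarith [yp_abs ha hq]) ht)

lemma sqrt_inv_int (δ : ℝ) (hδ : 0 ≤ δ) : IntegrableOn (fun r : ℝ => (√r)⁻¹) (Ioc 0 δ) ∧ ∫ r in (0:ℝ)..δ, (√r)⁻¹ = 2 * √δ := by
  have e : ∀ r ∈ uIcc 0 δ, (√r)⁻¹ = r ^ (-(1/2) : ℝ) := by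
    intro r hr
    rw [uIcc_of_le hδ] at hr
    rw [Real.sqrt_eq_rpow, Real.rpow_neg hr.1]
  have h1 := intervalIntegral.intervalIntegrable_rpow' (a := 0) (b := δ) (r := -(1/2)) (by norm_num)
  constructor
  · rw [intervalIntegrable_iff_integrableOn_Ioc_of_le hδ] at h1
    refine h1.congr_fun (fun r hr => (e r ?_).symm) measurableSet_Ioc
    rw [uIcc_of_le hδ]; exact ⟨hr.1.le, hr.2⟩
  · rw [intervalIntegral.integral_congr e, integral_rpow (Or.inl (by norm_num))]
    rw [Real.sqrt_eq_rpow]; norm_num; ring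

structure Crv (p lam : ℝ → ℝ) : Prop where
  cp : Continuous p
  mem : ∀ s, p s ∈ Ioo (-1:ℝ) 1
  cl : Continuous lam

lemma Crv.memI {p lam : ℝ → ℝ} (h : Crv p lam) (s : ℝ) : p s ∈ 𝕁 := Ioo_subset_Icc_self (h.mem s)

/-- source part with a lag -/
noncomputable def SS (a : ℝ) (p lam : ℝ → ℝ) (x t : ℝ) : ℝ := ∫ s in (0:ℝ)..t, Gk a x (p s) (t - s) * lam s

noncomputable def FF (a : ℝ) (φ p lam : ℝ → ℝ) (x t : ℝ) : ℝ := util φ x t + SS a p lam x t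

variable {a : ℝ} {p lam : ℝ → ℝ}

lemma SS_nonpos (x : ℝ) {t : ℝ} (ht : t ≤ 0) : SS a p lam x t = 0 := by
  unfold SS
  rw [intervalIntegral.integral_congr (g := fun _ => 0), intervalIntegral.integral_zero]
  intro s hs
  rw [uIcc_of_ge ht] at hs
  show _ * _ = _
  rw [Gk_nonpos_time _ _ _ (by linarith [hs.1]), zero_mul]

lemma lam_bdd (hl : Continuous lam) (u v : ℝ) : ∃ Λ > 0, ∀ s ∈ Icc u v, |lam s| ≤ Λ := by
  obtain ⟨C, hC⟩ := (isCompact_Icc (a := u) (b := v)).exists_bound_of_continuousOn hl.continuousOn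
  exact ⟨max C 1, by positivity, fun s hs => (hC s hs).trans (le_max_left _ _)⟩

lemma SS_rep (x : ℝ) {t T : ℝ} (_hT : 0 ≤ T) (htT : t ≤ T) : SS a p lam x t = ∫ r in Ioc 0 T, (Iio t).indicator (fun r => Gk a x (p (t-r)) r * lam (t-r)) r := by
  rcases le_or_gt t 0 with h | h
  · rw [SS_nonpos x h, setIntegral_eq_zero_of_forall_eq_zero]
    intro r hr
    rw [indicator_of_notMem]
    simp only [mem_Iio, not_lt]; linarith [hr.1]
  · unfold SS
    have e := intervalIntegral.integral_comp_sub_left (a := 0) (b := t) (fun s => Gk a x (p s) (t - s) * lam s) t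
    simp only [sub_sub_cancel, sub_self, sub_zero] at e
    rw [← e, intervalIntegral.integral_of_le h.le, setIntegral_indicator measurableSet_Iio, integral_Ioc_eq_integral_Ioo]
    congr 2
    ext r; simp only [mem_Ioo, mem_inter_iff, mem_Ioc, mem_Iio]
    constructor
    · rintro ⟨h1, h2⟩; exact ⟨⟨h1, by linarith⟩, h2⟩
    · rintro ⟨⟨h1, _⟩, h2⟩; exact ⟨h1, h2⟩

lemma Gk_meas (ha : 0 < a) (h : Crv p lam) {x : ℝ} (hx : |x| < 2) (t : ℝ) (A : Set ℝ) (hA : MeasurableSet A) (hA0 : A ⊆ Ioi 0) :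
    AEStronglyMeasurable (fun r => Gk a x (p (t-r)) r * lam (t-r)) (volume.restrict A) := by
  refine ContinuousOn.aestronglyMeasurable (fun r hr => ?_) hA
  refine (ContinuousAt.mul ?_ (h.cl.continuousAt.comp (by fun_prop))).continuousWithinAt
  have := h.cp
  exact ContinuousAt.comp (f := fun r : ℝ => (x, p (t-r), r)) (Gk_contAt_time ha hx (h.memI _) (ne_of_gt (hA0 hr))) (by fun_prop)

lemma SS_cont (ha : 0 < a) (h : Crv p lam) : ContinuousOn (fun z : ℝ² => SS a p lam z.1 z.2) {z | |z.1| ≤ 1} := by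
  rintro ⟨x0, t0⟩ hz
  have hx0 : |x0| ≤ 1 := hz
  set T := |t0| + 1
  have hT : 0 < T := by positivity
  have hev : ∀ᶠ z : ℝ² in 𝓝[{z | |z.1| ≤ 1}] (x0, t0), |z.1| ≤ 1 ∧ z.2 < T ∧ -T < z.2 := by
    have h1 : ∀ᶠ z : ℝ² in 𝓝 (x0, t0), z.2 < T ∧ -T < z.2 := by
      have e1 : t0 < T := by have := le_abs_self t0; show t0 < |t0| + 1; linarith
      have e2 : -T < t0 := by have := neg_abs_le t0; show -(|t0| + 1) < t0; linarith
      have : ∀ᶠ t in 𝓝 t0, t < T ∧ -T < t := Filter.Eventually.and (Iio_mem_nhds e1) (Ioi_mem_nhds e2)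
      exact (continuous_snd.tendsto ((x0, t0) : ℝ²)).eventually this
    filter_upwards [self_mem_nhdsWithin, nhdsWithin_le_nhds h1] with z h2 h3 using ⟨h2, h3⟩
  obtain ⟨Λ, hΛ, hlam⟩ := lam_bdd h.cl 0 T
  obtain ⟨C, hC, hG⟩ := Gk_bound a ha T
  have e : (fun z : ℝ² => SS a p lam z.1 z.2) =ᶠ[𝓝[{z | |z.1| ≤ 1}] (x0, t0)]
      fun z => ∫ r in Ioc 0 T, (Iio z.2).indicator (fun r => Gk a z.1 (p (z.2-r)) r * lam (z.2-r)) r := by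
    filter_upwards [hev] with z hz using SS_rep _ hT.le hz.2.1.le
  refine ContinuousWithinAt.congr_of_eventuallyEq ?_ e (SS_rep _ hT.le (by have := le_abs_self t0; show t0 ≤ |t0| + 1; linarith))
  refine continuousWithinAt_of_dominated (bound := fun r => C * (√r)⁻¹ * Λ) ?_ ?_ ?_ ?_
  · filter_upwards [hev] with z hz
    refine AEStronglyMeasurable.indicator ?_ measurableSet_Iio
    exact Gk_meas ha h (by linarith [hz.1]) _ _ measurableSet_Ioc (fun r hr => hr.1)
  · filter_upwards [hev] with z hz
    filter_upwards [ae_restrict_mem measurableSet_Ioc] with r hr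
    by_cases hrt : r < z.2
    · rw [indicator_of_mem (by exact hrt), norm_mul]
      exact mul_le_mul (hG _ _ _ hz.1 (h.memI _) hr.1 hr.2) (hlam _ ⟨by linarith, by linarith [hr.1, hz.2.1]⟩) (norm_nonneg _) (by positivity)
    · rw [indicator_of_notMem (by exact hrt), norm_zero]; positivity
  · exact ((sqrt_inv_int T hT.le).1.const_mul C).mul_const Λ
  · have hne : ∀ᵐ r ∂(volume.restrict (Ioc 0 T)), r ≠ t0 := ae_restrict_of_ae (by simp [ae_iff])
    filter_upwards [hne, ae_restrict_mem measurableSet_Ioc] with r hr hr2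
    apply ContinuousAt.continuousWithinAt
    rcases lt_or_gt_of_ne hr with h1 | h1
    · have e2 : (fun z : ℝ² => (Iio z.2).indicator (fun r => Gk a z.1 (p (z.2-r)) r * lam (z.2-r)) r) =ᶠ[𝓝 (x0,t0)] fun z => Gk a z.1 (p (z.2-r)) r * lam (z.2-r) := by
        have : ∀ᶠ z : ℝ² in 𝓝 (x0, t0), r < z.2 := continuousAt_snd.eventually (lt_mem_nhds h1)
        filter_upwards [this] with z hz
        rw [indicator_of_mem (by exact hz)]
      refine ContinuousAt.congr ?_ e2.symm
      have := h.cp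
      have := h.cl
      refine ContinuousAt.mul ?_ (by apply Continuous.continuousAt; fun_prop)
      exact ContinuousAt.comp (f := fun z : ℝ² => (z.1, p (z.2-r), r)) (Gk_contAt_time ha (by show |x0| < 2; linarith) (h.memI _) (ne_of_gt hr2.1)) (by apply Continuous.continuousAt; fun_prop)
    · have e2 : (fun z : ℝ² => (Iio z.2).indicator (fun r => Gk a z.1 (p (z.2-r)) r * lam (z.2-r)) r) =ᶠ[𝓝 (x0,t0)] fun z => 0 := by
        have : ∀ᶠ z : ℝ² in 𝓝 (x0, t0), z.2 < r := continuousAt_snd.eventually (gt_mem_nhds h1)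
        filter_upwards [this] with z hz
        rw [indicator_of_notMem (by simp only [mem_Iio, not_lt]; exact hz.le)]
      exact ContinuousAt.congr continuousAt_const e2.symm

/-- tail part of the source: integrability and the square-root bound -/
lemma Gk_tail_bound (ha : 0 < a) (h : Crv p lam) {x t δ Λ C : ℝ} (hx : |x| ≤ 1) (hδ : 0 ≤ δ)
    (hC : ∀ x q t, |x| ≤ 1 → q ∈ 𝕁 → 0 < t → t ≤ δ → |Gk a x q t| ≤ C * (√t)⁻¹)
    (hΛ : ∀ s ∈ Icc (t - δ) t, |lam s| ≤ Λ) (hC0 : 0 ≤ C) :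
    IntervalIntegrable (fun s => Gk a x (p s) (t - s) * lam s) volume (t - δ) t ∧
    |∫ s in (t-δ)..t, Gk a x (p s) (t - s) * lam s| ≤ C * Λ * (2 * √δ) := by
  have hΛ0 : 0 ≤ Λ := (abs_nonneg _).trans (hΛ t ⟨by linarith, le_refl t⟩)
  have hb : ∀ r ∈ Ioc 0 δ, ‖Gk a x (p (t-r)) r * lam (t-r)‖ ≤ C * (√r)⁻¹ * Λ := fun r hr => by
    rw [norm_mul]
    exact mul_le_mul (hC _ _ _ hx (h.memI _) hr.1 hr.2) (hΛ _ ⟨by linarith [hr.2], by linarith [hr.1]⟩) (norm_nonneg _) (by positivity)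
  have hi : IntegrableOn (fun r => C * (√r)⁻¹ * Λ) (Ioc 0 δ) := ((sqrt_inv_int δ hδ).1.const_mul C).mul_const Λ
  have h1 : IntervalIntegrable (fun r => Gk a x (p (t-r)) r * lam (t-r)) volume 0 δ := by
    rw [intervalIntegrable_iff_integrableOn_Ioc_of_le hδ]
    exact hi.mono' (Gk_meas ha h (by linarith) _ _ measurableSet_Ioc (fun r hr => hr.1))
      ((ae_restrict_mem measurableSet_Ioc).mono hb)
  have e := intervalIntegral.integral_comp_sub_left (a := 0) (b := δ) (fun s => Gk a x (p s) (t - s) * lam s) t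
  simp only [sub_sub_cancel, sub_zero] at e
  constructor
  · have := h1.comp_sub_left t
    simp only [sub_sub_cancel, sub_zero] at this
    exact this.symm
  · rw [← e]
    have h2 := intervalIntegral.norm_integral_le_of_norm_le hδ (Eventually.of_forall hb) ((intervalIntegrable_iff_integrableOn_Ioc_of_le hδ).2 hi)
    rw [Real.norm_eq_abs] at h2
    refine h2.trans (le_of_eq ?_)
    rw [intervalIntegral.integral_mul_const, intervalIntegral.integral_const_mul, (sqrt_inv_int δ hδ).2]; ring

lemma SS_integrable (ha : 0 < a) (h : Crv p lam) {x : ℝ} (hx : |x| ≤ 1) {t : ℝ} (ht : 0 ≤ t) (u v : ℝ) (hu : 0 ≤ u) (huv : u ≤ v) (hv : v ≤ t) :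
    IntervalIntegrable (fun s => Gk a x (p s) (t - s) * lam s) volume u v := by
  obtain ⟨C, hC, hG⟩ := Gk_bound a ha t
  obtain ⟨Λ, hΛ, hlam⟩ := lam_bdd h.cl (t - t) t
  have := (Gk_tail_bound ha h hx ht hG hlam hC.le).1
  rw [sub_self] at this
  refine this.mono_set ?_
  rw [uIcc_of_le huv, uIcc_of_le ht]
  exact Icc_subset_Icc hu hv

end P7

section P8

def gΩ2 : Set (ℝ² × ℝ²) := {z | ((z.1.1, z.1.2 - z.2.2), z.2.1) ∈ gΩ}

lemma gΩ2_open : IsOpen gΩ2 := gΩ_open.preimage (by fun_prop : Continuous fun z : ℝ² × ℝ² => ((z.1.1, z.1.2 - z.2.2), z.2.1))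

lemma gamma2_smooth : SmoothOn (fun z : ℝ² × ℝ² => heatGamma z.1.1 z.2.1 (z.1.2 - z.2.2)) gΩ2 := by
  refine SmoothOn.comp (g := fun z : ℝ² × ℝ² => ((z.1.1, z.1.2 - z.2.2), z.2.1)) heatGamma_smooth (fun n => ContDiff.contDiffOn ?_) (fun z hz => hz)
  fun_prop

lemma gamma2_caloric (w : ℝ²) : Caloric (fun q : ℝ² => heatGamma q.1 w.1 (q.2 - w.2)) {q | (q, w) ∈ gΩ2} := by
  have := (heatGamma_caloric w.1).affine (gΩ_slice_open w.1) 1 0 (-w.2) (by norm_num)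
  simp only [one_mul, add_zero, ← sub_eq_add_neg] at this
  exact this

def srcU (a : ℝ) (C : Set ℝ²) : Set ℝ² :=
  {z | ∀ w ∈ C, ((z.1, z.2 - w.2), w.1 - al a w.1) ∈ gΩ ∧ ((z.1, z.2 - w.2), w.1 + al a w.1) ∈ gΩ}

lemma srcU_eq (a : ℝ) (C : Set ℝ²) : srcU a C = {q | ∀ y ∈ (fun w : ℝ² => (w.1 - al a w.1, w.2)) '' C, (q, y) ∈ gΩ2} ∩
    {q | ∀ y ∈ (fun w : ℝ² => (w.1 + al a w.1, w.2)) '' C, (q, y) ∈ gΩ2} := by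
  ext z; constructor
  · intro h; constructor <;> (rintro _ ⟨w, hw, rfl⟩; first | exact (h w hw).1 | exact (h w hw).2)
  · rintro ⟨h1, h2⟩ w hw; exact ⟨h1 _ ⟨w, hw, rfl⟩, h2 _ ⟨w, hw, rfl⟩⟩

lemma img_compact (a : ℝ) {C : Set ℝ²} (hC : IsCompact C) (σ : ℝ) : IsCompact ((fun w : ℝ² => (w.1 + σ * al a w.1, w.2)) '' C) := by
  have := al_cont a
  exact hC.image (by fun_prop)

lemma srcU_open (a : ℝ) {C : Set ℝ²} (hC : IsCompact C) : IsOpen (srcU a C) := by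
  rw [srcU_eq]
  have h1 := img_compact a hC 1
  have h2 := img_compact a hC (-1)
  simp only [one_mul, neg_one_mul, ← sub_eq_add_neg] at h1 h2
  exact (pl_isOpen gΩ2_open h2).inter (pl_isOpen gΩ2_open h1)

lemma src_caloric {a : ℝ} {p lam : ℝ → ℝ} {C : Set ℝ²} (hC : IsCompact C) {u v : ℝ} (huv : u ≤ v) (hp : Measurable p)
    (hpC : ∀ s ∈ Ioc u v, (p s, s) ∈ C) (hl : IntegrableOn lam (Ioc u v)) :
    Caloric (fun z => ∫ s in u..v, Gk a z.1 (p s) (z.2 - s) * lam s) (srcU a C) ∧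
    ∀ z ∈ srcU a C, IntervalIntegrable (fun s => Gk a z.1 (p s) (z.2 - s) * lam s) volume u v := by
  rcases eq_or_lt_of_le huv with rfl | huv'
  · simp only [intervalIntegral.integral_same]
    exact ⟨Caloric.zero _, fun z _ => IntervalIntegrable.refl⟩
  have h1 := img_compact a hC 1
  have h2 := img_compact a hC (-1)
  simp only [one_mul, neg_one_mul, ← sub_eq_add_neg] at h1 h2
  have hv : v ∈ Ioc u v := ⟨huv', le_refl v⟩
  set pm : ℝ → ℝ² := (Ioc u v).piecewise (fun s => (p s - al a (p s), s)) (fun _ => (p v - al a (p v), v)) with hpm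
  set pp : ℝ → ℝ² := (Ioc u v).piecewise (fun s => (p s + al a (p s), s)) (fun _ => (p v + al a (p v), v)) with hpp
  have mal : Measurable (al a) := (al_cont a).measurable
  have mpm : Measurable pm := Measurable.piecewise measurableSet_Ioc ((hp.sub (mal.comp hp)).prodMk measurable_id) measurable_const
  have mpp : Measurable pp := Measurable.piecewise measurableSet_Ioc ((hp.add (mal.comp hp)).prodMk measurable_id) measurable_const
  have cpm : ∀ s, pm s ∈ (fun w : ℝ² => (w.1 - al a w.1, w.2)) '' C := by
    intro s
    by_cases hs : s ∈ Ioc u v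
    · rw [hpm, piecewise_eq_of_mem _ _ _ hs]; exact ⟨_, hpC s hs, rfl⟩
    · rw [hpm, piecewise_eq_of_notMem _ _ _ hs]; exact ⟨_, hpC v hv, rfl⟩
  have cpp : ∀ s, pp s ∈ (fun w : ℝ² => (w.1 + al a w.1, w.2)) '' C := by
    intro s
    by_cases hs : s ∈ Ioc u v
    · rw [hpp, piecewise_eq_of_mem _ _ _ hs]; exact ⟨_, hpC s hs, rfl⟩
    · rw [hpp, piecewise_eq_of_notMem _ _ _ hs]; exact ⟨_, hpC v hv, rfl⟩
  have cal1 := pl_caloric gΩ2_open gamma2_smooth gamma2_caloric h2 mpm cpm hl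
  have cal2 := pl_caloric gΩ2_open gamma2_smooth gamma2_caloric h1 mpp cpp hl
  have hO := srcU_open a hC
  have sub1 : srcU a C ⊆ _ := (srcU_eq a C).subset.trans inter_subset_left
  have sub2 : srcU a C ⊆ _ := (srcU_eq a C).subset.trans inter_subset_right
  have key : ∀ z : ℝ², ∀ s ∈ Ioc u v, Gk a z.1 (p s) (z.2 - s) * lam s = lam s * heatGamma z.1 (pm s).1 (z.2 - (pm s).2) - lam s * heatGamma z.1 (pp s).1 (z.2 - (pp s).2) := by
    intro z s hs
    rw [hpm, hpp, piecewise_eq_of_mem _ _ _ hs, piecewise_eq_of_mem _ _ _ hs]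
    unfold Gk; ring
  have i1 : ∀ z ∈ srcU a C, Integrable (fun s => lam s * heatGamma z.1 (pm s).1 (z.2 - (pm s).2)) (volume.restrict (Ioc u v)) := fun z hz =>
    (pl_hasFDerivAt gΩ2_open gamma2_smooth h2 mpm cpm hl (sub1 hz)).2.1
  have i2 : ∀ z ∈ srcU a C, Integrable (fun s => lam s * heatGamma z.1 (pp s).1 (z.2 - (pp s).2)) (volume.restrict (Ioc u v)) := fun z hz =>
    (pl_hasFDerivAt gΩ2_open gamma2_smooth h1 mpp cpp hl (sub2 hz)).2.1
  constructor
  · refine ((cal1.mono sub1).sub hO (cal2.mono sub2)).congr hO ?_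
    intro z hz
    rw [← integral_sub (i1 z hz) (i2 z hz), intervalIntegral.integral_of_le huv]
    exact setIntegral_congr_fun measurableSet_Ioc (key z)
  · intro z hz
    rw [intervalIntegrable_iff_integrableOn_Ioc_of_le huv]
    exact IntegrableOn.congr_fun ((i1 z hz).sub (i2 z hz)) (fun s hs => (key z s hs).symm) measurableSet_Ioc

/-- Time derivative of the primitive of a caloric function. -/
lemma caloric_primitive {f : ℝ² → ℝ} {U : Set ℝ²} (hU : IsOpen U) (hf : Caloric f U) {x0 x t : ℝ}
    (hx : ∀ z ∈ uIcc x0 x, (z, t) ∈ U) :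
    HasDerivAt (fun t => ∫ z in x0..x, f (z, t)) (dX f (x, t) - dX f (x0, t)) t := by
  have hK : IsCompact ((uIcc x0 x) ×ˢ ({t} : Set ℝ)) := isCompact_uIcc.prod isCompact_singleton
  obtain ⟨u, v, hu, hv, hu2, hv2, huv⟩ := generalized_tube_lemma isCompact_uIcc (isCompact_singleton (x := t)) hU (s := uIcc x0 x) (by rintro ⟨z, s⟩ ⟨h1, h2⟩; rw [mem_singleton_iff] at h2; simp only at h2 h1; rw [h2]; exact hx z h1)
  obtain ⟨r, hr, hball⟩ := Metric.isOpen_iff.1 hv t (hv2 rfl)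
  have hI : ∀ z ∈ uIcc x0 x, ∀ s ∈ Metric.closedBall t (r/2), (z, s) ∈ U := fun z hz s hs =>
    huv ⟨hu2 hz, hball (Metric.closedBall_subset_ball (by linarith) hs)⟩
  have hcont : ContinuousOn (dT f) (uIcc x0 x ×ˢ Metric.closedBall t (r/2)) := (hf.smooth.dT hU).continuousOn.mono (fun z hz => hI z.1 hz.1 z.2 hz.2)
  obtain ⟨M, hM⟩ := (isCompact_uIcc.prod (isCompact_closedBall t (r/2))).exists_bound_of_continuousOn hcont
  have hfc : ∀ s ∈ Metric.closedBall t (r/2), ContinuousOn (fun z => f (z, s)) (uIcc x0 x) := fun s hs =>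
    hf.smooth.continuousOn.comp (by fun_prop) (fun z hz => hI z hz s hs)
  have hr2 : Metric.closedBall t (r/2) ∈ 𝓝 t := Metric.closedBall_mem_nhds t (by linarith)
  have htm : t ∈ Metric.closedBall t (r/2) := mem_of_mem_nhds hr2
  have hdc : ContinuousOn (fun z => dT f (z, t)) (uIcc x0 x) := hcont.comp (by fun_prop) (fun z hz => ⟨hz, htm⟩)
  have main := intervalIntegral.hasDerivAt_integral_of_dominated_loc_of_deriv_le (μ := volume) (a := x0) (b := x) (F := fun s z => f (z, s)) (F' := fun s z => dT f (z, s)) (x₀ := t)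
    (s := Metric.closedBall t (r/2)) (bound := fun _ => M) hr2
    (by filter_upwards [hr2] with s hs using ((hfc s hs).mono uIoc_subset_uIcc).aestronglyMeasurable measurableSet_uIoc)
    ((hfc t htm).intervalIntegrable) ((hdc.mono uIoc_subset_uIcc).aestronglyMeasurable measurableSet_uIoc)
    (Eventually.of_forall fun z hz s hs => hM (z, s) ⟨uIoc_subset_uIcc hz, hs⟩) intervalIntegrable_const
    (Eventually.of_forall fun z hz s hs => hf.smooth.hasDerivT hU (hI z (uIoc_subset_uIcc hz) s hs))
  refine main.2.congr_deriv ?_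
  rw [← intervalIntegral.integral_eq_sub_of_hasDerivAt (f := fun z => dX f (z, t)) (f' := fun z => dT f (z, t)) (fun z hz => ?_) hdc.intervalIntegrable]
  rw [hf.heat _ (hx z hz)]
  exact (hf.smooth.dX hU).hasDerivX hU (hx z hz)

/-- Leibniz remainder -/
lemma leib_rem {H : ℝ → ℝ → ℝ → ℝ} {x0 x t0 : ℝ} (hx : x0 ≤ x) (U : Set (ℝ × ℝ × ℝ)) (hU : IsOpen U)
    (hH : ContinuousOn (fun w : ℝ × ℝ × ℝ => H w.1 w.2.1 w.2.2) U) (hz : ∀ z ∈ Icc x0 x, (z, t0, t0) ∈ U) :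
    HasDerivAt (fun t => ∫ z in x0..x, ∫ s in t0..t, H z t s) (∫ z in x0..x, H z t0 t0) t0 := by
  obtain ⟨u, v, hu, hv, hu2, hv2, huv⟩ := generalized_tube_lemma (isCompact_Icc (a := x0) (b := x)) (isCompact_singleton (x := (t0, t0))) hU (by
    rintro ⟨z, s⟩ ⟨h1, h2⟩; rw [mem_singleton_iff] at h2; simp only at h2 h1; rw [h2]; exact hz z h1)
  obtain ⟨r, hr, hball⟩ := Metric.isOpen_iff.1 hv (t0, t0) (hv2 rfl)
  have hI : ∀ z ∈ Icc x0 x, ∀ t ∈ Icc (t0 - r/2) (t0 + r/2), ∀ s ∈ Icc (t0 - r/2) (t0 + r/2), (z, t, s) ∈ U := by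
    intro z hz t ht s hs
    refine huv ⟨hu2 hz, hball ?_⟩
    rw [Metric.mem_ball, Prod.dist_eq, max_lt_iff, Real.dist_eq, Real.dist_eq, abs_lt, abs_lt]
    simp only
    refine ⟨⟨?_, ?_⟩, ⟨?_, ?_⟩⟩ <;> linarith [ht.1, ht.2, hs.1, hs.2]
  have hKc : IsCompact (Icc x0 x ×ˢ (Icc (t0 - r/2) (t0 + r/2) ×ˢ Icc (t0 - r/2) (t0 + r/2))) := isCompact_Icc.prod (isCompact_Icc.prod isCompact_Icc)
  have hcK : ContinuousOn (fun w : ℝ × ℝ × ℝ => H w.1 w.2.1 w.2.2) (Icc x0 x ×ˢ (Icc (t0 - r/2) (t0 + r/2) ×ˢ Icc (t0 - r/2) (t0 + r/2))) :=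
    hH.mono (fun w hw => hI w.1 hw.1 _ hw.2.1 _ hw.2.2)
  have huc := hKc.uniformContinuousOn_of_continuous hcK
  rw [Metric.uniformContinuousOn_iff] at huc
  have ht0 : t0 ∈ Icc (t0 - r/2) (t0 + r/2) := ⟨by linarith, by linarith⟩
  rw [hasDerivAt_iff_isLittleO, Asymptotics.isLittleO_iff]
  intro c hc
  obtain ⟨η, hη, hη2⟩ := huc (c / (x - x0 + 1)) (by have : 0 < x - x0 + 1 := by linarith
                                                    positivity)
  have hev : ∀ᶠ t in 𝓝 t0, |t - t0| < min η (r/2) := by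
    have : Metric.ball t0 (min η (r/2)) ∈ 𝓝 t0 := Metric.ball_mem_nhds _ (by positivity)
    filter_upwards [this] with t ht
    rwa [Metric.mem_ball, Real.dist_eq] at ht
  filter_upwards [hev] with t ht
  have ht1 := ht.trans_le (min_le_left _ _)
  have ht2 := ht.trans_le (min_le_right _ _)
  rw [abs_lt] at ht2
  have htm : t ∈ Icc (t0 - r/2) (t0 + r/2) := ⟨by linarith, by linarith⟩
  have hsm : ∀ s ∈ uIcc t0 t, s ∈ Icc (t0 - r/2) (t0 + r/2) := fun s hs => (uIcc_subset_Icc ht0 htm) hs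
  have cz : ContinuousOn (fun z => H z t0 t0) (Icc x0 x) := hH.comp (f := fun z => (z, t0, t0)) (by fun_prop) (fun z hz => hI z hz _ ht0 _ ht0)
  have cs : ∀ z ∈ Icc x0 x, ContinuousOn (fun s => H z t s) (uIcc t0 t) := fun z hz => hH.comp (f := fun s => (z, t, s)) (by fun_prop) (fun s hs => hI z hz _ htm _ (hsm s hs))
  have i1 : IntervalIntegrable (fun z => ∫ s in t0..t, H z t s) volume x0 x := by
    rw [intervalIntegrable_iff_integrableOn_Ioc_of_le hx]
    have c2 : ContinuousOn (fun w : ℝ² => H w.1 t w.2) (Icc x0 x ×ˢ uIcc t0 t) := hH.comp (f := fun w : ℝ² => (w.1, t, w.2)) (by fun_prop) (fun w hw => hI _ hw.1 _ htm _ (hsm _ hw.2))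
    have j1 := (c2.integrableOn_compact (μ := volume) (isCompact_Icc.prod isCompact_uIcc)).mono_set (prod_mono (Ioc_subset_Icc_self) (uIoc_subset_uIcc))
    rw [IntegrableOn, Measure.volume_eq_prod, ← Measure.prod_restrict] at j1
    have j2 := j1.integral_prod_left
    simp only [intervalIntegral.intervalIntegral_eq_integral_uIoc]
    exact j2.smul (if t0 ≤ t then (1:ℝ) else -1)
  have i2 : IntervalIntegrable (fun z => (t - t0) * H z t0 t0) volume x0 x := by
    refine ContinuousOn.intervalIntegrable ?_
    rw [uIcc_of_le hx]
    exact continuousOn_const.mul cz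
  have e : (∫ z in x0..x, ∫ s in t0..t, H z t s) - (∫ z in x0..x, ∫ s in t0..t0, H z t0 s) - (t - t0) • (∫ z in x0..x, H z t0 t0)
      = ∫ z in x0..x, ((∫ s in t0..t, H z t s) - (t - t0) * H z t0 t0) := by
    rw [intervalIntegral.integral_sub i1 i2, intervalIntegral.integral_const_mul]; simp
  rw [e]
  have hx1 : 0 < x - x0 + 1 := by linarith
  have b1 : ∀ z ∈ uIoc x0 x, ‖(∫ s in t0..t, H z t s) - (t - t0) * H z t0 t0‖ ≤ (c / (x - x0 + 1)) * |t - t0| := by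
    intro z hz
    rw [uIoc_of_le hx] at hz
    have hz := Ioc_subset_Icc_self hz
    have : (∫ s in t0..t, H z t s) - (t - t0) * H z t0 t0 = ∫ s in t0..t, (H z t s - H z t0 t0) := by
      rw [intervalIntegral.integral_sub (cs z hz).intervalIntegrable intervalIntegrable_const]; simp
    rw [this]
    refine intervalIntegral.norm_integral_le_of_norm_le_const (fun s hs => ?_)
    have hs := uIoc_subset_uIcc hs
    refine le_of_lt ?_
    refine hη2 (z, t, s) ⟨hz, htm, hsm s hs⟩ (z, t0, t0) ⟨hz, ht0, ht0⟩ ?_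
    rw [Prod.dist_eq, Prod.dist_eq]
    simp only [dist_self, Real.dist_eq]
    refine max_lt hη (max_lt ht1 ?_)
    refine lt_of_le_of_lt ?_ ht1
    exact Set.abs_sub_left_of_mem_uIcc hs
  refine (intervalIntegral.norm_integral_le_of_norm_le_const b1).trans ?_
  rw [abs_of_nonneg (by linarith : 0 ≤ x - x0), Real.norm_eq_abs, div_mul_eq_mul_div, div_mul_eq_mul_div, div_le_iff₀ hx1]
  have : 0 ≤ c * |t - t0| := by positivity
  nlinarith

end P8

section P9

structure Dat (a : ℝ) (φ φ' : ℝ → ℝ) (pI : ℝ) : Prop where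
  ha : 0 < a
  ha1 : a < 1
  ev : Ev φ
  hd : ∀ x, HasDerivAt φ (φ' x) x
  lip : ∃ L, ∀ x y, |φ' x - φ' y| ≤ L * |x - y|
  hpI : pI ∈ Ioo (-1:ℝ) 1
  z : φ pI = 0
  pos : ∀ x ∈ Ico (-1:ℝ) pI, 0 < φ x
  neg : ∀ x ∈ Ioc pI 1, φ x < 0
  sl : φ' pI < 0

variable {a : ℝ} {φ φ' p lam : ℝ → ℝ} {pI : ℝ}

lemma Dat.c (D : Dat a φ φ' pI) : Continuous φ := continuous_iff_continuousAt.2 fun x => (D.hd x).continuousAt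

lemma Dat.bd (D : Dat a φ φ' pI) : ∃ B > 0, ∀ y, |φ y| ≤ B := by
  obtain ⟨C, hC⟩ := (isCompact_Icc (a := (-1:ℝ)) (b := 1)).exists_bound_of_continuousOn D.c.continuousOn
  refine ⟨max C 1, by positivity, D.ev.bound fun y hy => ?_⟩
  exact (hC y (abs_le.1 hy)).trans (le_max_left _ _)

lemma ev_deriv_zero {f : ℝ → ℝ} {d c : ℝ} (h : HasDerivAt f d c) (he : ∀ x, f (2 * c - x) = f x) : d = 0 := by
  have h1 : HasDerivAt (fun x => f (2 * c - x)) (d * (-1)) c := by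
    have h2 : HasDerivAt (fun x : ℝ => 2 * c - x) (-1) c := by simpa using (hasDerivAt_id c).const_sub (2*c)
    exact HasDerivAt.comp c (by rw [show 2 * c - c = c by ring]; exact h) h2
  have h3 : (fun x => f (2 * c - x)) = f := funext he
  rw [h3] at h1
  have := h.unique h1
  linarith

noncomputable def Fd (a : ℝ) (φ p lam : ℝ → ℝ) (δ x t : ℝ) : ℝ := util φ x (t + δ) + ∫ s in (0:ℝ)..t, Gk a x (p s) (t + δ - s) * lam s

noncomputable def Wd (a : ℝ) (φ p lam : ℝ → ℝ) (δ x t : ℝ) : ℝ := ∫ z in (-1:ℝ)..x, Fd a φ p lam δ z t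
noncomputable def WW (a : ℝ) (φ p lam : ℝ → ℝ) (x t : ℝ) : ℝ := ∫ z in (-1:ℝ)..x, FF a φ p lam z t

/-- `Fd` with frozen upper limit. -/
noncomputable def Ph (a : ℝ) (φ p lam : ℝ → ℝ) (δ t' x t : ℝ) : ℝ := util φ x (t + δ) + ∫ s in (0:ℝ)..t', Gk a x (p s) (t + δ - s) * lam s

lemma strip_open (c : ℝ) : IsOpen {z : ℝ² | |z.1| < 2 ∧ c < z.2} := by
  have h1 : IsOpen {z : ℝ² | |z.1| < 2} := isOpen_lt (by fun_prop) (by fun_prop)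
  have h2 : IsOpen {z : ℝ² | c < z.2} := isOpen_lt (by fun_prop) (by fun_prop)
  exact h1.inter h2

lemma graph_compact {p : ℝ → ℝ} {u v : ℝ} (hp : ContinuousOn p (Icc u v)) : IsCompact ((fun s => (p s, s)) '' Icc u v) :=
  isCompact_Icc.image_of_continuousOn (hp.prodMk continuousOn_id)

lemma Ph_caloric (D : Dat a φ φ' pI) (h : Crv p lam) {δ t' : ℝ} (ht' : 0 ≤ t') :
    Caloric (fun z : ℝ² => Ph a φ p lam δ t' z.1 z.2) {z | |z.1| < 2 ∧ t' - δ < z.2} := by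
  obtain ⟨B, hB, hB2⟩ := D.bd
  have hO := strip_open (t' - δ)
  have h1 := (util_caloric D.ev D.c hB2).affine (by exact strip_open 0) 1 0 δ (by norm_num)
  simp only [one_mul, add_zero] at h1
  have hC := graph_compact (h.cp.continuousOn (s := Icc 0 t'))
  have h2 := (src_caloric (a := a) (lam := lam) hC ht' h.cp.measurable (fun s hs => ⟨s, Ioc_subset_Icc_self hs, rfl⟩) (h.cl.integrableOn_Ioc)).1.affine (srcU_open a hC) 1 0 δ (by norm_num)
  simp only [one_mul, add_zero] at h2
  refine (h1.mono ?_).add hO (h2.mono ?_)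
  · rintro z ⟨hz1, hz2⟩; exact ⟨hz1, by show 0 < z.2 + δ; linarith⟩
  · rintro z ⟨hz1, hz2⟩ w ⟨s, hs, rfl⟩
    have hne : z.2 + δ - s ≠ 0 := by have := hs.2; have : 0 < z.2 + δ - s := by linarith
                                     exact this.ne'
    exact ⟨mem_gΩ_of_time hz1 (by linarith [ym_abs D.ha (h.memI s)]) hne, mem_gΩ_of_time hz1 (by linarith [yp_abs D.ha (h.memI s)]) hne⟩

lemma Gk_refl_left (a x q t : ℝ) : Gk a (-2 - x) q t = Gk a x q t := by
  unfold Gk; rw [heatGamma_refl_left, heatGamma_refl_left]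

lemma Ph_refl (D : Dat a φ φ' pI) (δ t' x t : ℝ) : Ph a φ p lam δ t' (-2 - x) t = Ph a φ p lam δ t' x t := by
  unfold Ph
  rw [show util φ (-2 - x) (t + δ) = util φ x (t + δ) from (util_ev D.ev (t + δ)).2 x]
  simp only [Gk_refl_left]

lemma clamp_abs (x : ℝ) : |clamp x| ≤ 1 := abs_le.2 (clamp_mem x)

/-- global continuity of the frozen-kernel source with clamped arguments -/
lemma Fd_cont (D : Dat a φ φ' pI) (h : Crv p lam) {δ : ℝ} (hδ : 0 < δ) : Continuous (fun z : ℝ² => Fd a φ p lam δ (clamp z.1) (max z.2 0)) := by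
  obtain ⟨B, hB, hB2⟩ := D.bd
  have hcl := clamp_cont
  have hu := util_continuous D.c hB2
  have h1 : Continuous (fun z : ℝ² => util φ (clamp z.1) (max z.2 0 + δ)) :=
    hu.comp (g := fun z : ℝ² => util φ z.1 z.2) (f := fun z : ℝ² => (clamp z.1, max z.2 0 + δ)) (by fun_prop)
  refine h1.add ?_
  have e : ∀ z : ℝ², ∫ s in (0:ℝ)..(max z.2 0), Gk a (clamp z.1) (p s) (max z.2 0 + δ - s) * lam s =
      ∫ s in (0:ℝ)..(max z.2 0), Gk a (clamp z.1) (p s) (max (max z.2 0 - s) 0 + δ) * lam s := by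
    intro z
    refine intervalIntegral.integral_congr (fun s hs => ?_)
    rw [uIcc_of_le (le_max_right _ _)] at hs
    show Gk _ _ _ _ * _ = Gk _ _ _ _ * _
    rw [max_eq_left (a := max z.2 0 - s) (by linarith [hs.2])]; congr 2; ring
  simp only [e]
  refine intervalIntegral.continuous_parametric_intervalIntegral_of_continuous (f := fun (z : ℝ²) s => Gk a (clamp z.1) (p s) (max (max z.2 0 - s) 0 + δ) * lam s) ?_ (by fun_prop)
  have hp := h.cp
  have hl := h.cl
  rw [continuous_iff_continuousAt]
  rintro ⟨z, s⟩
  refine ContinuousAt.mul ?_ (by apply Continuous.continuousAt; fun_prop)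
  refine ContinuousAt.comp (f := fun w : ℝ² × ℝ => (clamp w.1.1, p w.2, max (max w.1.2 0 - w.2) 0 + δ)) (Gk_contAt_time D.ha (by show |clamp z.1| < 2; linarith [clamp_abs z.1]) (h.memI _) ?_) ?_
  · have : 0 ≤ max (max z.2 0 - s) 0 := le_max_right _ _
    show max (max z.2 0 - s) 0 + δ ≠ 0
    positivity
  · apply Continuous.continuousAt; fun_prop

lemma FF_cont (D : Dat a φ φ' pI) (h : Crv p lam) : Continuous (fun z : ℝ² => FF a φ p lam (clamp z.1) z.2) := by
  obtain ⟨B, hB, hB2⟩ := D.bd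
  have hcl := clamp_cont
  refine ((util_continuous D.c hB2).comp (g := fun z : ℝ² => util φ z.1 z.2) (f := fun z : ℝ² => (clamp z.1, z.2)) (by fun_prop)).add ?_
  exact (SS_cont D.ha h).comp_continuous (f := fun z : ℝ² => (clamp z.1, z.2)) (by fun_prop) (fun z => clamp_abs z.1)

lemma prim_clamp (f : ℝ → ℝ) {x : ℝ} (hx : |x| ≤ 1) : ∫ z in (-1:ℝ)..x, f (clamp z) = ∫ z in (-1:ℝ)..x, f z := by
  rw [abs_le] at hx
  refine intervalIntegral.integral_congr (fun z hz => ?_)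
  rw [uIcc_of_le hx.1] at hz
  show f (clamp z) = f z
  rw [clamp_eq ⟨hz.1, hz.2.trans hx.2⟩]

lemma prim_cont {f : ℝ → ℝ → ℝ} (hf : Continuous (fun z : ℝ² => f (clamp z.1) z.2)) : ContinuousOn (fun z : ℝ² => ∫ y in (-1:ℝ)..z.1, f y z.2) {z | |z.1| ≤ 1} := by
  have : Continuous (fun z : ℝ² => ∫ y in (-1:ℝ)..z.1, f (clamp y) z.2) :=
    intervalIntegral.continuous_parametric_intervalIntegral_of_continuous (f := fun (z : ℝ²) y => f (clamp y) z.2) (hf.comp (by fun_prop : Continuous fun w : ℝ² × ℝ => (w.2, w.1.2))) continuous_fst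
  exact this.continuousOn.congr fun z hz => (prim_clamp (fun y => f y z.2) hz).symm

lemma WW_cont (D : Dat a φ φ' pI) (h : Crv p lam) : ContinuousOn (fun z : ℝ² => WW a φ p lam z.1 z.2) {z | |z.1| ≤ 1} := prim_cont (FF_cont D h)

lemma Wd_cont (D : Dat a φ φ' pI) (h : Crv p lam) {δ : ℝ} (hδ : 0 < δ) : ContinuousOn (fun z : ℝ² => Wd a φ p lam δ z.1 z.2) {z | |z.1| ≤ 1 ∧ 0 ≤ z.2} := by
  have := (prim_cont (f := fun y t => Fd a φ p lam δ y (max t 0)) (Fd_cont D h hδ)).mono (fun (z : ℝ²) (hz : z ∈ {z : ℝ² | |z.1| ≤ 1 ∧ 0 ≤ z.2}) => hz.1)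
  refine this.congr fun z hz => ?_
  show Wd _ _ _ _ _ _ _ = ∫ y in (-1:ℝ)..z.1, Fd a φ p lam δ y (max z.2 0)
  rw [max_eq_left hz.2]; rfl

lemma Gk_slice_int (D : Dat a φ φ' pI) (h : Crv p lam) {z c u v : ℝ} (hz : |z| < 2) (hs : ∀ s ∈ uIcc u v, c - s ≠ 0) :
    IntervalIntegrable (fun s => Gk a z (p s) (c - s) * lam s) volume u v := by
  apply ContinuousOn.intervalIntegrable
  intro s hs'
  refine ContinuousAt.continuousWithinAt (ContinuousAt.mul ?_ h.cl.continuousAt)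
  refine ContinuousAt.comp (f := fun s : ℝ => (z, p s, c - s)) (Gk_contAt_time D.ha hz (h.memI _) (hs s hs')) ?_
  have := h.cp
  apply Continuous.continuousAt; fun_prop

lemma Ph_slice (D : Dat a φ φ' pI) (h : Crv p lam) {δ t' t : ℝ} (ht' : 0 ≤ t') (ht : t' - δ < t) :
    ContinuousOn (fun z => Ph a φ p lam δ t' z t) {z | |z| < 2} :=
  (Ph_caloric D h ht').smooth.continuousOn.comp (f := fun z : ℝ => (z, t)) (by fun_prop) (fun z hz => ⟨hz, ht⟩)

lemma Fd_slice (D : Dat a φ φ' pI) (h : Crv p lam) {δ t : ℝ} (hδ : 0 < δ) (ht : 0 ≤ t) :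
    ContinuousOn (fun z => Fd a φ p lam δ z t) {z | |z| < 2} := Ph_slice D h ht (by linarith)

lemma abs_lt2_open : IsOpen {z : ℝ | |z| < 2} := isOpen_lt (by fun_prop) (by fun_prop)

lemma uIcc_lt2 {x y : ℝ} (hx : |x| < 2) (hy : |y| < 2) : uIcc x y ⊆ {z : ℝ | |z| < 2} := by
  have : OrdConnected {z : ℝ | |z| < 2} := by
    have : {z : ℝ | |z| < 2} = Ioo (-2) 2 := by ext z; simp [abs_lt]
    rw [this]; exact ordConnected_Ioo
  exact this.uIcc_subset hx hy

lemma prim_deriv {f : ℝ → ℝ} (hf : ContinuousOn f {z | |z| < 2}) {y : ℝ} (hy : |y| < 2) : HasDerivAt (fun y => ∫ z in (-1:ℝ)..y, f z) (f y) y := by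
  refine intervalIntegral.integral_hasDerivAt_right (hf.mono (uIcc_lt2 (by norm_num) hy)).intervalIntegrable ?_ (hf.continuousAt (abs_lt2_open.mem_nhds hy))
  exact hf.stronglyMeasurableAtFilter abs_lt2_open _ hy

lemma Wd_pde (D : Dat a φ φ' pI) (h : Crv p lam) {δ x t : ℝ} (hδ : 0 < δ) (hx : |x| ≤ 1) (ht : 0 < t) :
    ∃ B, HasDerivAt (fun t => Wd a φ p lam δ x t) (B + lam t * ∫ z in (-1:ℝ)..x, Gk a z (p t) δ) t ∧
      (∀ᶠ y in 𝓝 x, HasDerivAt (fun y => Wd a φ p lam δ y t) (Fd a φ p lam δ y t) y) ∧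
      HasDerivAt (fun y => Fd a φ p lam δ y t) B x := by
  have hP := Ph_caloric D h (δ := δ) ht.le
  have hO := strip_open (t - δ)
  have hx2 : |x| < 2 := by linarith
  refine ⟨dX (fun z : ℝ² => Ph a φ p lam δ t z.1 z.2) (x, t), ?_, ?_, ?_⟩
  · have h1 := caloric_primitive hO hP (x0 := -1) (x := x) (t := t) (fun z hz => (⟨uIcc_lt2 (by norm_num) hx2 hz, by show t - δ < t; linarith⟩ : _ ∧ _))
    have h0 : dX (fun z : ℝ² => Ph a φ p lam δ t z.1 z.2) (-1, t) = 0 := by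
      refine ev_deriv_zero (f := fun y => Ph a φ p lam δ t y t) (c := -1) (hP.smooth.hasDerivX hO (⟨by norm_num, by show t - δ < t; linarith⟩ : _ ∧ _)) (fun y => ?_)
      rw [show (2:ℝ) * (-1) - y = -2 - y by ring]; exact Ph_refl D _ _ _ _
    have hU : IsOpen {w : ℝ × ℝ × ℝ | |w.1| < 2 ∧ 0 < w.2.1 + δ - w.2.2} := by
      have h1 : IsOpen {w : ℝ × ℝ × ℝ | |w.1| < 2} := isOpen_lt (by fun_prop) (by fun_prop)
      have h2 : IsOpen {w : ℝ × ℝ × ℝ | 0 < w.2.1 + δ - w.2.2} := isOpen_lt (by fun_prop) (by fun_prop)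
      exact h1.inter h2
    have h2 := leib_rem (H := fun z t s => Gk a z (p s) (t + δ - s) * lam s) (abs_le.1 hx).1 _ hU (t0 := t) (by
      rintro w ⟨hw1, hw2⟩
      refine ContinuousAt.continuousWithinAt (ContinuousAt.mul ?_ (h.cl.comp (by fun_prop)).continuousAt)
      have := h.cp
      refine ContinuousAt.comp (f := fun w : ℝ × ℝ × ℝ => (w.1, p w.2.2, w.2.1 + δ - w.2.2)) (Gk_contAt_time D.ha hw1 (h.memI _) hw2.ne') ?_
      apply Continuous.continuousAt; fun_prop) (fun z hz => (⟨by rw [abs_le] at hx; exact abs_lt.2 ⟨by linarith [hz.1], by linarith [hz.2]⟩, by show 0 < t + δ - t; linarith⟩ : _ ∧ _))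
    have h3 := h1.add h2
    rw [h0] at h3
    refine (h3.congr_of_eventuallyEq ?_).congr_deriv ?_
    · filter_upwards [Ioi_mem_nhds ht, Ioi_mem_nhds (show t - δ/2 < t by linarith), Iio_mem_nhds (show t < t + δ/2 by linarith)] with τ h1 h2 h3
      simp only [mem_Ioi, mem_Iio] at h1 h2 h3
      show Wd a φ p lam δ x τ = (∫ z in (-1:ℝ)..x, Ph a φ p lam δ t z τ) + _
      unfold Wd
      have i1 : IntervalIntegrable (fun z => Fd a φ p lam δ z τ) volume (-1) x := ((Fd_slice D h hδ h1.le).mono (uIcc_lt2 (by norm_num) hx2)).intervalIntegrable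
      have i2 : IntervalIntegrable (fun z => Ph a φ p lam δ t z τ) volume (-1) x := ((Ph_slice D h ht.le (by linarith)).mono (uIcc_lt2 (by norm_num) hx2)).intervalIntegrable
      rw [← sub_eq_iff_eq_add', ← intervalIntegral.integral_sub i1 i2]
      refine intervalIntegral.integral_congr (fun z hz => ?_)
      have hz2 : |z| < 2 := uIcc_lt2 (by norm_num) hx2 hz
      show Fd a φ p lam δ z τ - Ph a φ p lam δ t z τ = ∫ s in t..τ, Gk a z (p s) (τ + δ - s) * lam s
      unfold Fd Ph
      rw [← intervalIntegral.integral_add_adjacent_intervals (a := 0) (b := t) (c := τ) (Gk_slice_int D h hz2 ?_) (Gk_slice_int D h hz2 ?_)]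
      · ring
      · intro s hs; rw [uIcc_of_le ht.le] at hs; have := hs.2; exact (by linarith : 0 < τ + δ - s).ne'
      · intro s hs
        have : s ≤ max t τ := hs.2
        rcases max_cases t τ with h | h <;> exact (by linarith : 0 < τ + δ - s).ne'
    · rw [sub_zero, ← intervalIntegral.integral_const_mul]
      congr 1
      refine intervalIntegral.integral_congr (fun z hz => ?_)
      show Gk a z (p t) (t + δ - t) * lam t = lam t * Gk a z (p t) δ
      rw [add_sub_cancel_left, mul_comm]
  · filter_upwards [abs_lt2_open.mem_nhds hx2] with y hy
    exact prim_deriv (Fd_slice D h hδ ht.le) hy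
  · exact hP.smooth.hasDerivX hO (⟨hx2, by show t - δ < t; linarith⟩ : _ ∧ _)

end P9

section P10
variable {a : ℝ} {φ φ' p lam : ℝ → ℝ} {pI : ℝ}

lemma small_lt {c : ℝ} (hc : 0 < c) : ∀ᶠ δ in 𝓝[>] (0:ℝ), δ < c := mem_nhdsWithin_of_mem_nhds (Iio_mem_nhds hc)
lemma small_one : ∀ᶠ δ in 𝓝[>] (0:ℝ), δ < 1 := small_lt one_pos

lemma Fd_FF (D : Dat a φ φ' pI) (h : Crv p lam) (T : ℝ) {ε : ℝ} (hε : 0 < ε) :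
    ∀ᶠ δ in 𝓝[>] (0:ℝ), ∀ x t, |x| ≤ 1 → 0 ≤ t → t ≤ T → |Fd a φ p lam δ x t - FF a φ p lam x t| ≤ ε := by
  obtain ⟨C, hC, hG⟩ := Gk_bound a D.ha 1
  obtain ⟨Λ, hΛ, hlam⟩ := lam_bdd h.cl 0 (T + 1)
  have e1 : ∀ᶠ δ in 𝓝 (0:ℝ), C * Λ * (2 * √δ) < ε / 2 := by
    have : Continuous (fun δ : ℝ => C * Λ * (2 * √δ)) := by fun_prop
    exact (this.tendsto 0).eventually (Iio_mem_nhds (by simp; exact hε))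
  have e2 : ∀ᶠ δ in 𝓝 (0:ℝ), ∀ w ∈ 𝕁 ×ˢ Icc 0 T, |FF a φ p lam (clamp w.1) (w.2 + δ) - FF a φ p lam (clamp w.1) w.2| < ε / 2 := by
    refine IsCompact.eventually_forall_of_forall_eventually (isCompact_Icc.prod isCompact_Icc) (P := fun δ (w : ℝ²) => |FF a φ p lam (clamp w.1) (w.2 + δ) - FF a φ p lam (clamp w.1) w.2| < ε / 2) (fun w hw => ?_)
    have hF := FF_cont D h
    have c1 : Continuous (fun z : ℝ × ℝ² => |FF a φ p lam (clamp z.2.1) (z.2.2 + z.1) - FF a φ p lam (clamp z.2.1) z.2.2|) := by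
      refine ((hF.comp (f := fun z : ℝ × ℝ² => (z.2.1, z.2.2 + z.1)) (by fun_prop)).sub (hF.comp (f := fun z : ℝ × ℝ² => (z.2.1, z.2.2)) (by fun_prop))).abs
    exact (c1.tendsto ((0:ℝ), w)).eventually (Iio_mem_nhds (by simp; exact hε))
  filter_upwards [e1.filter_mono nhdsWithin_le_nhds, e2.filter_mono nhdsWithin_le_nhds, self_mem_nhdsWithin, small_one] with δ h1 h2 h3 h4 x t hx ht htT
  have hδ : 0 < δ := h3
  have hδ1 : δ < 1 := h4
  have b1 := h2 (x, t) ⟨abs_le.1 hx, ht, htT⟩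
  simp only [clamp_eq (abs_le.1 hx)] at b1
  have b2 := (Gk_tail_bound D.ha h (t := t + δ) (Λ := Λ) hx hδ.le (fun x q t h1 h2 h3 h4 => hG x q t h1 h2 h3 (by linarith)) (fun s hs => hlam s ⟨by linarith [hs.1], by linarith [hs.2]⟩) hC.le).2
  rw [add_sub_cancel_right] at b2
  have e : Fd a φ p lam δ x t = FF a φ p lam x (t + δ) - ∫ s in t..(t+δ), Gk a x (p s) (t + δ - s) * lam s := by
    unfold Fd FF SS
    rw [← intervalIntegral.integral_add_adjacent_intervals (SS_integrable D.ha h hx (by linarith : 0 ≤ t + δ) 0 t le_rfl ht (by linarith)) (SS_integrable D.ha h hx (by linarith : 0 ≤ t + δ) t (t + δ) ht (by linarith) le_rfl)]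
    ring
  rw [e]
  rw [abs_le] at b2 ⊢
  rw [abs_lt] at b1
  constructor <;> linarith [b1.1, b1.2, b2.1, b2.2]

lemma FF_slice (D : Dat a φ φ' pI) (h : Crv p lam) (t : ℝ) : ContinuousOn (fun x => FF a φ p lam x t) (Icc (-1) 1) := by
  refine ((FF_cont D h).comp (f := fun x : ℝ => (x, t)) (by fun_prop)).continuousOn.congr fun x hx => ?_
  show _ = FF a φ p lam (clamp x) t
  rw [clamp_eq hx]

lemma uIcc_I {x y : ℝ} (hx : x ∈ 𝕁) (hy : y ∈ 𝕁) : uIcc x y ⊆ 𝕁 := ordConnected_Icc.uIcc_subset hx hy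

lemma FF_ii (D : Dat a φ φ' pI) (h : Crv p lam) (t : ℝ) {x y : ℝ} (hx : x ∈ 𝕁) (hy : y ∈ 𝕁) : IntervalIntegrable (fun x => FF a φ p lam x t) volume x y :=
  ((FF_slice D h t).mono (uIcc_I hx hy)).intervalIntegrable

lemma Wd_WW (D : Dat a φ φ' pI) (h : Crv p lam) (T : ℝ) {ε : ℝ} (hε : 0 < ε) :
    ∀ᶠ δ in 𝓝[>] (0:ℝ), ∀ x t, |x| ≤ 1 → 0 ≤ t → t ≤ T → |Wd a φ p lam δ x t - WW a φ p lam x t| ≤ ε := by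
  filter_upwards [Fd_FF D h T (half_pos hε), self_mem_nhdsWithin] with δ h1 h3 x t hx ht htT
  have hδ : 0 < δ := h3
  unfold Wd WW
  have m1 : (-1:ℝ) ∈ 𝕁 := by constructor <;> norm_num
  rw [← intervalIntegral.integral_sub ((Fd_slice D h hδ ht).mono (uIcc_lt2 (by norm_num) (by linarith))).intervalIntegrable (FF_ii D h t m1 (abs_le.1 hx))]
  have := intervalIntegral.norm_integral_le_of_norm_le_const (a := -1) (b := x) (C := ε / 2) (f := fun z => Fd a φ p lam δ z t - FF a φ p lam z t) (fun z hz => h1 z t (abs_le.2 (uIcc_I m1 (abs_le.1 hx) (uIoc_subset_uIcc hz))) ht htT)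
  refine this.trans ?_
  have : |x - -1| ≤ 2 := by rw [abs_le] at hx ⊢; constructor <;> linarith
  nlinarith

/-! ### kernel estimates -/

lemma heatK_ev_zero {X : Type*} [TopologicalSpace X] {g : X → ℝ} {w : X} (hg : ContinuousAt g w) (h : g w ≠ 0) :
    ContinuousAt (fun z : ℝ × X => heatK (g z.2) z.1) (0, w) := by
  have : ContinuousAt (fun z : ℝ² => heatK z.1 z.2) (g w, 0) := heatK_smooth.continuousOn.continuousAt (isOpen_ne_zero.mem_nhds (by
    show (g w, (0:ℝ)) ≠ 0
    intro h'; exact h (congrArg Prod.fst h')))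
  refine ContinuousAt.comp (x := ((0:ℝ), w)) (f := fun z : ℝ × X => (g z.2, z.1)) (g := fun z : ℝ² => heatK z.1 z.2) this ?_
  refine ContinuousAt.prodMk ?_ continuousAt_fst
  exact ContinuousAt.comp (f := fun z : ℝ × X => z.2) (g := g) hg continuousAt_snd

lemma gamma_tail {d ε : ℝ} (hd : 0 < d) (hε : 0 < ε) : ∀ᶠ δ in 𝓝[>] (0:ℝ), ∀ z y, z ∈ Icc (-1) (1-d) → y ∈ 𝕁 →
    heatK (z - y) δ + heatK (z + 2 + y) δ ≤ heatGamma z y δ ∧ heatGamma z y δ ≤ heatK (z - y) δ + heatK (z + 2 + y) δ + ε := by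
  have e2 : ∀ᶠ δ in 𝓝 (0:ℝ), ∀ w ∈ Icc (-1:ℝ) (1-d) ×ˢ 𝕁, heatK (w.1 - 2 + w.2) δ + heatK (w.1 - 4 - w.2) δ + heatK (w.1 + 4 - w.2) δ + Gtail ((w.1, δ), w.2) < ε := by
    refine IsCompact.eventually_forall_of_forall_eventually (isCompact_Icc.prod isCompact_Icc) (P := fun δ (w : ℝ²) => heatK (w.1 - 2 + w.2) δ + heatK (w.1 - 4 - w.2) δ + heatK (w.1 + 4 - w.2) δ + Gtail ((w.1, δ), w.2) < ε) (fun w hw => ?_)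
    obtain ⟨⟨w1, w2⟩, w3, w4⟩ := hw
    have cc : ContinuousAt (fun z : ℝ × ℝ² => heatK (z.2.1 - 2 + z.2.2) z.1 + heatK (z.2.1 - 4 - z.2.2) z.1 + heatK (z.2.1 + 4 - z.2.2) z.1 + Gtail ((z.2.1, z.1), z.2.2)) (0, w) := by
      refine ContinuousAt.add (ContinuousAt.add (ContinuousAt.add ?_ ?_) ?_) ?_
      · exact heatK_ev_zero (g := fun w : ℝ² => w.1 - 2 + w.2) (by fun_prop) (by show w.1 - 2 + w.2 ≠ 0; linarith)
      · exact heatK_ev_zero (g := fun w : ℝ² => w.1 - 4 - w.2) (by fun_prop) (by show w.1 - 4 - w.2 ≠ 0; linarith)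
      · exact heatK_ev_zero (g := fun w : ℝ² => w.1 + 4 - w.2) (by fun_prop) (by show w.1 + 4 - w.2 ≠ 0; linarith)
      · refine ContinuousAt.comp (f := fun z : ℝ × ℝ² => ((z.2.1, z.1), z.2.2)) (g := Gtail) (Gtail_smooth.continuousOn.continuousAt (box2_open.mem_nhds ?_)) (by fun_prop)
        exact ⟨by show |w.1| < 2; rw [abs_lt]; constructor <;> linarith, by show |w.2| < 2; rw [abs_lt]; constructor <;> linarith⟩
    refine cc.eventually (Iio_mem_nhds ?_)
    show heatK _ 0 + heatK _ 0 + heatK _ 0 + Gtail _ < ε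
    rw [heatK_nonpos_time le_rfl, heatK_nonpos_time le_rfl, heatK_nonpos_time le_rfl, Gtail_nonpos_time le_rfl]; simpa using hε
  filter_upwards [e2.filter_mono nhdsWithin_le_nhds] with δ h1 z y hz hy
  have hz2 : |z| < 2 := by rw [abs_lt]; constructor <;> linarith [hz.1, hz.2]
  have hy2 : |y| < 2 := by rw [abs_lt]; constructor <;> linarith [hy.1, hy.2]
  have s0 : sg 0 = 1 := by simp [sg]
  have s1 : sg (-1) = -1 := by simp [sg]
  have s11 : sg 1 = -1 := by simp [sg]
  have s2 : sg 2 = 1 := by norm_num [sg]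
  have s22 : sg (-2) = 1 := by norm_num [sg]
  constructor
  · have := (heatK_summable δ hz2 hy2).sum_le_tsum {0, -1} (fun k _ => heatK_nonneg _ _)
    rw [Finset.sum_pair (by norm_num), s0, s1] at this
    rw [heatGamma_def]
    refine le_trans (le_of_eq ?_) this
    congr 2 <;> push_cast <;> ring
  · have := h1 (z, y) ⟨hz, hy⟩
    simp only at this
    rw [heatGamma_eq δ hz2 hy2]
    rw [show Finset.Icc (-2:ℤ) 2 = {-2, -1, 0, 1, 2} by decide]
    rw [Finset.sum_insert (by decide), Finset.sum_insert (by decide), Finset.sum_insert (by decide), Finset.sum_insert (by decide), Finset.sum_singleton, s0, s1, s11, s2, s22]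
    push_cast
    rw [show z - (2 * -2 + 1 * y) = z + 4 - y by ring, show z - (2 * -1 + -1 * y) = z + 2 + y by ring, show z - (2 * 0 + 1 * y) = z - y by ring, show z - (2 * 1 + -1 * y) = z - 2 + y by ring, show z - (2 * 2 + 1 * y) = z - 4 - y by ring]
    linarith

lemma heatK_ii {t : ℝ} (ht : 0 < t) (u v : ℝ) : IntervalIntegrable (fun x => heatK x t) volume u v := (heatK_continuous ht).intervalIntegrable _ _

lemma gauss_anti0 {t c r y1 y2 : ℝ} (ht : 0 < t) (hr : 0 ≤ r) (h1 : c ≤ y1) (h2 : y1 ≤ y2) :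
    ∫ z in (c-r)..(c+r), heatK (z - y2) t ≤ ∫ z in (c-r)..(c+r), heatK (z - y1) t := by
  rw [intervalIntegral.integral_comp_sub_right (fun z => heatK z t), intervalIntegral.integral_comp_sub_right (fun z => heatK z t)]
  have hi := heatK_ii ht
  have e1 := intervalIntegral.integral_interval_sub_interval_comm (hi (c-r-y2) (c+r-y2)) (hi (c-r-y1) (c+r-y1)) (hi (c-r-y2) (c-r-y1))
  have e2 : ∫ z in (c+r-y2)..(c+r-y1), heatK z t = ∫ z in (c-r-y2)..(c-r-y1), heatK (z + 2*r) t := by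
    rw [intervalIntegral.integral_comp_add_right (fun z => heatK z t)]; congr 1 <;> ring
  rw [e2] at e1
  have e3 : ∫ z in (c-r-y2)..(c-r-y1), heatK z t ≤ ∫ z in (c-r-y2)..(c-r-y1), heatK (z + 2*r) t := by
    refine intervalIntegral.integral_mono_on (by linarith) (hi _ _) (((heatK_continuous ht).comp (by fun_prop)).intervalIntegrable _ _) (fun z hz => heatK_anti ?_)
    rw [abs_of_nonpos (a := z) (by linarith [hz.2])]
    exact abs_le.2 ⟨by linarith, by linarith [hz.2]⟩
  linarith

lemma gauss_refl {t c r y : ℝ} : ∫ z in (c-r)..(c+r), heatK (z - (2*c - y)) t = ∫ z in (c-r)..(c+r), heatK (z - y) t := by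
  have : ∀ z, heatK (z - (2*c-y)) t = heatK ((2*c - z) - y) t := fun z => by rw [← heatK_neg]; congr 1; ring
  simp only [this]
  rw [intervalIntegral.integral_comp_sub_left (fun z => heatK (z - y) t)]
  congr 1 <;> ring

lemma gauss_anti {t c r y1 y2 : ℝ} (ht : 0 < t) (hr : 0 ≤ r) (h : |y1 - c| ≤ |y2 - c|) :
    ∫ z in (c-r)..(c+r), heatK (z - y2) t ≤ ∫ z in (c-r)..(c+r), heatK (z - y1) t := by
  have e : ∀ y, ∫ z in (c-r)..(c+r), heatK (z - y) t = ∫ z in (c-r)..(c+r), heatK (z - (c + |y - c|)) t := by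
    intro y
    rcases abs_cases (y - c) with ⟨h1, _⟩ | ⟨h1, _⟩
    · rw [h1]; simp
    · rw [h1, show c + -(y - c) = 2 * c - y by ring, gauss_refl]
  rw [e y1, e y2]
  exact gauss_anti0 ht hr (by linarith [abs_nonneg (y1 - c)]) (by linarith)

lemma Gk_zc (D : Dat a φ φ' pI) {q δ : ℝ} (hq : q ∈ 𝕁) (hδ : 0 < δ) : ContinuousOn (fun z => Gk a z q δ) {z | |z| < 2} := by
  intro z hz
  exact (ContinuousAt.comp (f := fun z : ℝ => (z, q, δ)) (Gk_contAt_time D.ha hz hq hδ.ne') (by fun_prop)).continuousWithinAt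

lemma Gk_zi (D : Dat a φ φ' pI) {q δ u v : ℝ} (hq : q ∈ 𝕁) (hδ : 0 < δ) (hu : |u| < 2) (hv : |v| < 2) : IntervalIntegrable (fun z => Gk a z q δ) volume u v :=
  ((Gk_zc D hq hδ).mono (uIcc_lt2 hu hv)).intervalIntegrable

lemma lin_low {f g h : ℝ → ℝ} {u v e : ℝ} (huv : u ≤ v) (hf : Continuous f) (hg : Continuous g) (hh : IntervalIntegrable h volume u v)
    (H : ∀ z ∈ Icc u v, f z - g z - e ≤ h z) : (∫ z in u..v, f z) - (∫ z in u..v, g z) - e * (v - u) ≤ ∫ z in u..v, h z := by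
  have c : Continuous (fun z => f z - g z - e) := by fun_prop
  refine le_trans (le_of_eq ?_) (intervalIntegral.integral_mono_on huv (c.intervalIntegrable _ _) hh H)
  have c1 : Continuous (fun z => f z - g z) := by fun_prop
  rw [intervalIntegral.integral_sub (c1.intervalIntegrable _ _) (by simp), intervalIntegral.integral_sub (hf.intervalIntegrable _ _) (hg.intervalIntegrable _ _), intervalIntegral.integral_const, smul_eq_mul]
  ring

lemma src_lower (D : Dat a φ φ' pI) {d ε : ℝ} (hd : 0 < d) (hε : 0 < ε) : ∀ᶠ δ in 𝓝[>] (0:ℝ), ∀ q ∈ 𝕁,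
    (∀ x ∈ Icc (-1:ℝ) (1-d), -ε ≤ ∫ z in (-1:ℝ)..x, Gk a z q δ) ∧
    (∀ c x, -1 ≤ x → x ≤ c → c ≤ q → 2*c - x ≤ 1 - d → -ε ≤ ∫ z in x..(2*c-x), Gk a z q δ) := by
  filter_upwards [gamma_tail hd (half_pos hε), self_mem_nhdsWithin] with δ h1 h2 q hq
  have hδ : 0 < δ := h2
  have hym := abs_le.1 (ym_abs D.ha hq)
  have hyp := abs_le.1 (yp_abs D.ha hq)
  have hal := al_nonneg D.ha hq
  set y1 := q - al a q with hy1
  set y2 := q + al a q with hy2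
  have pt : ∀ z ∈ Icc (-1:ℝ) (1-d), (heatK (z - y1) δ + heatK (z + 2 + y1) δ) - (heatK (z - y2) δ + heatK (z + 2 + y2) δ) - ε / 2 ≤ Gk a z q δ := by
    intro z hz
    have a1 := (h1 z y1 hz hym).1
    have a2 := (h1 z y2 hz hyp).2
    show _ ≤ heatGamma z y1 δ - heatGamma z y2 δ
    linarith
  have hK := heatK_continuous hδ
  have kc : ∀ c : ℝ, Continuous (fun z => heatK (z - c) δ) := fun c => hK.comp (by fun_prop)
  have kc2 : ∀ c : ℝ, Continuous (fun z => heatK (z + 2 + c) δ) := fun c => hK.comp (by fun_prop)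
  have ii : ∀ y u v, IntervalIntegrable (fun z => heatK (z - y) δ) volume u v := fun y u v => (kc y).intervalIntegrable _ _
  have ii2 : ∀ y u v, IntervalIntegrable (fun z => heatK (z + 2 + y) δ) volume u v := fun y u v => (kc2 y).intervalIntegrable _ _
  constructor
  · intro x hx
    have e : ∀ y, ∫ z in (-1:ℝ)..x, (heatK (z - y) δ + heatK (z + 2 + y) δ) = ∫ z in (-1 - (x+1))..(-1 + (x+1)), heatK (z - y) δ := by
      intro y
      rw [intervalIntegral.integral_add (ii _ _ _) (ii2 _ _ _)]
      have : ∀ z, heatK (z + 2 + y) δ = heatK ((-2 - z) - y) δ := fun z => by rw [← heatK_neg]; congr 1; ring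
      simp only [this]
      rw [intervalIntegral.integral_comp_sub_left (fun z => heatK (z - y) δ), add_comm, show (-2:ℝ) - -1 = -1 by norm_num, intervalIntegral.integral_add_adjacent_intervals (ii _ _ _) (ii _ _ _)]
      congr 1 <;> ring
    have m := lin_low (f := fun z => heatK (z - y1) δ + heatK (z + 2 + y1) δ) (g := fun z => heatK (z - y2) δ + heatK (z + 2 + y2) δ) hx.1 ((kc y1).add (kc2 y1)) ((kc y2).add (kc2 y2)) (Gk_zi D hq hδ (by norm_num) (by rw [abs_lt]; constructor <;> linarith [hx.1, hx.2])) (fun z hz => pt z ⟨hz.1, hz.2.trans hx.2⟩)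
    refine le_trans ?_ m
    rw [e, e]
    have := gauss_anti (t := δ) (c := -1) (r := x + 1) (y1 := y1) (y2 := y2) hδ (by linarith [hx.1]) (by rw [abs_of_nonneg (by linarith), abs_of_nonneg (by linarith)]; linarith)
    nlinarith [hx.1, hx.2]
  · intro c x hx1 hx2 hcq hx3
    have m := lin_low (f := fun z => heatK (z - y1) δ + heatK (z + 2 + y1) δ) (g := fun z => heatK (z - y2) δ + heatK (z + 2 + y2) δ) (show x ≤ 2*c-x by linarith) ((kc y1).add (kc2 y1)) ((kc y2).add (kc2 y2)) (Gk_zi D hq hδ (by rw [abs_lt]; constructor <;> linarith) (by rw [abs_lt]; constructor <;> linarith)) (fun z hz => pt z ⟨hx1.trans hz.1, hz.2.trans hx3⟩)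
    refine le_trans ?_ m
    rw [intervalIntegral.integral_add (ii _ _ _) (ii2 _ _ _), intervalIntegral.integral_add (ii _ _ _) (ii2 _ _ _)]
    have g1 := gauss_anti (t := δ) (c := c) (r := c - x) (y1 := y1) (y2 := y2) hδ (by linarith) (by rw [abs_of_nonneg (a := y2 - c) (by linarith), abs_le]; constructor <;> linarith)
    have g2 : ∫ z in x..(2*c-x), heatK (z + 2 + y2) δ ≤ ∫ z in x..(2*c-x), heatK (z + 2 + y1) δ := by
      refine intervalIntegral.integral_mono_on (by linarith) (ii2 _ _ _) (ii2 _ _ _) (fun z hz => heatK_anti ?_)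
      rw [abs_of_nonneg (by linarith [hz.1]), abs_of_nonneg (by linarith [hz.1])]; linarith
    rw [show c - (c - x) = x by ring, show c + (c - x) = 2*c - x by ring] at g1
    nlinarith

/-! ### super-limits -/

lemma W_super (D : Dat a φ φ' pI) (h : Crv p lam) {d T : ℝ} (hd : 0 < d) (hl : ∀ t ∈ Icc 0 T, 0 ≤ lam t) {Q : Set ℝ²} (hQ : ∀ z ∈ Q, |z.1| ≤ 1 ∧ 0 ≤ z.2 ∧ z.2 ≤ T) :
    SuperLim Q {z | z.1 ∈ Icc (-1:ℝ) (1-d) ∧ 0 < z.2 ∧ z.2 ≤ T} (WW a φ p lam) := by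
  intro ε hε
  obtain ⟨Λ, hΛ, hlam⟩ := lam_bdd h.cl 0 T
  obtain ⟨δ, h1, h2, h3⟩ := ((Wd_WW D h T hε).and ((src_lower D hd (div_pos hε hΛ)).and self_mem_nhdsWithin)).exists
  have hδ : 0 < δ := h3
  refine ⟨Wd a φ p lam δ, (Wd_cont D h hδ).mono fun z hz => ⟨(hQ z hz).1, (hQ z hz).2.1⟩, fun x t hxt => h1 x t (hQ _ hxt).1 (hQ _ hxt).2.1 (hQ _ hxt).2.2, ?_⟩
  rintro x t ⟨hx, ht, htT⟩
  simp only at hx ht htT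
  obtain ⟨B, hB1, hB2, hB3⟩ := Wd_pde D h hδ (x := x) (abs_le.2 ⟨hx.1, by linarith [hx.2]⟩) ht
  refine ⟨_, B, _, hB1, hB2, hB3, ?_⟩
  have := (h2 (p t) (h.memI t)).1 x hx
  have l0 := hl t ⟨ht.le, htT⟩
  have l1 := (abs_le.1 (hlam t ⟨ht.le, htT⟩)).2
  have : -ε ≤ lam t * ∫ z in (-1:ℝ)..x, Gk a z (p t) δ := by
    have e : lam t * (-(ε/Λ)) ≤ lam t * ∫ z in (-1:ℝ)..x, Gk a z (p t) δ := mul_le_mul_of_nonneg_left this l0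
    have e2 : lam t * (ε/Λ) ≤ Λ * (ε/Λ) := mul_le_mul_of_nonneg_right l1 (div_pos hε hΛ).le
    rw [mul_div_cancel₀ _ hΛ.ne'] at e2
    linarith
  linarith

noncomputable def ZZ (a : ℝ) (φ p lam : ℝ → ℝ) (c x t : ℝ) : ℝ := WW a φ p lam (2*c - x) t - WW a φ p lam x t

lemma Z_super (D : Dat a φ φ' pI) (h : Crv p lam) {c d T : ℝ} (hd : 0 < d) (hl : ∀ t ∈ Icc 0 T, 0 ≤ lam t) {Q : Set ℝ²} (hQ : ∀ z ∈ Q, |z.1| ≤ 1 ∧ |2*c - z.1| ≤ 1 ∧ 0 ≤ z.2 ∧ z.2 ≤ T) :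
    SuperLim Q {z | -1 ≤ z.1 ∧ z.1 ≤ c ∧ c ≤ p z.2 ∧ 2*c - z.1 ≤ 1-d ∧ 0 < z.2 ∧ z.2 ≤ T} (ZZ a φ p lam c) := by
  intro ε hε
  obtain ⟨Λ, hΛ, hlam⟩ := lam_bdd h.cl 0 T
  obtain ⟨δ, h1, h2, h3⟩ := ((Wd_WW D h T (half_pos hε)).and ((src_lower D hd (div_pos hε hΛ)).and self_mem_nhdsWithin)).exists
  have hδ : 0 < δ := h3
  refine ⟨fun x t => Wd a φ p lam δ (2*c - x) t - Wd a φ p lam δ x t, ?_, fun x t hxt => ?_, ?_⟩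
  · refine ContinuousOn.sub ?_ ((Wd_cont D h hδ).mono fun z hz => ⟨(hQ z hz).1, (hQ z hz).2.2.1⟩)
    exact (Wd_cont D h hδ).comp (f := fun z : ℝ² => (2*c - z.1, z.2)) (by fun_prop) (fun z hz => ⟨(hQ z hz).2.1, (hQ z hz).2.2.1⟩)
  · obtain ⟨q1, q2, q3, q4⟩ := hQ _ hxt
    have b1 := h1 x t q1 q3 q4
    have b2 := h1 (2*c-x) t q2 q3 q4
    unfold ZZ
    rw [abs_le] at b1 b2 ⊢
    constructor <;> linarith [b1.1, b1.2, b2.1, b2.2]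
  rintro x t ⟨hx1, hx2, hc, hx3, ht, htT⟩
  simp only at hx1 hx2 hx3 hc ht htT
  have hx' : |x| ≤ 1 := abs_le.2 ⟨hx1, by linarith⟩
  have hx'' : |2*c - x| ≤ 1 := abs_le.2 ⟨by linarith, by linarith⟩
  obtain ⟨B1, hB1, hB2, hB3⟩ := Wd_pde D h hδ hx' ht
  obtain ⟨B4, hB4, hB5, hB6⟩ := Wd_pde D h hδ hx'' ht
  have hr : ∀ y, HasDerivAt (fun y : ℝ => 2*c - y) (-1) y := fun y => by simpa using (hasDerivAt_id y).const_sub (2*c)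
  refine ⟨_, B4 - B1, fun y => Fd a φ p lam δ (2*c-y) t * (-1) - Fd a φ p lam δ y t, hB4.sub hB1, ?_, ?_, ?_⟩
  · have hev : ∀ᶠ y in 𝓝 x, HasDerivAt (fun y => Wd a φ p lam δ y t) (Fd a φ p lam δ (2*c-y) t) (2*c-y) := by
      have : Tendsto (fun y : ℝ => 2*c-y) (𝓝 x) (𝓝 (2*c-x)) := by
        have : Continuous (fun y : ℝ => 2*c-y) := by fun_prop
        exact this.tendsto x
      exact this.eventually hB5
    filter_upwards [hev, hB2] with y hy1 hy2
    exact (HasDerivAt.comp y hy1 (hr y)).sub hy2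
  · have := ((HasDerivAt.comp x hB6 (hr x)).mul_const (-1)).sub hB3
    exact this.congr_deriv (by ring)
  · have := (h2 (p t) (h.memI t)).2 c x hx1 hx2 hc hx3
    have l0 := hl t ⟨ht.le, htT⟩
    have l1 := (abs_le.1 (hlam t ⟨ht.le, htT⟩)).2
    have e0 : (∫ z in (-1:ℝ)..(2*c-x), Gk a z (p t) δ) - ∫ z in (-1:ℝ)..x, Gk a z (p t) δ = ∫ z in x..(2*c-x), Gk a z (p t) δ :=
      intervalIntegral.integral_interval_sub_left (Gk_zi D (h.memI t) hδ (by norm_num) (by linarith)) (Gk_zi D (h.memI t) hδ (by norm_num) (by linarith))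
    have : -ε ≤ lam t * ∫ z in x..(2*c-x), Gk a z (p t) δ := by
      have e : lam t * (-(ε/Λ)) ≤ lam t * ∫ z in x..(2*c-x), Gk a z (p t) δ := mul_le_mul_of_nonneg_left this l0
      have e2 : lam t * (ε/Λ) ≤ Λ * (ε/Λ) := mul_le_mul_of_nonneg_right l1 (div_pos hε hΛ).le
      rw [mul_div_cancel₀ _ hΛ.ne'] at e2
      linarith
    rw [← e0] at this
    linarith

end P10

section P11
variable {a : ℝ} {φ φ' p lam : ℝ → ℝ} {pI : ℝ}

lemma Caloric.of_cover {f : ℝ² → ℝ} {U : Set ℝ²} (h : ∀ z ∈ U, ∃ V, IsOpen V ∧ z ∈ V ∧ Caloric f V) : Caloric f U := by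
  refine ⟨SmoothOn.of_cover fun z hz => ?_, fun z hz => ?_⟩
  · obtain ⟨V, hV, hzV, hf⟩ := h z hz; exact ⟨V, hV, hzV, hf.smooth⟩
  · obtain ⟨V, hV, hzV, hf⟩ := h z hz; exact hf.heat z hzV

/-- domain of smoothness of `FF` -/
def FU (a : ℝ) (p : ℝ → ℝ) : Set ℝ² := {z | |z.1| < 1 ∧ 0 < z.2 ∧ z.1 ≠ p z.2 - al a (p z.2) ∧ z.1 ≠ p z.2 + al a (p z.2)}

lemma FU_open (hp : Continuous p) : IsOpen (FU a p) := by
  have hal := al_cont a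
  have h1 : IsOpen {z : ℝ² | |z.1| < 1} := isOpen_lt (by fun_prop) (by fun_prop)
  have h2 : IsOpen {z : ℝ² | 0 < z.2} := isOpen_lt (by fun_prop) (by fun_prop)
  have h3 : IsOpen {z : ℝ² | z.1 ≠ p z.2 - al a (p z.2)} := isOpen_ne_fun (by fun_prop) (by fun_prop)
  have h4 : IsOpen {z : ℝ² | z.1 ≠ p z.2 + al a (p z.2)} := isOpen_ne_fun (by fun_prop) (by fun_prop)
  exact h1.inter (h2.inter (h3.inter h4))

lemma mem_FU (ha : 0 < a) (h : Crv p lam) {t : ℝ} (ht : 0 < t) : (p t, t) ∈ FU a p := by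
  have := al_pos ha (h.mem t)
  exact ⟨abs_lt.2 (h.mem t), ht, by show p t ≠ _; linarith, by show p t ≠ _; linarith⟩

lemma SS_ext (x : ℝ) {t T : ℝ} (ht : 0 ≤ t) (hT : t ≤ T) (hi : IntervalIntegrable (fun s => Gk a x (p s) (t - s) * lam s) volume 0 T) : SS a p lam x t = ∫ s in (0:ℝ)..T, Gk a x (p s) (t - s) * lam s := by
  unfold SS
  have i1 := hi.mono_set (show uIcc 0 t ⊆ uIcc 0 T by rw [uIcc_of_le ht, uIcc_of_le (ht.trans hT)]; exact Icc_subset_Icc_right hT)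
  have i2 := hi.mono_set (show uIcc t T ⊆ uIcc 0 T by rw [uIcc_of_le hT, uIcc_of_le (ht.trans hT)]; exact Icc_subset_Icc_left ht)
  rw [← intervalIntegral.integral_add_adjacent_intervals i1 i2]
  have : ∫ s in t..T, Gk a x (p s) (t - s) * lam s = 0 := by
    rw [intervalIntegral.integral_congr (g := fun _ => 0)]
    · simp
    · intro s hs
      rw [uIcc_of_le hT] at hs
      show Gk a x (p s) (t - s) * lam s = 0
      rw [Gk_nonpos_time _ _ _ (by linarith [hs.1]), zero_mul]
  rw [this, add_zero]

/-- Caloricity of `FF` under very weak hypotheses on the curve. -/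
lemma FF_caloric_gen (D : Dat a φ φ' pI) {C : Set ℝ²} (hC : IsCompact C) {T : ℝ} (hT : 0 ≤ T) (hp : Measurable p)
    (hpC : ∀ s ∈ Ioc 0 T, (p s, s) ∈ C) (hl : IntegrableOn lam (Ioc 0 T)) :
    Caloric (fun z => util φ z.1 z.2 + ∫ s in (0:ℝ)..T, Gk a z.1 (p s) (z.2 - s) * lam s) ({z | |z.1| < 2 ∧ 0 < z.2} ∩ srcU a C) := by
  obtain ⟨B, hB, hB2⟩ := D.bd
  exact ((util_caloric D.ev D.c hB2).mono inter_subset_left).add ((strip_open 0).inter (srcU_open a hC)) ((src_caloric hC hT hp hpC hl).1.mono inter_subset_right)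

lemma FF_caloric (D : Dat a φ φ' pI) (h : Crv p lam) : Caloric (fun z : ℝ² => FF a φ p lam z.1 z.2) (FU a p) := by
  refine Caloric.of_cover fun z hz => ?_
  obtain ⟨x0, t0⟩ := z
  have ht0 : 0 < t0 := hz.2.1
  have hT : 0 ≤ t0 + 1 := by linarith
  have hC := graph_compact (h.cp.continuousOn (s := Icc 0 (t0+1)))
  have hpC : ∀ s ∈ Ioc 0 (t0+1), (p s, s) ∈ ((fun s => (p s, s)) '' Icc 0 (t0+1)) := fun s hs => ⟨s, Ioc_subset_Icc_self hs, rfl⟩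
  have h1 := FF_caloric_gen D hC hT h.cp.measurable hpC h.cl.integrableOn_Ioc
  have h2 := (src_caloric (a := a) hC hT h.cp.measurable hpC h.cl.integrableOn_Ioc).2
  have hV : IsOpen (FU a p ∩ {z : ℝ² | z.2 < t0 + 1}) := (FU_open h.cp).inter (isOpen_lt (by fun_prop) (by fun_prop))
  have hsub : FU a p ∩ {z : ℝ² | z.2 < t0 + 1} ⊆ srcU a ((fun s => (p s, s)) '' Icc 0 (t0+1)) := by
    rintro z ⟨⟨z1, z2, z3, z4⟩, z5⟩ w ⟨s, hs, rfl⟩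
    by_cases e : z.2 - s = 0
    · have : s = z.2 := by linarith
      subst this
      exact ⟨mem_gΩ_of_ne z1.le (ym_abs D.ha (h.memI _)) z3, mem_gΩ_of_ne z1.le (yp_abs D.ha (h.memI _)) z4⟩
    · exact ⟨mem_gΩ_of_time (by linarith) (by linarith [ym_abs D.ha (h.memI s)]) e, mem_gΩ_of_time (by linarith) (by linarith [yp_abs D.ha (h.memI s)]) e⟩
  refine ⟨_, hV, ⟨hz, by show t0 < t0 + 1; linarith⟩, (h1.mono ?_).congr hV ?_⟩
  · exact fun z hz => ⟨⟨by linarith [hz.1.1], hz.1.2.1⟩, hsub hz⟩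
  · intro z hz
    show util φ z.1 z.2 + SS a p lam z.1 z.2 = _
    rw [SS_ext _ hz.1.2.1.le (le_of_lt hz.2) (h2 z (hsub hz))]

/-! ### reflection -/

lemma util_refl (φ : ℝ → ℝ) (x t : ℝ) : util (fun y => -φ (-y)) x t = - util φ (-x) t := by
  unfold util
  rw [← integral_neg_eq_self, ← integral_neg]
  congr 1; ext ζ
  rw [heatK_neg]
  show heatK ζ 1 * (-φ (-(x - √t * -ζ))) = _
  rw [show -(x - √t * -ζ) = -x - √t * ζ by ring]; ring

lemma FF_refl (x t : ℝ) : FF a (fun y => -φ (-y)) (fun s => - p s) lam x t = - FF a φ p lam (-x) t := by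
  unfold FF SS
  rw [util_refl, neg_add, ← intervalIntegral.integral_neg]
  congr 1
  refine intervalIntegral.integral_congr fun s hs => ?_
  show Gk a x (- p s) (t - s) * lam s = - (Gk a (-x) (p s) (t - s) * lam s)
  have := Gk_neg a (-x) (p s) (t - s)
  rw [neg_neg] at this
  rw [this]; ring

lemma Dat.refl (D : Dat a φ φ' pI) : Dat a (fun y => -φ (-y)) (fun y => φ' (-y)) (-pI) where
  ha := D.ha
  ha1 := D.ha1
  ev := ⟨fun y => by show -φ (-(2 - y)) = -φ (-y); rw [show -(2 - y) = -2 - -y by ring, D.ev.2], fun y => by show -φ (-(-2 - y)) = -φ (-y); rw [show -(-2 - y) = 2 - -y by ring, D.ev.1]⟩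
  hd := fun x => by
    have := (HasDerivAt.comp x (D.hd (-x)) (hasDerivAt_neg x)).neg
    exact this.congr_deriv (by ring)
  lip := by
    obtain ⟨L, hL⟩ := D.lip
    refine ⟨L, fun x y => (hL _ _).trans_eq ?_⟩
    rw [show -x - -y = -(x - y) by ring, abs_neg]
  hpI := ⟨by linarith [D.hpI.2], by linarith [D.hpI.1]⟩
  z := by simp [D.z]
  pos := fun x hx => by
    have := D.neg (-x) ⟨by linarith [hx.2], by linarith [hx.1]⟩
    show 0 < -φ (-x); linarith
  neg := fun x hx => by
    have := D.pos (-x) ⟨by linarith [hx.2], by linarith [hx.1]⟩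
    show -φ (-x) < 0; linarith
  sl := by simpa using D.sl

structure Sol (a : ℝ) (φ : ℝ → ℝ) (pI T : ℝ) (p lam : ℝ → ℝ) : Prop where
  crv : Crv p lam
  p0 : p 0 = pI
  zero : ∀ t ∈ Icc 0 T, FF a φ p lam (p t) t = 0
  der : ∀ t ∈ Icc 0 T, HasDerivAt (fun x => FF a φ p lam x t) (-lam t) (p t)
  lpos : ∀ t ∈ Icc 0 T, 0 < lam t
  pos : ∀ t ∈ Icc 0 T, ∀ x ∈ Ico (-1:ℝ) (p t), 0 < FF a φ p lam x t
  neg : ∀ t ∈ Icc 0 T, ∀ x ∈ Ioc (p t) 1, FF a φ p lam x t < 0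

lemma Sol.mono {T T' : ℝ} (S : Sol a φ pI T p lam) (h : T' ≤ T) : Sol a φ pI T' p lam where
  crv := S.crv
  p0 := S.p0
  zero := fun t ht => S.zero t ⟨ht.1, ht.2.trans h⟩
  der := fun t ht => S.der t ⟨ht.1, ht.2.trans h⟩
  lpos := fun t ht => S.lpos t ⟨ht.1, ht.2.trans h⟩
  pos := fun t ht => S.pos t ⟨ht.1, ht.2.trans h⟩
  neg := fun t ht => S.neg t ⟨ht.1, ht.2.trans h⟩

lemma Crv.refl (h : Crv p lam) : Crv (fun s => - p s) lam :=
  ⟨h.cp.neg, fun s => ⟨by linarith [(h.mem s).2], by linarith [(h.mem s).1]⟩, h.cl⟩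

lemma Sol.refl {T : ℝ} (S : Sol a φ pI T p lam) : Sol a (fun y => -φ (-y)) (-pI) T (fun s => -p s) lam where
  crv := S.crv.refl
  p0 := by simp [S.p0]
  zero := fun t ht => by rw [FF_refl, neg_neg, S.zero t ht, neg_zero]
  der := fun t ht => by
    simp only [FF_refl]
    have h0 : HasDerivAt (fun x => FF a φ p lam x t) (-lam t) (-(-p t)) := by rw [neg_neg]; exact S.der t ht
    have := (HasDerivAt.comp (-p t) h0 (hasDerivAt_neg (-p t))).neg
    exact this.congr_deriv (by ring)
  lpos := S.lpos
  pos := fun t ht x hx => by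
    rw [FF_refl]
    have := S.neg t ht (-x) ⟨by linarith [hx.2], by linarith [hx.1]⟩
    linarith
  neg := fun t ht x hx => by
    rw [FF_refl]
    have := S.pos t ht (-x) ⟨by linarith [hx.2], by linarith [hx.1]⟩
    linarith

end P11

section P12
variable {a : ℝ} {φ φ' p lam : ℝ → ℝ} {pI T : ℝ}

lemma gamma_lip_loc {x0 t0 y0 : ℝ} (h : ((x0, t0), y0) ∈ gΩ) : ∃ M ≥ 0, ∃ r > 0, ∀ x x' t y, |x - x0| < r → |x' - x0| < r → |t - t0| < r → |y - y0| < r →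
    |heatGamma x y t - heatGamma x' y t| ≤ M * |x - x'| := by
  have hc : ContDiffAt ℝ 1 (fun z : ℝ² × ℝ => heatGamma z.1.1 z.2 z.1.2) ((x0, t0), y0) := by
    have := (heatGamma_smooth 1).contDiffAt (gΩ_open.mem_nhds h)
    simpa using this
  obtain ⟨K, s, hs, hl⟩ := hc.exists_lipschitzOnWith
  obtain ⟨r, hr, hball⟩ := Metric.mem_nhds_iff.1 hs
  refine ⟨K, K.2, r, hr, fun x x' t y hx hx' ht hy => ?_⟩
  have m1 : ((x, t), y) ∈ s := hball (by simp only [Metric.mem_ball, Prod.dist_eq, Real.dist_eq]; exact max_lt (max_lt hx ht) hy)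
  have m2 : ((x', t), y) ∈ s := hball (by simp only [Metric.mem_ball, Prod.dist_eq, Real.dist_eq]; exact max_lt (max_lt hx' ht) hy)
  have := hl.dist_le_mul _ m1 _ m2
  rw [Prod.dist_eq, Prod.dist_eq] at this
  simpa [Real.dist_eq] using this

lemma Gk_lip_loc {x0 q0 t0 : ℝ} (h1 : ((x0, t0), q0 - al a q0) ∈ gΩ) (h2 : ((x0, t0), q0 + al a q0) ∈ gΩ) : ∃ M ≥ 0, ∃ r > 0, ∀ x x' q t, |x - x0| < r → |x' - x0| < r → |t - t0| < r → |q - q0| < r →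
    |Gk a x q t - Gk a x' q t| ≤ M * |x - x'| := by
  obtain ⟨M1, hM1, r1, hr1, H1⟩ := gamma_lip_loc h1
  obtain ⟨M2, hM2, r2, hr2, H2⟩ := gamma_lip_loc h2
  have hal := al_cont a
  have e1 : ∀ᶠ q in 𝓝 q0, |(q - al a q) - (q0 - al a q0)| < r1 := by
    have : Continuous (fun q => |(q - al a q) - (q0 - al a q0)|) := by fun_prop
    exact (this.tendsto q0).eventually (Iio_mem_nhds (by simpa using hr1))
  have e2 : ∀ᶠ q in 𝓝 q0, |(q + al a q) - (q0 + al a q0)| < r2 := by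
    have : Continuous (fun q => |(q + al a q) - (q0 + al a q0)|) := by fun_prop
    exact (this.tendsto q0).eventually (Iio_mem_nhds (by simpa using hr2))
  obtain ⟨r3, hr3, H3⟩ := Metric.eventually_nhds_iff.1 (e1.and e2)
  refine ⟨M1 + M2, by positivity, min r1 (min r2 r3), by positivity, fun x x' q t hx hx' ht hq => ?_⟩
  simp only [lt_min_iff] at hx hx' ht hq
  obtain ⟨b1, b2⟩ := H3 (y := q) (by rw [Real.dist_eq]; exact hq.2.2)
  have c1 := H1 x x' t _ hx.1 hx'.1 ht.1 b1
  have c2 := H2 x x' t _ hx.2.1 hx'.2.1 ht.2.1 b2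
  unfold Gk
  rw [add_mul]
  calc _ = |(heatGamma x (q - al a q) t - heatGamma x' (q - al a q) t) - (heatGamma x (q + al a q) t - heatGamma x' (q + al a q) t)| := by congr 1; ring
    _ ≤ _ := (abs_sub _ _).trans (add_le_add c1 c2)

lemma gamma_small {r ε : ℝ} (hr : 0 < r) (hε : 0 < ε) : ∀ᶠ δ in 𝓝[>] (0:ℝ), ∀ z y, |z| ≤ 1 → |y| ≤ 1 → r ≤ |z - y| → heatGamma z y δ ≤ ε := by
  have hK : IsCompact ((𝕁 ×ˢ 𝕁) ∩ {w : ℝ² | r ≤ |w.1 - w.2|}) := (isCompact_Icc.prod isCompact_Icc).inter_right (isClosed_le (by fun_prop) (by fun_prop))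
  have := IsCompact.eventually_forall_of_forall_eventually (x₀ := (0:ℝ)) hK (P := fun δ (w : ℝ²) => heatGamma w.1 w.2 δ < ε) (by
    rintro w ⟨⟨w1, w2⟩, w3⟩
    have hne : w.1 ≠ w.2 := by
      intro e
      have : r ≤ |w.1 - w.2| := w3
      rw [e, sub_self, abs_zero] at this; linarith
    have hc := heatGamma_contAt (mem_gΩ_of_ne (t := 0) (abs_le.2 w1) (abs_le.2 w2) hne)
    have hc2 : ContinuousAt (fun z : ℝ × ℝ² => heatGamma z.2.1 z.2.2 z.1) (0, w) :=
      ContinuousAt.comp (x := ((0:ℝ), w)) (f := fun z : ℝ × ℝ² => ((z.2.1, z.1), z.2.2)) (g := fun z : ℝ² × ℝ => heatGamma z.1.1 z.2 z.1.2) hc (by fun_prop)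
    refine hc2.eventually (Iio_mem_nhds ?_)
    show heatGamma w.1 w.2 0 < ε
    rw [heatGamma_nonpos_time _ _ le_rfl]; exact hε)
  filter_upwards [this.filter_mono nhdsWithin_le_nhds] with δ h z y hz hy hzy
  exact (h (z, y) ⟨⟨abs_le.1 hz, abs_le.1 hy⟩, hzy⟩).le

lemma E_one (D : Dat a φ φ' pI) {r ε : ℝ} (hr : 0 < r) (hε : 0 < ε) : ∀ᶠ δ in 𝓝[>] (0:ℝ), ∀ x q, q ∈ 𝕁 → |x| ≤ 1 →
    q - al a q + r ≤ x → x ≤ q + al a q - r → |(∫ z in (-1:ℝ)..x, Gk a z q δ) - 1| ≤ ε := by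
  filter_upwards [gamma_small hr (show (0:ℝ) < ε/4 by positivity), self_mem_nhdsWithin] with δ h1 h2 x q hq hx hx1 hx2
  have hδ : 0 < δ := h2
  have hym := ym_abs D.ha hq
  have hyp := yp_abs D.ha hq
  have c1 := heatGamma_contX (z := q - al a q) (by linarith) hδ
  have c2 := heatGamma_contX (z := q + al a q) (by linarith) hδ
  have hx' := abs_le.1 hx
  have m1 := heatGamma_mass (q - al a q) hδ
  simp only [heatGamma_symm (q - al a q)] at m1
  unfold Gk
  rw [intervalIntegral.integral_sub (c1.intervalIntegrable _ _) (c2.intervalIntegrable _ _)]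
  rw [← intervalIntegral.integral_add_adjacent_intervals (c1.intervalIntegrable (-1) x) (c1.intervalIntegrable x 1)] at m1
  have b1 : ∫ z in x..1, heatGamma z (q - al a q) δ ≤ ε/2 := by
    have := intervalIntegral.integral_mono_on (μ := volume) hx'.2 (c1.intervalIntegrable x 1) (intervalIntegrable_const (c := ε/4)) (fun z hz => h1 z _ (abs_le.2 ⟨by linarith [hz.1], hz.2⟩) hym (by rw [abs_of_nonneg] <;> linarith [hz.1]))
    rw [intervalIntegral.integral_const, smul_eq_mul] at this
    nlinarith
  have b2 : ∫ z in (-1:ℝ)..x, heatGamma z (q + al a q) δ ≤ ε/2 := by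
    have := intervalIntegral.integral_mono_on (μ := volume) hx'.1 (c2.intervalIntegrable (-1) x) (intervalIntegrable_const (c := ε/4)) (fun z hz => h1 z _ (abs_le.2 ⟨hz.1, by linarith [hz.2]⟩) hyp (by rw [abs_of_nonpos] <;> linarith [hz.2]))
    rw [intervalIntegral.integral_const, smul_eq_mul] at this
    nlinarith
  have b3 : 0 ≤ ∫ z in x..1, heatGamma z (q - al a q) δ := intervalIntegral.integral_nonneg hx'.2 fun z _ => heatGamma_nonneg _ _ _
  have b4 : 0 ≤ ∫ z in (-1:ℝ)..x, heatGamma z (q + al a q) δ := intervalIntegral.integral_nonneg hx'.1 fun z _ => heatGamma_nonneg _ _ _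
  rw [abs_le]; constructor <;> linarith

set_option maxHeartbeats 1000000 in
lemma W_t_small (D : Dat a φ φ' pI) (S : Sol a φ pI T p lam) {t0 ε : ℝ} (h0 : 0 < t0) (hT : t0 ≤ T) (hε : 0 < ε) :
    ∃ ρ > 0, ∀ x t t', |x - p t0| < ρ → |t - t0| < ρ → |t' - t0| < ρ → |WW a φ p lam x t' - WW a φ p lam x t| ≤ ε * |t' - t| := by
  have h := S.crv
  obtain ⟨hpm, hpp⟩ := h.mem t0
  have hal := al_pos D.ha (h.mem t0)
  have hfu : (p t0, t0) ∈ FU a p := mem_FU D.ha h h0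
  have hcal := FF_caloric D h
  have hopen := FU_open (a := a) h.cp
  have hval : dX (fun z : ℝ² => FF a φ p lam z.1 z.2) (p t0, t0) = -lam t0 :=
    (hcal.smooth.hasDerivX hopen hfu).unique (S.der t0 ⟨h0.le, hT⟩)
  have hcd : ContinuousAt (dX (fun z : ℝ² => FF a φ p lam z.1 z.2)) (p t0, t0) :=
    (hcal.smooth.dX hopen).continuousOn.continuousAt (hopen.mem_nhds hfu)
  obtain ⟨Λ, hΛ, hlam⟩ := lam_bdd h.cl (t0-1) (t0+1)
  obtain ⟨M, hM, r1, hr1, hlip⟩ := Gk_lip_loc (a := a) (x0 := p t0) (q0 := p t0) (t0 := 0)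
    (mem_gΩ_of_ne (abs_le.2 ⟨by linarith, by linarith⟩) (ym_abs D.ha (h.memI t0)) (by linarith))
    (mem_gΩ_of_ne (abs_le.2 ⟨by linarith, by linarith⟩) (yp_abs D.ha (h.memI t0)) (by linarith))
  have hε6 : 0 < ε/8 := by positivity
  obtain ⟨r2, hr2, e2⟩ := Metric.eventually_nhds_iff.1 ((hcd.eventually (Metric.ball_mem_nhds _ hε6)).and (hopen.mem_nhds hfu))
  have hal2 := al_cont a
  have hp := h.cp
  have c1 : ∀ᶠ t in 𝓝 t0, |p t - p t0| < min r1 (al a (p t0)/8) :=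
    ((by fun_prop : Continuous fun t => |p t - p t0|).tendsto t0).eventually (Iio_mem_nhds (by simp; exact ⟨hr1, by linarith⟩))
  have c2 : ∀ᶠ t in 𝓝 t0, |lam t - lam t0| < ε/8 := by
    have := h.cl
    exact ((by fun_prop : Continuous fun t => |lam t - lam t0|).tendsto t0).eventually (Iio_mem_nhds (by simpa using hε6))
  have c3 : ∀ᶠ t in 𝓝 t0, 7 * al a (p t0)/8 < al a (p t) :=
    ((by fun_prop : Continuous fun t => al a (p t)).tendsto t0).eventually (Ioi_mem_nhds (by linarith))
  obtain ⟨r3, hr3, e3⟩ := Metric.eventually_nhds_iff.1 ((c1.and c2).and c3)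
  have hpa : 0 < 1 - |p t0| := by have := abs_lt.2 (⟨hpm, hpp⟩ : _ ∧ _); linarith
  obtain ⟨ρ, hρ0, l1, l2, l3, l4, l5, l6, l7⟩ : ∃ ρ > 0, 4*ρ ≤ r1 ∧ 4*ρ ≤ r2 ∧ 4*ρ ≤ r3 ∧ 4*ρ ≤ 1 ∧ 4*ρ ≤ al a (p t0)/8 ∧ 4*ρ ≤ t0/2 ∧ 4*ρ ≤ 1 - |p t0| := by
    have q : ∀ c : ℝ, 0 < c → ∀ᶠ ρ in 𝓝[>] (0:ℝ), 4*ρ ≤ c := fun c hc => (small_lt (c := c/4) (by linarith)).mono fun ρ h => by linarith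
    obtain ⟨ρ, m0, m1, m2, m3, m4, m5, m6, m7⟩ := ((eventually_mem_nhdsWithin (a := (0:ℝ)) (s := Ioi 0)).and ((q r1 hr1).and ((q r2 hr2).and ((q r3 hr3).and ((q 1 one_pos).and ((q (al a (p t0)/8) (by linarith)).and ((q (t0/2) (by linarith)).and (q _ hpa)))))))).exists
    exact ⟨ρ, m0, m1, m2, m3, m4, m5, m6, m7⟩
  have hxI : ∀ x, |x - p t0| < ρ → |x| < 1 := fun x hx => by
    have := abs_sub_abs_le_abs_sub x (p t0); linarith
  refine ⟨ρ, hρ0, fun x t t' hx ht ht' => ?_⟩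
  refine le_of_forall_pos_le_add fun e he => ?_
  have hδev : ∀ᶠ δ in 𝓝[>] (0:ℝ), δ < ρ ∧ δ * Λ * M ≤ ε/4 := by
    refine (small_lt hρ0).and ?_
    have : Tendsto (fun δ : ℝ => δ * Λ * M) (𝓝 0) (𝓝 (0 * Λ * M)) := (by fun_prop : Continuous fun δ : ℝ => δ * Λ * M).tendsto 0
    simp only [zero_mul] at this
    exact (this.eventually (Iic_mem_nhds (show (0:ℝ) < ε/4 by positivity))).filter_mono nhdsWithin_le_nhds
  obtain ⟨δ, ⟨⟨d1, d2⟩, d3⟩, d4, d5⟩ := ((hδev.and (Wd_WW D h (t0+1) (half_pos he))).and ((E_one D (r := al a (p t0)/2) (ε := ε/(4*Λ)) (by linarith) (by positivity)).and self_mem_nhdsWithin)).exists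
  have hδ : 0 < δ := d5
  -- derivative bound
  have key : ∀ s, |s - t0| < ρ → ∃ A, HasDerivAt (fun s => Wd a φ p lam δ x s) A s ∧ |A| ≤ ε := by
    intro s hs
    have hs' := abs_lt.1 hs
    have hx1 := hxI x hx
    have hs0 : 0 < s := by linarith
    obtain ⟨B, b1, -, b3⟩ := Wd_pde D h hδ hx1.le hs0
    refine ⟨_, b1, ?_⟩
    obtain ⟨⟨g1, g2⟩, g3⟩ := e3 (y := s) (by rw [Real.dist_eq]; linarith)
    have hmem : ∀ y, |y - p t0| < r2 → dist ((y, s + δ) : ℝ²) (p t0, t0) < r2 := fun y hy => by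
      rw [Prod.dist_eq, Real.dist_eq, Real.dist_eq]
      refine max_lt hy ?_
      rw [abs_lt]; constructor <;> linarith
    obtain ⟨g4, g5⟩ := e2 (hmem x (by linarith))
    rw [Real.dist_eq, hval] at g4
    have hFX := hcal.smooth.hasDerivX hopen g5
    have hR := hFX.sub b3
    have hlipR := hR.le_of_lip' (C := δ * Λ * M) (by positivity) (by
      have : ∀ᶠ y in 𝓝 x, |y - p t0| < ρ :=
        ((by fun_prop : Continuous fun y => |y - p t0|).tendsto x).eventually (Iio_mem_nhds hx)
      filter_upwards [this] with y hy
      have rep : ∀ y, |y - p t0| < ρ → FF a φ p lam y (s + δ) - Fd a φ p lam δ y s = ∫ w in s..(s+δ), Gk a y (p w) (s + δ - w) * lam w := fun y hy => by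
        unfold FF SS Fd
        rw [← intervalIntegral.integral_add_adjacent_intervals (b := s) (SS_integrable D.ha h (hxI y hy).le (by linarith) 0 s le_rfl hs0.le (by linarith)) (SS_integrable D.ha h (hxI y hy).le (by linarith) s (s+δ) hs0.le (by linarith) le_rfl)]
        ring
      show ‖(FF a φ p lam y (s + δ) - Fd a φ p lam δ y s) - (FF a φ p lam x (s + δ) - Fd a φ p lam δ x s)‖ ≤ _
      rw [rep y hy, rep x hx, ← intervalIntegral.integral_sub (SS_integrable D.ha h (hxI y hy).le (by linarith) s (s+δ) hs0.le (by linarith) le_rfl) (SS_integrable D.ha h (hxI x hx).le (by linarith) s (s+δ) hs0.le (by linarith) le_rfl)]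
      have := intervalIntegral.norm_integral_le_of_norm_le_const (a := s) (b := s+δ) (C := M * |y - x| * Λ) (f := fun w => Gk a y (p w) (s + δ - w) * lam w - Gk a x (p w) (s + δ - w) * lam w) (fun w hw => by
        rw [uIoc_of_le (by linarith)] at hw
        have q1 := hlip y x (p w) (s + δ - w) (by linarith) (by linarith) (by rw [abs_lt]; constructor <;> linarith [hw.1, hw.2]) (by
          have := (e3 (y := w) (by rw [Real.dist_eq, abs_lt]; constructor <;> linarith [hw.1, hw.2])).1.1
          exact this.trans_le (min_le_left _ _))
        rw [← sub_mul, norm_mul]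
        refine mul_le_mul q1 (hlam w ⟨by linarith [hw.1], by linarith [hw.2]⟩) (norm_nonneg _) (by positivity))
      refine this.trans (le_of_eq ?_)
      rw [Real.norm_eq_abs, add_sub_cancel_left, abs_of_pos hδ]; ring)
    rw [Real.norm_eq_abs] at hlipR
    have hE := d4 x (p s) (h.memI s) hx1.le (by
      have := (abs_lt.1 (g1.trans_le (min_le_right _ _))); have := abs_lt.1 hx; linarith) (by
      have := (abs_lt.1 (g1.trans_le (min_le_right _ _))); have := abs_lt.1 hx; linarith)
    have hls := hlam s ⟨by linarith, by linarith⟩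
    have hE2 : |lam s * ((∫ z in (-1:ℝ)..x, Gk a z (p s) δ) - 1)| ≤ ε/4 := by
      rw [abs_mul]
      calc _ ≤ Λ * (ε/(4*Λ)) := mul_le_mul hls hE (abs_nonneg _) hΛ.le
        _ = ε/4 := by field_simp
    have k1 := abs_le.1 hE2
    have k2 := abs_le.1 hlipR
    have k3 := abs_lt.1 g4
    have k4 := abs_lt.1 g2
    rw [abs_le]
    constructor <;> nlinarith
  choose! A hA hAb using key
  have hmv : ‖Wd a φ p lam δ x t' - Wd a φ p lam δ x t‖ ≤ ε * ‖t' - t‖ := by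
    refine Convex.norm_image_sub_le_of_norm_hasDerivWithin_le (s := Metric.ball t0 ρ) (f' := A) (fun s hs => (hA s ?_).hasDerivWithinAt) (fun s hs => hAb s ?_) (convex_ball _ _) ?_ ?_
    all_goals simp only [Metric.mem_ball, Real.dist_eq] at *
    all_goals assumption
  rw [Real.norm_eq_abs, Real.norm_eq_abs] at hmv
  have w1 := d3 x t (hxI x hx).le (by linarith [(abs_lt.1 ht).1]) (by linarith [(abs_lt.1 ht).2])
  have w2 := d3 x t' (hxI x hx).le (by linarith [(abs_lt.1 ht').1]) (by linarith [(abs_lt.1 ht').2])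
  have k1 := abs_le.1 hmv
  have k2 := abs_le.1 w1
  have k3 := abs_le.1 w2
  rw [abs_le]; constructor <;> linarith

lemma abs_of_mem {x : ℝ} (h : x ∈ 𝕁) : |x| ≤ 1 := abs_le.2 h

lemma WW_sub (D : Dat a φ φ' pI) (h : Crv p lam) (t : ℝ) {x y : ℝ} (hx : x ∈ 𝕁) (hy : y ∈ 𝕁) :
    WW a φ p lam y t - WW a φ p lam x t = ∫ z in x..y, FF a φ p lam z t := by
  unfold WW
  rw [intervalIntegral.integral_interval_sub_left (FF_ii D h t (by simp) hy) (FF_ii D h t (by simp) hx)]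

lemma WW_left (t : ℝ) : WW a φ p lam (-1) t = 0 := by unfold WW; simp

lemma Sol.nonneg (S : Sol a φ pI T p lam) {t x : ℝ} (ht : t ∈ Icc 0 T) (hx : -1 ≤ x) (hxp : x ≤ p t) : 0 ≤ FF a φ p lam x t := by
  rcases hxp.eq_or_lt with e | e
  · rw [e, S.zero t ht]
  · exact (S.pos t ht x ⟨hx, e⟩).le

lemma Sol.nonpos (S : Sol a φ pI T p lam) {t x : ℝ} (ht : t ∈ Icc 0 T) (hx : x ≤ 1) (hxp : p t ≤ x) : FF a φ p lam x t ≤ 0 := by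
  rcases hxp.eq_or_lt with e | e
  · rw [← e, S.zero t ht]
  · exact (S.neg t ht x ⟨e, hx⟩).le

lemma WW_mono (D : Dat a φ φ' pI) (S : Sol a φ pI T p lam) {t x y : ℝ} (ht : t ∈ Icc 0 T) (hx : -1 ≤ x) (hxy : x ≤ y) (hy : y ≤ p t) :
    WW a φ p lam x t ≤ WW a φ p lam y t := by
  have hp := (S.crv.mem t).2
  have := WW_sub D S.crv t (x := x) (y := y) ⟨hx, by linarith⟩ ⟨by linarith, by linarith⟩
  have h2 : 0 ≤ ∫ z in x..y, FF a φ p lam z t := intervalIntegral.integral_nonneg hxy fun z hz => S.nonneg ht (by linarith [hz.1]) (by linarith [hz.2])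
  linarith

lemma WW_anti (D : Dat a φ φ' pI) (S : Sol a φ pI T p lam) {t x y : ℝ} (ht : t ∈ Icc 0 T) (hx : p t ≤ x) (hxy : x ≤ y) (hy : y ≤ 1) :
    WW a φ p lam y t ≤ WW a φ p lam x t := by
  have hp := (S.crv.mem t).1
  have := WW_sub D S.crv t (x := x) (y := y) ⟨by linarith, by linarith⟩ ⟨by linarith, by linarith⟩
  have h2 : ∫ z in x..y, FF a φ p lam z t ≤ 0 := by
    have : 0 ≤ ∫ z in x..y, -FF a φ p lam z t := intervalIntegral.integral_nonneg hxy fun z hz => by linarith [S.nonpos ht (show z ≤ 1 by linarith [hz.2]) (by linarith [hz.1])]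
    rw [intervalIntegral.integral_neg] at this; linarith
  linarith

lemma WW_max (D : Dat a φ φ' pI) (S : Sol a φ pI T p lam) {t x : ℝ} (ht : t ∈ Icc 0 T) (hx : x ∈ 𝕁) :
    WW a φ p lam x t ≤ WW a φ p lam (p t) t := by
  rcases le_total x (p t) with e | e
  · exact WW_mono D S ht hx.1 e le_rfl
  · exact WW_anti D S ht le_rfl e hx.2

lemma WW_contOn (D : Dat a φ φ' pI) (h : Crv p lam) {q : ℝ → ℝ} (hq : Continuous q) (hqI : ∀ s, q s ∈ 𝕁) : Continuous (fun t => WW a φ p lam (q t) t) := by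
  rw [← continuousOn_univ]
  exact (WW_cont D h).comp (f := fun t => (q t, t)) (by fun_prop) (fun t _ => abs_of_mem (hqI t))

/-- conservation of the positive mass -/
lemma mass_const (D : Dat a φ φ' pI) (S : Sol a φ pI T p lam) {t : ℝ} (ht : t ∈ Icc 0 T) : WW a φ p lam (p t) t = WW a φ p lam pI 0 := by
  have hc := WW_contOn D S.crv S.crv.cp S.crv.memI
  have hder : ∀ t0, 0 < t0 → t0 < T → HasDerivAt (fun t => WW a φ p lam (p t) t) 0 t0 := by
    intro t0 h0 hT
    rw [hasDerivAt_iff_isLittleO, Asymptotics.isLittleO_iff]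
    intro ε hε
    obtain ⟨ρ, hρ, H⟩ := W_t_small D S h0 hT.le hε
    have hp := S.crv.cp
    have e1 : ∀ᶠ t in 𝓝 t0, |p t - p t0| < ρ := ((by fun_prop : Continuous fun t => |p t - p t0|).tendsto t0).eventually (Iio_mem_nhds (by simpa using hρ))
    have e2 : ∀ᶠ t in 𝓝 t0, |t - t0| < ρ := ((by fun_prop : Continuous fun t => |t - t0|).tendsto t0).eventually (Iio_mem_nhds (by simpa using hρ))
    filter_upwards [e1, e2, Ioi_mem_nhds h0, Iio_mem_nhds hT] with t h1 h2 h3 h4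
    have h3 : 0 < t := h3
    have h4 : t < T := h4
    rw [smul_zero, sub_zero, Real.norm_eq_abs, Real.norm_eq_abs]
    have k1 := abs_le.1 (H (p t0) t0 t (by simpa using hρ) (by simpa using hρ) h2)
    have k2 := abs_le.1 (H (p t) t0 t h1 (by simpa using hρ) h2)
    have m1 := WW_max D S (t := t) ⟨h3.le, h4.le⟩ (S.crv.memI t0)
    have m2 := WW_max D S (t := t0) ⟨h0.le, hT.le⟩ (S.crv.memI t)
    rw [abs_le]; constructor <;> linarith
  rcases ht.1.eq_or_lt with e | e
  · rw [← e, S.p0]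
  have hT : 0 < T := e.trans_le ht.2
  have key := is_const_of_deriv_eq_zero_aux hT hc hder ht
  rw [key, S.p0]
where
  is_const_of_deriv_eq_zero_aux {T : ℝ} {g : ℝ → ℝ} (hT : 0 < T) (hg : Continuous g) (hd : ∀ t0, 0 < t0 → t0 < T → HasDerivAt g 0 t0) {t : ℝ} (ht : t ∈ Icc 0 T) : g t = g 0 := by
    rcases ht.1.eq_or_lt with e | e
    · rw [e]
    · obtain ⟨c, hc1, hc2⟩ := exists_hasDerivAt_eq_slope g (fun _ => 0) e hg.continuousOn (fun x hx => hd x hx.1 (by linarith [hx.2, ht.2]))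
      rw [eq_comm, div_eq_zero_iff] at hc2
      rcases hc2 with h | h <;> linarith

lemma WW_refl (D : Dat a φ φ' pI) (h : Crv p lam) (t : ℝ) {x : ℝ} (hx : x ∈ 𝕁) :
    WW a (fun x => -φ (-x)) (fun s => -p s) lam x t = WW a φ p lam (-x) t - WW a φ p lam 1 t := by
  have h1 := WW_sub D h t (x := -x) (y := 1) ⟨by linarith [hx.2], by linarith [hx.1]⟩ (by simp)
  have : WW a (fun x => -φ (-x)) (fun s => -p s) lam x t = - ∫ z in (-x)..1, FF a φ p lam z t := by
    unfold WW
    simp_rw [FF_refl]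
    rw [intervalIntegral.integral_neg, intervalIntegral.integral_comp_neg (fun z => FF a φ p lam z t)]
    simp
  linarith

lemma mass_right (D : Dat a φ φ' pI) (S : Sol a φ pI T p lam) {t : ℝ} (ht : t ∈ Icc 0 T) : WW a φ p lam 1 t = WW a φ p lam 1 0 := by
  have h1 := mass_const D.refl S.refl ht
  have hI := Ioo_subset_Icc_self D.hpI
  rw [WW_refl D S.crv t ⟨by linarith [(S.crv.mem t).2], by linarith [(S.crv.mem t).1]⟩, WW_refl D S.crv 0 ⟨by linarith [hI.2], by linarith [hI.1]⟩, neg_neg, neg_neg, mass_const D S ht] at h1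
  linarith

lemma FF_zero (x : ℝ) : FF a φ p lam x 0 = φ x := by
  unfold FF; rw [SS_nonpos _ le_rfl, util_nonpos _ _ le_rfl, add_zero]

lemma WW_zero (x : ℝ) : WW a φ p lam x 0 = ∫ z in (-1:ℝ)..x, φ z := by
  unfold WW; simp_rw [FF_zero]

lemma WW_hasDeriv (D : Dat a φ φ' pI) (h : Crv p lam) (t : ℝ) {x : ℝ} (hx : x ∈ Ioo (-1:ℝ) 1) : HasDerivAt (fun x => WW a φ p lam x t) (FF a φ p lam x t) x := by
  unfold WW
  have hc : ContinuousOn (fun z => FF a φ p lam z t) (Ioo (-1:ℝ) 1) := (FF_slice D h t).mono Ioo_subset_Icc_self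
  exact intervalIntegral.integral_hasDerivAt_right (FF_ii D h t (by simp) (Ioo_subset_Icc_self hx))
    (hc.stronglyMeasurableAtFilter isOpen_Ioo x hx) (hc.continuousAt (isOpen_Ioo.mem_nhds hx))

lemma region_comp {V β : ℝ → ℝ → ℝ} {I : Set ℝ²} {lo hi : ℝ → ℝ} {u v : ℝ} (hlo : Continuous lo) (hhi : Continuous hi)
    (h1 : ∀ s, -1 ≤ lo s) (h2 : ∀ s, hi s ≤ 1)
    (hV : SuperLim {z : ℝ² | lo z.2 ≤ z.1 ∧ z.1 ≤ hi z.2 ∧ u ≤ z.2 ∧ z.2 ≤ v} I V)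
    (hβ : ContinuousOn (fun z : ℝ² => β z.1 z.2) {z : ℝ² | lo z.2 ≤ z.1 ∧ z.1 ≤ hi z.2 ∧ u ≤ z.2 ∧ z.2 ≤ v})
    (hbl : ∀ s ∈ Icc u v, lo s ≤ hi s → β (lo s) s ≤ V (lo s) s) (hbh : ∀ s ∈ Icc u v, lo s ≤ hi s → β (hi s) s ≤ V (hi s) s)
    (hb0 : ∀ x, lo u ≤ x → x ≤ hi u → β x u ≤ V x u)
    (hin : ∀ x s, lo s < x → x < hi s → u < s → s ≤ v → (x, s) ∈ I ∧ ∃ A B, ∃ D : ℝ → ℝ, HasDerivAt (β x) A s ∧ (∀ᶠ y in 𝓝 x, HasDerivAt (fun y => β y s) (D y) y) ∧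
    HasDerivAt D B x ∧ A ≤ B) {x s : ℝ} (k1 : lo s ≤ x) (k2 : x ≤ hi s) (k3 : u ≤ s) (k4 : s ≤ v) : β x s ≤ V x s := by
  refine comparison (τ := u) (S := v - u) (I := I) ?_ hV hβ ?_ ?_ x s ⟨k1, k2, k3, k4⟩
  · refine (isCompact_Icc.prod isCompact_Icc : IsCompact (𝕁 ×ˢ Icc u v)).of_isClosed_subset ?_ ?_
    · have c1 : IsClosed {z : ℝ² | lo z.2 ≤ z.1} := isClosed_le (by fun_prop) (by fun_prop)
      have c2 : IsClosed {z : ℝ² | z.1 ≤ hi z.2} := isClosed_le (by fun_prop) (by fun_prop)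
      have c3 : IsClosed {z : ℝ² | u ≤ z.2} := isClosed_le (by fun_prop) (by fun_prop)
      have c4 : IsClosed {z : ℝ² | z.2 ≤ v} := isClosed_le (by fun_prop) (by fun_prop)
      exact c1.inter (c2.inter (c3.inter c4))
    · rintro z ⟨q1, q2, q3, q4⟩
      exact ⟨⟨(h1 _).trans q1, q2.trans (h2 _)⟩, q3, q4⟩
  · rintro x s ⟨-, -, q3, q4⟩
    exact ⟨q3, by linarith⟩
  · rintro x s ⟨q1, q2, q3, q4⟩
    simp only at q1 q2 q3 q4
    rcases q1.eq_or_lt with e | e1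
    · left; rw [← e]; exact hbl s ⟨q3, q4⟩ (q1.trans q2)
    rcases q2.eq_or_lt with e | e2
    · left; rw [e]; exact hbh s ⟨q3, q4⟩ (q1.trans q2)
    rcases q3.eq_or_lt with e | e3
    · left; rw [← e] at q1 q2 ⊢; exact hb0 x q1 q2
    right
    obtain ⟨m1, m2⟩ := hin x s e1 e2 e3 q4
    refine ⟨m1, ?_, ?_, m2⟩
    · filter_upwards [Ioi_mem_nhds e1, Iio_mem_nhds e2] with y y1 y2
      exact ⟨le_of_lt y1, le_of_lt y2, q3, q4⟩
    · have a1 : ∀ᶠ s' in 𝓝 s, lo s' < x := (hlo.tendsto s).eventually (Iio_mem_nhds e1)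
      have a2 : ∀ᶠ s' in 𝓝 s, x < hi s' := (hhi.tendsto s).eventually (Ioi_mem_nhds e2)
      filter_upwards [a1.filter_mono nhdsWithin_le_nhds, a2.filter_mono nhdsWithin_le_nhds, nhdsWithin_le_nhds (Ioi_mem_nhds e3), self_mem_nhdsWithin] with s' b1 b2 b3 b4
      have b4 : s' < s := b4
      exact ⟨b1.le, b2.le, le_of_lt b3, by show s' ≤ v; linarith⟩

lemma Crv.gap (h : Crv p lam) (u v : ℝ) : ∃ d > 0, d ≤ 1 ∧ ∀ s ∈ Icc u v, p s ≤ 1 - d := by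
  rcases (Icc u v).eq_empty_or_nonempty with e | e
  · exact ⟨1, one_pos, le_rfl, by simp [e]⟩
  obtain ⟨s0, hs0, hm⟩ := isCompact_Icc.exists_isMaxOn e h.cp.continuousOn
  refine ⟨min 1 (1 - p s0), lt_min one_pos (by linarith [(h.mem s0).2]), min_le_left _ _, fun s hs => ?_⟩
  have : p s ≤ p s0 := hm hs
  have := min_le_right 1 (1 - p s0)
  linarith

/-- initial mass lower bound -/
lemma eta0 (D : Dat a φ φ' pI) : ∃ η > 0, (∀ x, -1 ≤ x → x ≤ pI → η * (x+1) ≤ ∫ z in (-1:ℝ)..x, φ z) ∧ 2*η ≤ ∫ z in (-1:ℝ)..pI, φ z := by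
  have hm := D.hpI
  have h1 : 0 < φ (-1) := D.pos (-1) ⟨le_rfl, hm.1⟩
  have ii : ∀ x y, IntervalIntegrable φ volume x y := fun x y => D.c.intervalIntegrable _ _
  obtain ⟨r, hr, H⟩ := Metric.eventually_nhds_iff.1 ((D.c.tendsto (-1)).eventually (Ioi_mem_nhds (show φ (-1)/2 < φ (-1) by linarith)))
  set r' := min (r/2) ((pI+1)/2) with hr'
  have hr0 : 0 < r' := lt_min (by linarith) (by linarith [hm.1])
  have l1 : r' ≤ r/2 := min_le_left _ _
  have l2 : r' ≤ (pI+1)/2 := min_le_right _ _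
  have A : ∀ x, -1 ≤ x → x ≤ -1 + r' → φ (-1)/2 * (x+1) ≤ ∫ z in (-1:ℝ)..x, φ z := fun x hx hx2 => by
    have := intervalIntegral.integral_mono_on (μ := volume) hx (intervalIntegrable_const (c := φ (-1)/2)) (ii (-1) x) (fun z hz => le_of_lt (H (y := z) (by rw [Real.dist_eq, abs_of_nonneg] <;> linarith [hz.1, hz.2])))
    rw [intervalIntegral.integral_const, smul_eq_mul] at this
    linarith
  have Bm : ∀ x y, -1 ≤ x → x ≤ y → y ≤ pI → ∫ z in (-1:ℝ)..x, φ z ≤ ∫ z in (-1:ℝ)..y, φ z := fun x y hx hxy hy => by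
    rw [← intervalIntegral.integral_add_adjacent_intervals (ii (-1) x) (ii x y)]
    have : 0 ≤ ∫ z in x..y, φ z := intervalIntegral.integral_nonneg hxy fun z hz => by
      rcases (hz.2.trans hy).eq_or_lt with e | e
      · rw [e, D.z]
      · exact (D.pos z ⟨by linarith [hz.1], e⟩).le
    linarith
  have g := A (-1+r') (by linarith) le_rfl
  have gp : 0 < ∫ z in (-1:ℝ)..(-1+r'), φ z := lt_of_lt_of_le (by positivity) (show φ (-1)/2 * r' ≤ _ by linarith [g, show φ (-1)/2 * (-1 + r' + 1) = φ (-1)/2 * r' by ring])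
  set g0 := ∫ z in (-1:ℝ)..(-1+r'), φ z
  refine ⟨min (φ (-1)/2) (g0/2), by positivity, fun x hx hx2 => ?_, ?_⟩
  · rcases le_total x (-1+r') with e | e
    · refine le_trans ?_ (A x hx e)
      exact mul_le_mul_of_nonneg_right (min_le_left _ _) (by linarith)
    · refine le_trans ?_ (Bm _ _ (by linarith) e hx2)
      refine (mul_le_mul_of_nonneg_right (min_le_right _ _) (by linarith)).trans ?_
      nlinarith [hm.2]
  · have := Bm (-1+r') pI (by linarith) (by linarith) le_rfl
    have := min_le_right (φ (-1)/2) (g0/2)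
    linarith

lemma W_lower (D : Dat a φ φ' pI) (S : Sol a φ pI T p lam) {η : ℝ} (hη : 0 < η) (e1 : ∀ x, -1 ≤ x → x ≤ pI → η * (x+1) ≤ ∫ z in (-1:ℝ)..x, φ z)
    (e2 : 2*η ≤ ∫ z in (-1:ℝ)..pI, φ z) {x s : ℝ} (hs : s ∈ Icc 0 T) (hx : -1 ≤ x) (hxp : x ≤ p s) : η * (x+1) ≤ WW a φ p lam x s := by
  obtain ⟨d, hd, hd1, hgap⟩ := S.crv.gap 0 T
  have hp := S.crv.memI
  refine region_comp (β := fun x _ => η * (x+1)) (V := WW a φ p lam) (lo := fun _ => -1) (hi := p) (u := 0) (v := T) continuous_const S.crv.cp (fun _ => le_rfl) (fun s => (hp s).2) (W_super D S.crv hd (T := T) (fun t ht => (S.lpos t ht).le) ?_) (by fun_prop) ?_ ?_ ?_ ?_ hx hxp hs.1 hs.2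
  · rintro z ⟨q1, q2, q3, q4⟩
    exact ⟨abs_le.2 ⟨q1, q2.trans (hp _).2⟩, q3, q4⟩
  · intro s _ _; rw [WW_left]; simp
  · intro s hs _
    rw [mass_const D S hs, WW_zero]
    nlinarith [(hp s).2]
  · intro x hx hx2
    rw [WW_zero]; rw [S.p0] at hx2; exact e1 x hx hx2
  · intro x s h1 h2 h3 h4
    refine ⟨⟨⟨h1.le, by have := hgap s ⟨h3.le, h4⟩; simp only; linarith⟩, h3, h4⟩, 0, 0, fun _ => η, hasDerivAt_const _ _, Eventually.of_forall fun y => ?_, hasDerivAt_const _ _, le_rfl⟩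
    exact (((hasDerivAt_id y).add_const 1).const_mul η).congr_deriv (by ring)

/-- upper bound for the deficit to the right -/
lemma A_upper (D : Dat a φ φ' pI) (S : Sol a φ pI T p lam) {B : ℝ} (hB : ∀ x, |φ x| ≤ B) {x s : ℝ} (hs : s ∈ Icc 0 T) (hx : p s ≤ x) (hx1 : x < 1) :
    WW a φ p lam pI 0 - 2 * B * (x+1) ≤ WW a φ p lam x s := by
  have hB0 : 0 ≤ B := (abs_nonneg _).trans (hB 0)
  obtain ⟨d, hd, hd1, hgap⟩ := S.crv.gap 0 T
  have hp := S.crv.memI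
  have hI := Ioo_subset_Icc_self D.hpI
  have ii : ∀ x y, IntervalIntegrable φ volume x y := fun x y => D.c.intervalIntegrable _ _
  have hint : ∀ x, pI ≤ x → ∫ z in pI..x, φ z ≥ -(B * (x - pI)) := fun x hx => by
    have := intervalIntegral.integral_mono_on (μ := volume) hx (intervalIntegrable_const (c := -B)) (ii pI x) (fun z _ => (abs_le.1 (hB z)).1)
    rw [intervalIntegral.integral_const, smul_eq_mul] at this
    nlinarith
  have hsub : ∀ x, WW a φ p lam x 0 = WW a φ p lam pI 0 + ∫ z in pI..x, φ z := fun x => by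
    rw [WW_zero, WW_zero, intervalIntegral.integral_add_adjacent_intervals (ii _ _) (ii _ _)]
  set d' := min d (1 - x)
  have hd' : 0 < d' := lt_min hd (by linarith)
  have l1 : d' ≤ d := min_le_left _ _
  have l2 : d' ≤ 1 - x := min_le_right _ _
  refine region_comp (β := fun x _ => WW a φ p lam pI 0 - 2 * B * (x+1)) (V := WW a φ p lam) (lo := p) (hi := fun _ => 1 - d') (u := 0) (v := T) S.crv.cp continuous_const (fun s => (hp s).1) (fun s => by linarith) (W_super D S.crv hd' (T := T) (fun t ht => (S.lpos t ht).le) ?_) (by fun_prop) ?_ ?_ ?_ ?_ hx (by linarith) hs.1 hs.2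
  · rintro z ⟨q1, q2, q3, q4⟩
    exact ⟨abs_le.2 ⟨(hp _).1.trans q1, by linarith⟩, q3, q4⟩
  · intro s hs _
    rw [mass_const D S hs]; nlinarith [(hp s).1]
  · intro s hs _
    have k1 := WW_anti D S hs (x := 1 - d') (y := 1) (by linarith [hgap s hs]) (by linarith) le_rfl
    rw [mass_right D S hs, hsub 1] at k1
    have := hint 1 hI.2
    nlinarith [hI.1]
  · intro x hx hx2
    rw [S.p0] at hx
    rw [hsub x]
    have := hint x hx
    nlinarith [hI.1]
  · intro x s h1 h2 h3 h4
    refine ⟨⟨⟨(hp s).1.trans h1.le, h2.le⟩, h3, h4⟩, 0, 0, fun _ => -(2*B), hasDerivAt_const _ _, Eventually.of_forall fun y => ?_, hasDerivAt_const _ _, le_rfl⟩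
    exact ((((hasDerivAt_id y).add_const 1).const_mul (2*B)).const_sub _).congr_deriv (by ring)

/-- the deficit stays small for short times left of a previous position of the interface -/
lemma A_exp (D : Dat a φ φ' pI) (S : Sol a φ pI T p lam) {τ s h z : ℝ} (hτ : 0 ≤ τ) (hτs : τ ≤ s) (hs : s ≤ T) (hh : 0 < h) (hsh : s - τ ≤ h) (hz : p s ≤ z) (hz2 : z ≤ p τ) :
    WW a φ p lam pI 0 - (WW a φ p lam pI 0 - WW a φ p lam 1 0) * Real.exp (-(p τ - z)^2/(4*h)) ≤ WW a φ p lam z s := by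
  obtain ⟨d, hd, hd1, hgap⟩ := S.crv.gap 0 T
  have hp := S.crv.memI
  have hcp := S.crv.cp
  set k := (p τ - z)/(2*h) with hk
  have hk0 : 0 ≤ k := div_nonneg (by linarith) (by linarith)
  have hM : 0 ≤ WW a φ p lam pI 0 - WW a φ p lam 1 0 := by
    have := WW_max D S (t := 0) (x := 1) ⟨le_rfl, by linarith⟩ (by simp)
    rw [S.p0] at this; linarith
  set M := WW a φ p lam pI 0 - WW a φ p lam 1 0 with hMd
  have main := region_comp (β := fun x t => WW a φ p lam pI 0 - M * Real.exp (k * (x - p τ) + k^2 * (t - τ))) (V := WW a φ p lam) (lo := p) (hi := fun _ => p τ) (u := τ) (v := T) (by fun_prop) continuous_const (fun s => (hp s).1) (fun s => (hp τ).2) (W_super D S.crv hd (T := T) (fun t ht => (S.lpos t ht).le) ?_) (by fun_prop) ?_ ?_ ?_ ?_ (x := z) (s := s) hz hz2 hτs hs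
  · refine le_trans ?_ main
    have : Real.exp (k * (z - p τ) + k^2 * (s - τ)) ≤ Real.exp (-(p τ - z)^2/(4*h)) := by
      refine Real.exp_le_exp.2 ?_
      have e : k^2 * h = (p τ - z)^2/(4*h) := by rw [hk]; field_simp; ring
      have e2 : k * (z - p τ) = - (2 * ((p τ - z)^2/(4*h))) := by rw [hk]; field_simp; ring
      have : k^2 * (s - τ) ≤ k^2 * h := mul_le_mul_of_nonneg_left hsh (sq_nonneg _)
      rw [neg_div]; linarith
    have := mul_le_mul_of_nonneg_left this hM
    linarith
  · rintro z ⟨q1, q2, q3, q4⟩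
    exact ⟨abs_le.2 ⟨(hp z.2).1.trans q1, q2.trans (hp _).2⟩, hτ.trans q3, q4⟩
  · intro s hs _
    have hs' : s ∈ Icc 0 T := ⟨hτ.trans hs.1, hs.2⟩
    rw [mass_const D S hs']
    have := mul_nonneg hM (Real.exp_pos (k * (p s - p τ) + k^2 * (s - τ))).le
    linarith
  · intro s hs e
    have hs' : s ∈ Icc 0 T := ⟨hτ.trans hs.1, hs.2⟩
    have k2 : 1 ≤ Real.exp (k * (p τ - p τ) + k^2 * (s - τ)) := Real.one_le_exp (by rw [sub_self, mul_zero, zero_add]; exact mul_nonneg (sq_nonneg _) (by linarith [hs.1]))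
    have k3 : WW a φ p lam 1 0 ≤ WW a φ p lam (p τ) s := by
      rw [← mass_right D S hs']
      exact WW_anti D S hs' e (hp τ).2 le_rfl
    nlinarith
  · intro x hx hx2
    have : x = p τ := le_antisymm hx2 hx
    rw [this, mass_const D S ⟨hτ, by linarith⟩]
    have := mul_nonneg hM (Real.exp_pos (k * (p τ - p τ) + k^2 * (τ - τ))).le
    linarith
  · intro x s h1 h2 h3 h4
    refine ⟨⟨⟨(hp s).1.trans h1.le, h2.le.trans (hgap τ ⟨hτ, by linarith⟩)⟩, by show 0 < s; linarith, h4⟩, -(M * (Real.exp (k * (x - p τ) + k^2 * (s - τ)) * k^2)), -(M * (Real.exp (k * (x - p τ) + k^2 * (s - τ)) * k * k)), fun y => -(M * (Real.exp (k * (y - p τ) + k^2 * (s - τ)) * k)), ?_, Eventually.of_forall fun y => ?_, ?_, by apply le_of_eq; ring⟩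
    · have := ((((hasDerivAt_id s).sub_const τ).const_mul (k^2)).const_add (k * (x - p τ))).exp
      exact ((this.const_mul M).const_sub _).congr_deriv (by simp)
    · have := ((((hasDerivAt_id y).sub_const (p τ)).const_mul k).add_const (k^2 * (s - τ))).exp
      exact ((this.const_mul M).const_sub _).congr_deriv (by simp)
    · have := ((((hasDerivAt_id x).sub_const (p τ)).const_mul k).add_const (k^2 * (s - τ))).exp
      exact (((this.mul_const k).const_mul M).neg).congr_deriv (by simp)

lemma heatK_le_inv {L : ℝ} (hL : 0 < L) (t : ℝ) : heatK L t ≤ 1/L := by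
  rcases le_or_gt t 0 with ht | ht
  · rw [heatK_nonpos_time ht]; positivity
  unfold heatK
  have hw : 0 < √(4*t) := by positivity
  have hw2 : √(4*t)^2 = 4*t := Real.sq_sqrt (by positivity)
  have h1 : √(4*t) ≤ √(4 * π * t) := Real.sqrt_le_sqrt (by nlinarith [Real.pi_gt_three])
  have h2 : Real.exp (-(L^2)/(4*t)) ≤ 1/(1 + L^2/(4*t)) := by
    rw [neg_div, Real.exp_neg, ← one_div]
    exact one_div_le_one_div_of_le (by positivity) (by linarith [Real.add_one_le_exp (L^2/(4*t))])
  have h3 : (√(4 * π * t))⁻¹ ≤ (√(4*t))⁻¹ := inv_anti₀ hw h1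
  refine (mul_le_mul h3 h2 (Real.exp_pos _).le (by positivity)).trans ?_
  set w := √(4*t) with hwd
  clear_value w
  rw [← hw2]
  rw [show w⁻¹ * (1/(1 + L^2/w^2)) = 1/(w + L^2/w) by field_simp]
  refine one_div_le_one_div_of_le hL ?_
  rw [← sub_nonneg, show w + L^2/w - L = ((w - L)^2 + w*L)/w by field_simp; ring]
  positivity

lemma Caloric.data {f : ℝ² → ℝ} {U : Set ℝ²} (hU : IsOpen U) (h : Caloric f U) {x t : ℝ} (hz : (x, t) ∈ U) :
    ∃ A B, ∃ D : ℝ → ℝ, HasDerivAt (fun s => f (x, s)) A t ∧ (∀ᶠ y in 𝓝 x, HasDerivAt (fun y => f (y, t)) (D y) y) ∧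
    HasDerivAt D B x ∧ A = B := by
  refine ⟨dT f (x, t), dX (dX f) (x, t), fun y => dX f (y, t), h.smooth.hasDerivT hU hz, ?_, (h.smooth.dX hU).hasDerivX hU hz, h.heat _ hz⟩
  filter_upwards [ev_slice hU hz] with y hy
  exact h.smooth.hasDerivX hU hy

lemma left_deriv_nonpos {g : ℝ → ℝ} {g' c l : ℝ} (hg : HasDerivAt g g' c) (h0 : g c = 0) (hl : l < c) (h : ∀ x ∈ Ico l c, 0 ≤ g x) : g' ≤ 0 := by
  by_contra hcon
  push Not at hcon
  have h1 := hg.tendsto_slope.mono_left (nhdsWithin_mono c (fun x (hx : x < c) => hx.ne) : 𝓝[<] c ≤ 𝓝[≠] c)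
  have h2 : ∀ᶠ x in 𝓝[<] c, l < x := nhdsWithin_le_nhds (Ioi_mem_nhds hl)
  obtain ⟨x, x1, x2, x3⟩ := ((h1.eventually (Ioi_mem_nhds hcon)).and (h2.and self_mem_nhdsWithin)).exists
  have x3 : x < c := x3
  have x2 : l < x := x2
  have x1 : 0 < slope g c x := x1
  rw [slope_def_field, h0, sub_zero] at x1
  have := h x ⟨x2.le, x3⟩
  have := div_nonpos_of_nonneg_of_nonpos this (by linarith : x - c ≤ 0)
  linarith

/-- moving plane lemma -/
lemma MPL (D : Dat a φ φ' pI) (S : Sol a φ pI T p lam) {τ t c ℓ m0 : ℝ} (hτ : 0 ≤ τ) (hτt : τ < t) (htT : t ≤ T) (hc : ∀ s ∈ Icc τ t, c ≤ p s)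
    (hℓ : -1 ≤ ℓ) (hℓc : ℓ < c) (hr : 2*c - ℓ < 1) (hm0 : 0 < m0) (hZ : ∀ s ∈ Icc τ t, m0 ≤ ZZ a φ p lam c ℓ s) (hZ0 : ∀ x ∈ Icc ℓ c, 0 ≤ ZZ a φ p lam c x τ) :
    m0 * ((c-ℓ)^2/(t-τ)) * heatK (2*(c-ℓ)) (t-τ) ≤ FF a φ p lam c t := by
  set L := c - ℓ with hL
  have hL0 : 0 < L := by linarith
  set w : ℝ² → ℝ := fun z => (m0 * L) * (heatK (1 * z.1 + -(ℓ - L)) (z.2 + -τ) - heatK (1 * z.1 + -(2*c - ℓ + L)) (z.2 + -τ)) with hw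
  set U : Set ℝ² := {z | ℓ - L < z.1 ∧ z.1 < 2*c-ℓ+L} with hUd
  have hU1 : IsOpen {z : ℝ² | ℓ - L < z.1} := isOpen_lt (by fun_prop) (by fun_prop)
  have hU2 : IsOpen {z : ℝ² | z.1 < 2*c-ℓ+L} := isOpen_lt (by fun_prop) (by fun_prop)
  have hU : IsOpen U := hU1.inter hU2
  have hwc : Caloric w U := by
    refine Caloric.const_mul hU (Caloric.sub hU ?_ ?_) _
    · refine (heatK_caloric.affine isOpen_ne_zero 1 (-(ℓ-L)) (-τ) (by norm_num)).mono ?_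
      rintro z ⟨h1, h2⟩ e
      have := congrArg Prod.fst e
      simp only [Prod.fst_zero] at this; linarith
    · refine (heatK_caloric.affine isOpen_ne_zero 1 (-(2*c-ℓ+L)) (-τ) (by norm_num)).mono ?_
      rintro z ⟨h1, h2⟩ e
      have := congrArg Prod.fst e
      simp only [Prod.fst_zero] at this; linarith
  have hw0 : ∀ s, w (c, s) = 0 := fun s => by
    simp only [hw]
    rw [show (1:ℝ) * c + -(ℓ - L) = 2*L by rw [hL]; ring, show (1:ℝ) * c + -(2*c-ℓ+L) = -(2*L) by rw [hL]; ring, heatK_neg]; ring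
  have hwl : ∀ s, w (ℓ, s) ≤ m0 := fun s => by
    simp only [hw]
    rw [show (1:ℝ) * ℓ + -(ℓ - L) = L by ring]
    have h1 := heatK_le_inv hL0 (s + -τ)
    have h2 := heatK_nonneg (1 * ℓ + -(2*c-ℓ+L)) (s + -τ)
    calc m0 * L * _ ≤ m0 * L * (1/L) := mul_le_mul_of_nonneg_left (by linarith) (by positivity)
      _ = m0 := by field_simp
  have hcI : c ∈ Ioo (-1:ℝ) 1 := ⟨by linarith, by linarith⟩
  have comp : ∀ x ∈ Icc ℓ c, w (x, t) ≤ ZZ a φ p lam c x t := by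
    intro x hx
    refine region_comp (β := fun x t => w (x, t)) (V := ZZ a φ p lam c) (lo := fun _ => ℓ) (hi := fun _ => c) (u := τ) (v := t) continuous_const continuous_const (fun _ => hℓ) (fun _ => by linarith)
      (Z_super D S.crv (d := 1 - (2*c-ℓ)) (T := t) (by linarith) (fun s hs => (S.lpos s ⟨hs.1, hs.2.trans htT⟩).le) ?_) (hwc.smooth.continuousOn.mono ?_) ?_ ?_ ?_ ?_ hx.1 hx.2 hτt.le le_rfl
    · rintro z ⟨q1, q2, q3, q4⟩
      exact ⟨abs_le.2 ⟨by linarith, by linarith⟩, abs_le.2 ⟨by linarith, by linarith⟩, by linarith, q4⟩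
    · rintro z ⟨q1, q2, q3, q4⟩
      exact ⟨by linarith, by linarith⟩
    · intro s hs _; exact (hwl s).trans (hZ s hs)
    · intro s hs _
      show w (c, s) ≤ _
      rw [hw0, ZZ]; simp [two_mul]
    · intro x h1 h2
      have : w (x, τ) = 0 := by simp only [hw]; rw [add_neg_cancel, heatK_nonpos_time le_rfl, heatK_nonpos_time le_rfl]; ring
      show w (x, τ) ≤ _
      rw [this]; exact hZ0 x ⟨h1, h2⟩
    · intro x s h1 h2 h3 h4
      refine ⟨⟨by simp only; linarith, h2.le, hc s ⟨h3.le, h4⟩, by simp only; linarith, by simp only; linarith, h4⟩, ?_⟩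
      obtain ⟨A, B, D', k1, k2, k3, k4⟩ := hwc.data hU (x := x) (t := s) ⟨by simp only; linarith, by simp only; linarith⟩
      exact ⟨A, B, D', k1, k2, k3, k4.le⟩
  have hσ : 0 < t - τ := by linarith
  -- derivative comparison at c
  have dZ : HasDerivAt (fun x => ZZ a φ p lam c x t) (-2 * FF a φ p lam c t) c := by
    unfold ZZ
    have h1 := WW_hasDeriv D S.crv t hcI
    have h1' : HasDerivAt (fun x => WW a φ p lam x t) (FF a φ p lam c t) (2*c - c) := by rw [show 2*c - c = c by ring]; exact h1
    have h2 := HasDerivAt.comp c h1' ((hasDerivAt_id c).const_sub (2*c))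
    exact (h2.sub h1).congr_deriv (by ring)
  have dW : HasDerivAt (fun x => w (x, t)) ((m0*L) * (-(2*(2*L)/(2*(t-τ))) * heatK (2*L) (t-τ))) c := by
    simp only [hw]
    have e1 : (1:ℝ) * c + -(ℓ - L) = 2*L := by rw [hL]; ring
    have e2 : (1:ℝ) * c + -(2*c-ℓ+L) = -(2*L) := by rw [hL]; ring
    have k1 := heatK_hasDerivX (1 * c + -(ℓ - L)) hσ
    have k2 := heatK_hasDerivX (1 * c + -(2*c-ℓ+L)) hσ
    have i1 : HasDerivAt (fun x : ℝ => 1 * x + -(ℓ - L)) 1 c := (((hasDerivAt_id c).const_mul 1).add_const _).congr_deriv (by norm_num)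
    have i2 : HasDerivAt (fun x : ℝ => 1 * x + -(2*c-ℓ+L)) 1 c := (((hasDerivAt_id c).const_mul 1).add_const _).congr_deriv (by norm_num)
    refine (((HasDerivAt.comp c k1 i1).sub (HasDerivAt.comp c k2 i2)).const_mul (m0*L)).congr_deriv ?_
    rw [e1, e2, heatK_neg]; ring
  have hd := dZ.sub dW
  have hnp : -2 * FF a φ p lam c t - (m0*L) * (-(2*(2*L)/(2*(t-τ))) * heatK (2*L) (t-τ)) ≤ 0 := by
    have e0 : ZZ a φ p lam c c t = 0 := by rw [ZZ]; simp [two_mul]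
    refine left_deriv_nonpos hd ?_ hℓc fun x hx => ?_
    · show ZZ a φ p lam c c t - w (c, t) = 0
      rw [e0, hw0, sub_zero]
    · have := comp x ⟨hx.1, hx.2.le⟩
      show 0 ≤ ZZ a φ p lam c x t - w (x, t)
      linarith
  have : (m0*L) * (-(2*(2*L)/(2*(t-τ))) * heatK (2*L) (t-τ)) = - 2 * (m0 * (L^2/(t-τ)) * heatK (2*L) (t-τ)) := by field_simp
  linarith

lemma P_left (D : Dat a φ φ' pI) : ∃ ε0 > 0, ε0 ≤ 1/2 ∧ ∀ T p lam, Sol a φ pI T p lam → ∀ t ∈ Icc 0 T, -1 + ε0 ≤ p t := by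
  obtain ⟨η, hη, he1, he2⟩ := eta0 D
  obtain ⟨B, hB⟩ : ∃ B, 0 < B ∧ ∀ x, |φ x| ≤ B := by
    obtain ⟨B, -, hB⟩ := D.bd
    exact ⟨max B 1, by positivity, fun x => (hB x).trans (le_max_left _ _)⟩
  obtain ⟨hB0, hB⟩ := hB
  have hm := D.hpI
  set M := ∫ z in (-1:ℝ)..pI, φ z with hM
  have hM0 : 0 < M := by linarith
  refine ⟨min (1/2) (min ((pI+1)/2) (M/(8*B))), lt_min (by norm_num) (lt_min (by linarith [hm.1]) (by positivity)), min_le_left _ _, ?_⟩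
  intro T p lam S t ht
  obtain ⟨t0, ht0, hmin⟩ := isCompact_Icc.exists_isMinOn ⟨t, ht⟩ S.crv.cp.continuousOn
  have hmt : p t0 ≤ p t := hmin ht
  refine le_trans ?_ hmt
  by_contra hcon
  push Not at hcon
  have c0 : p t0 + 1 < 1/2 := by have := min_le_left (1/2) (min ((pI+1)/2) (M/(8*B))); linarith
  have c1 : p t0 + 1 < (pI+1)/2 := by have := (min_le_right (1/2) (min ((pI+1)/2) (M/(8*B)))).trans (min_le_left _ _); linarith
  have c2 : p t0 + 1 < M/(8*B) := by have := (min_le_right (1/2) (min ((pI+1)/2) (M/(8*B)))).trans (min_le_right _ _); linarith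
  rw [lt_div_iff₀ (by positivity)] at c2
  have hp0 := (S.crv.mem t0).1
  have ht00 : 0 < t0 := by
    rcases ht0.1.eq_or_lt with e | e
    · rw [← e, S.p0] at c1 hp0; linarith
    · exact e
  have hx0 : 0 < p t0 + 1 := by linarith
  have := MPL D S (τ := 0) (t := t0) (c := p t0) (ℓ := -1) (m0 := min (M/2) (η * (2 * p t0 + 2))) le_rfl ht00 ht0.2
    (fun s hs => hmin ⟨hs.1, hs.2.trans ht0.2⟩) le_rfl hp0 (by linarith) (lt_min (by linarith) (mul_pos hη (by linarith))) (fun s hs => ?_) (fun x hx => ?_)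
  · rw [S.zero t0 ht0] at this
    have hpos : 0 < min (M/2) (η * (2 * p t0 + 2)) * ((p t0 - -1)^2/(t0-0)) * heatK (2*(p t0 - -1)) (t0-0) := by
      have h1 : 0 < min (M/2) (η * (2 * p t0 + 2)) := lt_min (by linarith) (mul_pos hη (by linarith))
      have h2 : 0 < heatK (2*(p t0 - -1)) (t0-0) := heatK_pos _ (by linarith)
      have h3 : 0 < p t0 - -1 := by linarith
      have h4 : 0 < t0 - 0 := by linarith
      positivity
    linarith
  · have hs' : s ∈ Icc 0 T := ⟨hs.1, hs.2.trans ht0.2⟩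
    unfold ZZ
    rw [WW_left, sub_zero]
    rcases le_total (2 * p t0 - -1) (p s) with e | e
    · refine (min_le_right _ _).trans ?_
      have := W_lower D S hη he1 he2 hs' (by linarith) e
      linarith
    · refine (min_le_left _ _).trans ?_
      have := A_upper D S hB hs' e (by linarith)
      rw [WW_zero, ← hM] at this
      nlinarith
  · unfold ZZ
    have := WW_mono D S (t := 0) (x := x) (y := 2 * p t0 - x) ⟨le_rfl, ht.1.trans ht.2⟩ hx.1 (by linarith [hx.2]) (by rw [S.p0]; linarith [hx.1])
    linarith

lemma P_bound (D : Dat a φ φ' pI) : ∃ ε0 > 0, ε0 ≤ 1/2 ∧ ∀ T p lam, Sol a φ pI T p lam → ∀ t ∈ Icc 0 T, -1 + ε0 ≤ p t ∧ p t ≤ 1 - ε0 := by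
  obtain ⟨e1, h1, h1', H1⟩ := P_left D
  obtain ⟨e2, h2, h2', H2⟩ := P_left D.refl
  refine ⟨min e1 e2, lt_min h1 h2, (min_le_left _ _).trans h1', fun T p lam S t ht => ⟨?_, ?_⟩⟩
  · have := H1 T p lam S t ht
    have := min_le_left e1 e2; linarith
  · have := H2 T _ lam S.refl t ht
    have := min_le_right e1 e2; linarith

/-- Uniform interior lower bound at distance `r` from a lower barrier for `p`. -/
def LBr (a : ℝ) (φ : ℝ → ℝ) (pI r : ℝ) : Prop := ∀ H > 0, ∀ δ > 0, ∃ c > 0, ∀ T p lam, Sol a φ pI T p lam → ∀ t, H ≤ t → t ≤ T → ∀ xm < 1,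
  (∀ s ∈ Icc (t - H) t, xm ≤ p s) → ∀ x, -1 + δ ≤ x → x ≤ xm - r → c ≤ FF a φ p lam x t

lemma W_incr (D : Dat a φ φ' pI) (S : Sol a φ pI T p lam) {t x y c : ℝ} (hx : -1 ≤ x) (hxy : x ≤ y) (hy : y ≤ 1) (hc : ∀ z ∈ Icc x y, c ≤ FF a φ p lam z t) :
    c * (y - x) ≤ WW a φ p lam y t - WW a φ p lam x t := by
  rw [WW_sub D S.crv t (x := x) (y := y) ⟨hx, by linarith⟩ ⟨by linarith, by linarith⟩]
  have := intervalIntegral.integral_mono_on hxy (intervalIntegrable_const (c := c)) (FF_ii D S.crv t (x := x) (y := y) ⟨hx, by linarith⟩ ⟨by linarith, by linarith⟩) hc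
  rw [intervalIntegral.integral_const, smul_eq_mul] at this
  linarith

lemma LB_step (D : Dat a φ φ' pI) {r : ℝ} (hr : 0 < r) (h : LBr a φ pI r) : LBr a φ pI (3/4*r) := by
  intro H hH δ hδ
  obtain ⟨η, hη, he1, he2⟩ := eta0 D
  obtain ⟨c, hc, hIH⟩ := h (H/2) (by linarith) (r/4) (by linarith)
  have k1 : 0 < heatK 4 H := heatK_pos _ hH
  have k2 : 0 < heatK 4 (H/2) := heatK_pos _ (by linarith)
  set c1 := η * (2*δ) * (δ^2/H) * heatK 4 H with hc1
  set c2 := c * (r/4) * ((3/4*r)^2/(H/2)) * heatK 4 (H/2) with hc2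
  have p1 : 0 < c1 := by positivity
  have p2 : 0 < c2 := by positivity
  refine ⟨min c1 c2, lt_min p1 p2, fun T p lam S t hHt htT xm hxm hp x hx hxr => ?_⟩
  have hpt : xm ≤ p t := hp t ⟨by linarith, le_rfl⟩
  rcases le_or_gt (2*x+1) xm with hA | hB
  · refine (min_le_left _ _).trans ?_
    have key := MPL D S (τ := t - H) (t := t) (c := x) (ℓ := -1) (m0 := η * (2*(x+1))) (by linarith) (by linarith) htT (fun s hs => by linarith [hp s hs]) le_rfl (by linarith) (by linarith)
      (by have : 0 < x + 1 := by linarith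
          positivity) (fun s hs => by
        unfold ZZ
        rw [WW_left, sub_zero]
        have := W_lower D S hη he1 he2 (x := 2*x - -1) (s := s) ⟨by linarith [hs.1], by linarith [hs.2]⟩ (by linarith) (by linarith [hp s hs])
        linarith) (fun y hy => by
        unfold ZZ
        have := WW_mono D S (t := t - H) (x := y) (y := 2*x - y) ⟨by linarith, by linarith⟩ hy.1 (by linarith [hy.2]) (by linarith [hp (t-H) ⟨le_rfl, by linarith⟩, hy.1])
        linarith)
    refine le_trans ?_ key
    have e : t - (t - H) = H := by ring
    rw [e, sub_neg_eq_add]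
    have hk : heatK 4 H ≤ heatK (2*(x+1)) H := heatK_anti (by rw [abs_of_nonneg (by linarith), abs_of_pos (by norm_num)]; linarith)
    rw [hc1]
    have : δ ≤ x + 1 := by linarith
    generalize x + 1 = y at this hk ⊢
    have : 0 < y := by linarith
    gcongr
  · refine (min_le_right _ _).trans ?_
    have hx1 : (-1:ℝ) < 2*x - xm := by linarith
    have key := MPL D S (τ := t - H/2) (t := t) (c := x) (ℓ := 2*x - xm) (m0 := c * (r/4)) (by linarith) (by linarith) htT (fun s hs => by linarith [hp s ⟨by linarith [hs.1], hs.2⟩]) hx1.le (by linarith) (by linarith)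
      (by positivity) (fun s hs => by
        unfold ZZ
        have e : 2*x - (2*x-xm) = xm := by ring
        rw [e]
        have hs' : s ∈ Icc 0 T := ⟨by linarith [hs.1], by linarith [hs.2]⟩
        have hps := hp s ⟨by linarith [hs.1], hs.2⟩
        have m1 := WW_mono D S hs' (x := 2*x-xm) (y := 2*x - xm + r/4) hx1.le (by linarith) (by linarith)
        have m2 := WW_mono D S hs' (x := xm - r) (y := xm) (by linarith) (by linarith) hps
        have m3 := W_incr D S (t := s) (x := 2*x-xm+r/4) (y := xm - r) (c := c) (by linarith) (by linarith) (by linarith) (fun z hz => by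
          refine hIH T p lam S s (by linarith [hs.1]) hs'.2 xm hxm (fun s' hs'' => hp s' ⟨by linarith [hs.1, hs''.1], by linarith [hs.2, hs''.2]⟩) z (by linarith [hz.1]) hz.2)
        have m4 : c * (r/4) ≤ c * (xm - r - (2*x - xm + r/4)) := by
          apply mul_le_mul_of_nonneg_left _ hc.le; linarith
        linarith) (fun y hy => by
        unfold ZZ
        have := WW_mono D S (t := t - H/2) (x := y) (y := 2*x - y) ⟨by linarith, by linarith⟩ (by linarith [hy.1]) (by linarith [hy.2]) (by linarith [hp (t-H/2) ⟨by linarith, by linarith⟩, hy.1])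
        linarith)
    refine le_trans ?_ key
    have e : t - (t - H/2) = H/2 := by ring
    have e2 : x - (2*x - xm) = xm - x := by ring
    rw [e, e2]
    have hk : heatK 4 (H/2) ≤ heatK (2*(xm - x)) (H/2) := heatK_anti (by rw [abs_of_nonneg (by linarith), abs_of_pos (by norm_num)]; linarith)
    rw [hc2]
    have : 3/4*r ≤ xm - x := by linarith
    generalize xm - x = y at this hk ⊢
    have : 0 < y := by linarith
    gcongr

lemma LB (D : Dat a φ φ' pI) {r : ℝ} (hr : 0 < r) : LBr a φ pI r := by
  have h0 : LBr a φ pI 2 := fun H hH δ hδ => ⟨1, one_pos, fun T p lam S t _ _ xm hxm _ x hx hx2 => by linarith⟩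
  have hn : ∀ n : ℕ, LBr a φ pI (2 * (3/4)^n) := by
    intro n
    induction n with
    | zero => simpa using h0
    | succ n ih =>
      have := LB_step D (by positivity) ih
      rwa [pow_succ, show (2:ℝ) * ((3/4)^n * (3/4)) = 3/4 * (2 * (3/4)^n) by ring]
  obtain ⟨n, hn'⟩ := exists_pow_lt_of_lt_one (show 0 < r/2 by linarith) (show (3/4:ℝ) < 1 by norm_num)
  intro H hH δ hδ
  obtain ⟨c, hc, h⟩ := hn n H hH δ hδ
  exact ⟨c, hc, fun T p lam S t h1 h2 xm h3 h4 x h5 h6 => h T p lam S t h1 h2 xm h3 h4 x h5 (by linarith)⟩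

/-- positivity at the left end -/
lemma F_left (D : Dat a φ φ' pI) : ∃ η > 0, ∀ T p lam, Sol a φ pI T p lam → ∀ t ∈ Icc 0 T, η ≤ FF a φ p lam (-1) t := by
  obtain ⟨η, hη, he1, he2⟩ := eta0 D
  refine ⟨η, hη, fun T p lam S t ht => ?_⟩
  by_contra hcon
  push Not at hcon
  have hm := S.crv.mem t
  have hc := (FF_slice D S.crv t) (-1) (by simp)
  set m := (FF a φ p lam (-1) t + η)/2 with hmd
  have h1 : ∀ᶠ x in 𝓝[Icc (-1) 1] (-1:ℝ), FF a φ p lam x t < m := hc.eventually (Iio_mem_nhds (by linarith))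
  obtain ⟨ε, hε, hb⟩ := Metric.mem_nhdsWithin_iff.1 h1
  set x := min (p t) (-1 + ε/2) with hx
  have hx1 : -1 < x := lt_min hm.1 (by linarith)
  have hx2 : x ≤ p t := min_le_left _ _
  have hx3 : x ≤ -1 + ε/2 := min_le_right _ _
  have w := W_lower D S hη he1 he2 ht hx1.le hx2
  have w2 := WW_sub D S.crv t (x := -1) (y := x) (by simp) ⟨hx1.le, by linarith [hm.2]⟩
  rw [WW_left, sub_zero] at w2
  have := intervalIntegral.integral_mono_on hx1.le (FF_ii D S.crv t (x := -1) (y := x) (by simp) ⟨hx1.le, by linarith [hm.2]⟩) (intervalIntegrable_const (c := m)) (fun z hz => by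
    have : z ∈ {x | FF a φ p lam x t < m} := hb ⟨by rw [Metric.mem_ball, Real.dist_eq, abs_lt]; constructor <;> linarith [hz.1, hz.2], by linarith [hz.1], by linarith [hz.2, hm.2]⟩
    exact le_of_lt this)
  rw [intervalIntegral.integral_const, smul_eq_mul] at this
  have : η * (x+1) ≤ (x+1) * m := by linarith
  nlinarith

def NoDrop (a : ℝ) (φ : ℝ → ℝ) (pI δ H H' : ℝ) : Prop := ∀ T p lam, Sol a φ pI T p lam → ∀ t, H ≤ t → t ≤ T → ∀ m, (∀ s ∈ Icc (t-H) t, m ≤ p s) →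
  ∀ t1 t2, t - H' ≤ t2 → t2 < t1 → t1 ≤ t → p t1 ≤ m + δ → (∀ s ∈ Icc t2 t1, p t1 ≤ p s) → p t2 - p t1 ≤ 8*δ

lemma NoDrop.mono {δ H H' H'' : ℝ} (h : NoDrop a φ pI δ H H') (h' : H'' ≤ H') : NoDrop a φ pI δ H H'' :=
  fun T p lam S t h1 h2 m h3 t1 t2 h4 h5 h6 h7 h8 => h T p lam S t h1 h2 m h3 t1 t2 (by linarith) h5 h6 h7 h8

lemma no_drop (D : Dat a φ φ' pI) {ε0 : ℝ} (hε : 0 < ε0) (hP : ∀ T p lam, Sol a φ pI T p lam → ∀ t ∈ Icc 0 T, -1 + ε0 ≤ p t ∧ p t ≤ 1 - ε0)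
    {δ H : ℝ} (hδ : 0 < δ) (hδ2 : 8*δ ≤ ε0) (hH : 0 < H) : ∃ H' > 0, H' ≤ H/2 ∧ NoDrop a φ pI δ H H' := by
  obtain ⟨c, hc, hLB⟩ := LB D hδ (H/2) (by linarith) (ε0/2) (by linarith)
  set M := (∫ z in (-1:ℝ)..pI, φ z) - ∫ z in (-1:ℝ)..1, φ z with hM
  set H' := min (H/2) (c*δ*(4*δ)^2/(4*(|M|+1))) with hH'
  have hH'0 : 0 < H' := lt_min (by linarith) (by positivity)
  have hH'1 : H' ≤ H/2 := min_le_left _ _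
  have hexp : M * Real.exp (-(4*δ)^2/(4*H')) ≤ c*δ := by
    have e1 : Real.exp (-(4*δ)^2/(4*H')) ≤ 4*H'/(4*δ)^2 := by
      rw [neg_div, Real.exp_neg, show 4*H'/(4*δ)^2 = ((4*δ)^2/(4*H'))⁻¹ by rw [inv_div]]
      have := Real.add_one_le_exp ((4*δ)^2/(4*H'))
      apply inv_anti₀ (by positivity); linarith
    have e2 : 4*H'/(4*δ)^2 ≤ c*δ/(|M|+1) := by
      have := min_le_right (H/2) (c*δ*(4*δ)^2/(4*(|M|+1)))
      rw [← hH', le_div_iff₀ (by positivity)] at this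
      rw [div_le_div_iff₀ (by positivity) (by positivity)]; linarith
    calc M * Real.exp (-(4*δ)^2/(4*H')) ≤ |M| * (c*δ/(|M|+1)) :=
          mul_le_mul (le_abs_self _) (e1.trans e2) (Real.exp_pos _).le (abs_nonneg _)
      _ ≤ c*δ := by
          rw [mul_div_assoc', div_le_iff₀ (by positivity)]
          nlinarith [mul_pos hc hδ]
  refine ⟨H', hH'0, hH'1, fun T p lam S t hHt htT m hm t1 t2 h2 h21 h1 hp1 hps => ?_⟩
  by_contra hcon
  push Not at hcon
  have ht1 : t1 ∈ Icc 0 T := ⟨by linarith, by linarith⟩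
  have ht2 : t2 ∈ Icc 0 T := ⟨by linarith, by linarith⟩
  have hmp : m ≤ p t1 := hm t1 ⟨by linarith, h1⟩
  have b1 := hP T p lam S t1 ht1
  have b2 := hP T p lam S t2 ht2
  have Z0 := S.zero t1 ht1
  set x0 := p t1 with hx0
  have hF : ∀ s ∈ Icc t2 t1, c * (2*δ) ≤ WW a φ p lam (x0 - 2*δ) s - WW a φ p lam (x0 - 4*δ) s := by
    intro s hs
    have := W_incr D S (t := s) (x := x0 - 4*δ) (y := x0 - 2*δ) (c := c) (by linarith) (by linarith) (by linarith) (fun z hz =>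
      hLB T p lam S s (by linarith [hs.1]) (by linarith [hs.2]) m (by linarith) (fun s' hs' => hm s' ⟨by linarith [hs.1, hs'.1], by linarith [hs.2, hs'.2]⟩) z (by linarith [hz.1]) (by linarith [hz.2]))
    have e : x0 - 2*δ - (x0 - 4*δ) = 2*δ := by ring
    rwa [e] at this
  have key := MPL D S (τ := t2) (t := t1) (c := x0) (ℓ := x0 - 4*δ) (m0 := c*δ) ht2.1 h21 ht1.2 hps (by linarith) (by linarith) (by linarith) (by positivity)
    (fun s hs => by
      unfold ZZ
      have e : 2*x0 - (x0 - 4*δ) = x0 + 4*δ := by ring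
      rw [e]
      have hs' : s ∈ Icc 0 T := ⟨by linarith [hs.1, ht2.1], by linarith [hs.2, ht1.2]⟩
      have f := hF s hs
      have cd : 0 < c * δ := by positivity
      rcases le_or_gt (x0 + 4*δ) (p s) with q | q
      · have := WW_mono D S hs' (x := x0 - 2*δ) (y := x0 + 4*δ) (by linarith) (by linarith) q
        linarith
      · have A := A_exp D S (τ := t2) (s := s) (h := H') (z := x0 + 4*δ) ht2.1 hs.1 hs'.2 hH'0 (by linarith [hs.2]) q.le (by linarith)
        have mc := mass_const D S hs'
        have mx := WW_max D S hs' (x := x0 - 2*δ) ⟨by linarith, by linarith⟩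
        rw [WW_zero, WW_zero] at A
        rw [WW_zero] at mc
        have hMn : 0 ≤ M := by
          have := WW_anti D S (t := 0) (x := pI) (y := 1) ⟨le_rfl, hs'.1.trans hs'.2⟩ S.p0.le D.hpI.2.le le_rfl
          rw [WW_zero, WW_zero] at this
          linarith
        have : M * Real.exp (-(p t2 - (x0+4*δ))^2/(4*H')) ≤ M * Real.exp (-(4*δ)^2/(4*H')) := by
          apply mul_le_mul_of_nonneg_left _ hMn
          apply Real.exp_le_exp.2
          apply div_le_div_of_nonneg_right _ (by positivity)
          apply neg_le_neg
          apply pow_le_pow_left₀ (by positivity)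
          linarith
        rw [← hM] at A
        linarith) (fun y hy => by
      unfold ZZ
      have := WW_mono D S ht2 (x := y) (y := 2*x0 - y) (by linarith [hy.1]) (by linarith [hy.2]) (by linarith [hy.1])
      linarith)
  have : 0 < c * δ * ((x0 - (x0 - 4*δ))^2/(t1-t2)) * heatK (2*(x0 - (x0-4*δ))) (t1-t2) := by
    have hk := heatK_pos (2*(x0 - (x0-4*δ))) (t := t1-t2) (by linarith)
    have : x0 - (x0-4*δ) = 4*δ := by ring
    have ht : 0 < t1 - t2 := by linarith
    rw [this] at hk ⊢
    positivity
  linarith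

def OscB (a : ℝ) (φ : ℝ → ℝ) (pI H0 H A : ℝ) : Prop := ∀ T p lam, Sol a φ pI T p lam → ∀ t, H0 ≤ t → t ≤ T → ∀ s ∈ Icc (t-H) t, ∀ s' ∈ Icc (t-H) t, p s - p s' ≤ A

lemma osc_step (D : Dat a φ φ' pI) {ε0 : ℝ} (hε : 0 < ε0) (hP : ∀ T p lam, Sol a φ pI T p lam → ∀ t ∈ Icc 0 T, -1 + ε0 ≤ p t ∧ p t ≤ 1 - ε0)
    {δ H H0 A : ℝ} (hδ : 0 < δ) (hδ2 : 8*δ ≤ ε0) (hH : 0 < H) (hHH : H ≤ H0) (hO : OscB a φ pI H0 H A) :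
    ∃ H' > 0, H' ≤ H0 ∧ OscB a φ pI H0 H' (max (8*δ) (A - δ)) := by
  obtain ⟨h1, h1p, h1H, N1⟩ := no_drop D hε hP hδ hδ2 hH
  obtain ⟨h2, h2p, h2H, N2⟩ := no_drop D.refl (ε0 := ε0) hε (fun T p lam S t ht => by
    have := hP T _ lam (by simpa using S.refl) t ht
    constructor <;> linarith [this.1, this.2]) hδ hδ2 hH
  refine ⟨min h1 h2, lt_min h1p h2p, (min_le_left _ _).trans (by linarith), fun T p lam S t ht0 htT => ?_⟩
  replace N1 := N1.mono (min_le_left h1 h2)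
  replace N2 := N2.mono (min_le_right h1 h2)
  have hle : min h1 h2 ≤ H := (min_le_left _ _).trans (by linarith)
  have hp0 : 0 < min h1 h2 := lt_min h1p h2p
  set H' := min h1 h2
  have hne : (Icc (t-H') t).Nonempty := ⟨t, by linarith, le_rfl⟩
  have hneH : (Icc (t-H) t).Nonempty := ⟨t, by linarith, le_rfl⟩
  have hcp := S.crv.cp
  obtain ⟨u, hu, hum⟩ := isCompact_Icc.exists_isMinOn hne hcp.continuousOn
  obtain ⟨v, hv, hvm⟩ := isCompact_Icc.exists_isMaxOn hne hcp.continuousOn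
  obtain ⟨U, hU, hUm⟩ := isCompact_Icc.exists_isMinOn hneH hcp.continuousOn
  obtain ⟨V, hV, hVm⟩ := isCompact_Icc.exists_isMaxOn hneH hcp.continuousOn
  have hUm' : ∀ s ∈ Icc (t-H) t, p U ≤ p s := fun s hs => hUm hs
  have hVm' : ∀ s ∈ Icc (t-H) t, p s ≤ p V := fun s hs => hVm hs
  have hum' : ∀ s ∈ Icc (t-H') t, p u ≤ p s := fun s hs => hum hs
  have hvm' : ∀ s ∈ Icc (t-H') t, p s ≤ p v := fun s hs => hvm hs
  intro s hs s' hs'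
  have q1 := hvm' s hs
  have q2 := hum' s' hs'
  have q3 := hO T p lam S t ht0 htT V hV U hU
  by_contra hcon
  push Not at hcon
  obtain ⟨r1, r2⟩ := max_lt_iff.1 hcon
  have hsub : ∀ s ∈ Icc (t-H') t, s ∈ Icc (t-H) t := fun s hs => ⟨by linarith [hs.1], hs.2⟩
  have q4 := hUm' u (hsub u hu)
  have q5 := hVm' v (hsub v hv)
  rcases lt_trichotomy v u with e | e | e
  · have := N1 T p lam S t (by linarith) htT (p U) hUm' u v hv.1 e hu.2 (by linarith) (fun w hw => hum' w ⟨by linarith [hw.1, hv.1], by linarith [hw.2, hu.2]⟩)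
    linarith
  · rw [e] at q1; linarith
  · have := N2 T _ lam S.refl t (by linarith) htT (-p V) (fun s hs => by linarith [hVm' s hs]) v u hu.1 e hv.2 (by linarith) (fun w hw => by linarith [hvm' w ⟨by linarith [hw.1, hu.1], by linarith [hw.2, hv.2]⟩])
    linarith

/-- uniform modulus of continuity of the free boundary -/
lemma osc (D : Dat a φ φ' pI) {H0 d : ℝ} (hH0 : 0 < H0) (hd : 0 < d) : ∃ H > 0, H ≤ H0 ∧ OscB a φ pI H0 H d := by
  obtain ⟨ε0, hε, -, hP⟩ := P_bound D
  set δ := min (d/8) (ε0/8) with hδ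
  have hδ0 : 0 < δ := lt_min (by linarith) (by linarith)
  have h1 : 8*δ ≤ d := by linarith [min_le_left (d/8) (ε0/8)]
  have h2 : 8*δ ≤ ε0 := by linarith [min_le_right (d/8) (ε0/8)]
  have hn : ∀ n : ℕ, ∃ H > 0, H ≤ H0 ∧ OscB a φ pI H0 H (max (8*δ) (2 - n*δ)) := by
    intro n
    induction n with
    | zero =>
      refine ⟨H0, hH0, le_rfl, fun T p lam S t _ _ s _ s' _ => le_max_of_le_right ?_⟩
      have := S.crv.mem s; have := S.crv.mem s'
      simp only [CharP.cast_eq_zero, zero_mul, sub_zero]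
      linarith [(S.crv.mem s).2, (S.crv.mem s').1]
    | succ n ih =>
      obtain ⟨H, hH, hHH, hO⟩ := ih
      obtain ⟨H', h1, h2, h3⟩ := osc_step D hε hP hδ0 h2 hH hHH hO
      refine ⟨H', h1, h2, fun T p lam S t q1 q2 s q3 s' q4 => (h3 T p lam S t q1 q2 s q3 s' q4).trans ?_⟩
      apply max_le (le_max_left _ _)
      rcases le_total (8*δ) (2 - n*δ) with e | e
      · rw [max_eq_right e]; apply le_max_of_le_right; push_cast; linarith
      · rw [max_eq_left e]; apply le_max_of_le_left; linarith
  obtain ⟨n, hn'⟩ := exists_nat_gt (2/δ)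
  rw [div_lt_iff₀ hδ0] at hn'
  obtain ⟨H, hH, hHH, hO⟩ := hn n
  refine ⟨H, hH, hHH, fun T p lam S t q1 q2 s q3 s' q4 => (hO T p lam S t q1 q2 s q3 s' q4).trans ?_⟩
  exact max_le h1 (by linarith)

/-- Fubini for the single-layer source -/
lemma fub (ha : 0 < a) (h : Crv p lam) {g : ℝ → ℝ} (hg : Continuous g) {t : ℝ} (ht : 0 ≤ t) :
    ∫ y in (-1:ℝ)..1, g y * SS a p lam y t = ∫ s in (0:ℝ)..t, (∫ y in (-1:ℝ)..1, g y * Gk a y (p s) (t-s)) * lam s := by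
  obtain ⟨B, hB⟩ := (isCompact_Icc (a := (-1:ℝ)) (b := 1)).exists_bound_of_continuousOn hg.continuousOn
  obtain ⟨C, hC, hG⟩ := Gk_bound a ha t
  obtain ⟨Λ, hΛ, hlam⟩ := lam_bdd h.cl 0 t
  have hcp := h.cp
  have hcl := h.cl
  have hint : Integrable (Function.uncurry fun y s => g y * (Gk a y (p s) (t-s) * lam s)) ((volume.restrict (Ioc (-1:ℝ) 1)).prod (volume.restrict (Ioo 0 t))) := by
    have i1 : Integrable (fun s : ℝ => (√(t-s))⁻¹) (volume.restrict (Ioo 0 t)) := by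
      have := ((intervalIntegrable_iff_integrableOn_Ioc_of_le ht).2 (sqrt_inv_int t ht).1).comp_sub_left t
      rw [sub_zero, sub_self] at this
      exact ((intervalIntegrable_iff_integrableOn_Ioc_of_le ht).1 this.symm).mono_set Ioo_subset_Ioc_self
    have i2 : Integrable (fun _ : ℝ => B * C * Λ) (volume.restrict (Ioc (-1:ℝ) 1)) := integrable_const _
    refine (i2.mul_prod i1).mono' ?_ ?_
    · rw [Measure.prod_restrict]
      refine ContinuousOn.aestronglyMeasurable (fun z hz => ?_) (measurableSet_Ioc.prod measurableSet_Ioo)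
      obtain ⟨z1, z2⟩ := hz
      have hc := Gk_contAt_time (a := a) (x := z.1) (q := p z.2) (t := t - z.2) ha (by have := abs_le.2 ⟨z1.1.le, z1.2⟩; linarith) (h.memI _) (by linarith [z2.2])
      have hc2 : ContinuousAt (fun z : ℝ² => Gk a z.1 (p z.2) (t - z.2)) z :=
        ContinuousAt.comp (x := z) (f := fun z : ℝ² => (z.1, p z.2, t - z.2)) (g := fun z : ℝ × ℝ × ℝ => Gk a z.1 z.2.1 z.2.2) hc (by fun_prop)
      have h3 : ContinuousAt (fun z : ℝ² => g z.1) z := by fun_prop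
      have h4 : ContinuousAt (fun z : ℝ² => lam z.2) z := by fun_prop
      exact (h3.mul (hc2.mul h4)).continuousWithinAt
    · rw [Measure.prod_restrict]
      refine (ae_restrict_iff' (measurableSet_Ioc.prod measurableSet_Ioo)).2 (Eventually.of_forall fun z hz => ?_)
      obtain ⟨z1, z2⟩ := hz
      have e1 := hB z.1 ⟨z1.1.le, z1.2⟩
      have e2 := hG z.1 (p z.2) (t - z.2) (abs_le.2 ⟨z1.1.le, z1.2⟩) (h.memI _) (by linarith [z2.2]) (by linarith [z2.1])
      have e3 := hlam z.2 ⟨z2.1.le, z2.2.le⟩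
      simp only [Function.uncurry]
      rw [norm_mul, norm_mul]
      rw [← Real.norm_eq_abs] at e2 e3
      have hB0 : 0 ≤ B := (norm_nonneg _).trans e1
      calc ‖g z.1‖ * (‖Gk a z.1 (p z.2) (t - z.2)‖ * ‖lam z.2‖) ≤ B * ((C * (√(t-z.2))⁻¹) * Λ) := by gcongr
        _ = _ := by ring
  have sw := integral_integral_swap hint
  rw [intervalIntegral.integral_of_le (by norm_num), intervalIntegral.integral_of_le ht, integral_Ioc_eq_integral_Ioo (x := 0) (y := t)]
  calc _ = ∫ y in Ioc (-1:ℝ) 1, ∫ s in Ioo 0 t, g y * (Gk a y (p s) (t-s) * lam s) := by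
        congr 1; ext y
        unfold SS
        rw [intervalIntegral.integral_of_le ht, integral_Ioc_eq_integral_Ioo, integral_const_mul]
    _ = ∫ s in Ioo 0 t, ∫ y in Ioc (-1:ℝ) 1, g y * (Gk a y (p s) (t-s) * lam s) := sw
    _ = _ := by
        congr 1; ext s
        rw [intervalIntegral.integral_of_le (by norm_num), ← integral_mul_const]
        congr 1; ext y; ring

lemma sin_Gk (ha : 0 < a) {q t : ℝ} (hq : q ∈ 𝕁) (ht : 0 < t) : ∫ y in (-1:ℝ)..1, Real.sin (π/2*y) * Gk a y q t
    = -(Real.exp (-(kap*t)) * (2 * Real.cos (π/2*q) * Real.sin (π/2 * al a q))) := by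
  have e : ∀ w, |w| ≤ 1 → ∫ y in (-1:ℝ)..1, Real.sin (π/2*y) * heatGamma y w t = Real.exp (-(kap*t)) * Real.sin (π/2 * w) := by
    intro w hw
    rw [← heatGamma_sin w ht]
    congr 1; ext y; rw [heatGamma_symm y, mul_comm]
  have ii : ∀ w, |w| ≤ 1 → IntervalIntegrable (fun y => Real.sin (π/2*y) * heatGamma y w t) volume (-1) 1 := fun w hw => by
    have := heatGamma_contX (z := w) (t := t) (by linarith) ht
    apply Continuous.intervalIntegrable; fun_prop
  have h1 := ym_abs ha hq
  have h2 := yp_abs ha hq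
  unfold Gk
  simp_rw [mul_sub]
  rw [intervalIntegral.integral_sub (ii _ h1) (ii _ h2), e _ h1, e _ h2, mul_add, mul_sub, Real.sin_add, Real.sin_sub]
  ring

/-- total variation -/
lemma L1_bound (D : Dat a φ φ' pI) (S : Sol a φ pI T p lam) {t : ℝ} (ht : t ∈ Icc 0 T) {g : ℝ → ℝ} {B : ℝ} (hg : Continuous g) (hB : ∀ y ∈ 𝕁, |g y| ≤ B) :
    |∫ y in (-1:ℝ)..1, g y * FF a φ p lam y t| ≤ B * (2 * (∫ z in (-1:ℝ)..pI, φ z) - ∫ z in (-1:ℝ)..1, φ z) := by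
  have hp := S.crv.mem t
  have hpI := S.crv.memI t
  have ii : ∀ x ∈ 𝕁, ∀ y ∈ 𝕁, IntervalIntegrable (fun y => g y * FF a φ p lam y t) volume x y := fun x hx y hy =>
    (FF_ii D S.crv t hx hy).continuousOn_mul hg.continuousOn
  have m1 : (-1:ℝ) ∈ 𝕁 := by simp
  have m2 : (1:ℝ) ∈ 𝕁 := by simp
  rw [← intervalIntegral.integral_add_adjacent_intervals (ii _ m1 _ hpI) (ii _ hpI _ m2)]
  have k1 : |∫ y in (-1:ℝ)..(p t), g y * FF a φ p lam y t| ≤ B * ∫ z in (-1:ℝ)..pI, φ z := by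
    have := intervalIntegral.norm_integral_le_of_norm_le (f := fun y => g y * FF a φ p lam y t) (g := fun y => B * FF a φ p lam y t) hp.1.le (Eventually.of_forall fun y hy => by
      rw [norm_mul]
      have h1 := S.nonneg ht (x := y) hy.1.le hy.2
      rw [Real.norm_eq_abs (FF a φ p lam y t), abs_of_nonneg h1]
      exact mul_le_mul_of_nonneg_right (hB y ⟨hy.1.le, by linarith [hy.2, hp.2]⟩) h1) ((FF_ii D S.crv t m1 hpI).const_mul B)
    rw [intervalIntegral.integral_const_mul] at this
    have mc := mass_const D S ht
    rw [WW_zero] at mc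
    rw [← mc]; exact this
  have k2 : |∫ y in (p t)..1, g y * FF a φ p lam y t| ≤ B * ((∫ z in (-1:ℝ)..pI, φ z) - ∫ z in (-1:ℝ)..1, φ z) := by
    have := intervalIntegral.norm_integral_le_of_norm_le (f := fun y => g y * FF a φ p lam y t) (g := fun y => -B * FF a φ p lam y t) hp.2.le (Eventually.of_forall fun y hy => by
      rw [norm_mul]
      have h1 := S.nonpos ht (x := y) hy.2 hy.1.le
      rw [Real.norm_eq_abs (FF a φ p lam y t), abs_of_nonpos h1]
      have := mul_le_mul_of_nonneg_right (hB y ⟨by linarith [hy.1, hp.1], hy.2⟩) (neg_nonneg.2 h1)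
      rw [Real.norm_eq_abs]; linarith) ((FF_ii D S.crv t hpI m2).const_mul (-B))
    rw [intervalIntegral.integral_const_mul, ← WW_sub D S.crv t hpI m2, mass_const D S ht, mass_right D S ht, WW_zero, WW_zero] at this
    refine this.trans (le_of_eq (by ring))
  have := abs_add_le (∫ y in (-1:ℝ)..(p t), g y * FF a φ p lam y t) (∫ y in (p t)..1, g y * FF a φ p lam y t)
  linarith

lemma SmoothOn.lip {E : Type} [NormedAddCommGroup E] [NormedSpace ℝ E] {f : E → ℝ} {U K : Set E} (hf : SmoothOn f U) (hU : IsOpen U) (hK : IsCompact K) (hKU : K ⊆ U) :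
    ∃ L ≥ 0, ∀ z ∈ K, ∀ z' ∈ K, |f z - f z'| ≤ L * ‖z - z'‖ := by
  have : LocallyLipschitzOn K f := by
    intro x hx
    have h1 : ContDiffAt ℝ 1 f x := by
      have := (hf 1).contDiffAt (hU.mem_nhds (hKU hx))
      simpa using this
    obtain ⟨C, t, ht, h⟩ := h1.exists_lipschitzOnWith
    exact ⟨C, t, mem_nhdsWithin_of_mem_nhds ht, h⟩
  obtain ⟨C, hC⟩ := this.exists_lipschitzOnWith_of_compact hK
  refine ⟨C, C.2, fun z hz z' hz' => ?_⟩
  have := hC.dist_le_mul z hz z' hz'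
  rwa [Real.dist_eq, dist_eq_norm] at this

/-- integrated flux bound -/
lemma int_lam (D : Dat a φ φ' pI) : ∃ C > 0, ∀ T p lam, Sol a φ pI T p lam → ∀ t ∈ Icc 0 T, ∀ u, 0 ≤ u → t - 1 ≤ u → u ≤ t → ∫ s in u..t, lam s ≤ C := by
  obtain ⟨ε0, hε, hε2, hP⟩ := P_bound D
  obtain ⟨B, hB0, hB⟩ := D.bd
  set M := 2 * (∫ z in (-1:ℝ)..pI, φ z) - ∫ z in (-1:ℝ)..1, φ z with hM
  have hpi := Real.pi_pos
  have ha := D.ha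
  obtain ⟨k0, hk0, hk⟩ : ∃ k0 > 0, ∀ q ∈ Icc (-1 + ε0) (1 - ε0), k0 ≤ 2 * Real.cos (π/2*q) * Real.sin (π/2 * al a q) := by
    have hc := al_cont a
    obtain ⟨q0, hq0, hm⟩ := (isCompact_Icc (a := -1+ε0) (b := 1-ε0)).exists_isMinOn ⟨0, by constructor <;> linarith⟩ (f := fun q => 2 * Real.cos (π/2*q) * Real.sin (π/2 * al a q)) (by fun_prop)
    refine ⟨_, ?_, fun q hq => hm hq⟩
    have h1 : 0 < Real.cos (π/2*q0) := Real.cos_pos_of_mem_Ioo ⟨by nlinarith [hq0.1], by nlinarith [hq0.2]⟩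
    have hal : 0 < al a q0 := al_pos ha ⟨by linarith [hq0.1], by linarith [hq0.2]⟩
    have hal1 : al a q0 ≤ a := min_le_left _ _
    have h2 : 0 < Real.sin (π/2 * al a q0) := Real.sin_pos_of_pos_of_lt_pi (by positivity) (by nlinarith [D.ha1])
    positivity
  refine ⟨(2*B + |M| + 1) / (Real.exp (-kap) * k0), by positivity, fun T p lam S t ht u hu0 hu1 hut => ?_⟩
  rw [le_div_iff₀ (by positivity)]
  set k : ℝ → ℝ := fun s => Real.exp (-(kap*(t-s))) * (2 * Real.cos (π/2*p s) * Real.sin (π/2 * al a (p s))) with hkd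
  have hcp := S.crv.cp
  have hcl := S.crv.cl
  have hac := al_cont a
  have hkc : Continuous k := by fun_prop
  have hfub := fub ha S.crv (g := fun y => Real.sin (π/2*y)) (by fun_prop) ht.1
  have e1 : ∫ s in (0:ℝ)..t, (∫ y in (-1:ℝ)..1, Real.sin (π/2*y) * Gk a y (p s) (t-s)) * lam s = ∫ s in (0:ℝ)..t, -(k s * lam s) := by
    refine intervalIntegral.integral_congr_Ioo_of_le ht.1 fun s hs => ?_
    show (∫ y in (-1:ℝ)..1, Real.sin (π/2*y) * Gk a y (p s) (t-s)) * lam s = _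
    rw [sin_Gk ha (S.crv.memI s) (by linarith [hs.2])]
    simp only [hkd]; ring
  rw [e1, intervalIntegral.integral_neg] at hfub
  have uc := util_continuous D.c hB
  have i1 : IntervalIntegrable (fun y => Real.sin (π/2*y) * util φ y t) volume (-1) 1 := by
    have : Continuous fun y => util φ y t := uc.comp (by fun_prop : Continuous fun y : ℝ => (y, t))
    apply Continuous.intervalIntegrable; fun_prop
  have i2 : IntervalIntegrable (fun y => Real.sin (π/2*y) * FF a φ p lam y t) volume (-1) 1 :=
    (FF_ii D S.crv t (x := -1) (y := 1) (by simp) (by simp)).continuousOn_mul (by fun_prop)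
  have e2 : ∫ y in (-1:ℝ)..1, Real.sin (π/2*y) * SS a p lam y t = (∫ y in (-1:ℝ)..1, Real.sin (π/2*y) * FF a φ p lam y t) - ∫ y in (-1:ℝ)..1, Real.sin (π/2*y) * util φ y t := by
    rw [← intervalIntegral.integral_sub i2 i1]
    congr 1; ext y; unfold FF; ring
  have b1 := L1_bound D S ht (g := fun y => Real.sin (π/2*y)) (B := 1) (by fun_prop) (fun y _ => Real.abs_sin_le_one _)
  have b2 : |∫ y in (-1:ℝ)..1, Real.sin (π/2*y) * util φ y t| ≤ 2*B := by
    have := intervalIntegral.norm_integral_le_of_norm_le_const (a := -1) (b := 1) (f := fun y => Real.sin (π/2*y) * util φ y t) (C := B) (fun y _ => by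
      rw [norm_mul]
      calc _ ≤ 1 * B := mul_le_mul (Real.abs_sin_le_one _) (util_bound hB _ _) (abs_nonneg _) zero_le_one
        _ = B := one_mul B)
    rw [Real.norm_eq_abs] at this
    refine this.trans (le_of_eq ?_)
    norm_num; ring
  have key : ∫ s in (0:ℝ)..t, k s * lam s ≤ 2*B + |M| := by
    rw [e2] at hfub
    rw [← hM, one_mul] at b1
    have := le_abs_self M
    have := abs_le.1 b1
    have := abs_le.1 b2
    linarith
  have hkn : ∀ s ∈ Icc 0 t, 0 ≤ k s * lam s := fun s hs => by
    have hs' : s ∈ Icc 0 T := ⟨hs.1, hs.2.trans ht.2⟩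
    have := hk (p s) (hP T p lam S s hs')
    exact mul_nonneg (mul_nonneg (Real.exp_pos _).le (by linarith)) (S.lpos s hs').le
  have ik : ∀ x y, IntervalIntegrable (fun s => k s * lam s) volume x y := fun x y => by
    apply Continuous.intervalIntegrable; fun_prop
  have key2 : ∫ s in u..t, k s * lam s ≤ ∫ s in (0:ℝ)..t, k s * lam s := by
    rw [← intervalIntegral.integral_add_adjacent_intervals (ik 0 u) (ik u t)]
    have := intervalIntegral.integral_nonneg (μ := volume) hu0 (f := fun s => k s * lam s) (fun s hs => hkn s ⟨hs.1, hs.2.trans hut⟩)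
    linarith
  have key3 : ∫ s in u..t, lam s * (Real.exp (-kap) * k0) ≤ ∫ s in u..t, k s * lam s := by
    refine intervalIntegral.integral_mono_on hut (by apply Continuous.intervalIntegrable; fun_prop) (ik _ _) fun s hs => ?_
    have hs' : s ∈ Icc 0 T := ⟨by linarith [hs.1], hs.2.trans ht.2⟩
    rw [mul_comm]
    apply mul_le_mul_of_nonneg_right _ (S.lpos s hs').le
    apply mul_le_mul _ (hk (p s) (hP T p lam S s hs')) hk0.le (Real.exp_pos _).le
    apply Real.exp_le_exp.2
    have : 0 < kap := by unfold kap; positivity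
    nlinarith [hs.1, hs.2]
  rw [intervalIntegral.integral_mul_const] at key3
  linarith

lemma util_restart (D : Dat a φ φ' pI) {x τ h : ℝ} (hx : |x| ≤ 1) (hτ : 0 < τ) (hh : 0 < h) :
    ∫ y in (-1:ℝ)..1, heatGamma x y h * util φ y τ = util φ x (τ+h) := by
  obtain ⟨B, hB0, hB⟩ := D.bd
  have hφ := D.c
  simp_rw [util_eq_gamma D.ev D.c hB _ hτ]
  rw [util_eq_gamma D.ev D.c hB _ (by linarith : 0 < τ + h)]
  simp_rw [intervalIntegral.integral_of_le (show (-1:ℝ) ≤ 1 by norm_num)]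
  simp_rw [← integral_const_mul]
  rw [integral_integral_swap]
  · refine setIntegral_congr_fun measurableSet_Ioc fun z hz => ?_
    show (∫ y in Ioc (-1:ℝ) 1, heatGamma x y h * (heatGamma y z τ * φ z)) = _
    have hz' : |z| ≤ 1 := abs_le.2 ⟨hz.1.le, hz.2⟩
    have := semigroup (x := x) (z := z) (by linarith) (by linarith) hh hτ
    rw [intervalIntegral.integral_of_le (by norm_num)] at this
    rw [← this, ← integral_mul_const]
    congr 1; ext y; ring
  · rw [Measure.prod_restrict]
    refine IntegrableOn.mono_set (t := Icc (-1) 1 ×ˢ Icc (-1) 1) (ContinuousOn.integrableOn_compact (isCompact_Icc.prod isCompact_Icc) ?_) (prod_mono Ioc_subset_Icc_self Ioc_subset_Icc_self)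
    rintro z ⟨hz1, hz2⟩
    have a1 := abs_of_mem hz1
    have a2 := abs_of_mem hz2
    have c1 : ContinuousAt (fun z : ℝ² => heatGamma x z.1 h) z := (heatGamma_contY (x := x) (t := h) (by linarith) hh).continuousAt.comp (by fun_prop)
    have c2 : ContinuousAt (fun z : ℝ² => heatGamma z.1 z.2 τ) z :=
      ContinuousAt.comp (x := z) (f := fun z : ℝ² => ((z.1, τ), z.2)) (g := fun z : ℝ² × ℝ => heatGamma z.1.1 z.2 z.1.2) (heatGamma_contAt (mem_gΩ_of_time (by linarith) (by linarith) hτ.ne')) (by fun_prop)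
    exact (c1.mul (c2.mul (by fun_prop))).continuousWithinAt

lemma restart (D : Dat a φ φ' pI) (hC : Crv p lam) {x τ h : ℝ} (hx : |x| ≤ 1) (hτ : 0 < τ) (hh : 0 < h) :
    FF a φ p lam x (τ+h) = (∫ y in (-1:ℝ)..1, heatGamma x y h * FF a φ p lam y τ) + ∫ s in τ..(τ+h), Gk a x (p s) (τ+h-s) * lam s := by
  obtain ⟨B, hB0, hB⟩ := D.bd
  have ha := D.ha
  have gc := heatGamma_contY (x := x) (t := h) (by linarith) hh
  have uc := util_continuous D.c hB
  have i1 : IntervalIntegrable (fun y => heatGamma x y h * util φ y τ) volume (-1) 1 := by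
    have : Continuous fun y => util φ y τ := uc.comp (by fun_prop : Continuous fun y : ℝ => (y, τ))
    apply Continuous.intervalIntegrable; fun_prop
  have i2 : IntervalIntegrable (fun y => heatGamma x y h * FF a φ p lam y τ) volume (-1) 1 :=
    (FF_ii D hC τ (x := -1) (y := 1) (by simp) (by simp)).continuousOn_mul (by fun_prop)
  have e2 : ∫ y in (-1:ℝ)..1, heatGamma x y h * SS a p lam y τ = (∫ y in (-1:ℝ)..1, heatGamma x y h * FF a φ p lam y τ) - ∫ y in (-1:ℝ)..1, heatGamma x y h * util φ y τ := by
    rw [← intervalIntegral.integral_sub i2 i1]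
    congr 1; ext y; unfold FF; ring
  rw [util_restart D hx hτ hh, fub ha hC gc hτ.le] at e2
  have e1 : ∫ s in (0:ℝ)..τ, (∫ y in (-1:ℝ)..1, heatGamma x y h * Gk a y (p s) (τ-s)) * lam s = ∫ s in (0:ℝ)..τ, Gk a x (p s) (τ+h-s) * lam s := by
    refine intervalIntegral.integral_congr_Ioo_of_le hτ.le fun s hs => ?_
    show (∫ y in (-1:ℝ)..1, heatGamma x y h * Gk a y (p s) (τ-s)) * lam s = Gk a x (p s) (τ+h-s) * lam s
    congr 1
    have hts : 0 < τ - s := by linarith [hs.2]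
    have h1 := ym_abs ha (hC.memI s)
    have h2 := yp_abs ha (hC.memI s)
    have ii : ∀ w, |w| ≤ 1 → IntervalIntegrable (fun y => heatGamma x y h * heatGamma y w (τ-s)) volume (-1) 1 := fun w hw => by
      have := heatGamma_contX (z := w) (t := τ-s) (by linarith) hts
      apply Continuous.intervalIntegrable; fun_prop
    unfold Gk
    simp_rw [mul_sub]
    rw [intervalIntegral.integral_sub (ii _ h1) (ii _ h2), semigroup (by linarith) (by linarith) hh hts, semigroup (by linarith) (by linarith) hh hts, show τ - s + h = τ + h - s by ring]
  rw [e1] at e2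
  have ad := intervalIntegral.integral_add_adjacent_intervals (SS_integrable ha hC hx (by linarith : 0 ≤ τ + h) 0 τ le_rfl hτ.le (by linarith)) (SS_integrable ha hC hx (by linarith : 0 ≤ τ + h) τ (τ+h) hτ.le (by linarith) le_rfl)
  have : FF a φ p lam x (τ+h) = util φ x (τ+h) + ∫ s in (0:ℝ)..(τ+h), Gk a x (p s) (τ+h-s) * lam s := rfl
  linarith

lemma gamma_lip_h {h : ℝ} (hh : 0 < h) : ∃ L ≥ 0, ∀ x x' y, |x| ≤ 1 → |x'| ≤ 1 → |y| ≤ 1 → |heatGamma x y h - heatGamma x' y h| ≤ L * |x - x'| := by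
  obtain ⟨L, hL, H⟩ := heatGamma_smooth.lip gΩ_open (K := (Icc (-1) 1 ×ˢ {h}) ×ˢ Icc (-1) 1) ((isCompact_Icc.prod isCompact_singleton).prod isCompact_Icc) (by
    rintro ⟨⟨x, t⟩, y⟩ ⟨⟨h1, h2⟩, h3⟩
    have a1 := abs_of_mem h1
    have a2 := abs_of_mem h3
    have a3 : t = h := h2
    exact mem_gΩ_of_time (by linarith) (by linarith) (by rw [a3]; exact hh.ne'))
  refine ⟨L, hL, fun x x' y hx hx' hy => ?_⟩
  have := H ((x, h), y) ⟨⟨abs_le.1 hx, rfl⟩, abs_le.1 hy⟩ ((x', h), y) ⟨⟨abs_le.1 hx', rfl⟩, abs_le.1 hy⟩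
  simpa [Prod.norm_def] using this

/-- points at distance at least `r` from the source -/
def gK (r : ℝ) : Set (ℝ² × ℝ) := {z | |z.1.1| ≤ 1 ∧ |z.2| ≤ 1 ∧ 0 ≤ z.1.2 ∧ z.1.2 ≤ 1 ∧ r ≤ |z.1.1 - z.2|}

lemma gK_compact (r : ℝ) : IsCompact (gK r) := by
  refine IsCompact.of_isClosed_subset ((isCompact_Icc (a := (-1:ℝ)) (b := 1)).prod (isCompact_Icc (a := (0:ℝ)) (b := 1)) |>.prod (isCompact_Icc (a := (-1:ℝ)) (b := 1))) ?_ ?_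
  · have c1 : IsClosed {z : ℝ² × ℝ | |z.1.1| ≤ 1} := isClosed_le (by fun_prop) (by fun_prop)
    have c2 : IsClosed {z : ℝ² × ℝ | |z.2| ≤ 1} := isClosed_le (by fun_prop) (by fun_prop)
    have c3 : IsClosed {z : ℝ² × ℝ | 0 ≤ z.1.2} := isClosed_le (by fun_prop) (by fun_prop)
    have c4 : IsClosed {z : ℝ² × ℝ | z.1.2 ≤ 1} := isClosed_le (by fun_prop) (by fun_prop)
    have c5 : IsClosed {z : ℝ² × ℝ | r ≤ |z.1.1 - z.2|} := isClosed_le (by fun_prop) (by fun_prop)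
    exact c1.inter (c2.inter (c3.inter (c4.inter c5)))
  · rintro ⟨⟨x, t⟩, y⟩ ⟨h1, h2, h3, h4, h5⟩
    exact ⟨⟨abs_le.1 h1, h3, h4⟩, abs_le.1 h2⟩

lemma gK_sub {r : ℝ} (hr : 0 < r) : gK r ⊆ gΩ := by
  rintro ⟨⟨x, t⟩, y⟩ ⟨h1, h2, h3, h4, h5⟩
  refine mem_gΩ_of_ne h1 h2 fun e => ?_
  simp only at h5
  rw [e, sub_self, abs_zero] at h5; linarith

lemma al_lower {ε q : ℝ} (hq : q ∈ Icc (-1 + ε) (1 - ε)) : min a ε ≤ al a q := by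
  unfold al
  exact le_min (min_le_left _ _) (le_min ((min_le_right _ _).trans (by linarith [hq.2])) ((min_le_right _ _).trans (by linarith [hq.1])))

lemma far_m {r x q t : ℝ} (ha : 0 < a) (hx : |x| ≤ 1) (hq : q ∈ 𝕁) (h : 2*r ≤ al a q) (hxq : |x - q| ≤ r) (h0 : 0 ≤ t) (h1 : t ≤ 1) : ((x, t), q - al a q) ∈ gK r := by
  refine ⟨hx, ym_abs ha hq, h0, h1, ?_⟩
  have := abs_le.1 hxq
  show r ≤ |x - (q - al a q)|
  exact le_trans (by linarith) (le_abs_self _)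

lemma far_p {r x q t : ℝ} (ha : 0 < a) (hx : |x| ≤ 1) (hq : q ∈ 𝕁) (h : 2*r ≤ al a q) (hxq : |x - q| ≤ r) (h0 : 0 ≤ t) (h1 : t ≤ 1) : ((x, t), q + al a q) ∈ gK r := by
  refine ⟨hx, yp_abs ha hq, h0, h1, ?_⟩
  have := abs_le.1 hxq
  show r ≤ |x - (q + al a q)|
  exact le_trans (by linarith) (neg_le_abs _)

lemma Gk_lip_far (ha : 0 < a) {r : ℝ} (hr : 0 < r) : ∃ L ≥ 0, ∀ x x' q t, |x| ≤ 1 → |x'| ≤ 1 → q ∈ 𝕁 → 2*r ≤ al a q → |x - q| ≤ r → |x' - q| ≤ r → 0 ≤ t → t ≤ 1 →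
    |Gk a x q t - Gk a x' q t| ≤ L * |x - x'| := by
  obtain ⟨L, hL, H⟩ := heatGamma_smooth.lip gΩ_open (gK_compact r) (gK_sub hr)
  refine ⟨2*L, by positivity, fun x x' q t hx hx' hq h1 h2 h3 h4 h5 => ?_⟩
  have e1 := H _ (far_m ha hx hq h1 h2 h4 h5) _ (far_m ha hx' hq h1 h3 h4 h5)
  have e2 := H _ (far_p ha hx hq h1 h2 h4 h5) _ (far_p ha hx' hq h1 h3 h4 h5)
  simp only [Prod.norm_def, Prod.fst_sub, Prod.snd_sub, sub_self, norm_zero, Real.norm_eq_abs] at e1 e2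
  simp only [max_eq_left (abs_nonneg (x - x'))] at e1 e2
  unfold Gk
  have := abs_sub (heatGamma x (q - al a q) t - heatGamma x' (q - al a q) t) (heatGamma x (q + al a q) t - heatGamma x' (q + al a q) t)
  calc _ = |(heatGamma x (q - al a q) t - heatGamma x' (q - al a q) t) - (heatGamma x (q + al a q) t - heatGamma x' (q + al a q) t)| := by congr 1; ring
    _ ≤ _ := by linarith

set_option maxHeartbeats 1000000 in
/-- uniform flux bound away from `t = 0` -/
lemma lam_unif (D : Dat a φ φ' pI) {H0 : ℝ} (hH0 : 0 < H0) : ∃ Λ > 0, ∀ T p lam, Sol a φ pI T p lam → ∀ t, H0 ≤ t → t ≤ T → lam t ≤ Λ := by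
  obtain ⟨ε0, hε, hε2, hP⟩ := P_bound D
  have ha := D.ha
  obtain ⟨C, hC, hI⟩ := int_lam D
  set r := min a ε0 / 2 with hr
  have hr0 : 0 < r := by have := lt_min ha hε; linarith
  have hr1 : r ≤ ε0/2 := by have := min_le_right a ε0; linarith
  obtain ⟨H, hH, hHH, hO⟩ := osc D hH0 (show 0 < r/2 by linarith)
  set h := min (H/2) 1 with hh
  have hh0 : 0 < h := lt_min (by linarith) one_pos
  have hhH : h ≤ H/2 := min_le_left _ _
  have hh1 : h ≤ 1 := min_le_right _ _
  obtain ⟨L1, hL1, G1⟩ := gamma_lip_h hh0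
  obtain ⟨L2, hL2, G2⟩ := Gk_lip_far ha hr0
  set M := 2 * (∫ z in (-1:ℝ)..pI, φ z) - ∫ z in (-1:ℝ)..1, φ z with hM
  refine ⟨L1 * |M| + L2 * C + 1, by positivity, fun T p lam S t ht0 htT => ?_⟩
  have hcp := S.crv.cp
  have hcl := S.crv.cl
  have ht : t ∈ Icc 0 T := ⟨by linarith, htT⟩
  have hpt := hP T p lam S t ht
  have hd := S.der t ht
  have hlip := hd.le_of_lip' (C := L1 * |M| + L2 * C) (by positivity) (by
    have hev : ∀ᶠ x in 𝓝 (p t), |x - p t| < r/2 := by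
      have : Continuous fun x => |x - p t| := by fun_prop
      exact (this.tendsto (p t)).eventually (Iio_mem_nhds (by simpa using hr0))
    filter_upwards [hev] with x hx
    have hxx := abs_lt.1 hx
    have hx1 : |x| ≤ 1 := abs_le.2 ⟨by linarith [hpt.1], by linarith [hpt.2]⟩
    have hpt1 : |p t| ≤ 1 := abs_of_mem (S.crv.memI t)
    have hτ : 0 < t - h := by linarith
    have et : t - h + h = t := by ring
    have R := restart D S.crv (x := x) (τ := t - h) (h := h) hx1 hτ hh0
    have R' := restart D S.crv (x := p t) (τ := t - h) (h := h) hpt1 hτ hh0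
    rw [et] at R R'
    have gc := heatGamma_contY (x := x) (t := h) (by linarith) hh0
    have gc' := heatGamma_contY (x := p t) (t := h) (by linarith) hh0
    have b1 := L1_bound D S (t := t - h) ⟨hτ.le, by linarith⟩ (g := fun y => heatGamma x y h - heatGamma (p t) y h) (B := L1 * |x - p t|) (by fun_prop) (fun y hy => G1 _ _ _ hx1 hpt1 (abs_of_mem hy))
    have i1 : ∀ x', Continuous (fun y => heatGamma x' y h) → IntervalIntegrable (fun y => heatGamma x' y h * FF a φ p lam y (t-h)) volume (-1) 1 := fun x' hx' =>
      (FF_ii D S.crv (t-h) (x := -1) (y := 1) (by simp) (by simp)).continuousOn_mul (by fun_prop)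
    simp_rw [sub_mul] at b1
    rw [intervalIntegral.integral_sub (i1 _ gc) (i1 _ gc'), ← hM] at b1
    have s1 := SS_integrable ha S.crv hx1 ht.1 (t-h) t hτ.le (by linarith) le_rfl
    have s2 := SS_integrable ha S.crv hpt1 ht.1 (t-h) t hτ.le (by linarith) le_rfl
    have b2 : |(∫ s in (t-h)..t, Gk a x (p s) (t-s) * lam s) - ∫ s in (t-h)..t, Gk a (p t) (p s) (t-s) * lam s| ≤ L2 * |x - p t| * C := by
      rw [← intervalIntegral.integral_sub s1 s2]
      have := intervalIntegral.norm_integral_le_of_norm_le (a := t - h) (b := t) (μ := volume) (f := fun s => Gk a x (p s) (t-s) * lam s - Gk a (p t) (p s) (t-s) * lam s) (g := fun s => L2 * |x - p t| * lam s) (by linarith) (Eventually.of_forall fun s hs => by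
        have hs' : s ∈ Icc 0 T := ⟨by linarith [hs.1], by linarith [hs.2]⟩
        have hl := S.lpos s hs'
        rw [← sub_mul, norm_mul, Real.norm_eq_abs (lam s), abs_of_pos hl]
        apply mul_le_mul_of_nonneg_right _ hl.le
        have m1 : s ∈ Icc (t-H) t := ⟨by linarith [hs.1], hs.2⟩
        have m2 : t ∈ Icc (t-H) t := ⟨by linarith, le_rfl⟩
        have o1 := hO T p lam S t ht0 htT s m1 t m2
        have o2 := hO T p lam S t ht0 htT t m2 s m1
        have hal : min a ε0 ≤ al a (p s) := al_lower (hP T p lam S s hs')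
        exact G2 x (p t) (p s) (t-s) hx1 hpt1 (S.crv.memI s) (by linarith) (abs_le.2 ⟨by linarith, by linarith⟩) (abs_le.2 ⟨by linarith, by linarith⟩) (by linarith [hs.2]) (by linarith [hs.1])) (by apply Continuous.intervalIntegrable; fun_prop)
      rw [intervalIntegral.integral_const_mul] at this
      refine this.trans (mul_le_mul_of_nonneg_left (hI T p lam S t ht (t-h) hτ.le (by linarith) (by linarith)) (by positivity))
    rw [R, R', Real.norm_eq_abs, Real.norm_eq_abs]
    have b3 : L1 * |x - p t| * M ≤ L1 * |x - p t| * |M| := mul_le_mul_of_nonneg_left (le_abs_self _) (by positivity)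
    have b1' := abs_le.1 b1
    have b2' := abs_le.1 b2
    rw [abs_le]
    constructor <;> linarith)
  rw [norm_neg, Real.norm_eq_abs] at hlip
  linarith [le_abs_self (lam t)]

/-- uniform bound of the solution away from `t = 0` -/
lemma F_unif (D : Dat a φ φ' pI) {H0 : ℝ} (hH0 : 0 < H0) : ∃ B, ∀ T p lam, Sol a φ pI T p lam → ∀ t, H0 ≤ t → t ≤ T → ∀ x, |x| ≤ 1 → |FF a φ p lam x t| ≤ B := by
  have ha := D.ha
  set h := H0/2 with hh
  have hh0 : 0 < h := by positivity
  obtain ⟨Λ, hΛ, hl⟩ := lam_unif D hh0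
  obtain ⟨C, hC, hG⟩ := Gk_bound a ha h
  obtain ⟨C', hC', hG'⟩ := heatGamma_bound h
  set M := 2 * (∫ z in (-1:ℝ)..pI, φ z) - ∫ z in (-1:ℝ)..1, φ z with hM
  refine ⟨C' * (√h)⁻¹ * M + C * Λ * (2 * √h), fun T p lam S t ht0 htT x hx => ?_⟩
  have hτ : 0 < t - h := by linarith
  have R := restart D S.crv (x := x) (τ := t - h) (h := h) hx hτ hh0
  rw [show t - h + h = t by ring] at R
  have gc := heatGamma_contY (x := x) (t := h) (by linarith) hh0
  have b1 := L1_bound D S (t := t - h) ⟨hτ.le, by linarith⟩ (g := fun y => heatGamma x y h) (B := C' * (√h)⁻¹) gc (fun y hy => by rw [abs_of_nonneg (heatGamma_nonneg _ _ _)]; exact hG' _ _ _ hx (abs_of_mem hy) hh0 le_rfl)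
  have b2 := (Gk_tail_bound ha S.crv (t := t) (δ := h) (Λ := Λ) hx hh0.le hG (fun s hs => by
    have hs' : s ∈ Icc 0 T := ⟨by linarith [hs.1], by linarith [hs.2]⟩
    rw [abs_of_pos (S.lpos s hs')]; exact hl T p lam S s (by linarith [hs.1]) hs'.2) hC.le).2
  rw [R]
  exact (abs_add_le _ _).trans (add_le_add b1 b2)

end P12

section P20

/-- The abstract fixed point map. -/
noncomputable def Psi (g : ℝ → ℝ → ℝ) (k : ℝ → ℝ → ℝ → ℝ) (c : ℝ → ℝ) (T : ℝ) (p l : ℝ → ℝ) (t : ℝ) : ℝ :=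
  g (p t) t + ∫ s in T..t, k (p t) (p s) (t - s) * c (l s)

variable {g B : ℝ → ℝ → ℝ} {k k1 k2 : ℝ → ℝ → ℝ → ℝ} {c : ℝ → ℝ} {T L M R : ℝ}

lemma Psi_cont (hg : Continuous fun z : ℝ² => g z.1 z.2) (hk : Continuous fun z : ℝ × ℝ × ℝ => k z.1 z.2.1 z.2.2)
    (hc : Continuous c) {p l : ℝ → ℝ} (hp : Continuous p) (hl : Continuous l) : Continuous (Psi g k c T p l) := by
  unfold Psi
  refine Continuous.add (hg.comp (hp.prodMk continuous_id)) ?_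
  refine intervalIntegral.continuous_parametric_intervalIntegral_of_continuous (f := fun t s => k (p t) (p s) (t - s) * c (l s)) ?_ continuous_id
  have : Continuous fun z : ℝ² => k (p z.1) (p z.2) (z.1 - z.2) :=
    hk.comp ((hp.comp continuous_fst).prodMk ((hp.comp continuous_snd).prodMk (continuous_fst.sub continuous_snd)))
  exact this.mul (hc.comp (hl.comp continuous_snd))

lemma Psi_ii (hk : Continuous fun z : ℝ × ℝ × ℝ => k z.1 z.2.1 z.2.2)
    (hc : Continuous c) {p l : ℝ → ℝ} (hp : Continuous p) (hl : Continuous l) (t x u v : ℝ) :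
    IntervalIntegrable (fun s => k x (p s) (t - s) * c (l s)) volume u v := by
  refine Continuous.intervalIntegrable ?_ _ _
  have : Continuous fun s : ℝ => k x (p s) (t - s) :=
    hk.comp (continuous_const.prodMk (hp.prodMk (continuous_const.sub continuous_id)))
  exact this.mul (hc.comp hl)

lemma Psi_diff (hk : Continuous fun z : ℝ × ℝ × ℝ => k z.1 z.2.1 z.2.2)
    (hc : Continuous c) (hM : ∀ x q t, |k x q t| ≤ M) (hL : ∀ x x' q q' t, |k x q t - k x' q' t| ≤ L * (|x - x'| + |q - q'|))
    (hL0 : 0 ≤ L) (hcR : ∀ x, |c x| ≤ R) (hc1 : ∀ x y, |c x - c y| ≤ |x - y|)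
    {p l q m : ℝ → ℝ} (hp : Continuous p) (hl : Continuous l) (hq : Continuous q) (hm : Continuous m)
    {t h d1 d2 : ℝ} (ht : T ≤ t) (hh : t ≤ T + h) (e1 : ∀ s ∈ Icc T t, |p s - q s| ≤ d1) (e2 : ∀ s ∈ Icc T t, |l s - m s| ≤ d2) :
    |Psi g k c T p l t - Psi g k c T q m t| ≤ |g (p t) t - g (q t) t| + h * (L * (2 * d1) * R + M * d2) := by
  have hd1 : 0 ≤ d1 := (abs_nonneg _).trans (e1 t ⟨ht, le_rfl⟩)
  have hd2 : 0 ≤ d2 := (abs_nonneg _).trans (e2 t ⟨ht, le_rfl⟩)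
  have hR : 0 ≤ R := (abs_nonneg _).trans (hcR 0)
  have hM0 : 0 ≤ M := (abs_nonneg _).trans (hM 0 0 0)
  unfold Psi
  have I1 := Psi_ii hk hc hp hl t (p t) T t
  have I2 := Psi_ii hk hc hq hm t (q t) T t
  have key : |(∫ s in T..t, k (p t) (p s) (t - s) * c (l s)) - ∫ s in T..t, k (q t) (q s) (t - s) * c (m s)| ≤ h * (L * (2 * d1) * R + M * d2) := by
    rw [← intervalIntegral.integral_sub I1 I2]
    have := intervalIntegral.norm_integral_le_of_norm_le_const (a := T) (b := t) (C := L * (2 * d1) * R + M * d2)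
      (f := fun s => k (p t) (p s) (t - s) * c (l s) - k (q t) (q s) (t - s) * c (m s)) (fun s hs => by
        rw [uIoc_of_le ht] at hs
        have hs' : s ∈ Icc T t := ⟨hs.1.le, hs.2⟩
        have a1 := hL (p t) (q t) (p s) (q s) (t - s)
        have a2 := e1 t ⟨ht, le_rfl⟩
        have a3 := e1 s hs'
        have a4 : |k (p t) (p s) (t - s) - k (q t) (q s) (t - s)| ≤ L * (2 * d1) :=
          a1.trans (mul_le_mul_of_nonneg_left (by linarith) hL0)
        rw [Real.norm_eq_abs, show k (p t) (p s) (t - s) * c (l s) - k (q t) (q s) (t - s) * c (m s) = (k (p t) (p s) (t - s) - k (q t) (q s) (t - s)) * c (l s) + k (q t) (q s) (t - s) * (c (l s) - c (m s)) by ring]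
        refine (abs_add_le _ _).trans (add_le_add ?_ ?_)
        · rw [abs_mul]; exact mul_le_mul a4 (hcR _) (abs_nonneg _) (by positivity)
        · rw [abs_mul]; exact mul_le_mul (hM _ _ _) ((hc1 _ _).trans (e2 s hs')) (abs_nonneg _) hM0)
    rw [Real.norm_eq_abs, abs_of_nonneg (by linarith : (0:ℝ) ≤ t - T)] at this
    refine this.trans ?_
    rw [mul_comm]
    exact mul_le_mul_of_nonneg_right (by linarith) (by positivity)
  calc _ = |(g (p t) t - g (q t) t) + ((∫ s in T..t, k (p t) (p s) (t - s) * c (l s)) - ∫ s in T..t, k (q t) (q s) (t - s) * c (m s))| := by congr 1; ring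
    _ ≤ _ := (abs_add_le _ _).trans (by linarith)

/-- Hypotheses of the abstract fixed point problem. -/
structure FPH (g B : ℝ → ℝ → ℝ) (k1 k2 : ℝ → ℝ → ℝ → ℝ) (c : ℝ → ℝ) (L M R : ℝ) : Prop where
  hg : Continuous fun z : ℝ² => g z.1 z.2
  hB : Continuous fun z : ℝ² => B z.1 z.2
  hk1 : Continuous fun z : ℝ × ℝ × ℝ => k1 z.1 z.2.1 z.2.2
  hk2 : Continuous fun z : ℝ × ℝ × ℝ => k2 z.1 z.2.1 z.2.2
  hc : Continuous c
  gl : ∀ x y t, |g x t - g y t| ≤ |x - y| / 4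
  Bl : ∀ x y t, |B x t - B y t| ≤ L * |x - y|
  m1 : ∀ x q t, |k1 x q t| ≤ M
  m2 : ∀ x q t, |k2 x q t| ≤ M
  l1 : ∀ x x' q q' t, |k1 x q t - k1 x' q' t| ≤ L * (|x - x'| + |q - q'|)
  l2 : ∀ x x' q q' t, |k2 x q t - k2 x' q' t| ≤ L * (|x - x'| + |q - q'|)
  L0 : 0 ≤ L
  cR : ∀ x, |c x| ≤ R
  c1 : ∀ x y, |c x - c y| ≤ |x - y|

lemma fp_contr (H : FPH g B k1 k2 c L M R) (T : ℝ) : ∃ N > 0, ∃ h0 > 0, ∀ p l q m : ℝ → ℝ, Continuous p → Continuous l → Continuous q → Continuous m →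
    ∀ t, T ≤ t → t ≤ T + h0 → ∀ d, (∀ s ∈ Icc T t, |p s - q s| ≤ d ∧ |l s - m s| ≤ N * d) →
    |Psi g k1 c T p l t - Psi g k1 c T q m t| ≤ d / 2 ∧ |Psi B k2 c T p l t - Psi B k2 c T q m t| ≤ N * (d / 2) := by
  have hR : 0 ≤ R := (abs_nonneg _).trans (H.cR 0)
  have hM0 : 0 ≤ M := (abs_nonneg _).trans (H.m1 0 0 0)
  have hL0 := H.L0
  set N := 4 * L + 1 with hN
  have hN0 : 0 < N := by positivity
  set Q := L * 2 * R + M * N + 1 with hQ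
  have hQ0 : 0 < Q := by positivity
  refine ⟨N, hN0, 1 / (4 * Q), by positivity, fun p l q m hp hl hq hm t ht ht' d hd => ?_⟩
  have hd0 : 0 ≤ d := (abs_nonneg _).trans (hd t ⟨ht, le_rfl⟩).1
  have e0 : 1 / (4 * Q) * (L * (2 * d) * R + M * (N * d)) ≤ d / 4 := by
    rw [show L * (2 * d) * R + M * (N * d) = (Q - 1) * d by rw [hQ]; ring, div_mul_eq_mul_div, div_le_iff₀ (by positivity)]
    nlinarith
  have d1 := Psi_diff (g := g) H.hk1 H.hc H.m1 H.l1 hL0 H.cR H.c1 hp hl hq hm ht ht' (fun s hs => (hd s hs).1) (fun s hs => (hd s hs).2)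
  have d2 := Psi_diff (g := B) H.hk2 H.hc H.m2 H.l2 hL0 H.cR H.c1 hp hl hq hm ht ht' (fun s hs => (hd s hs).1) (fun s hs => (hd s hs).2)
  have g1 := H.gl (p t) (q t) t
  have g2 := H.Bl (p t) (q t) t
  have g3 := (hd t ⟨ht, le_rfl⟩).1
  have g4 := mul_le_mul_of_nonneg_left g3 hL0
  constructor
  · linarith
  · rw [hN]; nlinarith

lemma fp_unique (H : FPH g B k1 k2 c L M R) (T : ℝ) : ∃ h0 > 0, ∀ p l q m : ℝ → ℝ, Continuous p → Continuous l → Continuous q → Continuous m →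
    ∀ t0, T ≤ t0 → t0 ≤ T + h0 → (∀ t ∈ Icc T t0, p t = Psi g k1 c T p l t ∧ l t = Psi B k2 c T p l t ∧ q t = Psi g k1 c T q m t ∧ m t = Psi B k2 c T q m t) →
    ∀ t ∈ Icc T t0, p t = q t ∧ l t = m t := by
  obtain ⟨N, hN, h0, hh0, C⟩ := fp_contr H T
  refine ⟨h0, hh0, fun p l q m hp hl hq hm t0 h1 h2 hf => ?_⟩
  have cont : ContinuousOn (fun s => max |p s - q s| (|l s - m s| / N)) (Icc T t0) := by
    apply Continuous.continuousOn; fun_prop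
  obtain ⟨s, hs, hmax⟩ := isCompact_Icc.exists_isMaxOn ⟨T, left_mem_Icc.2 h1⟩ cont
  set d := max |p s - q s| (|l s - m s| / N) with hd
  have hdd : ∀ t ∈ Icc T t0, |p t - q t| ≤ d ∧ |l t - m t| ≤ N * d := by
    intro t ht
    have := hmax ht
    have h3 : max |p t - q t| (|l t - m t| / N) ≤ d := this
    refine ⟨(le_max_left _ _).trans h3, ?_⟩
    have := (le_max_right _ _).trans h3
    rw [div_le_iff₀ hN] at this
    linarith
  have h4 := C p l q m hp hl hq hm s hs.1 (hs.2.trans h2) d (fun u hu => hdd u ⟨hu.1, hu.2.trans hs.2⟩)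
  obtain ⟨f1, f2, f3, f4⟩ := hf s hs
  rw [← f1, ← f2, ← f3, ← f4] at h4
  have h5 : d ≤ d / 2 := by
    rw [hd]
    refine max_le h4.1 ?_
    rw [div_le_iff₀ hN]; linarith [h4.2]
  intro t ht
  obtain ⟨a1, a2⟩ := hdd t ht
  have hd0 : d ≤ 0 := by linarith
  have b1 : |p t - q t| ≤ 0 := by linarith
  have b2 : |l t - m t| ≤ 0 := a2.trans (mul_nonpos_of_nonneg_of_nonpos hN.le hd0)
  exact ⟨by linarith [abs_nonpos_iff.1 b1], by linarith [abs_nonpos_iff.1 b2]⟩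

lemma fp_exists (H : FPH g B k1 k2 c L M R) (T : ℝ) : ∃ h0 > 0, ∃ p l : ℝ → ℝ, Continuous p ∧ Continuous l ∧ 
    ∀ t ∈ Icc T (T + h0), p t = Psi g k1 c T p l t ∧ l t = Psi B k2 c T p l t := by
  obtain ⟨N, hN, h0, hh0, C⟩ := fp_contr H T
  refine ⟨h0, hh0, ?_⟩
  have hTT : T ≤ T + h0 := by linarith
  let pe : C(Icc T (T + h0), ℝ²) → ℝ → ℝ := fun w s => (w (projIcc T (T + h0) hTT s)).1
  let le : C(Icc T (T + h0), ℝ²) → ℝ → ℝ := fun w s => N * (w (projIcc T (T + h0) hTT s)).2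
  have cpe : ∀ w, Continuous (pe w) := fun w => continuous_fst.comp (w.continuous.comp continuous_projIcc)
  have cle : ∀ w, Continuous (le w) := fun w => continuous_const.mul (continuous_snd.comp (w.continuous.comp continuous_projIcc))
  let Φ : C(Icc T (T + h0), ℝ²) → C(Icc T (T + h0), ℝ²) := fun w =>
    ⟨fun t => (Psi g k1 c T (pe w) (le w) t, Psi B k2 c T (pe w) (le w) t / N),
      ((Psi_cont H.hg H.hk1 H.hc (cpe w) (cle w)).comp continuous_subtype_val).prodMk
      (((Psi_cont H.hB H.hk2 H.hc (cpe w) (cle w)).comp continuous_subtype_val).div_const N)⟩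
  have hΦ : ContractingWith (1/2) Φ := by
    refine ⟨by norm_num [← NNReal.coe_lt_coe], LipschitzWith.of_dist_le_mul fun w v => ?_⟩
    rw [ContinuousMap.dist_le (by positivity)]
    intro t
    have hb : ∀ s, dist (w s) (v s) ≤ dist w v := fun s => ContinuousMap.dist_apply_le_dist s
    have := C (pe w) (le w) (pe v) (le v) (cpe w) (cle w) (cpe v) (cle v) t t.2.1 t.2.2 (dist w v) (fun s hs => by
      have h3 := hb (projIcc T (T + h0) hTT s)
      rw [Prod.dist_eq, Real.dist_eq, Real.dist_eq] at h3
      refine ⟨(le_max_left _ _).trans h3, ?_⟩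
      show |N * _ - N * _| ≤ _
      rw [← mul_sub, abs_mul, abs_of_pos hN]
      exact mul_le_mul_of_nonneg_left ((le_max_right _ _).trans h3) hN.le)
    show dist (Psi g k1 c T (pe w) (le w) t, Psi B k2 c T (pe w) (le w) t / N) (Psi g k1 c T (pe v) (le v) t, Psi B k2 c T (pe v) (le v) t / N) ≤ _
    rw [Prod.dist_eq, Real.dist_eq, Real.dist_eq]
    have e : ((1/2 : NNReal) : ℝ) * dist w v = dist w v / 2 := by push_cast; ring
    rw [e]
    refine max_le this.1 ?_
    show |_ / N - _ / N| ≤ _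
    rw [← sub_div, abs_div, abs_of_pos hN, div_le_iff₀ hN]
    linarith [this.2]
  let w := ContractingWith.fixedPoint Φ hΦ
  have hw : Φ w = w := ContractingWith.fixedPoint_isFixedPt hΦ
  refine ⟨pe w, le w, cpe w, cle w, fun t ht => ?_⟩
  have := congrArg (fun u : C(Icc T (T + h0), ℝ²) => u ⟨t, ht⟩) hw
  have e1 : Psi g k1 c T (pe w) (le w) t = (w ⟨t, ht⟩).1 := congrArg Prod.fst this
  have e2 : Psi B k2 c T (pe w) (le w) t / N = (w ⟨t, ht⟩).2 := congrArg Prod.snd this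
  rw [e1]
  have e3 : projIcc T (T + h0) hTT t = ⟨t, ht⟩ := projIcc_of_mem hTT ht
  constructor
  · show (w (projIcc T (T + h0) hTT t)).1 = _
    rw [e3]
  · show N * (w (projIcc T (T + h0) hTT t)).2 = _
    rw [e3, ← e2]; field_simp
end P20

section P21
variable {a : ℝ} {φ φ' p lam : ℝ → ℝ} {pI T : ℝ}

/-- projection onto `[m - r, m + r]` -/
noncomputable def cc (m r x : ℝ) : ℝ := max (m - r) (min (m + r) x)
lemma cc_cont (m r : ℝ) : Continuous (cc m r) := by unfold cc; fun_prop
lemma cc_abs (m x : ℝ) {r : ℝ} (hr : 0 ≤ r) : |cc m r x - m| ≤ r := by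
  unfold cc
  rw [abs_le]
  exact ⟨by linarith [le_max_left (m - r) (min (m + r) x)], by linarith [max_le (by linarith : m - r ≤ m + r) (min_le_left (m + r) x)]⟩
lemma cc_eq {m r x : ℝ} (h : |x - m| ≤ r) : cc m r x = x := by
  rw [abs_le] at h
  unfold cc; rw [min_eq_right (by linarith), max_eq_right (by linarith)]
lemma cc_lip (m r x y : ℝ) : |cc m r x - cc m r y| ≤ |x - y| := by
  unfold cc
  refine (abs_max_sub_max_le_max _ _ _ _).trans ?_
  rw [sub_self, abs_zero]
  refine max_le (abs_nonneg _) ?_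
  refine (abs_min_sub_min_le_max _ _ _ _).trans ?_
  rw [sub_self, abs_zero]
  exact max_le (abs_nonneg _) le_rfl

lemma al_lip (a q q' : ℝ) : |al a q - al a q'| ≤ |q - q'| := by
  unfold al
  refine (abs_min_sub_min_le_max _ _ _ _).trans ?_
  rw [sub_self, abs_zero]
  refine max_le (abs_nonneg _) ?_
  refine (abs_min_sub_min_le_max _ _ _ _).trans ?_
  refine max_le ?_ ?_
  · rw [show 1 - q - (1 - q') = -(q - q') by ring, abs_neg]
  · rw [show 1 + q - (1 + q') = q - q' by ring]

/-- clamped kernels -/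
noncomputable def kk (E : ℝ² × ℝ → ℝ) (a m ρ x q t : ℝ) : ℝ :=
  E ((cc m ρ x, cc (1/2) (1/2) t), cc m ρ q - al a (cc m ρ q)) - E ((cc m ρ x, cc (1/2) (1/2) t), cc m ρ q + al a (cc m ρ q))

/-- geometric condition on the box -/
structure Bx (a m ρ r : ℝ) : Prop where
  ha : 0 < a
  hr : 0 < r
  hρ : 0 < ρ
  h1 : -1 < m - ρ
  h2 : m + ρ < 1
  h3 : 2 * ρ ≤ r
  h4 : ∀ q, |q - m| ≤ ρ → 2 * r ≤ al a q

lemma Bx.abs1 {m ρ r x : ℝ} (h : Bx a m ρ r) (hx : |x - m| ≤ ρ) : |x| < 1 := by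
  have := abs_le.1 hx
  rw [abs_lt]; constructor <;> linarith [h.h1, h.h2]

lemma Bx.gm {m ρ r x q t : ℝ} (h : Bx a m ρ r) (hx : |x - m| ≤ ρ) (hq : |q - m| ≤ ρ) (h0 : 0 ≤ t) (h1 : t ≤ 1) :
    ((x, t), q - al a q) ∈ gK r ∧ ((x, t), q + al a q) ∈ gK r := by
  have e : |x - q| ≤ r := by
    have := abs_le.1 hx; have := abs_le.1 hq; rw [abs_le]; constructor <;> linarith [h.h3]
  exact ⟨far_m h.ha (h.abs1 hx).le (abs_le.1 (h.abs1 hq).le) (h.h4 q hq) e h0 h1, far_p h.ha (h.abs1 hx).le (abs_le.1 (h.abs1 hq).le) (h.h4 q hq) e h0 h1⟩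

lemma cc_half (t : ℝ) : 0 ≤ cc (1/2) (1/2) t ∧ cc (1/2) (1/2) t ≤ 1 := by
  have := abs_le.1 (cc_abs (1/2) t (r := 1/2) (by norm_num)); constructor <;> linarith

lemma Bx.gmc {m ρ r : ℝ} (h : Bx a m ρ r) (x q t : ℝ) :
    ((cc m ρ x, cc (1/2) (1/2) t), cc m ρ q - al a (cc m ρ q)) ∈ gK r ∧ ((cc m ρ x, cc (1/2) (1/2) t), cc m ρ q + al a (cc m ρ q)) ∈ gK r :=
  h.gm (cc_abs m x h.hρ.le) (cc_abs m q h.hρ.le) (cc_half t).1 (cc_half t).2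

lemma kk_cont {E : ℝ² × ℝ → ℝ} (hE : SmoothOn E gΩ) {m ρ r : ℝ} (h : Bx a m ρ r) :
    Continuous fun z : ℝ × ℝ × ℝ => kk E a m ρ z.1 z.2.1 z.2.2 := by
  have c1 := cc_cont m ρ
  have c2 := cc_cont (1/2) (1/2)
  have c3 := al_cont a
  unfold kk
  refine Continuous.sub ?_ ?_
  · exact hE.continuousOn.comp_continuous (f := fun z : ℝ × ℝ × ℝ => ((cc m ρ z.1, cc (1/2) (1/2) z.2.2), cc m ρ z.2.1 - al a (cc m ρ z.2.1))) (by fun_prop) (fun z => gK_sub h.hr (h.gmc _ _ _).1)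
  · exact hE.continuousOn.comp_continuous (f := fun z : ℝ × ℝ × ℝ => ((cc m ρ z.1, cc (1/2) (1/2) z.2.2), cc m ρ z.2.1 + al a (cc m ρ z.2.1))) (by fun_prop) (fun z => gK_sub h.hr (h.gmc _ _ _).2)

lemma kk_bdd {E : ℝ² × ℝ → ℝ} (hE : SmoothOn E gΩ) {r : ℝ} (hr : 0 < r) :
    ∃ M, ∃ L, 0 ≤ M ∧ 0 ≤ L ∧ ∀ m ρ, Bx a m ρ r → (∀ x q t, |kk E a m ρ x q t| ≤ M) ∧ (∀ x x' q q' t, |kk E a m ρ x q t - kk E a m ρ x' q' t| ≤ L * (|x - x'| + |q - q'|)) := by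
  obtain ⟨M, hM⟩ := (gK_compact r).exists_bound_of_continuousOn (hE.continuousOn.mono (gK_sub hr))
  obtain ⟨L, hL, HL⟩ := hE.lip gΩ_open (gK_compact r) (gK_sub hr)
  refine ⟨max M 0 + max M 0, 2 * L * 2, by positivity, by positivity, fun m ρ h => ⟨fun x q t => ?_, fun x x' q q' t => ?_⟩⟩
  · unfold kk
    exact (abs_sub _ _).trans (add_le_add ((hM _ (h.gmc _ _ _).1).trans (le_max_left _ _)) ((hM _ (h.gmc _ _ _).2).trans (le_max_left _ _)))
  · unfold kk
    have e1 := HL _ (h.gmc x q t).1 _ (h.gmc x' q' t).1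
    have e2 := HL _ (h.gmc x q t).2 _ (h.gmc x' q' t).2
    have c1 := cc_lip m ρ x x'
    have c2 := cc_lip m ρ q q'
    have c3 := (al_lip a (cc m ρ q) (cc m ρ q')).trans c2
    have nn := abs_nonneg (x - x')
    have nn' := abs_nonneg (q - q')
    have n1 : ‖(((cc m ρ x, cc (1/2) (1/2) t), cc m ρ q - al a (cc m ρ q)) - ((cc m ρ x', cc (1/2) (1/2) t), cc m ρ q' - al a (cc m ρ q')) : ℝ² × ℝ)‖ ≤ 2 * (|x - x'| + |q - q'|) := by
      simp only [Prod.norm_def, Prod.fst_sub, Prod.snd_sub, sub_self, norm_zero, Real.norm_eq_abs]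
      refine max_le (max_le (by linarith) (by linarith)) ?_
      rw [show cc m ρ q - al a (cc m ρ q) - (cc m ρ q' - al a (cc m ρ q')) = (cc m ρ q - cc m ρ q') - (al a (cc m ρ q) - al a (cc m ρ q')) by ring]
      exact (abs_sub _ _).trans (by linarith)
    have n2 : ‖(((cc m ρ x, cc (1/2) (1/2) t), cc m ρ q + al a (cc m ρ q)) - ((cc m ρ x', cc (1/2) (1/2) t), cc m ρ q' + al a (cc m ρ q')) : ℝ² × ℝ)‖ ≤ 2 * (|x - x'| + |q - q'|) := by
      simp only [Prod.norm_def, Prod.fst_sub, Prod.snd_sub, sub_self, norm_zero, Real.norm_eq_abs]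
      refine max_le (max_le (by linarith) (by linarith)) ?_
      rw [show cc m ρ q + al a (cc m ρ q) - (cc m ρ q' + al a (cc m ρ q')) = (cc m ρ q - cc m ρ q') + (al a (cc m ρ q) - al a (cc m ρ q')) by ring]
      exact (abs_add_le _ _).trans (by linarith)
    have f1 := e1.trans (mul_le_mul_of_nonneg_left n1 hL)
    have f2 := e2.trans (mul_le_mul_of_nonneg_left n2 hL)
    generalize E ((cc m ρ x, cc (1/2) (1/2) t), cc m ρ q - al a (cc m ρ q)) = A1 at *
    generalize E ((cc m ρ x', cc (1/2) (1/2) t), cc m ρ q' - al a (cc m ρ q')) = A2 at *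
    generalize E ((cc m ρ x, cc (1/2) (1/2) t), cc m ρ q + al a (cc m ρ q)) = A3 at *
    generalize E ((cc m ρ x', cc (1/2) (1/2) t), cc m ρ q' + al a (cc m ρ q')) = A4 at *
    rw [show A1 - A3 - (A2 - A4) = (A1 - A2) - (A3 - A4) by ring]
    exact (abs_sub _ _).trans (by linarith)

/-- the Neumann kernel as a function on the product -/
noncomputable def G0 (z : ℝ² × ℝ) : ℝ := heatGamma z.1.1 z.2 z.1.2
/-- its `x` derivative -/
noncomputable def G1 (z : ℝ² × ℝ) : ℝ := fderiv ℝ G0 z ((1, 0), 0)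

lemma G0_smooth : SmoothOn G0 gΩ := heatGamma_smooth
lemma G1_smooth : SmoothOn G1 gΩ := G0_smooth.fderivApply gΩ_open _

lemma G0_deriv {x t y : ℝ} (h : ((x, t), y) ∈ gΩ) : HasDerivAt (fun x => heatGamma x y t) (G1 ((x, t), y)) x := by
  have h1 := G0_smooth.hasFDerivAt gΩ_open h
  have h2 : HasDerivAt (fun x : ℝ => ((x, t), y)) (((1:ℝ), (0:ℝ)), (0:ℝ)) x := ((hasDerivAt_id x).prodMk (hasDerivAt_const x t)).prodMk (hasDerivAt_const x y)
  exact h1.comp_hasDerivAt x h2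

lemma kk_eq {m ρ x q t : ℝ} (hx : |x - m| ≤ ρ) (hq : |q - m| ≤ ρ) (h0 : 0 ≤ t) (h1 : t ≤ 1) : kk G0 a m ρ x q t = Gk a x q t := by
  unfold kk; rw [cc_eq hx, cc_eq hq, cc_eq (by rw [abs_le]; constructor <;> linarith)]; rfl

lemma kk_deriv {m ρ r x q t : ℝ} (h : Bx a m ρ r) (hx : |x - m| < ρ) (hq : |q - m| ≤ ρ) (h0 : 0 ≤ t) (h1 : t ≤ 1) :
    HasDerivAt (fun x => kk G0 a m ρ x q t) (kk G1 a m ρ x q t) x := by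
  have e := h.gm hx.le hq h0 h1
  have d := (G0_deriv (gK_sub h.hr e.1)).sub (G0_deriv (gK_sub h.hr e.2))
  have e1 : kk G1 a m ρ x q t = G1 ((x, t), q - al a q) - G1 ((x, t), q + al a q) := by
    unfold kk; rw [cc_eq hx.le, cc_eq hq, cc_eq (by rw [abs_le]; constructor <;> linarith)]
  rw [e1]
  refine d.congr_of_eventuallyEq ?_
  have : ∀ᶠ y in 𝓝 x, |y - m| < ρ := (isOpen_lt (by fun_prop) (by fun_prop) : IsOpen {y : ℝ | |y - m| < ρ}).mem_nhds hx
  filter_upwards [this] with y hy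
  rw [kk_eq hy.le hq h0 h1]; rfl

/-- derivative of the short-time source integral -/
lemma src_deriv {m ρ r : ℝ} (h : Bx a m ρ r) {q l c : ℝ → ℝ} (hq : Continuous q) (hl : Continuous l) (hc : Continuous c) {R : ℝ} (hR : ∀ x, |c x| ≤ R) {u t : ℝ} (hut : u ≤ t) (ht1 : t ≤ u + 1)
    (hqm : ∀ s ∈ Icc u t, |q s - m| ≤ ρ) {x : ℝ} (hx : |x - m| < ρ) :
    HasDerivAt (fun x => ∫ s in u..t, kk G0 a m ρ x (q s) (t - s) * c (l s)) (∫ s in u..t, kk G1 a m ρ x (q s) (t - s) * c (l s)) x := by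
  obtain ⟨M, L, hM0, hL0, H⟩ := kk_bdd (a := a) G1_smooth h.hr
  have HM := (H m ρ h).1
  have hO : IsOpen {y : ℝ | |y - m| < ρ} := isOpen_lt (by fun_prop) (by fun_prop)
  refine (intervalIntegral.hasDerivAt_integral_of_dominated_loc_of_deriv_le (F := fun x s => kk G0 a m ρ x (q s) (t - s) * c (l s)) (F' := fun x s => kk G1 a m ρ x (q s) (t - s) * c (l s)) (s := {y : ℝ | |y - m| < ρ}) (bound := fun _ => M * R) (hO.mem_nhds hx) ?_ ?_ ?_ ?_ ?_ ?_).2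
  · exact Eventually.of_forall fun y => (Psi_ii (kk_cont G0_smooth h) hc hq hl t y u t).1.aestronglyMeasurable.mono_measure (by rw [uIoc_of_le hut])
  · exact Psi_ii (kk_cont G0_smooth h) hc hq hl t x u t
  · exact (Psi_ii (kk_cont G1_smooth h) hc hq hl t x u t).1.aestronglyMeasurable.mono_measure (by rw [uIoc_of_le hut])
  · refine Eventually.of_forall fun s _ y _ => ?_
    rw [Real.norm_eq_abs, abs_mul]
    exact mul_le_mul (HM _ _ _) (hR _) (abs_nonneg _) hM0
  · exact intervalIntegrable_const
  · refine Eventually.of_forall fun s hs y hy => ?_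
    rw [uIoc_of_le hut] at hs
    exact (kk_deriv h hy (hqm s ⟨hs.1.le, hs.2⟩) (by linarith [hs.2]) (by linarith [hs.1])).mul_const _

lemma Dat.c' (D : Dat a φ φ' pI) : Continuous φ' := by
  obtain ⟨L, hL⟩ := D.lip
  refine (LipschitzWith.of_dist_le_mul (K := (max L 0).toNNReal) fun x y => ?_).continuous
  rw [Real.dist_eq, Real.dist_eq, Real.coe_toNNReal _ (le_max_right _ _)]
  exact (hL x y).trans (mul_le_mul_of_nonneg_right (le_max_left _ _) (abs_nonneg _))

lemma Dat.bd' (D : Dat a φ φ' pI) : ∃ B > 0, ∀ y, |φ' y| ≤ B := by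
  obtain ⟨L, hL⟩ := D.lip
  obtain ⟨B, hB, hb⟩ := D.bd
  refine ⟨2 * B + |L|, by positivity, fun y => ?_⟩
  obtain ⟨ξ, hξ, e⟩ := exists_hasDerivAt_eq_slope φ φ' (show y < y + 1 by linarith) D.c.continuousOn (fun x _ => D.hd x)
  rw [show y + 1 - y = 1 by ring, div_one] at e
  have h1 : |φ' ξ| ≤ 2 * B := by rw [e]; exact (abs_sub _ _).trans (by linarith [hb (y+1), hb y])
  have h2 : |φ' y - φ' ξ| ≤ |L| := by
    refine (hL y ξ).trans ?_
    have : |y - ξ| ≤ 1 := by rw [abs_le]; constructor <;> linarith [hξ.1, hξ.2]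
    calc _ ≤ |L| * |y - ξ| := mul_le_mul_of_nonneg_right (le_abs_self _) (abs_nonneg _)
      _ ≤ _ := mul_le_of_le_one_right (abs_nonneg _) this
  calc |φ' y| = |φ' ξ + (φ' y - φ' ξ)| := by congr 1; ring
    _ ≤ _ := (abs_add_le _ _).trans (by linarith)

/-- frozen source up to time `T` -/
noncomputable def Jb (a : ℝ) (p lam : ℝ → ℝ) (T : ℝ) (z : ℝ²) : ℝ := ∫ s in (0:ℝ)..T, Gk a z.1 (p s) (z.2 - s) * lam s
noncomputable def bg (a : ℝ) (φ p lam : ℝ → ℝ) (T x t : ℝ) : ℝ := util φ x t + Jb a p lam T (x, t)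
noncomputable def bgx (a : ℝ) (φ' p lam : ℝ → ℝ) (T x t : ℝ) : ℝ := util φ' x t + dX (Jb a p lam T) (x, t)

lemma Jb_caloric (ha : 0 < a) (h : Crv p lam) (hT : 0 ≤ T) : ∃ U : Set ℝ², IsOpen U ∧ (p T, T) ∈ U ∧ Caloric (Jb a p lam T) U := by
  have hC := graph_compact (h.cp.continuousOn (s := Icc 0 T))
  have hpC : ∀ s ∈ Ioc 0 T, (p s, s) ∈ ((fun s => (p s, s)) '' Icc 0 T) := fun s hs => ⟨s, Ioc_subset_Icc_self hs, rfl⟩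
  refine ⟨_, srcU_open a hC, ?_, (src_caloric (a := a) hC hT h.cp.measurable hpC h.cl.integrableOn_Ioc).1⟩
  rintro w ⟨s, hs, rfl⟩
  have a0 := abs_le.2 (h.memI T)
  have := al_pos ha (h.mem T)
  by_cases e : T - s = 0
  · have : s = T := by linarith
    subst this
    exact ⟨mem_gΩ_of_ne a0 (ym_abs ha (h.memI _)) (by show p s ≠ p s - al a (p s); linarith), mem_gΩ_of_ne a0 (yp_abs ha (h.memI _)) (by show p s ≠ p s + al a (p s); linarith)⟩
  · exact ⟨mem_gΩ_of_time (by linarith) (by linarith [ym_abs ha (h.memI s)]) e, mem_gΩ_of_time (by linarith) (by linarith [yp_abs ha (h.memI s)]) e⟩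

lemma FF_split (ha : 0 < a) {q l : ℝ → ℝ} (h : Crv q l) (hT : 0 ≤ T) (hag : ∀ s ∈ Icc 0 T, q s = p s ∧ l s = lam s) {x t : ℝ} (hx : |x| ≤ 1) (ht : T ≤ t) :
    FF a φ q l x t = bg a φ p lam T x t + ∫ s in T..t, Gk a x (q s) (t - s) * l s := by
  unfold FF bg Jb SS
  rw [← intervalIntegral.integral_add_adjacent_intervals (SS_integrable ha h hx (hT.trans ht) 0 T le_rfl hT ht) (SS_integrable ha h hx (hT.trans ht) T t hT ht le_rfl), add_assoc]
  congr 2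
  refine intervalIntegral.integral_congr fun s hs => ?_
  rw [uIcc_of_le hT] at hs
  show Gk a x (q s) (t - s) * l s = Gk a x (p s) (t - s) * lam s
  rw [(hag s hs).1, (hag s hs).2]

set_option maxHeartbeats 1000000 in
/-- local structure of the free boundary problem near time `T` -/
theorem loc (D : Dat a φ φ' pI) (h : Crv p lam) (hT : 0 ≤ T) (hl : 0 < lam T) (hz : FF a φ p lam (p T) T = 0)
    (hd : HasDerivAt (fun x => FF a φ p lam x T) (-lam T) (p T)) :
    ∃ ρ τ : ℝ, ∃ g B : ℝ → ℝ → ℝ, ∃ k1 k2 : ℝ → ℝ → ℝ → ℝ, ∃ c : ℝ → ℝ, ∃ L M R : ℝ, 0 < ρ ∧ 0 < τ ∧ -1 < p T - ρ ∧ p T + ρ < 1 ∧ FPH g B k1 k2 c L M R ∧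
    (∀ q l t, Continuous q → Continuous l → T ≤ t → t ≤ T + τ → |Psi g k1 c T q l t - p T| < ρ ∧ |Psi B k2 c T q l t - lam T| < lam T / 2) ∧
    (∀ q l, Crv q l → (∀ s ∈ Icc 0 T, q s = p s ∧ l s = lam s) → ∀ t, T ≤ t → t ≤ T + τ → (∀ s ∈ Icc T t, |q s - p T| < ρ ∧ |l s - lam T| < lam T / 2) →
      Psi g k1 c T q l t = q t + FF a φ q l (q t) t / lam T ∧ HasDerivAt (fun x => FF a φ q l x t) (-(Psi B k2 c T q l t)) (q t) ∧
      ∀ x, |x - p T| < ρ → ∃ d < 0, HasDerivAt (fun x => FF a φ q l x t) d x) := by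
  have ha := D.ha
  obtain ⟨U, hU, hmU, hJ⟩ := Jb_caloric ha h hT
  obtain ⟨Bφ, hBφ, hB⟩ := D.bd
  obtain ⟨Bφ', hBφ', hB'⟩ := D.bd'
  obtain ⟨Lφ, hLφ⟩ := D.lip
  have ucont := util_continuous D.c hB
  have ucont' := util_continuous D.c' hB'
  have uder := util_hasDerivAt D.hd D.c' hB hB'
  set m := p T with hm
  set l0 := lam T with hl0
  have halm := al_pos ha (h.mem T)
  set r := al a m / 4 with hr
  have hr0 : 0 < r := by positivity
  -- derivative of background on U
  have bder : ∀ x t, (x, t) ∈ U → HasDerivAt (fun x => bg a φ p lam T x t) (bgx a φ' p lam T x t) x := fun x t hxt =>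
    (uder x t).add (hJ.smooth.hasDerivX hU hxt)
  have bcont : ContinuousOn (fun z : ℝ² => bg a φ p lam T z.1 z.2) U := ucont.continuousOn.add hJ.smooth.continuousOn
  have bxcont : ContinuousOn (fun z : ℝ² => bgx a φ' p lam T z.1 z.2) U := ucont'.continuousOn.add (hJ.smooth.dX hU).continuousOn
  have eFb : ∀ x, |x| ≤ 1 → FF a φ p lam x T = bg a φ p lam T x T := fun x hx => by
    rw [FF_split (p := p) (lam := lam) ha h hT (fun s _ => ⟨rfl, rfl⟩) hx le_rfl, intervalIntegral.integral_same, add_zero]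
  have hm1 : |m| < 1 := abs_lt.2 (h.mem T)
  have b0 : bg a φ p lam T m T = 0 := by rw [← eFb m hm1.le]; exact hz
  have bx0 : bgx a φ' p lam T m T = -l0 := by
    refine (bder m T hmU).unique (hd.congr_of_eventuallyEq ?_)
    have : ∀ᶠ y in 𝓝 m, |y| < 1 := (isOpen_lt (by fun_prop) (by fun_prop) : IsOpen {y : ℝ | |y| < 1}).mem_nhds hm1
    filter_upwards [this] with y hy
    exact (eFb y hy.le).symm
  -- choose ρ
  have hev : ∀ᶠ z : ℝ² in 𝓝 (m, T), z ∈ U ∧ |bgx a φ' p lam T z.1 z.2 + l0| < l0 / 4 := by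
    have h0U : ∀ᶠ z : ℝ² in 𝓝 (m, T), z ∈ U := hU.mem_nhds hmU
    refine h0U.and ?_
    have : ContinuousAt (fun z : ℝ² => |bgx a φ' p lam T z.1 z.2 + l0|) (m, T) :=
      ((bxcont.continuousAt (hU.mem_nhds hmU)).add continuousAt_const).abs
    refine this.eventually (Iio_mem_nhds ?_)
    show |bgx a φ' p lam T m T + l0| < l0 / 4
    rw [bx0, neg_add_cancel, abs_zero]; positivity
  obtain ⟨ε, hε, hball⟩ := Metric.eventually_nhds_iff.1 hev
  obtain ⟨ρ, hρ, hρε, hρr⟩ : ∃ ρ > 0, ρ < ε ∧ ρ ≤ r / 2 := ⟨min (ε/2) (r/2), by positivity, (min_le_left _ _).trans_lt (by linarith), min_le_right _ _⟩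
  have hbx : ∀ x t, |x - m| ≤ ρ → |t - T| ≤ ρ → (x, t) ∈ U ∧ |bgx a φ' p lam T x t + l0| < l0 / 4 := by
    intro x t hx ht
    refine hball (y := (x, t)) ?_
    rw [Prod.dist_eq, Real.dist_eq, Real.dist_eq]
    exact max_lt (by linarith) (by linarith)
  have hal1 := al_le_l a m
  have hal2 := al_le_r a m
  have bx : Bx a m ρ r := by
    refine ⟨ha, hr0, hρ, ?_, ?_, by linarith, fun q hq => ?_⟩
    · linarith
    · linarith
    · have := abs_le.1 ((al_lip a q m).trans hq); linarith
  obtain ⟨M0, L0, hM0, hL0, H0⟩ := kk_bdd (a := a) G0_smooth hr0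
  obtain ⟨M1, L1, hM1, hL1, H1⟩ := kk_bdd (a := a) G1_smooth hr0
  obtain ⟨H0a, H0b⟩ := H0 m ρ bx
  obtain ⟨H1a, H1b⟩ := H1 m ρ bx
  -- compact box and Lipschitz constant
  set K : Set ℝ² := Icc (m - ρ) (m + ρ) ×ˢ Icc (T - ρ) (T + ρ) with hK
  have hKU : K ⊆ U := by
    rintro ⟨x, t⟩ ⟨h1, h2⟩
    exact (hbx x t (by rw [abs_le]; constructor <;> linarith [h1.1, h1.2]) (by rw [abs_le]; constructor <;> linarith [h2.1, h2.2])).1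
  obtain ⟨LJ, hLJ, HJ⟩ := (hJ.smooth.dX hU).lip hU (isCompact_Icc.prod isCompact_Icc) hKU
  have hmemK : ∀ x t, (cc m ρ x, cc T ρ t) ∈ K := fun x t => by
    have e1 := abs_le.1 (cc_abs m x hρ.le)
    have e2 := abs_le.1 (cc_abs T t hρ.le)
    exact ⟨⟨by linarith, by linarith⟩, ⟨by linarith, by linarith⟩⟩
  set g : ℝ → ℝ → ℝ := fun x t => cc m ρ x + bg a φ p lam T (cc m ρ x) (cc T ρ t) / l0 with hg
  set B : ℝ → ℝ → ℝ := fun x t => -bgx a φ' p lam T (cc m ρ x) (cc T ρ t) with hBdef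
  set k1 : ℝ → ℝ → ℝ → ℝ := fun x q t => kk G0 a m ρ x q t / l0 with hk1
  set k2 : ℝ → ℝ → ℝ → ℝ := fun x q t => -kk G1 a m ρ x q t with hk2
  set c : ℝ → ℝ := cc l0 (l0 / 2) with hc
  have ccm := cc_cont m ρ
  have ccT := cc_cont T ρ
  set M := M0 / l0 + M1 with hM
  set L := L0 / l0 + L1 + (|Lφ| + LJ) with hL
  set R := l0 + l0 / 2 with hR
  have hF : FPH g B k1 k2 c L M R := by
    have cpair : Continuous fun z : ℝ² => (cc m ρ z.1, cc T ρ z.2) := by fun_prop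
    refine ⟨?_, ?_, (kk_cont G0_smooth bx).div_const _, (kk_cont G1_smooth bx).neg, cc_cont _ _, ?_, ?_, ?_, ?_, ?_, ?_, by positivity, ?_, cc_lip _ _⟩
    · exact (ccm.comp continuous_fst).add ((bcont.comp_continuous cpair (fun z => hKU (hmemK _ _))).div_const _)
    · exact (bxcont.comp_continuous cpair (fun z => hKU (hmemK _ _))).neg
    · intro x y t
      have hconv : Convex ℝ (Icc (m - ρ) (m + ρ)) := convex_Icc _ _
      have := hconv.norm_image_sub_le_of_norm_hasDerivWithin_le (f := fun x => x + bg a φ p lam T x (cc T ρ t) / l0) (f' := fun x => 1 + bgx a φ' p lam T x (cc T ρ t) / l0) (C := 1/4)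
        (fun x hx => ((hasDerivAt_id x).add ((bder x (cc T ρ t) (hKU ⟨hx, (hmemK x t).2⟩)).div_const l0)).hasDerivWithinAt) (fun x hx => by
          have e := (hbx x (cc T ρ t) (by rw [abs_le]; constructor <;> linarith [hx.1, hx.2]) (cc_abs T t hρ.le)).2
          rw [Real.norm_eq_abs, show 1 + bgx a φ' p lam T x (cc T ρ t) / l0 = (bgx a φ' p lam T x (cc T ρ t) + l0) / l0 by field_simp; ring, abs_div, abs_of_pos hl, div_le_iff₀ hl]
          linarith) (hmemK y t).1 (hmemK x t).1
      rw [Real.norm_eq_abs, Real.norm_eq_abs] at this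
      refine this.trans ?_
      linarith [cc_lip m ρ x y]
    · intro x y t
      have e1 := util_lip D.c' hB' hLφ (cc m ρ x) (cc m ρ y) (cc T ρ t)
      have e2 := HJ _ (hmemK x t) _ (hmemK y t)
      simp only [Prod.norm_def, Prod.fst_sub, Prod.snd_sub, sub_self, norm_zero, Real.norm_eq_abs, max_eq_left (abs_nonneg (cc m ρ x - cc m ρ y))] at e2
      have e3 := cc_lip m ρ x y
      have e4 : |B x t - B y t| ≤ (|Lφ| + LJ) * |cc m ρ x - cc m ρ y| := by
        show |(-(util φ' _ _ + dX _ _)) - (-(util φ' _ _ + dX _ _))| ≤ _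
        have e5 : Lφ * |cc m ρ x - cc m ρ y| ≤ |Lφ| * |cc m ρ x - cc m ρ y| := mul_le_mul_of_nonneg_right (le_abs_self _) (abs_nonneg _)
        generalize util φ' (cc m ρ x) (cc T ρ t) = A1 at *
        generalize util φ' (cc m ρ y) (cc T ρ t) = A2 at *
        generalize dX (Jb a p lam T) (cc m ρ x, cc T ρ t) = A3 at *
        generalize dX (Jb a p lam T) (cc m ρ y, cc T ρ t) = A4 at *
        rw [show -(A1 + A3) - -(A2 + A4) = -((A1 - A2) + (A3 - A4)) by ring, abs_neg]
        exact (abs_add_le _ _).trans (by linarith)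
      refine e4.trans (mul_le_mul ?_ e3 (abs_nonneg _) (by positivity))
      have : 0 ≤ L0 / l0 := by positivity
      linarith
    · intro x q t
      show |_ / l0| ≤ M
      rw [abs_div, abs_of_pos hl]
      have := div_le_div_of_nonneg_right (H0a x q t) hl.le
      linarith
    · intro x q t
      show |-_| ≤ M
      rw [abs_neg]
      have : 0 ≤ M0 / l0 := by positivity
      linarith [H1a x q t]
    · intro x x' q q' t
      show |_ / l0 - _ / l0| ≤ _
      rw [← sub_div, abs_div, abs_of_pos hl]
      have := div_le_div_of_nonneg_right (H0b x x' q q' t) hl.le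
      refine this.trans ?_
      rw [mul_div_right_comm]
      refine mul_le_mul_of_nonneg_right ?_ (by positivity)
      have := abs_nonneg Lφ
      linarith
    · intro x x' q q' t
      show |-_ - -_| ≤ _
      rw [neg_sub_neg, abs_sub_comm]
      refine (H1b x x' q q' t).trans (mul_le_mul_of_nonneg_right ?_ (by positivity))
      have := abs_nonneg Lφ
      have : 0 ≤ L0 / l0 := by positivity
      linarith
    · intro x
      have := abs_le.1 (cc_abs l0 x (r := l0 / 2) (by positivity))
      rw [abs_le]; constructor <;> linarith
  -- choose τ
  have hR0 : 0 < R := by positivity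
  have hMM : 0 ≤ M := by positivity
  have hτev : ∀ᶠ τ in 𝓝[>] (0:ℝ), M * R * τ < ρ / 4 ∧ M * R * τ < l0 / 8 ∧ τ < ρ ∧ τ < 1 := by
    have c1 : ∀ e > 0, ∀ᶠ τ in 𝓝[>] (0:ℝ), M * R * τ < e := fun e he => by
      have : ContinuousAt (fun τ : ℝ => M * R * τ) 0 := by fun_prop
      exact (this.eventually (Iio_mem_nhds (by simpa using he))).filter_mono nhdsWithin_le_nhds
    exact (c1 _ (by positivity)).and ((c1 _ (by positivity)).and ((small_lt hρ).and small_one))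
  have hbev : ∃ δ > 0, ∀ t, |t - T| < δ → |bg a φ p lam T m t| < l0 * (ρ / 4) := by
    have : ContinuousAt (fun t : ℝ => |bg a φ p lam T m t|) T :=
      (ContinuousAt.comp (x := T) (f := fun t : ℝ => (m, t)) (g := fun z : ℝ² => bg a φ p lam T z.1 z.2) (bcont.continuousAt (hU.mem_nhds hmU)) (by fun_prop)).abs
    have := this.eventually (Iio_mem_nhds (show |bg a φ p lam T m T| < l0 * (ρ / 4) by rw [b0, abs_zero]; positivity))
    obtain ⟨δ, hδ, H⟩ := Metric.eventually_nhds_iff.1 this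
    exact ⟨δ, hδ, fun t ht => H (by rwa [Real.dist_eq])⟩
  obtain ⟨δ, hδ, hbδ⟩ := hbev
  obtain ⟨τ, ⟨⟨t1, t2, t3, t4⟩, t5⟩, t6⟩ := ((hτev.and (small_lt hδ)).and self_mem_nhdsWithin).exists
  have hτ0 : 0 < τ := t6
  have srcb : ∀ k : ℝ → ℝ → ℝ → ℝ, (∀ x q t, |k x q t| ≤ M) → ∀ (q l : ℝ → ℝ) (x t : ℝ), T ≤ t → t ≤ T + τ → |∫ s in T..t, k x (q s) (t - s) * c (l s)| ≤ M * R * τ := by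
    intro k hk q l x t ht1 ht2
    have := intervalIntegral.norm_integral_le_of_norm_le_const (a := T) (b := t) (C := M * R) (f := fun s => k x (q s) (t - s) * c (l s)) (fun s _ => by
      rw [Real.norm_eq_abs, abs_mul]; exact mul_le_mul (hk _ _ _) (hF.cR _) (abs_nonneg _) hMM)
    rw [Real.norm_eq_abs, abs_of_nonneg (by linarith : (0:ℝ) ≤ t - T)] at this
    exact this.trans (mul_le_mul_of_nonneg_left (by linarith) (by positivity))
  refine ⟨ρ, τ, g, B, k1, k2, c, L, M, R, hρ, hτ0, bx.h1, bx.h2, hF, ?_, ?_⟩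
  · intro q l t hq hl' ht1 ht2
    have tT : |t - T| ≤ ρ := by rw [abs_le]; constructor <;> linarith
    have e1 := srcb k1 hF.m1 q l (q t) t ht1 ht2
    have e2 := srcb k2 hF.m2 q l (q t) t ht1 ht2
    constructor
    · have e3 : |g (q t) t - g m t| ≤ ρ / 4 := by
        have e4 := hF.gl (cc m ρ (q t)) m t
        have e5 : g (cc m ρ (q t)) t = g (q t) t := by
          show cc m ρ (cc m ρ (q t)) + bg a φ p lam T (cc m ρ (cc m ρ (q t))) _ / l0 = _
          rw [cc_eq (cc_abs m (q t) hρ.le)]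
        rw [e5] at e4
        linarith [cc_abs m (q t) hρ.le]
      have e6 : |g m t - m| < ρ / 4 := by
        show |cc m ρ m + bg a φ p lam T (cc m ρ m) (cc T ρ t) / l0 - m| < _
        rw [cc_eq (x := m) (by rw [sub_self, abs_zero]; exact hρ.le), cc_eq tT, add_sub_cancel_left, abs_div, abs_of_pos hl, div_lt_iff₀ hl]
        linarith [hbδ t (by rw [abs_lt]; constructor <;> linarith)]
      unfold Psi
      rw [show g (q t) t + (∫ s in T..t, k1 (q t) (q s) (t - s) * c (l s)) - m = (g (q t) t - g m t) + (g m t - m) + ∫ s in T..t, k1 (q t) (q s) (t - s) * c (l s) by ring]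
      refine (abs_add_le _ _).trans_lt ?_
      linarith [abs_add_le (g (q t) t - g m t) (g m t - m)]
    · have e3 : |B (q t) t - l0| < l0 / 4 := by
        have := (hbx (cc m ρ (q t)) (cc T ρ t) (cc_abs _ _ hρ.le) (cc_abs _ _ hρ.le)).2
        show |-_ - l0| < _
        rwa [← neg_add', abs_neg]
      unfold Psi
      rw [add_sub_right_comm]
      refine (abs_add_le _ _).trans_lt ?_
      linarith
  · intro q l hC hag t ht1 ht2 hin
    have tT : |t - T| ≤ ρ := by rw [abs_le]; constructor <;> linarith
    have htin : t ∈ Icc T t := ⟨ht1, le_rfl⟩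
    have hqt := (hin t htin).1
    have ecl : ∀ s ∈ Icc T t, c (l s) = l s := fun s hs => cc_eq (hin s hs).2.le
    have srcG : ∀ x, |x - m| ≤ ρ → (∫ s in T..t, Gk a x (q s) (t - s) * l s) = ∫ s in T..t, kk G0 a m ρ x (q s) (t - s) * c (l s) := by
      intro x hx
      refine intervalIntegral.integral_congr fun s hs => ?_
      rw [uIcc_of_le ht1] at hs
      show Gk a x (q s) (t - s) * l s = kk G0 a m ρ x (q s) (t - s) * c (l s)
      rw [ecl s hs, kk_eq hx (hin s hs).1.le (by linarith [hs.2]) (by linarith [hs.1])]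
    have FFe : ∀ x, |x - m| ≤ ρ → FF a φ q l x t = bg a φ p lam T x t + ∫ s in T..t, kk G0 a m ρ x (q s) (t - s) * c (l s) := by
      intro x hx
      rw [FF_split ha hC hT hag (bx.abs1 hx).le ht1, srcG x hx]
    have FFd : ∀ x, |x - m| < ρ → HasDerivAt (fun x => FF a φ q l x t) (bgx a φ' p lam T x t + ∫ s in T..t, kk G1 a m ρ x (q s) (t - s) * c (l s)) x := by
      intro x hx
      have d1 := bder x t (hbx x t hx.le tT).1
      have d2 := src_deriv bx hC.cp hC.cl hF.hc hF.cR ht1 (by linarith) (fun s hs => (hin s hs).1.le) hx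
      refine (d1.add d2).congr_of_eventuallyEq ?_
      have : ∀ᶠ y in 𝓝 x, |y - m| < ρ := (isOpen_lt (by fun_prop) (by fun_prop) : IsOpen {y : ℝ | |y - m| < ρ}).mem_nhds hx
      filter_upwards [this] with y hy
      exact FFe y hy.le
    have k2e : ∀ x, (∫ s in T..t, k2 x (q s) (t - s) * c (l s)) = -∫ s in T..t, kk G1 a m ρ x (q s) (t - s) * c (l s) := by
      intro x
      rw [← intervalIntegral.integral_neg]
      congr 1; ext s; show -_ * _ = _; ring
    refine ⟨?_, ?_, fun x hx => ⟨_, ?_, FFd x hx⟩⟩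
    · unfold Psi
      show cc m ρ (q t) + bg a φ p lam T (cc m ρ (q t)) (cc T ρ t) / l0 + _ = _
      rw [cc_eq hqt.le, cc_eq tT, FFe _ hqt.le, add_div, ← add_assoc]
      congr 1
      rw [← intervalIntegral.integral_div]
      congr 1; ext s; show _ / l0 * _ = _; ring
    · refine (FFd _ hqt).congr_deriv ?_
      unfold Psi
      rw [k2e]
      show _ = -(-bgx a φ' p lam T (cc m ρ (q t)) (cc T ρ t) + _)
      rw [cc_eq hqt.le, cc_eq tT]; ring
    · have e1 := (hbx x t hx.le tT).2
      have e2 := srcb k2 hF.m2 q l x t ht1 ht2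
      rw [k2e, abs_neg] at e2
      have := abs_lt.1 e1
      have := abs_le.1 e2
      linarith

lemma FF_congr {q l : ℝ → ℝ} {t : ℝ} (hag : ∀ s ∈ Icc 0 t, q s = p s ∧ l s = lam s) (x : ℝ) : FF a φ q l x t = FF a φ p lam x t := by
  unfold FF
  rcases le_total t 0 with ht | ht
  · rw [SS_nonpos x ht, SS_nonpos x ht]
  · congr 1
    unfold SS
    refine intervalIntegral.integral_congr fun s hs => ?_
    rw [uIcc_of_le ht] at hs
    show Gk a x (q s) (t - s) * l s = Gk a x (p s) (t - s) * lam s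
    rw [(hag s hs).1, (hag s hs).2]

lemma Psi_congr {g : ℝ → ℝ → ℝ} {k : ℝ → ℝ → ℝ → ℝ} {c : ℝ → ℝ} {q l : ℝ → ℝ} {t : ℝ} (hTt : T ≤ t) (hag : ∀ s ∈ Icc T t, q s = p s ∧ l s = lam s) :
    Psi g k c T q l t = Psi g k c T p lam t := by
  unfold Psi
  rw [(hag t ⟨hTt, le_rfl⟩).1]
  congr 1
  refine intervalIntegral.integral_congr fun s hs => ?_
  rw [uIcc_of_le hTt] at hs
  show k (p t) (q s) (t - s) * c (l s) = k (p t) (p s) (t - s) * c (lam s)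
  rw [(hag s hs).1, (hag s hs).2]

set_option maxHeartbeats 1000000 in
theorem Sol.unique (D : Dat a φ φ' pI) {q l : ℝ → ℝ} (S : Sol a φ pI T p lam) (S' : Sol a φ pI T q l) : ∀ t ∈ Icc 0 T, q t = p t ∧ l t = lam t := by
  by_contra hne
  push Not at hne
  obtain ⟨t1, ht1, hne1⟩ := hne
  set E := {t | t ∈ Icc 0 T ∧ ¬(q t = p t ∧ l t = lam t)} with hE
  have hEne : E.Nonempty := ⟨t1, ht1, fun e => hne1 e.1 e.2⟩
  have hEb : BddBelow E := ⟨0, fun t ht => ht.1.1⟩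
  set t0 := sInf E with ht0
  have h00 : 0 ≤ t0 := le_csInf hEne fun t ht => ht.1.1
  have h0T : t0 ≤ T := (csInf_le hEb ⟨ht1, fun e => hne1 e.1 e.2⟩).trans ht1.2
  have hT0 : 0 ≤ T := h00.trans h0T
  have cl : IsClosed {t | q t = p t ∧ l t = lam t} := (isClosed_eq S'.crv.cp S.crv.cp).inter (isClosed_eq S'.crv.cl S.crv.cl)
  have hlt : ∀ t ∈ Ico 0 t0, q t = p t ∧ l t = lam t := by
    intro t ht
    by_contra hn
    have := csInf_le hEb (show t ∈ E from ⟨⟨ht.1, by linarith [ht.2]⟩, hn⟩)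
    linarith [ht.2]
  have h0 : q 0 = p 0 ∧ l 0 = lam 0 := by
    have e : q 0 = p 0 := by rw [S.p0, S'.p0]
    have d1 := S.der 0 ⟨le_rfl, hT0⟩
    have d2 := S'.der 0 ⟨le_rfl, hT0⟩
    refine ⟨e, ?_⟩
    simp only [FF_zero] at d1 d2
    rw [e] at d2
    linarith [d1.unique d2]
  have hle : ∀ t ∈ Icc 0 t0, q t = p t ∧ l t = lam t := by
    rcases eq_or_lt_of_le h00 with e | e
    · intro t ht
      rw [show t = 0 from le_antisymm (by linarith [ht.2]) ht.1]; exact h0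
    · intro t ht
      have := cl.closure_subset_iff.2 (show Ico 0 t0 ⊆ _ from hlt)
      rw [closure_Ico e.ne] at this
      exact this ht
  have ht0I : t0 ∈ Icc 0 T := ⟨h00, h0T⟩
  obtain ⟨ρ, τ, g, B, k1, k2, c, L, M, R, hρ, hτ, _, _, hF, -, hB⟩ := loc D S.crv h00 (S.lpos t0 ht0I) (S.zero t0 ht0I) (S.der t0 ht0I)
  obtain ⟨h1, hh1, hu⟩ := fp_unique hF t0
  have ee := hle t0 ⟨h00, le_rfl⟩
  have hlp := S.lpos t0 ht0I
  have near : ∀ (u : ℝ → ℝ) (b e : ℝ), Continuous u → u t0 = b → 0 < e → ∀ᶠ t in 𝓝 t0, |u t - b| < e := by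
    intro u b e hu hb he
    have : Continuous fun t => |u t - b| := by fun_prop
    exact (this.tendsto t0).eventually (Iio_mem_nhds (by show |u t0 - b| < e; rw [hb, sub_self, abs_zero]; exact he))
  have hall := (near p (p t0) ρ S.crv.cp rfl hρ).and ((near q (p t0) ρ S'.crv.cp ee.1 hρ).and ((near lam (lam t0) (lam t0 / 2) S.crv.cl rfl (by positivity)).and (near l (lam t0) (lam t0 / 2) S'.crv.cl ee.2 (by positivity))))
  obtain ⟨ε, hε, hall⟩ := Metric.eventually_nhds_iff.1 hall
  set h := min (ε/2) (min τ h1) with hh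
  have hh0 : 0 < h := by positivity
  have hb1 : h ≤ ε/2 := min_le_left _ _
  have hb2 : h ≤ τ := (min_le_right _ _).trans (min_le_left _ _)
  have hb3 : h ≤ h1 := (min_le_right _ _).trans (min_le_right _ _)
  set t2 := min T (t0 + h) with ht2
  have ht02 : t0 ≤ t2 := le_min h0T (by linarith)
  have hcl : ∀ s ∈ Icc t0 t2, dist s t0 < ε := fun s hs => by
    rw [Real.dist_eq, abs_of_nonneg (by linarith [hs.1])]
    linarith [hs.2.trans (min_le_right T (t0+h))]
  have fin := hu p lam q l S.crv.cp S.crv.cl S'.crv.cp S'.crv.cl t2 ht02 ((min_le_right _ _).trans (by linarith)) (fun t ht => by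
    have htT : t ∈ Icc 0 T := ⟨by linarith [ht.1], ht.2.trans (min_le_left _ _)⟩
    have htt : t ≤ t0 + τ := by linarith [ht.2.trans (min_le_right T (t0+h))]
    obtain ⟨a1, a2, -⟩ := hB p lam S.crv (fun s _ => ⟨rfl, rfl⟩) t ht.1 htt (fun s hs => by
      obtain ⟨b1, b2, b3, b4⟩ := hall (hcl s ⟨hs.1, hs.2.trans ht.2⟩); exact ⟨b1, b3⟩)
    obtain ⟨a3, a4, -⟩ := hB q l S'.crv hle t ht.1 htt (fun s hs => by
      obtain ⟨b1, b2, b3, b4⟩ := hall (hcl s ⟨hs.1, hs.2.trans ht.2⟩); exact ⟨b2, b4⟩)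
    rw [S.zero t htT, zero_div, add_zero] at a1
    rw [S'.zero t htT, zero_div, add_zero] at a3
    exact ⟨a1.symm, by linarith [a2.unique (S.der t htT)], a3.symm, by linarith [a4.unique (S'.der t htT)]⟩)
  have hT' : ∀ t ∈ Icc 0 t2, q t = p t ∧ l t = lam t := by
    intro t ht
    rcases le_total t t0 with e | e
    · exact hle t ⟨ht.1, e⟩
    · have := fin t ⟨e, ht.2⟩; exact ⟨this.1.symm, this.2.symm⟩
  rcases le_total T (t0 + h) with e | e
  · have : t2 = T := min_eq_left e
    rw [this] at hT'
    exact hne1 (hT' t1 ht1).1 (hT' t1 ht1).2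
  · have e2 : t2 = t0 + h := min_eq_right e
    rw [e2] at hT'
    obtain ⟨t, htE, htl⟩ := exists_lt_of_csInf_lt hEne (show sInf E < t0 + h by rw [← ht0]; linarith)
    exact htE.2 (hT' t ⟨htE.1.1, htl.le⟩)

set_option maxHeartbeats 1000000 in
theorem Sol.extend (D : Dat a φ φ' pI) (hT : 0 ≤ T) (S : Sol a φ pI T p lam) : ∃ h > 0, ∃ q l : ℝ → ℝ, Sol a φ pI (T + h) q l := by
  have hTI : T ∈ Icc 0 T := ⟨hT, le_rfl⟩
  obtain ⟨ρ, τ, g, B, k1, k2, c, L, M, R, hρ, hτ, hm1, hm2, hF, hA, hB⟩ := loc D S.crv hT (S.lpos T hTI) (S.zero T hTI) (S.der T hTI)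
  obtain ⟨h0, hh0, P, Lm, cP, cL, hfix⟩ := fp_exists hF T
  have hlp := S.lpos T hTI
  set h1 := min h0 τ with hh1
  have h10 : 0 < h1 := by positivity
  have h1a : h1 ≤ h0 := min_le_left _ _
  have h1b : h1 ≤ τ := min_le_right _ _
  -- values at T
  obtain ⟨f1, f2, -⟩ := hB p lam S.crv (fun s _ => ⟨rfl, rfl⟩) T le_rfl (by linarith) (fun s hs => by
    have : s = T := le_antisymm hs.2 hs.1
    rw [this, sub_self, sub_self, abs_zero]; exact ⟨hρ, by positivity⟩)
  have gT : ∀ (g : ℝ → ℝ → ℝ) k p l, Psi g k c T p l T = g (p T) T := fun g k p l => by unfold Psi; rw [intervalIntegral.integral_same, add_zero]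
  rw [gT, S.zero T hTI, zero_div, add_zero] at f1
  rw [gT] at f2
  have f3 := f2.unique (S.der T hTI)
  obtain ⟨f4, f5⟩ := hfix T ⟨le_rfl, by linarith⟩
  rw [gT] at f4 f5
  have eP : P T = p T := by
    have := hF.gl (P T) (p T) T
    rw [← f4, f1] at this
    have h0 := abs_nonneg (P T - p T)
    have : |P T - p T| ≤ 0 := by linarith
    linarith [abs_nonpos_iff.1 this]
  have eL : Lm T = lam T := by rw [f5, eP]; linarith
  -- range
  have rng : ∀ t ∈ Icc T (T + h1), |P t - p T| < ρ ∧ |Lm t - lam T| < lam T / 2 := by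
    intro t ht
    have := hA P Lm t cP cL ht.1 (by linarith [ht.2])
    obtain ⟨e1, e2⟩ := hfix t ⟨ht.1, by linarith [ht.2]⟩
    rwa [← e1, ← e2] at this
  set q : ℝ → ℝ := fun s => if s ≤ T then p s else P (min s (T + h1)) with hq
  set l : ℝ → ℝ := fun s => if s ≤ T then lam s else Lm (min s (T + h1)) with hl
  have q1 : ∀ s, s ≤ T → q s = p s ∧ l s = lam s := fun s hs => ⟨if_pos hs, if_pos hs⟩
  have q2 : ∀ s ∈ Icc T (T + h1), q s = P s ∧ l s = Lm s := fun s hs => by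
    rcases eq_or_lt_of_le hs.1 with e | e
    · rw [← e, eP, eL]; exact q1 T le_rfl
    · constructor
      · show (if s ≤ T then p s else P (min s (T + h1))) = _
        rw [if_neg (by linarith), min_eq_left hs.2]
      · show (if s ≤ T then lam s else Lm (min s (T + h1))) = _
        rw [if_neg (by linarith), min_eq_left hs.2]
  have crv : Crv q l := by
    refine ⟨?_, fun s => ?_, ?_⟩
    · refine Continuous.if_le S.crv.cp (by fun_prop) continuous_id continuous_const fun s hs => ?_
      have : s = T := hs
      rw [this, min_eq_left (by linarith), eP]
    · show (if s ≤ T then p s else P (min s (T + h1))) ∈ _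
      split_ifs with hs
      · exact S.crv.mem s
      · push Not at hs
        have := abs_lt.1 (rng (min s (T + h1)) ⟨le_min hs.le (by linarith), min_le_right _ _⟩).1
        constructor <;> linarith
    · refine Continuous.if_le S.crv.cl (by fun_prop) continuous_id continuous_const fun s hs => ?_
      have : s = T := hs
      rw [this, min_eq_left (by linarith), eL]
  have qrng : ∀ t ∈ Icc T (T + h1), |q t - p T| < ρ ∧ |l t - lam T| < lam T / 2 := fun t ht => by
    rw [(q2 t ht).1, (q2 t ht).2]; exact rng t ht
  have main : ∀ t ∈ Icc T (T + h1), FF a φ q l (q t) t = 0 ∧ HasDerivAt (fun x => FF a φ q l x t) (-l t) (q t) ∧ ∀ x, |x - p T| < ρ → ∃ d < 0, HasDerivAt (fun x => FF a φ q l x t) d x := by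
    intro t ht
    obtain ⟨a1, a2, a3⟩ := hB q l crv (fun s hs => q1 s hs.2) t ht.1 (by linarith [ht.2]) (fun s hs => qrng s ⟨hs.1, hs.2.trans ht.2⟩)
    have c1 : ∀ s ∈ Icc T t, q s = P s ∧ l s = Lm s := fun s hs => q2 s ⟨hs.1, hs.2.trans ht.2⟩
    obtain ⟨e1, e2⟩ := hfix t ⟨ht.1, by linarith [ht.2]⟩
    rw [Psi_congr ht.1 c1, ← e1, (q2 t ht).1] at a1
    rw [Psi_congr ht.1 c1, ← e2, ← (q2 t ht).2] at a2
    refine ⟨?_, a2, a3⟩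
    rw [(q2 t ht).1]
    have : FF a φ q l (P t) t / lam T = 0 := by linarith
    rcases div_eq_zero_iff.1 this with e | e
    · exact e
    · exact absurd e hlp.ne'
  -- signs on compact sides
  have cF := FF_cont D crv
  have evp : ∀ᶠ t in 𝓝 T, ∀ x ∈ Icc (-1) (p T - ρ / 2), 0 < FF a φ q l (clamp x) t := by
    refine IsCompact.eventually_forall_of_forall_eventually isCompact_Icc (P := fun t x => 0 < FF a φ q l (clamp x) t) fun x hx => ?_
    have hxx : x ∈ 𝕁 := ⟨hx.1, by linarith [hx.2]⟩
    have hpos : 0 < FF a φ q l (clamp x) T := by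
      rw [clamp_eq hxx, FF_congr (fun s hs => q1 s hs.2)]
      exact S.pos T hTI x ⟨hx.1, by linarith [hx.2]⟩
    have : Continuous fun z : ℝ² => FF a φ q l (clamp z.2) z.1 := cF.comp (f := fun z : ℝ² => (z.2, z.1)) (by fun_prop)
    exact (this.tendsto (T, x)).eventually (Ioi_mem_nhds hpos)
  have evn : ∀ᶠ t in 𝓝 T, ∀ x ∈ Icc (p T + ρ / 2) 1, FF a φ q l (clamp x) t < 0 := by
    refine IsCompact.eventually_forall_of_forall_eventually isCompact_Icc (P := fun t x => FF a φ q l (clamp x) t < 0) fun x hx => ?_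
    have hxx : x ∈ 𝕁 := ⟨by linarith [hx.1], hx.2⟩
    have hpos : FF a φ q l (clamp x) T < 0 := by
      rw [clamp_eq hxx, FF_congr (fun s hs => q1 s hs.2)]
      exact S.neg T hTI x ⟨by linarith [hx.1], hx.2⟩
    have : Continuous fun z : ℝ² => FF a φ q l (clamp z.2) z.1 := cF.comp (f := fun z : ℝ² => (z.2, z.1)) (by fun_prop)
    exact (this.tendsto (T, x)).eventually (Iio_mem_nhds hpos)
  obtain ⟨ε, hε, hev⟩ := Metric.eventually_nhds_iff.1 (evp.and evn)
  set h := min (ε / 2) h1 with hh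
  have hh0 : 0 < h := by positivity
  have hb1 : h ≤ ε / 2 := min_le_left _ _
  have hb2 : h ≤ h1 := min_le_right _ _
  have anti : ∀ t ∈ Icc T (T + h1), StrictAntiOn (fun x => FF a φ q l x t) (Ioo (p T - ρ) (p T + ρ)) := by
    intro t ht
    have hx' : ∀ x ∈ Ioo (p T - ρ) (p T + ρ), |x - p T| < ρ := fun x hx => by rw [abs_lt]; constructor <;> linarith [hx.1, hx.2]
    refine strictAntiOn_of_deriv_neg (convex_Ioo _ _) (fun x hx => ?_) (fun x hx => ?_)
    · obtain ⟨d, _, hd⟩ := (main t ht).2.2 x (hx' x hx)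
      exact hd.continuousAt.continuousWithinAt
    · rw [interior_Ioo] at hx
      obtain ⟨d, hd0, hd⟩ := (main t ht).2.2 x (hx' x hx)
      rw [hd.deriv]; exact hd0
  have qI : ∀ t ∈ Icc T (T + h1), q t ∈ Ioo (p T - ρ) (p T + ρ) := fun t ht => by
    have := abs_lt.1 (qrng t ht).1; constructor <;> linarith
  have hI : ∀ t, T ≤ t → t ≤ T + h → t ∈ Icc T (T + h1) := fun t h1 h2 => ⟨h1, by linarith⟩
  have hdist : ∀ t, T ≤ t → t ≤ T + h → dist t T < ε := fun t h1 h2 => by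
    rw [Real.dist_eq, abs_of_nonneg (by linarith)]; linarith
  refine ⟨h, hh0, q, l, crv, ?_, ?_, ?_, ?_, ?_, ?_⟩
  · rw [(q1 0 hT).1]; exact S.p0
  · intro t ht
    rcases le_total t T with e | e
    · rw [FF_congr (fun s hs => q1 s (hs.2.trans e)), (q1 t e).1]; exact S.zero t ⟨ht.1, e⟩
    · exact (main t (hI t e ht.2)).1
  · intro t ht
    rcases le_total t T with e | e
    · simp only [FF_congr (a := a) (φ := φ) (fun s (hs : s ∈ Icc 0 t) => q1 s (hs.2.trans e))]
      rw [(q1 t e).1, (q1 t e).2]; exact S.der t ⟨ht.1, e⟩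
    · exact (main t (hI t e ht.2)).2.1
  · intro t ht
    rcases le_total t T with e | e
    · rw [(q1 t e).2]; exact S.lpos t ⟨ht.1, e⟩
    · have := abs_lt.1 (qrng t (hI t e ht.2)).2; linarith
  · intro t ht x hx
    rcases le_total t T with e | e
    · rw [FF_congr (fun s hs => q1 s (hs.2.trans e))]
      rw [(q1 t e).1] at hx
      exact S.pos t ⟨ht.1, e⟩ x hx
    · have htI := hI t e ht.2
      rcases le_total x (p T - ρ / 2) with e2 | e2
      · have := (hev (hdist t e ht.2)).1 x ⟨hx.1, e2⟩
        rwa [clamp_eq ⟨hx.1, by linarith⟩] at this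
      · have h3 := anti t htI (show x ∈ Ioo (p T - ρ) (p T + ρ) from ⟨by linarith, by linarith [hx.2, (qI t htI).2]⟩) (qI t htI) hx.2
        simp only [(main t htI).1] at h3
        exact h3
  · intro t ht x hx
    rcases le_total t T with e | e
    · rw [FF_congr (fun s hs => q1 s (hs.2.trans e))]
      rw [(q1 t e).1] at hx
      exact S.neg t ⟨ht.1, e⟩ x hx
    · have htI := hI t e ht.2
      rcases le_total (p T + ρ / 2) x with e2 | e2
      · have := (hev (hdist t e ht.2)).2 x ⟨e2, hx.2⟩
        rwa [clamp_eq ⟨by linarith, hx.2⟩] at this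
      · have h3 := anti t htI (qI t htI) (show x ∈ Ioo (p T - ρ) (p T + ρ) from ⟨by linarith [hx.1, (qI t htI).1], by linarith⟩) hx.1
        simp only [(main t htI).1] at h3
        exact h3

/-- trivial solution at time zero -/
lemma Sol.init (D : Dat a φ φ' pI) : Sol a φ pI 0 (fun _ => pI) (fun _ => -φ' pI) := by
  have e : ∀ t ∈ Icc (0:ℝ) 0, t = 0 := fun t ht => le_antisymm ht.2 ht.1
  refine ⟨⟨continuous_const, fun _ => D.hpI, continuous_const⟩, rfl, ?_, ?_, ?_, ?_, ?_⟩
  · intro t ht; rw [e t ht, FF_zero]; exact D.z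
  · intro t ht; rw [e t ht]; simp only [FF_zero, neg_neg]; exact D.hd pI
  · intro t _; linarith [D.sl]
  · intro t ht x hx; rw [e t ht, FF_zero]; exact D.pos x hx
  · intro t ht x hx; rw [e t ht, FF_zero]; exact D.neg x hx

set_option maxHeartbeats 1000000 in
/-- any integrable flux satisfying the flux condition agrees with a continuous function up to `t = 0` and `t = T` -/
lemma flux_cont (D : Dat a φ φ' pI) {q l : ℝ → ℝ} (hq : Continuous q) (hm : ∀ s, q s ∈ Ioo (-1:ℝ) 1) (hT : 0 < T) (hl : IntegrableOn l (Ioc 0 T))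
    (hd : ∀ t ∈ Ioo 0 T, HasDerivAt (fun x => FF a φ q l x t) (-l t) (q t)) :
    ∃ G : ℝ → ℝ, ContinuousOn G (Icc 0 T) ∧ (∀ t ∈ Ioo 0 T, l t = G t) ∧ G 0 = -φ' (q 0) := by
  have ha := D.ha
  obtain ⟨B, hB, hb⟩ := D.bd
  obtain ⟨B', hB', hb'⟩ := D.bd'
  have hC := graph_compact (hq.continuousOn (s := Icc 0 T))
  have hpC : ∀ s ∈ Ioc 0 T, (q s, s) ∈ ((fun s => (q s, s)) '' Icc 0 T) := fun s hs => ⟨s, Ioc_subset_Icc_self hs, rfl⟩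
  obtain ⟨hcal, hint⟩ := src_caloric (a := a) hC hT.le hq.measurable hpC hl
  set U := srcU a ((fun s => (q s, s)) '' Icc 0 T) with hUdef
  have hU : IsOpen U := srcU_open a hC
  have hmemI : ∀ s, q s ∈ 𝕁 := fun s => Ioo_subset_Icc_self (hm s)
  have hmem : ∀ t ∈ Icc 0 T, (q t, t) ∈ U := by
    rintro t ht w ⟨s, hs, rfl⟩
    have a0 := abs_le.2 (hmemI t)
    have := al_pos ha (hm t)
    by_cases e : t - s = 0
    · have : s = t := by linarith
      subst this
      exact ⟨mem_gΩ_of_ne a0 (ym_abs ha (hmemI _)) (by show q s ≠ q s - al a (q s); linarith), mem_gΩ_of_ne a0 (yp_abs ha (hmemI _)) (by show q s ≠ q s + al a (q s); linarith)⟩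
    · exact ⟨mem_gΩ_of_time (by linarith) (by linarith [ym_abs ha (hmemI s)]) e, mem_gΩ_of_time (by linarith) (by linarith [yp_abs ha (hmemI s)]) e⟩
  set J : ℝ² → ℝ := fun z => ∫ s in (0:ℝ)..T, Gk a z.1 (q s) (z.2 - s) * l s with hJ
  refine ⟨fun t => -(util φ' (q t) t + dX J (q t, t)), ?_, fun t ht => ?_, ?_⟩
  · refine ContinuousOn.neg (ContinuousOn.add ?_ ?_)
    · exact ((util_continuous D.c' hb').comp (hq.prodMk continuous_id)).continuousOn
    · exact (hcal.smooth.dX hU).continuousOn.comp (hq.prodMk continuous_id).continuousOn (fun t ht => hmem t ht)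
  · have h1 : HasDerivAt (fun x => util φ x t + J (x, t)) (util φ' (q t) t + dX J (q t, t)) (q t) :=
      (util_hasDerivAt D.hd D.c' hb hb' (q t) t).add (hcal.smooth.hasDerivX hU (hmem t ⟨ht.1.le, ht.2.le⟩))
    have h2 : (fun x => FF a φ q l x t) =ᶠ[𝓝 (q t)] (fun x => util φ x t + J (x, t)) := by
      have hev : ∀ᶠ x in 𝓝 (q t), (x, t) ∈ U := (by fun_prop : Continuous fun x : ℝ => (x, t)).continuousAt.eventually (hU.mem_nhds (hmem t ⟨ht.1.le, ht.2.le⟩))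
      filter_upwards [hev] with x hx
      have hi : IntervalIntegrable (fun s => Gk a x (q s) (t - s) * l s) volume 0 T := hint (x, t) hx
      show util φ x t + SS a q l x t = util φ x t + J (x, t)
      rw [SS_ext x ht.1.le ht.2.le hi]
    have := (h1.congr_of_eventuallyEq h2).unique (hd t ht)
    simp only []
    linarith
  · have h1 := hcal.smooth.hasDerivX hU (hmem 0 ⟨le_rfl, hT.le⟩)
    have h0 : ∀ x, J (x, 0) = 0 := by
      intro x
      rw [hJ]
      simp only []
      rw [intervalIntegral.integral_congr (g := fun _ => 0)]
      · simp
      · intro s hs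
        rw [uIcc_of_le hT.le] at hs
        show Gk a x (q s) (0 - s) * l s = 0
        rw [Gk_nonpos_time _ _ _ (by linarith [hs.1]), zero_mul]
    have h2 : dX J (q 0, 0) = 0 := by
      refine h1.unique ?_
      have : (fun x => J (x, 0)) = fun _ => 0 := funext h0
      show HasDerivAt (fun x => J (x, 0)) 0 (q 0)
      rw [this]; exact hasDerivAt_const _ _
    show -(util φ' (q 0) 0 + dX J (q 0, 0)) = _
    rw [h2, util_nonpos _ _ le_rfl, add_zero]

lemma ext_lim {g : ℝ → ℝ} {Ts L : ℝ} (h0 : 0 < Ts) (hg : ContinuousOn g (Ico 0 Ts)) (h : Tendsto g (𝓝[<] Ts) (𝓝 L)) :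
    ∃ G : ℝ → ℝ, Continuous G ∧ (∀ t ∈ Ico 0 Ts, G t = g t) ∧ G Ts = L ∧ ∀ t, G t = L ∨ ∃ s ∈ Ico 0 Ts, G t = g s := by
  have hs : Icc 0 Ts \ {Ts} ⊆ Ico 0 Ts := fun t ht => ⟨ht.1.1, lt_of_le_of_ne ht.1.2 ht.2⟩
  have hc : ContinuousOn (Function.update g Ts L) (Icc 0 Ts) := by
    rw [continuousOn_update_iff]
    refine ⟨hg.mono hs, fun _ => h.mono_left (nhdsWithin_mono _ fun t ht => (hs ht).2)⟩
  refine ⟨IccExtend h0.le ((Icc 0 Ts).domRestrict (Function.update g Ts L)), hc.domRestrict.Icc_extend', fun t ht => ?_, ?_, fun t => ?_⟩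
  · rw [IccExtend_of_mem h0.le _ ⟨ht.1, ht.2.le⟩]
    show Function.update g Ts L t = g t
    rw [Function.update_of_ne ht.2.ne]
  · rw [IccExtend_of_mem h0.le _ ⟨h0.le, le_rfl⟩]
    show Function.update g Ts L Ts = L
    rw [Function.update_self]
  · show Function.update g Ts L _ = L ∨ ∃ s ∈ Ico 0 Ts, Function.update g Ts L _ = g s
    set w := projIcc 0 Ts h0.le t
    by_cases e : (w : ℝ) = Ts
    · left; rw [e, Function.update_self]
    · right; exact ⟨w, ⟨w.2.1, lt_of_le_of_ne w.2.2 e⟩, by rw [Function.update_of_ne e]⟩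

lemma Sol.congr {q l : ℝ → ℝ} (hT : 0 ≤ T) (S : Sol a φ pI T p lam) (h : Crv q l) (hag : ∀ s ∈ Icc 0 T, q s = p s ∧ l s = lam s) : Sol a φ pI T q l := by
  have hF : ∀ t ∈ Icc 0 T, ∀ x, FF a φ q l x t = FF a φ p lam x t := fun t ht x => FF_congr (fun s hs => hag s ⟨hs.1, hs.2.trans ht.2⟩) x
  refine ⟨h, by rw [(hag 0 ⟨le_rfl, hT⟩).1]; exact S.p0, fun t ht => ?_, fun t ht => ?_, fun t ht => ?_, fun t ht x hx => ?_, fun t ht x hx => ?_⟩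
  · rw [hF t ht, (hag t ht).1]; exact S.zero t ht
  · simp only [hF t ht]; rw [(hag t ht).1, (hag t ht).2]; exact S.der t ht
  · rw [(hag t ht).2]; exact S.lpos t ht
  · rw [hF t ht]; rw [(hag t ht).1] at hx; exact S.pos t ht x hx
  · rw [hF t ht]; rw [(hag t ht).1] at hx; exact S.neg t ht x hx

lemma glue (D : Dat a φ φ' pI) : ∃ p l : ℝ → ℝ, ∀ T p' l', Sol a φ pI T p' l' → ∀ t ∈ Icc 0 T, p' t = p t ∧ l' t = l t := by
  classical
  let P : ℝ → Prop := fun t => ∃ pl : (ℝ → ℝ) × (ℝ → ℝ), Sol a φ pI t pl.1 pl.2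
  refine ⟨fun t => if h : P t then (Classical.choose h).1 t else 0, fun t => if h : P t then (Classical.choose h).2 t else 0, fun T p' l' S t ht => ?_⟩
  have hP : P t := ⟨(p', l'), S.mono ht.2⟩
  simp only [dif_pos hP]
  exact Sol.unique D (Classical.choose_spec hP) (S.mono ht.2) t ⟨ht.1, le_rfl⟩

set_option maxHeartbeats 1000000 in
lemma closure1 (D : Dat a φ φ' pI) {Ts : ℝ} (hTs : 0 < Ts) (H : ∀ T, 0 ≤ T → T < Ts → ∃ p l, Sol a φ pI T p l) :
    ∃ q l, Crv q l ∧ ∀ T, 0 ≤ T → T < Ts → Sol a φ pI T q l := by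
  obtain ⟨p, l, hg⟩ := glue D
  have hF : ∀ T p' l', Sol a φ pI T p' l' → ∀ t ∈ Icc 0 T, ∀ x, FF a φ p l x t = FF a φ p' l' x t := fun T p' l' S t ht x =>
    FF_congr (fun s hs => ⟨((hg T p' l' S s ⟨hs.1, hs.2.trans ht.2⟩).1).symm, ((hg T p' l' S s ⟨hs.1, hs.2.trans ht.2⟩).2).symm⟩) x
  have hcts : ContinuousOn p (Ico 0 Ts) ∧ ContinuousOn l (Ico 0 Ts) := by
    have key : ∀ t ∈ Ico 0 Ts, ∃ p' l' : ℝ → ℝ, Continuous p' ∧ Continuous l' ∧ p =ᶠ[𝓝[Ico 0 Ts] t] p' ∧ l =ᶠ[𝓝[Ico 0 Ts] t] l' := by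
      intro t ht
      obtain ⟨p', l', S⟩ := H ((t + Ts)/2) (by linarith [ht.1]) (by linarith [ht.2])
      have hev : ∀ᶠ s in 𝓝[Ico 0 Ts] t, s ∈ Icc 0 ((t+Ts)/2) := by
        filter_upwards [self_mem_nhdsWithin, nhdsWithin_le_nhds (Iio_mem_nhds (show t < (t+Ts)/2 by linarith [ht.2]))] with s h1 h2
        exact ⟨h1.1, le_of_lt h2⟩
      refine ⟨p', l', S.crv.cp, S.crv.cl, ?_, ?_⟩
      · filter_upwards [hev] with s hs using ((hg _ _ _ S s hs).1).symm
      · filter_upwards [hev] with s hs using ((hg _ _ _ S s hs).2).symm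
    constructor
    · intro t ht
      obtain ⟨p', l', c1, c2, e1, e2⟩ := key t ht
      exact c1.continuousWithinAt.congr_of_eventuallyEq e1 (e1.eq_of_nhdsWithin ht)
    · intro t ht
      obtain ⟨p', l', c1, c2, e1, e2⟩ := key t ht
      exact c2.continuousWithinAt.congr_of_eventuallyEq e2 (e2.eq_of_nhdsWithin ht)
  -- limit of p
  have hcau : Cauchy (map p (𝓝[<] Ts)) := by
    rw [Metric.cauchy_iff]
    refine ⟨inferInstance, fun ε hε => ?_⟩
    obtain ⟨h, hh, hh2, hosc⟩ := osc D (show 0 < Ts/2 by linarith) (show 0 < ε/2 by linarith)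
    refine ⟨p '' Ioo (Ts - h) Ts, image_mem_map (Ioo_mem_nhdsLT (by linarith)), ?_⟩
    have key : ∀ s ∈ Ioo (Ts - h) Ts, ∀ s' ∈ Ioo (Ts - h) Ts, p s - p s' ≤ ε/2 := by
      intro s hs s' hs'
      have hm : max s s' < Ts := max_lt hs.2 hs'.2
      have hm0 : Ts / 2 ≤ max s s' := le_trans (by linarith [hs.1]) (le_max_left _ _)
      obtain ⟨p', l', S⟩ := H (max s s') (by linarith) hm
      have := hosc _ _ _ S (max s s') hm0 le_rfl s ⟨by linarith [hs.1], le_max_left _ _⟩ s' ⟨by linarith [hs'.1], le_max_right _ _⟩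
      rwa [(hg _ _ _ S s ⟨by linarith [hs.1], le_max_left _ _⟩).1, (hg _ _ _ S s' ⟨by linarith [hs'.1], le_max_right _ _⟩).1] at this
    rintro _ ⟨s, hs, rfl⟩ _ ⟨s', hs', rfl⟩
    rw [Real.dist_eq, abs_lt]
    constructor <;> linarith [key s hs s' hs', key s' hs' s hs]
  obtain ⟨ps, hps⟩ := cauchy_map_iff_exists_tendsto.1 hcau
  obtain ⟨ε0, hε0, hε1, hPb⟩ := P_bound D
  have hpb : ∀ t ∈ Ico 0 Ts, -1 + ε0 ≤ p t ∧ p t ≤ 1 - ε0 := by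
    intro t ht
    obtain ⟨p', l', S⟩ := H t ht.1 ht.2
    have := hPb _ _ _ S t ⟨ht.1, le_rfl⟩
    rwa [(hg _ _ _ S t ⟨ht.1, le_rfl⟩).1] at this
  have hev0 : ∀ᶠ t in 𝓝[<] Ts, t ∈ Ico 0 Ts := Ico_mem_nhdsLT hTs
  have hps1 : -1 + ε0 ≤ ps := ge_of_tendsto hps (hev0.mono fun t ht => (hpb t ht).1)
  have hps2 : ps ≤ 1 - ε0 := le_of_tendsto hps (hev0.mono fun t ht => (hpb t ht).2)
  obtain ⟨q, hqc, hqe, hqT, hqr⟩ := ext_lim hTs hcts.1 hps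
  have hqm : ∀ s, q s ∈ Ioo (-1:ℝ) 1 := by
    intro s
    rcases hqr s with e | ⟨t, ht, e⟩
    · rw [e]; constructor <;> linarith
    · rw [e]; constructor <;> linarith [(hpb t ht).1, (hpb t ht).2]
  -- integrability
  obtain ⟨Λ, hΛ, hlu⟩ := lam_unif D (show 0 < Ts/2 by linarith)
  obtain ⟨M, hM⟩ := (isCompact_Icc (a := (0:ℝ)) (b := Ts/2)).exists_bound_of_continuousOn (hcts.2.mono fun t ht => ⟨ht.1, by linarith [ht.2]⟩)
  have hlb : ∀ t ∈ Ico 0 Ts, ‖l t‖ ≤ max M Λ := by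
    intro t ht
    rcases le_total t (Ts/2) with h | h
    · exact (hM t ⟨ht.1, h⟩).trans (le_max_left _ _)
    · obtain ⟨p', l', S⟩ := H t ht.1 ht.2
      have h1 := hlu _ _ _ S t h le_rfl
      have h2 := S.lpos t ⟨ht.1, le_rfl⟩
      rw [(hg _ _ _ S t ⟨ht.1, le_rfl⟩).2] at h1 h2
      rw [Real.norm_eq_abs, abs_of_pos h2]; exact h1.trans (le_max_right _ _)
  have hli : IntegrableOn l (Ioc 0 Ts) := by
    rw [integrableOn_Ioc_iff_integrableOn_Ioo]
    refine IntegrableOn.of_bound (by simp) ((hcts.2.mono Ioo_subset_Ico_self).aestronglyMeasurable measurableSet_Ioo) (max M Λ) ?_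
    exact (ae_restrict_iff' measurableSet_Ioo).2 (Eventually.of_forall fun t ht => hlb t ⟨ht.1.le, ht.2⟩)
  have hqF : ∀ t ∈ Ico 0 Ts, ∀ x, FF a φ q l x t = FF a φ p l x t := fun t ht x => FF_congr (fun s hs => ⟨hqe s ⟨hs.1, hs.2.trans_lt ht.2⟩, rfl⟩) x
  obtain ⟨G, hGc, hGe, -⟩ := flux_cont D hqc hqm hTs hli (by
    intro t ht
    have ht' : t ∈ Ico 0 Ts := ⟨ht.1.le, ht.2⟩
    obtain ⟨p', l', S⟩ := H t ht'.1 ht'.2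
    have := S.der t ⟨ht'.1, le_rfl⟩
    simp only [hqF t ht', hF _ _ _ S t ⟨ht'.1, le_rfl⟩]
    rw [hqe t ht', ← (hg _ _ _ S t ⟨ht'.1, le_rfl⟩).2, ← (hg _ _ _ S t ⟨ht'.1, le_rfl⟩).1]
    exact this)
  have hlim : Tendsto l (𝓝[<] Ts) (𝓝 (G Ts)) := by
    have h1 : Tendsto G (𝓝[<] Ts) (𝓝 (G Ts)) := ((hGc Ts ⟨hTs.le, le_rfl⟩).mono_left (nhdsWithin_le_of_mem (by
      filter_upwards [hev0] with t ht using ⟨ht.1, ht.2.le⟩)))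
    refine h1.congr' ?_
    filter_upwards [Ioo_mem_nhdsLT hTs] with t ht using (hGe t ht).symm
  obtain ⟨l2, hl2c, hl2e, -, -⟩ := ext_lim hTs hcts.2 hlim
  refine ⟨q, l2, ⟨hqc, hqm, hl2c⟩, fun T hT0 hT => ?_⟩
  obtain ⟨p', l', S⟩ := H T hT0 hT
  refine S.congr hT0 ⟨hqc, hqm, hl2c⟩ fun s hs => ?_
  have := hg _ _ _ S s hs
  have hs' : s ∈ Ico 0 Ts := ⟨hs.1, hs.2.trans_lt hT⟩
  rw [hqe s hs', hl2e s hs']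
  exact ⟨this.1.symm, this.2.symm⟩

lemma dXdT_comm {f : ℝ² → ℝ} {U : Set ℝ²} (hU : IsOpen U) (h : SmoothOn f U) {z : ℝ²} (hz : z ∈ U) : dT (dX f) z = dX (dT f) z := by
  have hc : ContDiffAt ℝ 2 f z := (h 2).contDiffAt (hU.mem_nhds hz)
  have hs : IsSymmSndFDerivAt ℝ f z := hc.isSymmSndFDerivAt (by simp)
  have hd : DifferentiableAt ℝ (fderiv ℝ f) z := (((h 2).fderiv_of_isOpen hU (m := 1) (by norm_num)).contDiffAt (hU.mem_nhds hz)).differentiableAt (by norm_num)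
  have key : ∀ v w : ℝ², fderiv ℝ (fun z => fderiv ℝ f z v) z w = fderiv ℝ (fderiv ℝ f) z w v := by
    intro v w
    have := (hd.hasFDerivAt.clm_apply (hasFDerivAt_const v z)).fderiv
    rw [this]; simp
  show fderiv ℝ (fun z => fderiv ℝ f z (1, 0)) z (0, 1) = fderiv ℝ (fun z => fderiv ℝ f z (0, 1)) z (1, 0)
  rw [key, key]
  exact hs _ _

lemma Caloric.dX {f : ℝ² → ℝ} {U : Set ℝ²} (hU : IsOpen U) (h : Caloric f U) : Caloric (_root_.dX f) U := by
  refine ⟨h.smooth.dX hU, ?_⟩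
  rintro ⟨x, t⟩ hz
  rw [dXdT_comm hU h.smooth hz]
  refine dX_eq hU (h.smooth.dT hU) hz ?_
  refine (((h.smooth.dX hU).dX hU).hasDerivX hU hz).congr_of_eventuallyEq ?_
  filter_upwards [ev_slice hU hz] with y hy
  exact h.heat _ hy

/-- the scaling symmetry of the heat equation -/
lemma Caloric.gal {f : ℝ² → ℝ} {U : Set ℝ²} (hU : IsOpen U) (h : Caloric f U) (m τ : ℝ) :
    Caloric (fun z => 2 * (z.2 - τ) * _root_.dX f z + (z.1 - m) * f z) U := by
  have hX := h.dX hU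
  have hs : SmoothOn (fun z : ℝ² => 2 * (z.2 - τ) * _root_.dX f z + (z.1 - m) * f z) U := by
    refine SmoothOn.add (SmoothOn.mul (fun n => ?_) hX.smooth) (SmoothOn.mul (fun n => ?_) h.smooth)
    · exact (by fun_prop : ContDiff ℝ n fun z : ℝ² => 2 * (z.2 - τ)).contDiffOn
    · exact (by fun_prop : ContDiff ℝ n fun z : ℝ² => (z.1 - m)).contDiffOn
  refine ⟨hs, ?_⟩
  rintro ⟨x, t⟩ hz
  have e1 : HasDerivAt (fun s : ℝ => 2 * (s - τ)) 2 t := by simpa using ((hasDerivAt_id t).sub_const τ).const_mul 2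
  have e2 : ∀ y : ℝ, HasDerivAt (fun y : ℝ => y - m) 1 y := fun y => (hasDerivAt_id y).sub_const m
  have k1 := (e1.mul (hX.smooth.hasDerivT hU hz)).add ((h.smooth.hasDerivT hU hz).const_mul (x - m))
  have k2 := ((hX.smooth.dX hU).hasDerivX hU hz).const_mul (2 * (t - τ)) |>.add ((h.smooth.hasDerivX hU hz).add ((e2 x).mul (hX.smooth.hasDerivX hU hz)))
  refine heat_of hU hs hz (fun y => 2 * (t - τ) * _root_.dX (_root_.dX f) (y, t) + (f (y, t) + (y - m) * _root_.dX f (y, t))) k1 ?_ k2 ?_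
  · filter_upwards [ev_slice hU hz] with y hy
    have := ((hX.smooth.hasDerivX hU hy).const_mul (2 * (t - τ))).add ((e2 y).mul (h.smooth.hasDerivX hU hy))
    refine this.congr_deriv ?_
    ring
  · rw [hX.heat _ hz, h.heat _ hz]; ring

lemma pos_at (D : Dat a φ φ' pI) {q l : ℝ → ℝ} {Ts : ℝ} (hTs : 0 < Ts) (h : Crv q l) (HS : ∀ T, 0 ≤ T → T < Ts → Sol a φ pI T q l) :
    ∀ x ∈ Ico (-1:ℝ) (q Ts), 0 < FF a φ q l x Ts := by
  intro x hx
  have hx1 : x ≤ 1 := by linarith [hx.2, (h.mem Ts).2]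
  have hc : Tendsto (fun t => FF a φ q l x t) (𝓝[<] Ts) (𝓝 (FF a φ q l x Ts)) := by
    have := (FF_cont D h).comp (by fun_prop : Continuous fun t : ℝ => (x, t))
    have h2 := (this.tendsto Ts).mono_left (nhdsWithin_le_nhds (s := Iio Ts))
    simp only [Function.comp_def] at h2
    rwa [clamp_eq ⟨hx.1, hx1⟩] at h2
  rcases eq_or_lt_of_le hx.1 with e | e
  · subst e
    obtain ⟨η, hη, hF⟩ := F_left D
    refine hη.trans_le (ge_of_tendsto hc ?_)
    filter_upwards [Ico_mem_nhdsLT hTs] with t ht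
    exact hF _ _ _ (HS t ht.1 ht.2) t ⟨ht.1, le_rfl⟩
  · set r := (q Ts - x) / 3 with hr
    have hr0 : 0 < r := by have := hx.2; rw [hr]; linarith
    have hev : ∀ᶠ s in 𝓝 Ts, q Ts - r < q s := (h.cp.tendsto Ts).eventually (Ioi_mem_nhds (by linarith))
    obtain ⟨ε, hε, hb⟩ := Metric.eventually_nhds_iff.1 hev
    obtain ⟨H, hH, hH1, hH2⟩ : ∃ H > 0, H ≤ ε/3 ∧ H ≤ Ts/2 := ⟨min (ε/3) (Ts/2), by positivity, min_le_left _ _, min_le_right _ _⟩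
    obtain ⟨c, hc0, hL⟩ := LB D hr0 H hH (x + 1) (by linarith)
    refine hc0.trans_le (ge_of_tendsto hc ?_)
    filter_upwards [Ioo_mem_nhdsLT (show Ts - H < Ts by linarith)] with t ht
    refine hL t q l (HS t (by linarith [ht.1]) ht.2) t (by linarith [ht.1]) le_rfl (q Ts - r) (by linarith [(h.mem Ts).2]) (fun s hs => ?_) x (by linarith) (by linarith)
    refine (hb ?_).le
    rw [Real.dist_eq, abs_lt]; constructor <;> linarith [hs.1, hs.2, ht.1, ht.2]

set_option maxHeartbeats 1000000 in
lemma lpos_at (D : Dat a φ φ' pI) {q l : ℝ → ℝ} {Ts : ℝ} (hTs : 0 < Ts) (h : Crv q l) (HS : ∀ T, 0 ≤ T → T < Ts → Sol a φ pI T q l)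
    (hz : FF a φ q l (q Ts) Ts = 0) (hp : ∀ x ∈ Ico (-1:ℝ) (q Ts), 0 < FF a φ q l x Ts) (hn : ∀ x ∈ Ioc (q Ts) 1, FF a φ q l x Ts < 0) :
    dX (fun z => FF a φ q l z.1 z.2) (q Ts, Ts) < 0 := by
  have ha := D.ha
  have hU : IsOpen (FU a q) := FU_open h.cp
  have hF := FF_caloric D h
  set F : ℝ² → ℝ := fun z => FF a φ q l z.1 z.2 with hFdef
  set U := FU a q with hUdef
  have hFc := hF.smooth.continuousOn
  have hXc := (hF.smooth.dX hU).continuousOn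
  set m := q Ts with hm
  have hmU : (m, Ts) ∈ U := mem_FU ha h hTs
  obtain ⟨ε, hε, hball⟩ := Metric.isOpen_iff.1 hU _ hmU
  set R := ε / 2 with hR
  have hR0 : 0 < R := by positivity
  have hbox : ∀ x t, |x - m| ≤ R → |t - Ts| ≤ R → (x, t) ∈ U := by
    intro x t hx ht
    refine hball ?_
    rw [Metric.mem_ball, Prod.dist_eq, Real.dist_eq, Real.dist_eq]
    exact max_lt (by show |x - m| < ε; linarith) (by show |t - Ts| < ε; linarith)
  have habs : |m - R - m| ≤ R ∧ |m + R - m| ≤ R := by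
    rw [abs_le, abs_le]; refine ⟨⟨?_, ?_⟩, ⟨?_, ?_⟩⟩ <;> linarith
  have hL := hbox (m - R) Ts habs.1 (by simp [hR0.le])
  have hRr := hbox (m + R) Ts habs.2 (by simp [hR0.le])
  have hLp : 0 < F (m - R, Ts) := hp _ ⟨by have := (abs_lt.1 hL.1).1; exact this.le, by linarith⟩
  have hRp : F (m + R, Ts) < 0 := hn _ ⟨by linarith, by have := (abs_lt.1 hRr.1).2; exact this.le⟩
  obtain ⟨c, hc, hc1, hc2⟩ : ∃ c > 0, c < F (m - R, Ts) ∧ F (m + R, Ts) < -c := by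
    refine ⟨min (F (m - R, Ts)) (-F (m + R, Ts)) / 2, by have := lt_min hLp (neg_pos.2 hRp); linarith, ?_, ?_⟩
    · have := min_le_left (F (m - R, Ts)) (-F (m + R, Ts)); have := lt_min hLp (neg_pos.2 hRp); linarith
    · have := min_le_right (F (m - R, Ts)) (-F (m + R, Ts)); have := lt_min hLp (neg_pos.2 hRp); linarith
  have hK : IsCompact (Icc (m - R) (m + R) ×ˢ Icc (Ts - R) (Ts + R)) := isCompact_Icc.prod isCompact_Icc
  have hmemb : ∀ x, x ∈ Icc (m - R) (m + R) ↔ |x - m| ≤ R := fun x => by rw [abs_le]; constructor <;> rintro ⟨h1, h2⟩ <;> constructor <;> linarith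
  obtain ⟨A0, hA0⟩ := hK.exists_bound_of_continuousOn (hXc.mono fun z hz => by
    refine hbox z.1 z.2 ((hmemb _).1 hz.1) ?_
    rw [abs_le]; constructor <;> linarith [hz.2.1, hz.2.2])
  set A := max A0 1
  have hA : 0 < A := lt_of_lt_of_le one_pos (le_max_right _ _)
  have hAb : ∀ x t, |x - m| ≤ R → |t - Ts| ≤ R → |dX F (x, t)| ≤ A := fun x t hx ht => by
    have h2 := abs_le.1 ht
    exact (hA0 (x, t) ⟨(hmemb _).2 hx, ⟨by show Ts - R ≤ t; linarith, by show t ≤ Ts + R; linarith⟩⟩).trans (le_max_left _ _)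
  -- choose δ
  have slice : ∀ x, (x, Ts) ∈ U → ContinuousAt (fun t => F (x, t)) Ts := fun x hx =>
    ContinuousAt.comp (x := Ts) (f := fun t => (x, t)) (g := F) (hFc.continuousAt (hU.mem_nhds hx)) (by fun_prop)
  have hev : ∀ᶠ t in 𝓝 Ts, c < F (m - R, t) ∧ F (m + R, t) < -c ∧ |q t - m| < R/2 := by
    refine ((slice _ hL).eventually (Ioi_mem_nhds hc1)).and (((slice _ hRr).eventually (Iio_mem_nhds hc2)).and ?_)
    have : Continuous fun t => |q t - m| := (h.cp.sub continuous_const).abs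
    exact (this.tendsto Ts).eventually (Iio_mem_nhds (by simpa [hm] using hR0))
  obtain ⟨δ, hδ, hδb⟩ := Metric.eventually_nhds_iff.1 hev
  obtain ⟨d, hd, hd1, hd2, hd3, hd4⟩ : ∃ d > 0, d < δ ∧ d ≤ R ∧ d ≤ Ts/2 ∧ 4 * d * A ≤ R * c / 4 := by
    refine ⟨min (min (δ/2) R) (min (Ts/2) (R * c / (16 * A))), by positivity, ?_, ?_, ?_, ?_⟩
    · exact ((min_le_left _ _).trans (min_le_left _ _)).trans_lt (by linarith)
    · exact (min_le_left _ _).trans (min_le_right _ _)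
    · exact (min_le_right _ _).trans (min_le_left _ _)
    · have : min (min (δ/2) R) (min (Ts/2) (R * c / (16 * A))) ≤ R * c / (16 * A) := (min_le_right _ _).trans (min_le_right _ _)
      generalize min (min (δ/2) R) (min (Ts/2) (R * c / (16 * A))) = w at this
      rw [le_div_iff₀ (by positivity)] at this
      linarith
  have hside : ∀ t ∈ Icc (Ts - d) Ts, c < F (m - R, t) ∧ F (m + R, t) < -c ∧ |q t - m| < R/2 := fun t ht => hδb (by
    rw [Real.dist_eq, abs_lt]; constructor <;> linarith [ht.1, ht.2])
  set t1 := Ts - d with ht1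
  have ht1p : 0 < t1 := by linarith
  have S1 := HS t1 ht1p.le (by linarith)
  set m1 := q t1 with hm1
  have hm1m : |m1 - m| < R/2 := (hside t1 ⟨le_rfl, by linarith⟩).2.2
  have hm1m' := abs_lt.1 hm1m
  have ht1R : |t1 - Ts| ≤ R := by rw [abs_le]; constructor <;> linarith
  have hX1 : dX F (m1, t1) < 0 := by
    have := dX_eq hU hF.smooth (hbox m1 t1 (by linarith) ht1R) (S1.der t1 ⟨ht1p.le, le_rfl⟩)
    rw [this]
    linarith [S1.lpos t1 ⟨ht1p.le, le_rfl⟩]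
  -- bottom
  have hbot : ∀ᶠ η in 𝓝[>] (0:ℝ), ∀ x ∈ Icc (m - R) (m + R), 2 * η * dX F (x, t1) + (x - m1) * F (x, t1) < 0 := by
    have hFle : ∀ x ∈ Icc (m - R) (m + R), (x - m1) * F (x, t1) ≤ 0 ∧ (x ≠ m1 → (x - m1) * F (x, t1) < 0) := by
      intro x hx
      have hxU := abs_lt.1 (hbox x t1 ((hmemb x).1 hx) ht1R).1
      simp only [] at hxU
      rcases lt_trichotomy x m1 with h1 | h1 | h1
      · have := S1.pos t1 ⟨ht1p.le, le_rfl⟩ x ⟨hxU.1.le, h1⟩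
        have h3 : (x - m1) * F (x, t1) < 0 := mul_neg_of_neg_of_pos (by linarith) this
        exact ⟨h3.le, fun _ => h3⟩
      · rw [h1]; simp
      · have := S1.neg t1 ⟨ht1p.le, le_rfl⟩ x ⟨h1, hxU.2.le⟩
        have h3 : (x - m1) * F (x, t1) < 0 := mul_neg_of_pos_of_neg (by linarith) this
        exact ⟨h3.le, fun _ => h3⟩
    have hXs : ContinuousOn (fun x => dX F (x, t1)) (Icc (m - R) (m + R)) := hXc.comp (by fun_prop) (fun x hx => hbox x t1 ((hmemb x).1 hx) ht1R)
    have hm1K : m1 ∈ Icc (m - R) (m + R) := (hmemb _).2 (by linarith)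
    -- near m1 the derivative is negative
    have hnear : ∀ᶠ x in 𝓝[Icc (m - R) (m + R)] m1, dX F (x, t1) < 0 := (hXs m1 hm1K).eventually (Iio_mem_nhds hX1)
    obtain ⟨e, he, hen⟩ := Metric.eventually_nhds_iff.1 (eventually_nhdsWithin_iff.1 hnear)
    -- away from m1
    have hK2 : IsCompact (Icc (m - R) (m + R) ∩ {x : ℝ | e ≤ |x - m1|}) := isCompact_Icc.inter_right (isClosed_le (by fun_prop) (by fun_prop))
    have hFs : ContinuousOn (fun x => (x - m1) * F (x, t1)) (Icc (m - R) (m + R)) := ContinuousOn.mul (by fun_prop) (hFc.comp (by fun_prop) (fun x hx => hbox x t1 ((hmemb x).1 hx) ht1R))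
    obtain ⟨κ, hκ, hκb⟩ : ∃ κ > 0, ∀ x ∈ Icc (m - R) (m + R) ∩ {x : ℝ | e ≤ |x - m1|}, (x - m1) * F (x, t1) ≤ -κ := by
      rcases (Icc (m - R) (m + R) ∩ {x : ℝ | e ≤ |x - m1|}).eq_empty_or_nonempty with h0 | h0
      · exact ⟨1, one_pos, fun x hx => by rw [h0] at hx; exact hx.elim⟩
      · obtain ⟨x0, hx0, hmax⟩ := hK2.exists_isMaxOn h0 (hFs.mono inter_subset_left)
        have : (x0 - m1) * F (x0, t1) < 0 := (hFle x0 hx0.1).2 (fun e0 => by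
          have h5 : e ≤ |x0 - m1| := hx0.2
          rw [e0, sub_self, abs_zero] at h5; linarith)
        exact ⟨-((x0 - m1) * F (x0, t1)), by linarith, fun x hx => by have : (x - m1) * F (x, t1) ≤ (x0 - m1) * F (x0, t1) := hmax hx; linarith⟩
    have hsm : ∀ᶠ η in 𝓝[>] (0:ℝ), η < κ / (4 * A) := nhdsWithin_le_nhds (Iio_mem_nhds (by positivity))
    filter_upwards [hsm, self_mem_nhdsWithin] with η h1 h2 x hx
    have h2 : 0 < η := h2
    by_cases hxe : e ≤ |x - m1|
    · have k1 := hκb x ⟨hx, hxe⟩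
      have k2 := (abs_le.1 (hAb x t1 ((hmemb x).1 hx) ht1R)).2
      rw [lt_div_iff₀ (by positivity)] at h1
      nlinarith
    · have k1 := hen (by rw [Real.dist_eq]; push Not at hxe; exact hxe) hx
      have k2 := (hFle x hx).1
      nlinarith
  have hsm : ∀ᶠ η in 𝓝[>] (0:ℝ), η < d := nhdsWithin_le_nhds (Iio_mem_nhds hd)
  obtain ⟨η, hηb, hηd, hη0⟩ := (hbot.and (hsm.and self_mem_nhdsWithin)).exists
  have hη0 : 0 < η := hη0
  have hV := hF.gal hU m1 (t1 - η)
  set V : ℝ² → ℝ := fun z => 2 * (z.2 - (t1 - η)) * dX F z + (z.1 - m1) * F z with hVdef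
  have hVc := hV.smooth.continuousOn
  have hboxT : ∀ x t, x ∈ Icc (m - R) (m + R) → t ∈ Icc t1 Ts → (x, t) ∈ U := fun x t hx ht => hbox x t ((hmemb x).1 hx) (by
    rw [abs_le]; constructor <;> linarith [ht.1, ht.2])
  -- negative gap on the bottom
  obtain ⟨ε1, hε1, hε1b⟩ : ∃ ε1 > 0, ∀ x ∈ Icc (m - R) (m + R), V (x, t1) ≤ -ε1 := by
    obtain ⟨x0, hx0, hmax⟩ := (isCompact_Icc (a := m - R) (b := m + R)).exists_isMaxOn ⟨m, ⟨by linarith, by linarith⟩⟩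
      (hVc.comp (f := fun x : ℝ => (x, t1)) (by fun_prop) (fun x hx => hboxT x t1 hx ⟨le_rfl, by linarith⟩))
    have h0 : V (x0, t1) < 0 := by
      have := hηb x0 hx0
      rw [hVdef]; simp only []
      rw [show t1 - (t1 - η) = η by ring]; exact this
    exact ⟨-V (x0, t1), by linarith, fun x hx => by have : V (x, t1) ≤ V (x0, t1) := hmax hx; linarith⟩
  set ε2 := min ε1 (R * c / 4) with hε2
  have hε2p : 0 < ε2 := by positivity
  have hQ : IsCompact (Icc (m - R) (m + R) ×ˢ Icc t1 Ts) := isCompact_Icc.prod isCompact_Icc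
  have hmain := MP1 hQ (Φ := fun x t => -ε2 - V (x, t)) (e := 0) (τ := t1) (S := d) le_rfl (by
      refine ContinuousOn.sub continuousOn_const (hVc.comp (f := fun z : ℝ² => (z.1, z.2)) (by fun_prop) (fun z hz => hboxT z.1 z.2 hz.1 hz.2)))
    (fun x t hxt => ⟨hxt.2.1, by have : t ≤ Ts := hxt.2.2; linarith⟩) (by
    rintro x t ⟨hx, ht⟩
    simp only [] at hx ht
    have hxt := hboxT x t hx ht
    have htR : |t - Ts| ≤ R := by rw [abs_le]; constructor <;> linarith [ht.1, ht.2]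
    have hAx := abs_le.1 (hAb x t ((hmemb x).1 hx) htR)
    have hco : 0 ≤ 2 * (t - (t1 - η)) ∧ 2 * (t - (t1 - η)) ≤ 4 * d := ⟨by linarith [ht.1], by linarith [ht.2]⟩
    have hdx : 2 * (t - (t1 - η)) * dX F (x, t) ≤ R * c / 4 := by
      calc _ ≤ 2 * (t - (t1 - η)) * A := mul_le_mul_of_nonneg_left hAx.2 hco.1
        _ ≤ 4 * d * A := mul_le_mul_of_nonneg_right hco.2 hA.le
        _ ≤ _ := hd4
    by_cases b0 : t = t1
    · left
      have := hε1b x hx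
      rw [b0]; have := min_le_left ε1 (R * c / 4); linarith
    by_cases b1 : x = m - R
    · left
      have := (hside t ht).1
      have e2 := min_le_right ε1 (R * c / 4)
      have : (x - m1) * F (x, t) ≤ -(R * c / 2) := by
        rw [b1]; nlinarith
      show -0 ≤ -ε2 - (2 * (t - (t1 - η)) * dX F (x, t) + (x - m1) * F (x, t))
      linarith
    by_cases b2 : x = m + R
    · left
      have := (hside t ht).2.1
      have e2 := min_le_right ε1 (R * c / 4)
      have : (x - m1) * F (x, t) ≤ -(R * c / 2) := by
        rw [b2]; nlinarith
      show -0 ≤ -ε2 - (2 * (t - (t1 - η)) * dX F (x, t) + (x - m1) * F (x, t))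
      linarith
    right
    have x1 : m - R < x := lt_of_le_of_ne hx.1 (Ne.symm b1)
    have x2 : x < m + R := lt_of_le_of_ne hx.2 b2
    have x3 : t1 < t := lt_of_le_of_ne ht.1 (Ne.symm b0)
    obtain ⟨A', B', Dd, k1, k2, k3, k4⟩ := hV.data hU hxt
    refine ⟨?_, ?_, -A', -B', fun y => -Dd y, ?_, ?_, k3.neg, by linarith⟩
    · filter_upwards [Ioo_mem_nhds x1 x2] with y hy
      exact ⟨Ioo_subset_Icc_self hy, ht⟩
    · filter_upwards [Ioo_mem_nhdsLT x3] with s hs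
      exact ⟨hx, ⟨hs.1.le, hs.2.le.trans ht.2⟩⟩
    · exact (k1.const_sub (-ε2))
    · filter_upwards [k2] with y hy
      exact hy.const_sub (-ε2))
  have hfin := hmain m Ts ⟨⟨by linarith, by linarith⟩, ⟨by linarith, le_rfl⟩⟩
  have hV0 : V (m, Ts) = 2 * (Ts - (t1 - η)) * dX F (m, Ts) := by
    rw [hVdef]; simp only []
    rw [show F (m, Ts) = 0 from hz, mul_zero, add_zero]
  rw [hV0] at hfin
  by_contra hcon
  push Not at hcon
  have : 0 ≤ 2 * (Ts - (t1 - η)) * dX F (m, Ts) := mul_nonneg (by linarith) hcon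
  linarith

lemma closure2 (D : Dat a φ φ' pI) {q l : ℝ → ℝ} {Ts : ℝ} (hTs : 0 < Ts) (h : Crv q l) (HS : ∀ T, 0 ≤ T → T < Ts → Sol a φ pI T q l) : Sol a φ pI Ts q l := by
  have hz : FF a φ q l (q Ts) Ts = 0 := by
    have hc := (FF_cont D h).comp (h.cp.prodMk continuous_id)
    have h1 := (hc.tendsto Ts).mono_left (nhdsWithin_le_nhds (s := Iio Ts))
    simp only [Function.comp_def, id] at h1
    rw [clamp_eq (h.memI Ts)] at h1
    refine tendsto_nhds_unique h1 (tendsto_const_nhds.congr' ?_)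
    filter_upwards [Ico_mem_nhdsLT hTs] with t ht
    rw [clamp_eq (h.memI t), (HS t ht.1 ht.2).zero t ⟨ht.1, le_rfl⟩]
  have hp := pos_at D hTs h HS
  have hn : ∀ x ∈ Ioc (q Ts) 1, FF a φ q l x Ts < 0 := by
    intro x hx
    have := pos_at D.refl hTs h.refl (fun T h0 h1 => (HS T h0 h1).refl) (-x) ⟨by linarith [hx.2], by linarith [hx.1]⟩
    rw [FF_refl, neg_neg] at this
    linarith
  have hX := lpos_at D hTs h HS hz hp hn
  have hU : IsOpen (FU a q) := FU_open h.cp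
  have hF := FF_caloric D h
  have hmU := mem_FU D.ha h hTs
  have hder := hF.smooth.hasDerivX hU hmU
  have hlim : dX (fun z => FF a φ q l z.1 z.2) (q Ts, Ts) = -l Ts := by
    have h1 : ContinuousAt (fun t => dX (fun z => FF a φ q l z.1 z.2) (q t, t)) Ts :=
      ContinuousAt.comp (x := Ts) (f := fun t => (q t, t)) (g := dX (fun z => FF a φ q l z.1 z.2)) ((hF.smooth.dX hU).continuousOn.continuousAt (hU.mem_nhds hmU))
        (h.cp.continuousAt.prodMk continuousAt_id)
    refine tendsto_nhds_unique (h1.tendsto.mono_left (nhdsWithin_le_nhds (s := Iio Ts))) (((h.cl.neg.tendsto Ts).mono_left (nhdsWithin_le_nhds (s := Iio Ts))).congr' ?_)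
    filter_upwards [Ioo_mem_nhdsLT hTs] with t ht
    exact (dX_eq hU hF.smooth (mem_FU D.ha h ht.1) ((HS t ht.1.le ht.2).der t ⟨ht.1.le, le_rfl⟩)).symm
  have split : ∀ {P : ℝ → Prop}, (∀ t ∈ Ico 0 Ts, P t) → P Ts → ∀ t ∈ Icc 0 Ts, P t := by
    intro P h1 h2 t ht
    rcases eq_or_lt_of_le ht.2 with e | e
    · rw [e]; exact h2
    · exact h1 t ⟨ht.1, e⟩
  refine ⟨h, (HS 0 le_rfl hTs).p0, split (fun t ht => (HS t ht.1 ht.2).zero t ⟨ht.1, le_rfl⟩) hz, split (fun t ht => (HS t ht.1 ht.2).der t ⟨ht.1, le_rfl⟩) ?_,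
    split (fun t ht => (HS t ht.1 ht.2).lpos t ⟨ht.1, le_rfl⟩) (by linarith), split (fun t ht => (HS t ht.1 ht.2).pos t ⟨ht.1, le_rfl⟩) hp, split (fun t ht => (HS t ht.1 ht.2).neg t ⟨ht.1, le_rfl⟩) hn⟩
  rw [← hlim]; exact hder

/-- global existence -/
theorem global (D : Dat a φ φ' pI) : ∃ p l : ℝ → ℝ, ∀ T, 0 ≤ T → Sol a φ pI T p l := by
  have hall : ∀ T, 0 ≤ T → ∃ p l : ℝ → ℝ, Sol a φ pI T p l := by
    by_contra hcon
    push Not at hcon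
    obtain ⟨T0, hT0, hno⟩ := hcon
    set E := {T : ℝ | 0 ≤ T ∧ ∃ p l : ℝ → ℝ, Sol a φ pI T p l} with hE
    have h0 : (0:ℝ) ∈ E := ⟨le_rfl, _, _, Sol.init D⟩
    have hb : BddAbove E := ⟨T0, by
      rintro T ⟨h1, p, l, S⟩
      by_contra hc
      push Not at hc
      exact hno p l (S.mono hc.le)⟩
    set Ts := sSup E with hTs
    have hTs0 : 0 < Ts := by
      obtain ⟨h, hh, q, l, S⟩ := (Sol.init D).extend D le_rfl
      exact lt_of_lt_of_le (by linarith) (le_csSup hb (show 0 + h ∈ E from ⟨by linarith, q, l, S⟩))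
    obtain ⟨q, l, hcrv, hS⟩ := closure1 D hTs0 (fun T h1 h2 => by
      obtain ⟨T', ⟨hT'0, p, l, S⟩, hlt⟩ := exists_lt_of_lt_csSup ⟨0, h0⟩ h2
      exact ⟨p, l, S.mono hlt.le⟩)
    obtain ⟨h, hh, q', l', S⟩ := (closure2 D hTs0 hcrv hS).extend D hTs0.le
    have := le_csSup hb (show Ts + h ∈ E from ⟨by linarith, q', l', S⟩)
    linarith
  obtain ⟨p, l, hg⟩ := glue D
  -- freeze the curves for negative times
  have hcts : ∀ t, 0 ≤ t → ∃ p' l' : ℝ → ℝ, Sol a φ pI (t + 1) p' l' ∧ ∀ s ≤ t + 1, p (max s 0) = p' (max s 0) ∧ l (max s 0) = l' (max s 0) := by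
    intro t ht
    obtain ⟨p', l', S⟩ := hall (t + 1) (by linarith)
    exact ⟨p', l', S, fun s hs => by
      have := hg _ _ _ S (max s 0) ⟨le_max_right _ _, max_le hs (by linarith)⟩
      exact ⟨this.1.symm, this.2.symm⟩⟩
  have hcrv : Crv (fun s => p (max s 0)) (fun s => l (max s 0)) := by
    refine ⟨continuous_iff_continuousAt.2 fun t => ?_, fun t => ?_, continuous_iff_continuousAt.2 fun t => ?_⟩
    · obtain ⟨p', l', S, he⟩ := hcts (max t 0) (le_max_right _ _)
      have hc : Continuous fun s => p' (max s 0) := S.crv.cp.comp (by fun_prop)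
      refine hc.continuousAt.congr ?_
      filter_upwards [Iio_mem_nhds (show t < max t 0 + 1 by linarith [le_max_left t 0])] with s hs
      exact (he s (le_of_lt hs)).1.symm
    · obtain ⟨p', l', S, he⟩ := hcts (max t 0) (le_max_right _ _)
      have := S.crv.mem (max t 0)
      rwa [← (he t (by linarith [le_max_left t 0])).1] at this
    · obtain ⟨p', l', S, he⟩ := hcts (max t 0) (le_max_right _ _)
      have hc : Continuous fun s => l' (max s 0) := S.crv.cl.comp (by fun_prop)
      refine hc.continuousAt.congr ?_
      filter_upwards [Iio_mem_nhds (show t < max t 0 + 1 by linarith [le_max_left t 0])] with s hs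
      exact (he s (le_of_lt hs)).2.symm
  refine ⟨fun s => p (max s 0), fun s => l (max s 0), fun T hT => ?_⟩
  obtain ⟨p', l', S⟩ := hall T hT
  refine S.congr hT hcrv fun s hs => ?_
  have := hg _ _ _ S s hs
  simp only [max_eq_left hs.1]
  exact ⟨this.1.symm, this.2.symm⟩

noncomputable def evx (f : ℝ → ℝ) (y : ℝ) : ℝ := f (2 / π * Real.arcsin (Real.sin (π / 2 * y)))

lemma evx_ev (f : ℝ → ℝ) : Ev (evx f) := by
  refine ⟨fun y => ?_, fun y => ?_⟩
  · unfold evx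
    rw [show π / 2 * (2 - y) = π - π / 2 * y by ring, Real.sin_pi_sub]
  · unfold evx
    rw [show π / 2 * (-2 - y) = -(π / 2 * y + π) by ring, Real.sin_neg, Real.sin_add_pi, neg_neg]

lemma evx_eq (f : ℝ → ℝ) {x : ℝ} (hx : x ∈ 𝕁) : evx f x = f x := by
  unfold evx
  have := Real.pi_pos
  rw [Real.arcsin_sin (by nlinarith [hx.1]) (by nlinarith [hx.2])]
  congr 1; field_simp

lemma evx_der {f d : ℝ → ℝ} (h : ∀ x ∈ 𝕁, HasDerivWithinAt f (d x) (Icc (-1) 1) x) (h1 : d 1 = 0) (h2 : d (-1) = 0) :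
    ∀ x ∈ 𝕁, HasDerivAt (evx f) (d x) x := by
  have hw : ∀ x ∈ 𝕁, HasDerivWithinAt (evx f) (d x) (Icc (-1) 1) x := fun x hx =>
    (h x hx).congr (fun y hy => evx_eq f hy) (evx_eq f hx)
  have hE := evx_ev f
  intro x hx
  have hend : ∀ c b : ℝ, c ∈ (𝕁) → d c = 0 → (∀ y, evx f (2 * c - y) = evx f y) → MapsTo (fun y => 2 * c - y) (Icc b (b + 2)) (𝕁) → Icc b (b + 2) ∪ (𝕁) ∈ 𝓝 c → HasDerivAt (evx f) (d c) c := by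
    intro c b hc h0 hs hm hn
    have hL : HasDerivWithinAt (evx f) (d c) (𝕁) (2 * c - c) := by rw [show 2 * c - c = c by ring]; exact hw c hc
    have hR := HasDerivWithinAt.comp c hL ((hasDerivAt_id c).const_sub (2 * c)).hasDerivWithinAt hm
    rw [show (evx f ∘ fun y => 2 * c - y) = evx f from funext hs, h0, zero_mul, ← h0] at hR
    exact (hR.union (hw c hc)).hasDerivAt hn
  rcases eq_or_lt_of_le hx.1 with e | e
  · refine hend x (-3) hx (e ▸ h2) (fun y => ?_) (fun y hy => ⟨by linarith [hy.2], by linarith [hy.1]⟩) ?_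
    · rw [← e, ← hE.2 y]; norm_num
    · rw [show (-3:ℝ) + 2 = -1 by norm_num, Icc_union_Icc_eq_Icc (by norm_num) (by norm_num), ← e]; exact Icc_mem_nhds (by norm_num) (by norm_num)
  rcases eq_or_lt_of_le hx.2 with e2 | e2
  · refine hend x 1 hx (e2 ▸ h1) (fun y => ?_) (fun y hy => ⟨by linarith [hy.2], by linarith [hy.1]⟩) ?_
    · rw [e2, ← hE.1 y]; norm_num
    · rw [union_comm, Icc_union_Icc_eq_Icc (by norm_num) (by norm_num), e2]; exact Icc_mem_nhds (by norm_num) (by norm_num)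
  exact (hw x hx).hasDerivAt (Icc_mem_nhds e e2)

lemma evx_lip {g : ℝ → ℝ} {L : ℝ} (hL : 0 ≤ L) (hg : ∀ x ∈ 𝕁, ∀ y ∈ 𝕁, |g x - g y| ≤ L * |x - y|) (h1 : g 1 = 0) (h2 : g (-1) = 0)
    (him : ∀ (k : ℤ) y, g y = sg k * g (sg k * (y - 2 * k))) : ∀ x y, |g x - g y| ≤ L * |x - y| := by
  have hb : ∀ x ∈ 𝕁, |g x| ≤ L * (1 - x) ∧ |g x| ≤ L * (x + 1) := by
    intro x hx
    have u := hg x hx 1 (by norm_num)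
    have v := hg x hx (-1) (by norm_num)
    rw [h1, sub_zero, abs_of_nonpos (show x - 1 ≤ 0 by linarith [hx.2])] at u
    rw [h2, sub_zero, abs_of_nonneg (show 0 ≤ x - -1 by linarith [hx.1])] at v
    exact ⟨by linarith, by linarith⟩
  have hc : ∀ (k : ℤ) (y : ℝ), |y - 2 * k| ≤ 1 → |g y| ≤ L * (1 - (y - 2 * k)) ∧ |g y| ≤ L * (1 + (y - 2 * k)) := by
    intro k y hy
    rw [abs_le] at hy
    rw [him k y]
    rcases sg_cases k with ⟨-, e⟩ | ⟨-, e⟩ <;> rw [e]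
    · have := hb (y - 2 * k) hy
      simp only [one_mul]; constructor <;> linarith
    · have := hb (-(y - 2 * k)) ⟨by linarith, by linarith⟩
      simp only [neg_mul, one_mul, abs_neg]; constructor <;> linarith
  have hex : ∀ y : ℝ, ∃ k : ℤ, |y - 2 * k| ≤ 1 := by
    intro y
    obtain ⟨k, hk⟩ := exists_img y
    refine ⟨k, ?_⟩
    rcases sg_cases k with ⟨-, e⟩ | ⟨-, e⟩ <;> rw [e] at hk
    · simpa using hk
    · rw [abs_sub_comm]; simpa using hk
  have hlt : ∀ (k j : ℤ) (x y : ℝ), |x - 2 * k| ≤ 1 → |y - 2 * j| ≤ 1 → k < j → |g x - g y| ≤ L * |x - y| := by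
    intro k j x y hx hy hkj
    have u := (hc k x hx).1
    have v := (hc j y hy).2
    have hkj' : (k:ℝ) + 1 ≤ j := by exact_mod_cast hkj
    have w : y - x ≤ |x - y| := by rw [abs_sub_comm]; exact le_abs_self _
    have := mul_le_mul_of_nonneg_left w hL
    have := mul_le_mul_of_nonneg_left hkj' hL
    have := abs_sub (g x) (g y)
    nlinarith
  intro x y
  obtain ⟨k, hk⟩ := hex x
  obtain ⟨j, hj⟩ := hex y
  rcases lt_trichotomy k j with h | h | h
  · exact hlt k j x y hk hj h
  · subst h
    rw [abs_le] at hk hj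
    rw [him k x, him k y]
    rcases sg_cases k with ⟨-, e⟩ | ⟨-, e⟩ <;> rw [e]
    · have := hg (x - 2 * k) hk (y - 2 * k) hj
      simp only [one_mul]; rwa [show x - 2 * k - (y - 2 * k) = x - y by ring] at this
    · have := hg (-(x - 2 * k)) ⟨by linarith, by linarith⟩ (-(y - 2 * k)) ⟨by linarith, by linarith⟩
      rw [show -(x - 2 * k) - -(y - 2 * k) = -(x - y) by ring, abs_neg] at this
      simp only [neg_mul, one_mul]
      rw [← neg_sub', abs_neg] 
      exact this
  · rw [abs_sub_comm, abs_sub_comm x]; exact hlt j k y x hj hk h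

lemma data {f : ℝ → ℝ} {a₀ lamI : ℝ} (ha : a ∈ Ioo (0:ℝ) 1) (hI : IsInitialDatum f pI a₀ lamI) :
    ∃ φ', Dat a (evx f) φ' pI ∧ φ' pI = -lamI := by
  have hU : UniqueDiffOn ℝ (𝕁) := uniqueDiffOn_Icc (by norm_num)
  set d := derivWithin f (𝕁) with hd
  have hdw : ∀ x ∈ 𝕁, HasDerivWithinAt f (d x) (Icc (-1) 1) x := fun x hx =>
    ((hI.smooth.differentiableOn (by norm_num)) x hx).hasDerivWithinAt
  have hc1 : ContDiffOn ℝ 1 d (Icc (-1) 1) := hI.smooth.derivWithin hU (by norm_num)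
  obtain ⟨K, hK⟩ := hc1.exists_lipschitzOnWith (by norm_num) (convex_Icc _ _) isCompact_Icc
  have hder := evx_der hdw hI.neumann_right hI.neumann_left
  have hE := evx_ev f
  have him : ∀ (k : ℤ) y, deriv (evx f) y = sg k * deriv (evx f) (sg k * (y - 2 * k)) := by
    intro k y
    have e : evx f = fun y => evx f (sg k * (y - 2 * k)) := funext fun y => hE.eq_img k y
    conv_lhs => rw [e]
    have := deriv_comp_mul_left (sg k) (fun w => evx f (w - sg k * (2 * k))) y
    simp only [mul_sub] at this ⊢
    rw [this, deriv_comp_sub_const, smul_eq_mul]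
  have hall : ∀ x, HasDerivAt (evx f) (deriv (evx f) x) x := by
    intro y
    obtain ⟨k, hk⟩ := exists_img y
    have h1 := hder _ (abs_le.1 hk)
    have h2 : HasDerivAt (fun y : ℝ => sg k * (y - 2 * k)) (sg k * 1) y := ((hasDerivAt_id y).sub_const _).const_mul _
    have h3 := HasDerivAt.comp y h1 h2
    have e : (evx f ∘ fun y : ℝ => sg k * (y - 2 * k)) = evx f := (funext fun y => hE.eq_img k y).symm
    rw [e] at h3
    exact h3.differentiableAt.hasDerivAt
  have hdd : ∀ x ∈ 𝕁, deriv (evx f) x = d x := fun x hx => (hder x hx).deriv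
  have hp : deriv (evx f) pI = -lamI := by
    rw [hdd pI (Ioo_subset_Icc_self hI.pI_mem), hI.lamI_eq, neg_neg, hd, derivWithin_of_mem_nhds (Icc_mem_nhds hI.pI_mem.1 hI.pI_mem.2)]
  refine ⟨deriv (evx f), ⟨ha.1, ha.2, hE, hall, ⟨K, ?_⟩, hI.pI_mem, ?_, ?_, ?_, ?_⟩, hp⟩
  · refine evx_lip K.2 (fun x hx y hy => ?_) ((hdd 1 (by norm_num)).trans hI.neumann_right) ((hdd (-1) (by norm_num)).trans hI.neumann_left) him
    rw [hdd x hx, hdd y hy]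
    have := hK.dist_le_mul x hx y hy
    simpa [Real.dist_eq] using this
  · rw [evx_eq f (Ioo_subset_Icc_self hI.pI_mem)]; exact hI.zero_at
  · intro x hx; rw [evx_eq f ⟨hx.1, hx.2.le.trans hI.pI_mem.2.le⟩]; exact hI.pos_left x hx
  · intro x hx; rw [evx_eq f ⟨hI.pI_mem.1.le.trans hx.1.le, hx.2⟩]; exact hI.neg_right x hx
  · rw [hp]; linarith [hI.lamI_pos]

lemma dh {f : ℝ → ℝ} (D : Dat a (evx f) φ' pI) (q l : ℝ → ℝ) (x : ℝ) {t : ℝ} (ht : 0 < t) :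
    FF a (evx f) q l x t = (∫ x' in (-1 : ℝ)..1, heatGamma x x' t * f x')
        + ∫ s in (0 : ℝ)..t, (heatGamma x (q s - abar a q s) (t - s) - heatGamma x (q s + abar a q s) (t - s)) * l s := by
  obtain ⟨B, -, hB⟩ := D.bd
  have e : (∫ x' in (-1 : ℝ)..1, heatGamma x x' t * f x') = util (evx f) x t := by
    rw [util_eq_gamma D.ev D.c hB x ht]
    refine intervalIntegral.integral_congr fun y hy => ?_
    rw [uIcc_of_le (by norm_num)] at hy
    simp only [evx_eq f hy]
  rw [e]; rfl

lemma FF_tendsto (D : Dat a φ φ' pI) (h : Crv p lam) :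
    TendstoUniformlyOn (fun t x => FF a φ p lam x t) φ (𝓝[>] 0) (Icc (-1) 1) := by
  rw [Metric.tendstoUniformlyOn_iff]
  intro ε hε
  have hc := FF_cont D h
  have h2 : Continuous fun z : ℝ² => dist (φ (clamp z.2)) (FF a φ p lam (clamp z.2) z.1) :=
    (D.c.comp (clamp_cont.comp continuous_snd)).dist (hc.comp (continuous_snd.prodMk continuous_fst))
  have h3 : ∀ᶠ t in 𝓝 (0:ℝ), ∀ x ∈ 𝕁, dist (φ (clamp x)) (FF a φ p lam (clamp x) t) < ε := by
    refine IsCompact.eventually_forall_of_forall_eventually isCompact_Icc (P := fun t x => dist (φ (clamp x)) (FF a φ p lam (clamp x) t) < ε) fun x hx => ?_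
    refine (h2.tendsto (0, x)).eventually (Iio_mem_nhds ?_)
    simp only [FF_zero, dist_self]; exact hε
  filter_upwards [h3.filter_mono nhdsWithin_le_nhds] with t ht x hx
  simpa only [clamp_eq hx] using ht x hx

lemma FF_bdd (D : Dat a φ φ' pI) (h : ∀ T, 0 ≤ T → Sol a φ pI T p lam) :
    ∃ B : ℝ, ∀ x ∈ 𝕁, ∀ t > (0:ℝ), |FF a φ p lam x t| ≤ B := by
  obtain ⟨B, hB⟩ := F_unif D one_pos
  have hc := FF_cont D (h 0 le_rfl).crv
  obtain ⟨B', hB'⟩ := ((isCompact_Icc (a := (-1:ℝ)) (b := 1)).prod (isCompact_Icc (a := (0:ℝ)) (b := 1))).exists_bound_of_continuousOn hc.continuousOn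
  refine ⟨max B B', fun x hx t ht => ?_⟩
  rcases le_total 1 t with h1 | h1
  · exact (hB t p lam (h t ht.le) t h1 le_rfl x (abs_le.2 hx)).trans (le_max_left _ _)
  · have := hB' (x, t) ⟨hx, ht.le, h1⟩
    simp only [clamp_eq hx, Real.norm_eq_abs] at this
    exact this.trans (le_max_right _ _)

lemma exist {f : ℝ → ℝ} (D : Dat a (evx f) φ' pI) (h : ∀ T, 0 ≤ T → Sol a (evx f) pI T p lam) :
    GoodSolution a f (FF a (evx f) p lam) p := by
  have C := (h 0 le_rfl).crv
  have hfl : ∀ t, 0 < t → flux (FF a (evx f) p lam) p t = lam t := fun t ht => by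
    unfold flux; rw [((h t ht.le).der t ⟨ht.le, le_rfl⟩).deriv, neg_neg]
  have hm : ∀ t : ℝ, 0 < t → t ∈ Icc 0 t := fun t ht => ⟨ht.le, le_rfl⟩
  refine ⟨⟨C.cp.continuousOn, fun t _ => C.mem t, fun t ht => (h t (le_of_lt ht)).zero t (hm t ht), fun t ht => (h t (le_of_lt ht)).pos t (hm t ht),
    fun t ht => (h t (le_of_lt ht)).neg t (hm t ht), fun t ht => ((h t (le_of_lt ht)).der t (hm t ht)).differentiableAt, ?_, ?_⟩, ?_, ?_, ?_⟩
  · have := C.cl.locallyIntegrable (μ := volume) |>.locallyIntegrableOn (Ioi 0)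
    intro t ht
    obtain ⟨s, hs, hi⟩ := this t ht
    refine ⟨s ∩ Ioi 0, inter_mem hs self_mem_nhdsWithin, ?_⟩
    refine (hi.mono_set inter_subset_left).congr ?_
    have : ∀ᵐ t ∂(volume.restrict (s ∩ Ioi 0)), t ∈ Ioi (0:ℝ) := by
      refine ae_mono (Measure.restrict_mono inter_subset_right le_rfl) (ae_restrict_mem measurableSet_Ioi)
    filter_upwards [this] with t ht
    exact (hfl t ht).symm
  · intro t ht x hx
    rw [dh D p lam x ht]
    congr 1
    refine intervalIntegral.integral_congr_Ioo_of_le (le_of_lt ht) fun s hs => ?_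
    simp only [hfl s hs.1]
  · obtain ⟨B, hB⟩ := FF_bdd D h
    exact ⟨B, fun x hx => hB x (Ioo_subset_Icc_self hx)⟩
  · exact (FF_tendsto D C).congr_right fun x hx => evx_eq f hx
  · intro T hT
    have S := h T hT.le
    obtain ⟨t1, ht1, hl⟩ := isCompact_Icc.exists_isMinOn (nonempty_Icc.2 hT.le) C.cl.continuousOn
    obtain ⟨t2, ht2, hl2⟩ := isCompact_Icc.exists_isMinOn (nonempty_Icc.2 hT.le) ((al_cont a).comp C.cp).continuousOn
    have p1 := S.lpos t1 ht1
    have p2 := al_pos D.ha (C.mem t2)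
    obtain ⟨r, hr, hr'⟩ := exists_between (lt_min p1 p2)
    have hA : ∀ t, 0 < t → t ≤ T → r < al a (p t) := fun t h1 h2 => by
      have : al a (p t2) ≤ al a (p t) := hl2 (show t ∈ Icc 0 T from ⟨h1.le, h2⟩)
      have := hr'.trans_le (min_le_right _ _)
      linarith
    refine ⟨r, hr, ?_, fun t h1 h2 => ?_, fun t h1 h2 => ?_⟩
    · refine contDiffOn_infty.2 fun n => ((FF_caloric D C).smooth n).mono ?_
      rintro ⟨x, t⟩ ⟨h1, h2, h3⟩
      have := hA t h2 h3
      have := al_le_l a (p t)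
      have := al_le_r a (p t)
      simp only at h1 h2 h3
      rw [abs_le] at h1
      show |x| < 1 ∧ 0 < t ∧ x ≠ p t - al a (p t) ∧ x ≠ p t + al a (p t)
      exact ⟨abs_lt.2 ⟨by linarith, by linarith⟩, h2, fun e => by linarith, fun e => by linarith⟩
    · rw [hfl t h1]
      have : lam t1 ≤ lam t := hl (show t ∈ Icc 0 T from ⟨h1.le, h2⟩)
      have := hr'.trans_le (min_le_left _ _)
      linarith
    · have := hA t h1 h2
      have := al_le_l a (p t)
      have := al_le_r a (p t)
      exact ⟨by linarith, by linarith⟩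

noncomputable def cE (y t : ℝ) (z : ℂ) : ℂ := ∑' k : ℤ, Complex.exp (-(z - ((2 * k + sg k * y : ℝ) : ℂ)) ^ 2 / ((4 * t : ℝ) : ℂ))

lemma cE_real (y t x : ℝ) : (((√(4 * π * t))⁻¹ : ℝ) : ℂ) * cE y t x = (heatGamma x y t : ℂ) := by
  rw [heatGamma_def]
  unfold heatK
  rw [tsum_mul_left, Complex.ofReal_mul, Complex.ofReal_tsum]
  unfold cE
  congr 2; ext k
  push_cast
  rfl

lemma cE_diff {y t : ℝ} (hy : |y| ≤ 1) (ht : 0 < t) : Differentiable ℂ (cE y t) := by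
  intro z
  have hs := (heatK_summable (x := 0) (y := y) (2 * t) (by norm_num) (by linarith)).mul_left (√(4 * π * (2 * t)) * Real.exp ((‖z‖ + 1) ^ 2 / (4 * t)))
  have := Complex.differentiableOn_tsum_of_summable_norm (F := fun (k : ℤ) (z : ℂ) => Complex.exp (-(z - ((2 * k + sg k * y : ℝ) : ℂ)) ^ 2 / ((4 * t : ℝ) : ℂ)))
    (U := Metric.ball 0 (‖z‖ + 1)) hs (fun k => ?_) Metric.isOpen_ball (fun k w hw => ?_)
  · exact this.differentiableAt (Metric.isOpen_ball.mem_nhds (by simp))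
  · apply Differentiable.differentiableOn
    fun_prop
  · rw [Complex.norm_exp, Complex.div_ofReal_re]
    set c : ℝ := 2 * k + sg k * y
    have hw' : ‖w‖ < ‖z‖ + 1 := by simpa using hw
    have h2 : w.re * w.re + w.im * w.im ≤ (‖z‖ + 1) ^ 2 := by
      rw [← Complex.normSq_apply, Complex.normSq_eq_norm_sq]
      exact pow_le_pow_left₀ (norm_nonneg _) hw'.le 2
    have e : (-(w - (c : ℂ)) ^ 2).re = -((w.re - c) ^ 2 - w.im ^ 2) := by
      simp [pow_two]
    unfold heatK
    have hsq : √(4 * π * (2 * t)) ≠ 0 := by positivity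
    rw [show √(4 * π * (2 * t)) * Real.exp ((‖z‖ + 1) ^ 2 / (4 * t)) * ((√(4 * π * (2 * t)))⁻¹ * Real.exp (-(0 - c) ^ 2 / (4 * (2 * t))))
      = Real.exp ((‖z‖ + 1) ^ 2 / (4 * t)) * Real.exp (-(0 - c) ^ 2 / (4 * (2 * t))) by field_simp, ← Real.exp_add, Real.exp_le_exp, e,
      show (‖z‖ + 1) ^ 2 / (4 * t) + -(0 - c) ^ 2 / (4 * (2 * t)) = ((‖z‖ + 1) ^ 2 - c ^ 2 / 2) / (4 * t) by field_simp; ring]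
    gcongr
    nlinarith [sq_nonneg (2 * w.re - c)]

lemma Gk_iso (ha : 0 < a) {q t : ℝ} (hq : q ∈ Ioo (-1:ℝ) 1) (ht : 0 < t) (x0 : ℝ) : ∀ᶠ x in 𝓝[≠] x0, Gk a x q t ≠ 0 := by
  have hq' := Ioo_subset_Icc_self hq
  by_contra hf
  have hf' : ∃ᶠ x in 𝓝[≠] x0, Gk a x q t = 0 := by
    rw [Filter.Frequently]; simpa using hf
  have hd : Differentiable ℂ fun z => cE (q - al a q) t z - cE (q + al a q) t z := (cE_diff (ym_abs ha hq') ht).sub (cE_diff (yp_abs ha hq') ht)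
  have hr : ∀ x : ℝ, (((√(4 * π * t))⁻¹ : ℝ) : ℂ) * (cE (q - al a q) t x - cE (q + al a q) t x) = (Gk a x q t : ℂ) := by
    intro x; rw [mul_sub, cE_real, cE_real]; unfold Gk; push_cast; rfl
  have hc : (((√(4 * π * t))⁻¹ : ℝ) : ℂ) ≠ 0 := by
    have : (√(4 * π * t))⁻¹ ≠ 0 := by positivity
    exact_mod_cast this
  have htend : Tendsto (fun x : ℝ => (x : ℂ)) (𝓝[≠] x0) (𝓝[≠] (x0 : ℂ)) := by
    refine tendsto_nhdsWithin_iff.2 ⟨(Complex.continuous_ofReal.tendsto x0).mono_left nhdsWithin_le_nhds, ?_⟩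
    filter_upwards [self_mem_nhdsWithin] with x hx h
    exact hx (by simpa using h)
  have hz : ∃ᶠ z in 𝓝[≠] (x0 : ℂ), cE (q - al a q) t z - cE (q + al a q) t z = 0 := by
    refine htend.frequently (hf'.mono fun x hx => ?_)
    have := hr x
    rw [hx, Complex.ofReal_zero] at this
    exact (mul_eq_zero.1 this).resolve_left hc
  have hA : AnalyticOnNhd ℂ (fun z => cE (q - al a q) t z - cE (q + al a q) t z) univ := hd.differentiableOn.analyticOnNhd isOpen_univ
  have h0 := hA.eqOn_zero_of_preconnected_of_frequently_eq_zero isPreconnected_univ (mem_univ _) hz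
  have hG : ∀ x, Gk a x q t = 0 := fun x => by
    have h1 := h0 (mem_univ (x : ℂ))
    have h2 := hr x
    simp only [Pi.zero_apply] at h1
    rw [h1, mul_zero] at h2
    exact_mod_cast h2.symm
  have hs := sin_Gk ha hq' ht
  simp only [hG, mul_zero, intervalIntegral.integral_zero] at hs
  have p0 := Real.pi_pos
  have h1 : 0 < Real.cos (π / 2 * q) := Real.cos_pos_of_mem_Ioo ⟨by nlinarith [hq.1], by nlinarith [hq.2]⟩
  have := al_pos ha hq
  have := al_le_l a q
  have := al_le_r a q
  have h2 : 0 < Real.sin (π / 2 * al a q) := Real.sin_pos_of_pos_of_lt_pi (by positivity) (by nlinarith)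
  have : 0 < Real.exp (-(kap*t)) * (2 * Real.cos (π/2*q) * Real.sin (π/2 * al a q)) := by positivity
  linarith

lemma flux_int {f : ℝ → ℝ} (D : Dat a (evx f) φ' pI) {g : ℝ → ℝ → ℝ} {q : ℝ → ℝ} (hP : IsSolutionP a f (Ioi 0) g q)
    (hq : Tendsto q (𝓝[>] 0) (𝓝 pI)) (T : ℝ) : IntegrableOn (flux g q) (Ioc 0 T) := by
  set m := flux g q with hm
  have hms : AEStronglyMeasurable m (volume.restrict (Ioi 0)) := hP.flux_loc_int.aestronglyMeasurable
  by_contra hn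
  have key : ∀ t ∈ Ioc 0 T, ∀ x, |x| < 1 → Gk a x pI t ≠ 0 → g x t = util (evx f) x t := by
    intro t ht x hx hG
    have hd := hP.duhamel t ht.1 x (Ioo_subset_Icc_self (abs_lt.1 hx))
    rw [← hm, ← dh D q m x ht.1] at hd
    rw [hd]
    unfold FF SS
    rw [intervalIntegral.integral_undef, add_zero]
    intro hi
    rw [intervalIntegrable_iff_integrableOn_Ioc_of_le ht.1.le] at hi
    have hcA := Gk_contAt_time (a := a) D.ha (show |x| < 2 by linarith) (Ioo_subset_Icc_self D.hpI) (ne_of_gt ht.1)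
    have ht2 : Tendsto (fun s => ((x, q s, t - s) : ℝ × ℝ × ℝ)) (𝓝[>] 0) (𝓝 (x, pI, t)) := by
      refine tendsto_const_nhds.prodMk_nhds (hq.prodMk_nhds ?_)
      have : Continuous fun s : ℝ => t - s := by fun_prop
      have := (this.tendsto 0).mono_left (nhdsWithin_le_nhds (s := Ioi 0))
      simpa using this
    have hev : ∀ᶠ s in 𝓝[>] (0:ℝ), |Gk a x pI t| / 2 < |Gk a x (q s) (t - s)| :=
      ((hcA.abs.tendsto.comp ht2).eventually (Ioi_mem_nhds (show |Gk a x pI t| / 2 < |Gk a x pI t| by linarith [abs_pos.2 hG])))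
    obtain ⟨δ, hδ, hδs⟩ := mem_nhdsGT_iff_exists_Ioo_subset.1 (hev.and (small_lt ht.1))
    have hδ0 : (0:ℝ) < δ := hδ
    set c := |Gk a x pI t| / 2
    have hc : 0 < c := by have := abs_pos.2 hG; positivity
    have i1 : IntegrableOn m (Ioo 0 δ) := by
      have hi' : IntegrableOn (fun s => c⁻¹ * ‖Gk a x (q s) (t - s) * m s‖) (Ioo 0 δ) := (hi.mono_set (fun s hs => ⟨hs.1, (hδs hs).2.le⟩)).norm.const_mul _
      refine Integrable.mono' hi' (hms.mono_measure (Measure.restrict_mono (fun s hs => hs.1) le_rfl)) ?_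
      refine (ae_restrict_iff' measurableSet_Ioo).2 (Eventually.of_forall fun s hs => ?_)
      have h1 : c < |Gk a x (q s) (t - s)| := (hδs hs).1
      rw [norm_mul, Real.norm_eq_abs, Real.norm_eq_abs, ← mul_assoc]
      refine le_mul_of_one_le_left (abs_nonneg _) ?_
      rw [inv_mul_eq_div, one_le_div hc]; exact h1.le
    have i2 : IntegrableOn m (Icc (δ/2) T) := hP.flux_loc_int.integrableOn_compact_subset (fun s hs => lt_of_lt_of_le (by positivity) hs.1) isCompact_Icc
    exact hn ((i1.union i2).mono_set fun s hs => by
      rcases lt_or_ge s δ with h | h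
      · exact Or.inl ⟨hs.1, h⟩
      · exact Or.inr ⟨by linarith, hs.2⟩)
  obtain ⟨B, -, hB⟩ := D.bd
  obtain ⟨B', -, hB'⟩ := D.bd'
  have hmt : ∀ t ∈ Ioc 0 T, m t = -util φ' (q t) t := by
    intro t ht
    have hqm := hP.p_mem t ht.1
    have hU := util_hasDerivAt D.hd D.c' hB hB' (q t) t
    have he : ∀ᶠ x in 𝓝[≠] (q t), g x t = util (evx f) x t := by
      filter_upwards [Gk_iso D.ha D.hpI ht.1 (q t), nhdsWithin_le_nhds (Ioo_mem_nhds hqm.1 hqm.2)] with x h1 h2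
      exact key t ht x (abs_lt.2 h2) h1
    have he2 : (fun x => g x t) =ᶠ[𝓝 (q t)] fun x => util (evx f) x t :=
      ((hP.diff_at t ht.1).continuousAt.eventuallyEq_nhds_iff_eventuallyEq_nhdsNE hU.continuousAt).1 he
    rw [hm]; unfold flux
    rw [he2.deriv_eq, hU.deriv]
  refine hn (IntegrableOn.of_bound (by simp) (hms.mono_measure (Measure.restrict_mono (fun s hs => hs.1) le_rfl)) B' ?_)
  refine (ae_restrict_iff' measurableSet_Ioc).2 (Eventually.of_forall fun s hs => ?_)
  rw [hmt s hs, norm_neg]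
  exact util_bound hB' _ _

lemma q_tendsto {f : ℝ → ℝ} (D : Dat a (evx f) φ' pI) {g : ℝ → ℝ → ℝ} {q : ℝ → ℝ} (hP : IsSolutionP a f (Ioi 0) g q)
    (hu : TendstoUniformlyOn (fun t x => g x t) f (𝓝[>] 0) (Icc (-1) 1)) : Tendsto q (𝓝[>] 0) (𝓝 pI) := by
  have hpI := D.hpI
  refine tendsto_order.2 ⟨fun b hb => ?_, fun b hb => ?_⟩
  · have hm : max b (-1) ∈ Ico (-1) pI := ⟨le_max_right _ _, max_lt hb hpI.1⟩
    have hm' : max b (-1) ∈ 𝕁 := ⟨hm.1, by linarith [hm.2, hpI.2]⟩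
    have hp := D.pos _ hm
    rw [evx_eq f hm'] at hp
    filter_upwards [(hu.tendsto_at hm').eventually (Ioi_mem_nhds hp), self_mem_nhdsWithin] with t h1 h2
    by_contra hle
    push Not at hle
    have h1' : 0 < g (max b (-1)) t := h1
    rcases (hle.trans (le_max_left b (-1))).eq_or_lt with e | e
    · rw [← e, hP.zero_at t h2] at h1'; exact lt_irrefl _ h1'
    · exact lt_asymm h1' (hP.neg_right t h2 _ ⟨e, hm'.2⟩)
  · have hm : min b 1 ∈ Ioc pI 1 := ⟨lt_min hb hpI.2, min_le_right _ _⟩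
    have hm' : min b 1 ∈ 𝕁 := ⟨by linarith [hm.1, hpI.1], hm.2⟩
    have hp := D.neg _ hm
    rw [evx_eq f hm'] at hp
    filter_upwards [(hu.tendsto_at hm').eventually (Iio_mem_nhds hp), self_mem_nhdsWithin] with t h1 h2
    by_contra hle
    push Not at hle
    have h1' : g (min b 1) t < 0 := h1
    rcases ((min_le_left b 1).trans hle).eq_or_lt with e | e
    · rw [e, hP.zero_at t h2] at h1'; exact lt_irrefl _ h1'
    · exact lt_asymm h1' (hP.pos_left t h2 _ ⟨hm'.1, e⟩)

lemma ite_cont {c : ℝ} {w : ℝ → ℝ} (h1 : ∀ t > 0, ContinuousAt w t) (h2 : Tendsto w (𝓝[>] 0) (𝓝 c)) : Continuous fun t => if t ≤ 0 then c else w t := by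
  refine continuous_iff_continuousAt.2 fun t => ?_
  rcases lt_trichotomy t 0 with h | h | h
  · refine (continuousAt_const (y := c)).congr ?_
    filter_upwards [Iio_mem_nhds h] with s hs
    exact (if_pos (le_of_lt hs)).symm
  · subst h
    refine continuousAt_iff_continuous_left'_right'.2 ⟨?_, ?_⟩
    · refine (continuousWithinAt_const (b := c)).congr (fun s hs => if_pos (le_of_lt hs)) (if_pos le_rfl)
    · unfold ContinuousWithinAt
      simp only [le_refl, if_true]
      refine h2.congr' ?_
      filter_upwards [self_mem_nhdsWithin] with s hs
      exact (if_neg (not_le.2 hs)).symm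
  · refine (h1 t h).congr ?_
    filter_upwards [Ioi_mem_nhds h] with s hs
    exact (if_neg (not_le.2 hs)).symm

lemma good_sol {f : ℝ → ℝ} (D : Dat a (evx f) φ' pI) {g : ℝ → ℝ → ℝ} {q : ℝ → ℝ} (hG : GoodSolution a f g q) :
    ∃ q2 l2, (∀ T, 0 ≤ T → Sol a (evx f) pI T q2 l2) ∧ (∀ t > 0, q2 t = q t) ∧ ∀ x ∈ 𝕁, ∀ t > 0, g x t = FF a (evx f) q2 l2 x t := by
  obtain ⟨hP, -, hu, hr⟩ := hG
  have hqt := q_tendsto D hP hu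
  set q2 : ℝ → ℝ := fun t => if t ≤ 0 then pI else q t with hq2
  set l2 : ℝ → ℝ := fun t => if t ≤ 0 then -φ' pI else flux g q t with hl2
  have eq : ∀ t > 0, q2 t = q t := fun t ht => if_neg (not_le.2 ht)
  have el : ∀ t > 0, l2 t = flux g q t := fun t ht => if_neg (not_le.2 ht)
  have eq0 : q2 0 = pI := if_pos le_rfl
  have el0 : l2 0 = -φ' pI := if_pos le_rfl
  have hqc : Continuous q2 := ite_cont (fun t ht => hP.p_cont.continuousAt (Ioi_mem_nhds ht)) hqt
  have hqm : ∀ s, q2 s ∈ Ioo (-1) 1 := fun s => by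
    rcases le_or_gt s 0 with h | h
    · rw [show q2 s = pI from if_pos h]; exact D.hpI
    · rw [eq s h]; exact hP.p_mem s h
  have hg : ∀ x ∈ 𝕁, ∀ t > 0, g x t = FF a (evx f) q2 l2 x t := by
    intro x hx t ht
    rw [hP.duhamel t ht x hx, dh D q2 l2 x ht]
    congr 1
    refine intervalIntegral.integral_congr_Ioo_of_le (le_of_lt ht) fun s hs => ?_
    simp only [abar, eq s hs.1, el s hs.1]
  have hli : ∀ T, IntegrableOn l2 (Ioc 0 T) := fun T =>
    (flux_int D hP hqt T).congr_fun (fun s hs => (el s hs.1).symm) measurableSet_Ioc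
  have hder : ∀ t > 0, HasDerivAt (fun x => FF a (evx f) q2 l2 x t) (-l2 t) (q2 t) := by
    intro t ht
    have h1 := (hP.diff_at t ht).hasDerivAt
    have hm := hP.p_mem t ht
    rw [el t ht, eq t ht]
    unfold flux
    rw [neg_neg]
    refine h1.congr_of_eventuallyEq ?_
    filter_upwards [Icc_mem_nhds hm.1 hm.2] with x hx
    exact (hg x hx t ht).symm
  have hG := fun (T : ℝ) (hT : 0 < T) => flux_cont D hqc hqm hT (hli T) (fun t ht => hder t ht.1)
  have hlc : Continuous l2 := by
    refine ite_cont (fun t ht => ?_) ?_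
    · obtain ⟨G, hG1, hG2, -⟩ := hG (t + 1) (by linarith)
      refine (hG1.continuousAt (Icc_mem_nhds ht (by linarith))).congr ?_
      filter_upwards [Ioo_mem_nhds ht (show t < t + 1 by linarith)] with s hs
      rw [← hG2 s hs, el s hs.1]
    · obtain ⟨G, hG1, hG2, hG3⟩ := hG 1 one_pos
      have h0 := (hG1 0 (by norm_num)).mono (Ioo_subset_Icc_self : Ioo (0:ℝ) 1 ⊆ _)
      unfold ContinuousWithinAt at h0
      rw [hG3, eq0, nhdsWithin_Ioo_eq_nhdsGT one_pos] at h0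
      refine h0.congr' ?_
      filter_upwards [Ioo_mem_nhdsGT (one_pos (α := ℝ))] with s hs
      rw [← hG2 s hs, el s hs.1]
  refine ⟨q2, l2, fun T hT => ⟨⟨hqc, hqm, hlc⟩, eq0, fun t ht => ?_, fun t ht => ?_, fun t ht => ?_, fun t ht x hx => ?_, fun t ht x hx => ?_⟩, eq, hg⟩
  all_goals rcases ht.1.eq_or_lt with e | e
  · rw [← e, FF_zero, eq0, D.z]
  · rw [← hg _ (Ioo_subset_Icc_self (hqm t)) t e, eq t e]; exact hP.zero_at t e
  · rw [← e, eq0, el0, neg_neg]; simp only [FF_zero]; exact D.hd pI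
  · exact hder t e
  · rw [← e, el0]; linarith [D.sl]
  · obtain ⟨r, hr0, -, h1, -⟩ := hr t e
    rw [el t e]; exact hr0.trans (h1 t e le_rfl)
  · rw [← e, eq0] at hx; rw [← e, FF_zero]; exact D.pos x hx
  · rw [← hg x ⟨hx.1, hx.2.le.trans (hqm t).2.le⟩ t e]; rw [eq t e] at hx; exact hP.pos_left t e x hx
  · rw [← e, eq0] at hx; rw [← e, FF_zero]; exact D.neg x hx
  · rw [← hg x ⟨(hqm t).1.le.trans hx.1.le, hx.2⟩ t e]; rw [eq t e] at hx; exact hP.neg_right t e x hx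

end P21

end Development

/-- Global existence and uniqueness for problem (P). -/
theorem statement0 (a a₀ lamI : ℝ) (fI : ℝ → ℝ) (pI : ℝ)
    (ha : a ∈ Set.Ioo (0:ℝ) 1) (ha₀ : 0 < a₀) (ha₀' : a₀ < a / 4)
    (hI : IsInitialDatum fI pI a₀ lamI) :
    ∃ f p, GoodSolution a fI f p ∧
      ∀ g q, GoodSolution a fI g q →
        (∀ x ∈ Set.Icc (-1:ℝ) 1, ∀ t > (0:ℝ), f x t = g x t) ∧
        (∀ t > (0:ℝ), p t = q t) := by
  obtain ⟨φ', D, -⟩ := data ha hI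
  obtain ⟨p, l, S⟩ := global D
  refine ⟨FF a (evx fI) p l, p, exist D S, fun g q hG => ?_⟩
  obtain ⟨q2, l2, S2, e1, e2⟩ := good_sol D hG
  refine ⟨fun x hx t ht => ?_, fun t ht => ?_⟩
  · rw [e2 x hx t ht]
    exact FF_congr (Sol.unique D (S2 t (le_of_lt ht)) (S t (le_of_lt ht))) x
  · rw [← e1 t ht]
    exact (Sol.unique D (S2 t (le_of_lt ht)) (S t (le_of_lt ht)) t ⟨le_of_lt ht, le_rfl⟩).1
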